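/- Open embedding theorem: there exist λ′ ∈ ℂ^{Q_0} and an injection Φ : M*_st(𝐁) ↪ M^reg_{λ′}(Q,α) whose image is exactly the set of classes of (M_a,ψ_ρ) ∈ M^reg_{λ′}(Q,α) for which the block matrix (ψ_{ρ^{[0,j]}_{[i,j′]}})_{1≤j≤m^(0),1≤j′≤m^(i)} is invertible for every i ∈ I_irr∖{0}. Moreover, if I_irr = {0} then λ′ = λ and Φ is bijective. -/

import Mathlib

open Polynomial Matrix BigOperators

namespace DS

noncomputable section

/-- The data of a collection of HTL normal forms `B⁽ⁱ⁾`, `i = 0,…,p`, on `ℂⁿ`: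
block counts `m i`, pole orders `kk i`, block sizes `nn i j`, irregular parts
`q i j ∈ s²ℂ[s]` (pairwise distinct, degree ≤ kk i), residue blocks `R i j`,
chosen annihilating eigenvalue lists `ξ i j`, and an identification of
`Σ j, Fin (nn i j)` with `Fin n` (the block decomposition of `ℂⁿ`). -/
structure Setup where
  p : ℕ
  n : ℕ
  hn : 0 < n
  m : Fin (p+1) → ℕ
  hm : ∀ i, 0 < m i
  kk : Fin (p+1) → ℕ
  hkk : ∀ i, 0 < kk i
  nn : ∀ i : Fin (p+1), Fin (m i) → ℕ
  q : ∀ i : Fin (p+1), Fin (m i) → Polynomial ℂ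
  hq0 : ∀ i j, (q i j).coeff 0 = 0
  hq1 : ∀ i j, (q i j).coeff 1 = 0
  hqdeg : ∀ i j, (q i j).natDegree ≤ kk i
  hqdist : ∀ i : Fin (p+1), ∀ j j' : Fin (m i), j ≠ j' → q i j ≠ q i j'
  e : ∀ i : Fin (p+1), Fin (m i) → ℕ
  he : ∀ i j, 0 < e i j
  xi : ∀ (i : Fin (p+1)) (j : Fin (m i)), Fin (e i j) → ℂ
  R : ∀ (i : Fin (p+1)) (j : Fin (m i)), Matrix (Fin (nn i j)) (Fin (nn i j)) ℂ
  hxi : ∀ i j, (((List.finRange (e i j)).map fun l => R i j - xi i j l • 1).prod) = 0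
  emb : ∀ i : Fin (p+1), (Σ j : Fin (m i), Fin (nn i j)) ≃ Fin n
  hreg : ∀ i : Fin (p+1), ¬ (1 < m i ∨ i = 0) → kk i = 1

/-- `i ∈ I_irr` : the indices of irregular singular points together with `0`. -/
def Iirr (S : Setup) (i : Fin (S.p+1)) : Prop := 1 < S.m i ∨ i = 0

instance (S : Setup) : DecidablePred (Iirr S) := fun i =>
  inferInstanceAs (Decidable (1 < S.m i ∨ i = 0))

/-- Vertices `[i,j]` for `i ∈ I_irr`. -/
abbrev Vb (S : Setup) := Σ i : {i : Fin (S.p+1) // Iirr S i}, Fin (S.m i.1)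

/-- Vertices `[i,j,k]` for `0 ≤ i ≤ p`, `1 ≤ j ≤ m⁽ⁱ⁾`, `1 ≤ k ≤ e[i,j]-1`
(the third component `κ` encodes `k = κ+1`). -/
abbrev Vr (S : Setup) := Σ i : Fin (S.p+1), Σ j : Fin (S.m i), Fin (S.e i j - 1)

/-- The vertex set `Q₀` of the quiver `Q`. -/
abbrev V (S : Setup) := Vb S ⊕ Vr S

/-- `d_i(j,j') = deg (q_j - q_j') - 2`. -/
def dcnt (S : Setup) (i : Fin (S.p+1)) (j j' : Fin (S.m i)) : ℕ :=
  (S.q i j - S.q i j').natDegree - 2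

/-- The number of arrows of `Q` from a vertex `a` to a vertex `b`. -/
def arr (S : Setup) : V S → V S → ℕ
  | .inl ⟨i, j⟩, .inl ⟨i', j'⟩ =>
      (if i.1 = 0 ∧ i'.1 ≠ 0 then 1 else 0) +
      (if h : i = i' then
        (if (j : ℕ) < (j' : ℕ) then dcnt S i.1 j (Fin.cast (by rw [h]) j') else 0)
       else 0)
  | .inl _, .inr _ => 0
  | .inr ⟨i, j, κ⟩, .inl ⟨i', j'⟩ =>
      (if i = i'.1 ∧ (j : ℕ) = (j' : ℕ) ∧ (κ : ℕ) = 0 then 1 else 0) +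
      (if ¬ Iirr S i ∧ i'.1 = 0 ∧ (j : ℕ) = 0 ∧ (κ : ℕ) = 0 then 1 else 0)
  | .inr ⟨i, j, κ⟩, .inr ⟨i', j', κ'⟩ =>
      if i = i' ∧ (j : ℕ) = (j' : ℕ) ∧ (κ : ℕ) = (κ' : ℕ) + 1 then 1 else 0

/-- The Euler form `⟨β,γ⟩` of the quiver `Q`. -/
def eform (S : Setup) (β γ : V S → ℤ) : ℤ :=
  (∑ a : V S, β a * γ a) - ∑ a : V S, ∑ b : V S, (arr S a b : ℤ) * β a * γ b

/-- The symmetrized bilinear form `(β,γ)`. -/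
def bform (S : Setup) (β γ : V S → ℤ) : ℤ := eform S β γ + eform S γ β

/-- The quadratic form `q(β)`. -/
def qform (S : Setup) (β : V S → ℤ) : ℤ := eform S β β

/-- `p(β) = 1 - q(β)`. -/
def pform (S : Setup) (β : V S → ℤ) : ℤ := 1 - qform S β

/-- The coordinate vector `ε_a`. -/
def eps (S : Setup) (a : V S) : V S → ℤ := fun b => if b = a then 1 else 0

/-- The fundamental reflection `s_a`. -/
def refl1 (S : Setup) (a : V S) (β : V S → ℤ) : V S → ℤ :=
  fun b => β b - bform S β (eps S a) * eps S a b

/-- Iterated fundamental reflections (a Weyl group element). -/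
def reflList (S : Setup) (l : List (V S)) (β : V S → ℤ) : V S → ℤ :=
  l.foldr (refl1 S) β

/-- The support of a vector. -/
def supp (S : Setup) (β : V S → ℤ) : Set (V S) := {a | β a ≠ 0}

/-- The support of `β` is connected in the underlying graph of `Q`. -/
def connSupp (S : Setup) (β : V S → ℤ) : Prop :=
  ∀ a ∈ supp S β, ∀ b ∈ supp S β,
    Relation.ReflTransGen
      (fun x y => (0 < arr S x y + arr S y x) ∧ x ∈ supp S β ∧ y ∈ supp S β) a b

/-- The fundamental set of the root system of `Q` (all vertices of `Q` are loop-free). -/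
def fund (S : Setup) (β : V S → ℤ) : Prop :=
  β ≠ 0 ∧ (∀ a, 0 ≤ β a) ∧ connSupp S β ∧ ∀ a : V S, bform S β (eps S a) ≤ 0

/-- Real roots of `Q`. -/
def isRealRoot (S : Setup) (β : V S → ℤ) : Prop :=
  ∃ (l : List (V S)) (a : V S), β = reflList S l (eps S a)

/-- Imaginary roots of `Q`. -/
def isImagRoot (S : Setup) (β : V S → ℤ) : Prop :=
  ∃ (l : List (V S)) (γ : V S → ℤ), (fund S γ ∨ fund S (-γ)) ∧ β = reflList S l γ

/-- Roots of `Q`. -/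
def isRoot (S : Setup) (β : V S → ℤ) : Prop := isRealRoot S β ∨ isImagRoot S β

/-- Positive roots of `Q`. -/
def isPosRoot (S : Setup) (β : V S → ℤ) : Prop := isRoot S β ∧ ∀ a, 0 ≤ β a

/-- The index `0` as an element of `I_irr`. -/
def i0 (S : Setup) : {i : Fin (S.p+1) // Iirr S i} := ⟨0, Or.inr rfl⟩

/-- The vertex `[0,j]`. -/
def v0 (S : Setup) (j : Fin (S.m 0)) : V S := Sum.inl ⟨i0 S, j⟩

/-- The vertex `[i,j]` for `i ∈ I_irr`. -/
def vI (S : Setup) (i : {i : Fin (S.p+1) // Iirr S i}) (j : Fin (S.m i.1)) : V S :=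
  Sum.inl ⟨i, j⟩

/-- The lattice `L`: `Σ_j β_[0,j] = Σ_j β_[i,j]` for all `i ∈ I_irr ∖ {0}`. -/
def inL (S : Setup) (β : V S → ℤ) : Prop :=
  ∀ i : {i : Fin (S.p+1) // Iirr S i}, i.1 ≠ 0 →
    (∑ j : Fin (S.m 0), β (v0 S j)) = ∑ j : Fin (S.m i.1), β (vI S i j)

/-- `L⁺ = L ∩ (ℤ≥0)^{Q₀}`. -/
def inLpos (S : Setup) (β : V S → ℤ) : Prop := inL S β ∧ ∀ a, 0 ≤ β a

/-- The dimension vector `α` (as natural numbers):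
`α_[i,j] = n⁽ⁱ⁾_j`, `α_[i,j,k] = rank ∏_{l=1}^k (R⁽ⁱ⁾_j - ξ^{[i,j]}_l)`. -/
noncomputable def alN (S : Setup) : V S → ℕ
  | .inl ⟨i, j⟩ => S.nn i.1 j
  | .inr ⟨i, j, κ⟩ =>
      ((((List.finRange (S.e i j)).take ((κ : ℕ) + 1)).map
          fun l => S.R i j - S.xi i j l • 1).prod).rank

/-- The dimension vector `α` as an integer vector. -/
noncomputable def alZ (S : Setup) : V S → ℤ := fun a => (alN S a : ℤ)

/-- The parameter `λ ∈ ℂ^{Q₀}`. -/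
noncomputable def lam (S : Setup) : V S → ℂ
  | .inl ⟨i, j⟩ =>
      if h : i.1 = 0 then
        (- S.xi 0 (Fin.cast (by rw [h]) j) ⟨0, S.he 0 (Fin.cast (by rw [h]) j)⟩)
          - ∑ i' ∈ Finset.univ.filter (fun i' : Fin (S.p+1) => ¬ Iirr S i'),
              S.xi i' ⟨0, S.hm i'⟩ ⟨0, S.he i' ⟨0, S.hm i'⟩⟩
      else - S.xi i.1 j ⟨0, S.he i.1 j⟩
  | .inr ⟨i, j, κ⟩ =>
      S.xi i j ⟨(κ : ℕ), by have := κ.2; omega⟩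
        - S.xi i j ⟨(κ : ℕ) + 1, by have := κ.2; omega⟩

/-- Pairing `β · μ = Σ_a β_a μ_a` between `ℤ^{Q₀}` and `ℂ^{Q₀}`. -/
noncomputable def dotC (S : Setup) (β : V S → ℤ) (μ : V S → ℂ) : ℂ :=
  ∑ a : V S, (β a : ℂ) * μ a

/-- `β ∈ R̃⁺_μ` : positive roots of `Q` lying in `L` with `β·μ = 0`. -/
def inRt (S : Setup) (μ : V S → ℂ) (β : V S → ℤ) : Prop :=
  isPosRoot S β ∧ inL S β ∧ dotC S β μ = 0

/-- `β ∈ ℕR̃⁺_μ` : finite sums (including `0`) of elements of `R̃⁺_μ`. -/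
def inNRt (S : Setup) (μ : V S → ℂ) (β : V S → ℤ) : Prop :=
  ∃ (r : ℕ) (γ : Fin r → (V S → ℤ)), (∀ t, inRt S μ (γ t)) ∧ β = ∑ t, γ t

/-- `β ∈ Σ̃_μ`. -/
def inSig (S : Setup) (μ : V S → ℂ) (β : V S → ℤ) : Prop :=
  inRt S μ β ∧ ∀ (r : ℕ), 2 ≤ r → ∀ γ : Fin r → (V S → ℤ),
    (∀ t, inRt S μ (γ t)) → β = ∑ t, γ t → (∑ t, pform S (γ t)) < pform S β

/-! ### The matrix side: truncated orbits.

An element `Σ_{j=1}^{k} A_j x^{-j}` of `𝔤_k*` is encoded as the polynomial matrix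
`Σ_{j=1}^{k} A_j x^{k-j}` (of degree `< k`); the coadjoint `G_k`-action becomes
conjugation modulo `x^k` by polynomial matrices with invertible constant term. -/

abbrev PMat (S : Setup) := Matrix (Fin S.n) (Fin S.n) (Polynomial ℂ)

/-- All entries have degree `< k`. -/
def degLT (S : Setup) (k : ℕ) (A : PMat S) : Prop :=
  ∀ a b, (A a b).degree < (k : ℕ)

/-- The HTL normal form `B⁽ⁱ⁾`, in the polynomial encoding. -/
noncomputable def Bmat (S : Setup) (i : Fin (S.p+1)) : PMat S :=
  Matrix.of fun a b =>
    if h : ((S.emb i).symm a).1 = ((S.emb i).symm b).1 then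
      (if Fin.cast (by rw [h]) ((S.emb i).symm a).2 = ((S.emb i).symm b).2 then
          Polynomial.reflect (S.kk i) (S.q i ((S.emb i).symm b).1)
        else 0)
        + Polynomial.C
            (S.R i ((S.emb i).symm b).1 (Fin.cast (by rw [h]) ((S.emb i).symm a).2)
              ((S.emb i).symm b).2)
          * Polynomial.X ^ (S.kk i - 1)
    else 0

/-- Membership in the truncated orbit `𝒪_{B⁽ⁱ⁾}`. -/
def inOrbit (S : Setup) (i : Fin (S.p+1)) (A : PMat S) : Prop :=
  degLT S (S.kk i) A ∧
  ∃ g : PMat S, IsUnit (g.map fun r => r.coeff 0) ∧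
    ∀ a b, (Polynomial.X ^ (S.kk i) : Polynomial ℂ) ∣ (g * Bmat S i - A * g) a b

/-- The residue matrix `A⁽ⁱ⁾₁`. -/
def resMat (S : Setup) (i : Fin (S.p+1)) (A : PMat S) : Matrix (Fin S.n) (Fin S.n) ℂ :=
  Matrix.of fun a b => (A a b).coeff (S.kk i - 1)

/-- `(A⁽ⁱ⁾)_{0≤i≤p} ∈ ∏ 𝒪_{B⁽ⁱ⁾}` with `Σ A⁽ⁱ⁾₁ = 0`. -/
def isDSElem (S : Setup) (A : ∀ _ : Fin (S.p+1), PMat S) : Prop :=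
  (∀ i, inOrbit S i (A i)) ∧ (∑ i, resMat S i (A i)) = 0

/-- Irreducibility of the collection of all coefficient matrices `A⁽ⁱ⁾_j`. -/
def irredTuple (S : Setup) (A : ∀ _ : Fin (S.p+1), PMat S) : Prop :=
  ∀ W : Submodule ℂ (Fin S.n → ℂ),
    (∀ (i : Fin (S.p+1)) (l : ℕ), ∀ v ∈ W,
        (Matrix.of fun a b => (A i a b).coeff l).mulVec v ∈ W) →
    W = ⊥ ∨ W = ⊤

/-! ### Representations of the double quiver -/

/-- A representation of the double quiver `Q̄` with dimension vector `β`: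
`f a b ρ` is the matrix of `ψ_ρ : ℂ^{β a} → ℂ^{β b}` and `g a b ρ` the matrix of
`ψ_{ρ*} : ℂ^{β b} → ℂ^{β a}`, for the `ρ`-th arrow `a → b` of `Q`. -/
structure Rep (S : Setup) (β : V S → ℕ) where
  f : ∀ a b : V S, Fin (arr S a b) → Matrix (Fin (β b)) (Fin (β a)) ℂ
  g : ∀ a b : V S, Fin (arr S a b) → Matrix (Fin (β a)) (Fin (β b)) ℂ

/-- The moment map at a vertex `c`. -/
noncomputable def moment (S : Setup) {β : V S → ℕ} (M : Rep S β) (c : V S) :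
    Matrix (Fin (β c)) (Fin (β c)) ℂ :=
  (∑ a : V S, ∑ ρ : Fin (arr S a c), M.f a c ρ * M.g a c ρ)
    - ∑ b : V S, ∑ ρ : Fin (arr S c b), M.g c b ρ * M.f c b ρ

/-- `M ∈ Rep(Q̄,β)_μ`. -/
def onMu (S : Setup) {β : V S → ℕ} (μ : V S → ℂ) (M : Rep S β) : Prop :=
  ∀ c : V S, moment S M c = μ c • (1 : Matrix (Fin (β c)) (Fin (β c)) ℂ)

/-- The block matrix `(ψ_{ρ^{[0,j]}_{[i,j']}})_{j,j'}` for `i ∈ I_irr ∖ {0}`. -/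
noncomputable def crossMat (S : Setup) {β : V S → ℕ} (M : Rep S β)
    (i : {i : Fin (S.p+1) // Iirr S i}) :
    Matrix (Σ j' : Fin (S.m i.1), Fin (β (vI S i j'))) (Σ j : Fin (S.m 0), Fin (β (v0 S j))) ℂ :=
  Matrix.of fun x y =>
    if h : 0 < arr S (v0 S y.1) (vI S i x.1) then
      M.f (v0 S y.1) (vI S i x.1) ⟨0, h⟩ x.2 y.2
    else 0

/-- All the block matrices `(ψ_{ρ^{[0,j]}_{[i,j']}})` for `i ∈ I_irr ∖ {0}` are invertible. -/
def crossBij (S : Setup) {β : V S → ℕ} (M : Rep S β) : Prop :=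
  ∀ i : {i : Fin (S.p+1) // Iirr S i}, i.1 ≠ 0 →
    Function.Bijective ((crossMat S M i).mulVec)

/-- The combined map `(ψ_{ρ^{[i,1,1]}_{[0,j]}})_j : ℂ^{β [i,1,1]} → ⊕_j ℂ^{β [0,j]}`
(for `i ∈ I_reg`). -/
noncomputable def regMatF (S : Setup) {β : V S → ℕ} (M : Rep S β)
    (i : Fin (S.p+1)) (j : Fin (S.m i)) (κ : Fin (S.e i j - 1)) :
    Matrix (Σ j' : Fin (S.m 0), Fin (β (v0 S j'))) (Fin (β (Sum.inr ⟨i, j, κ⟩))) ℂ :=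
  Matrix.of fun x y =>
    if h : 0 < arr S (Sum.inr ⟨i, j, κ⟩) (v0 S x.1) then
      M.f (Sum.inr ⟨i, j, κ⟩) (v0 S x.1) ⟨0, h⟩ x.2 y
    else 0

/-- The combined map `(ψ_{(ρ^{[i,1,1]}_{[0,j]})*})_j : ⊕_j ℂ^{β [0,j]} → ℂ^{β [i,1,1]}`. -/
noncomputable def regMatG (S : Setup) {β : V S → ℕ} (M : Rep S β)
    (i : Fin (S.p+1)) (j : Fin (S.m i)) (κ : Fin (S.e i j - 1)) :
    Matrix (Fin (β (Sum.inr ⟨i, j, κ⟩))) (Σ j' : Fin (S.m 0), Fin (β (v0 S j'))) ℂ :=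
  Matrix.of fun y x =>
    if h : 0 < arr S (Sum.inr ⟨i, j, κ⟩) (v0 S x.1) then
      M.g (Sum.inr ⟨i, j, κ⟩) (v0 S x.1) ⟨0, h⟩ y x.2
    else 0

/-- `M ∈ Rep(Q̄,β)_μ^{dif}` (the open conditions). -/
def difCond (S : Setup) {β : V S → ℕ} (M : Rep S β) : Prop :=
  crossBij S M ∧
  (∀ (i : Fin (S.p+1)), ¬ Iirr S i → ∀ (j : Fin (S.m i)) (κ : Fin (S.e i j - 1)),
      (κ : ℕ) = 0 →
      Function.Injective ((regMatF S M i j κ).mulVec) ∧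
      Function.Surjective ((regMatG S M i j κ).mulVec)) ∧
  (∀ (i : Fin (S.p+1)) (j : Fin (S.m i)) (κ : Fin (S.e i j - 1)) (b : V S)
      (ρ : Fin (arr S (Sum.inr ⟨i, j, κ⟩) b)),
      (¬ Iirr S i ∧ (κ : ℕ) = 0) ∨
      (Function.Injective ((M.f (Sum.inr ⟨i, j, κ⟩) b ρ).mulVec) ∧
       Function.Surjective ((M.g (Sum.inr ⟨i, j, κ⟩) b ρ).mulVec)))

/-- A family of subspaces forming a subrepresentation of `M`. -/
def isSubrep (S : Setup) {β : V S → ℕ} (M : Rep S β)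
    (W : ∀ a : V S, Submodule ℂ (Fin (β a) → ℂ)) : Prop :=
  ∀ (a b : V S) (ρ : Fin (arr S a b)),
    (∀ v ∈ W a, (M.f a b ρ).mulVec v ∈ W b) ∧ (∀ v ∈ W b, (M.g a b ρ).mulVec v ∈ W a)

/-- Irreducibility of a representation. -/
def irredRep (S : Setup) {β : V S → ℕ} (M : Rep S β) : Prop :=
  ∀ W, isSubrep S M W → (∀ a, W a = ⊥) ∨ (∀ a, W a = ⊤)

/-- A dimension vector is balanced if `Σ_j γ_[0,j] = Σ_j γ_[i,j]` for all `i ∈ I_irr∖{0}`. -/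
def balanced (S : Setup) (γ : V S → ℕ) : Prop :=
  ∀ i : {i : Fin (S.p+1) // Iirr S i}, i.1 ≠ 0 →
    (∑ j : Fin (S.m 0), γ (v0 S j)) = ∑ j : Fin (S.m i.1), γ (vI S i j)

/-- Quasi-irreducibility: no nontrivial proper subrepresentation with balanced
dimension vector. -/
def quasiIrred (S : Setup) {β : V S → ℕ} (M : Rep S β) : Prop :=
  ∀ W, isSubrep S M W → balanced S (fun a => Module.finrank ℂ (W a)) →
    (∀ a, W a = ⊥) ∨ (∀ a, W a = ⊤)

/-- Simultaneous conjugation of representations by `∏_a GL(β_a, ℂ)`. -/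
def repConj (S : Setup) {β : V S → ℕ} (M N : Rep S β) : Prop :=
  ∃ g : ∀ a : V S, (Matrix (Fin (β a)) (Fin (β a)) ℂ)ˣ,
    (∀ a b ρ, N.f a b ρ = ((g b).val * M.f a b ρ) * ((g a)⁻¹).val) ∧
    (∀ a b ρ, N.g a b ρ = ((g a).val * M.g a b ρ) * ((g b)⁻¹).val)

/-- Simultaneous conjugation of tuples by `GL(n, ℂ)`. -/
def tupConj (S : Setup) (A A' : ∀ _ : Fin (S.p+1), PMat S) : Prop :=
  ∃ g : (Matrix (Fin S.n) (Fin S.n) ℂ)ˣ,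
    ∀ i, A' i = (g.val.map Polynomial.C) * A i * ((g⁻¹).val.map Polynomial.C)

/-- Carrier of the moduli space `ℳ*_{st}(𝐁)`. -/
abbrev MstC (S : Setup) := {A : ∀ _ : Fin (S.p+1), PMat S // isDSElem S A ∧ irredTuple S A}

/-- The moduli space `ℳ*_{st}(𝐁)` of stable connections, identified with conjugacy
classes of irreducible elements of `∏ 𝒪_{B⁽ⁱ⁾}` with vanishing residue sum. -/
abbrev Mst (S : Setup) := Quot (fun A A' : MstC S => tupConj S A.1 A'.1)

abbrev DSC (S : Setup) := {A : ∀ _ : Fin (S.p+1), PMat S // isDSElem S A}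

abbrev DSQ (S : Setup) := Quot (fun A A' : DSC S => tupConj S A.1 A'.1)

abbrev RepIrrC (S : Setup) (μ : V S → ℂ) :=
  {M : Rep S (alN S) // onMu S μ M ∧ irredRep S M}

/-- The quiver variety `𝔐^{reg}_μ(Q,α)`. -/
abbrev Mreg (S : Setup) (μ : V S → ℂ) :=
  Quot (fun M N : RepIrrC S μ => repConj S M.1 N.1)

abbrev DifC (S : Setup) (μ : V S → ℂ) :=
  {M : Rep S (alN S) // onMu S μ M ∧ difCond S M}

abbrev DifQ (S : Setup) (μ : V S → ℂ) :=
  Quot (fun M N : DifC S μ => repConj S M.1 N.1)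

abbrev QIC (S : Setup) (μ : V S → ℂ) :=
  {M : Rep S (alN S) // onMu S μ M ∧ quasiIrred S M ∧ crossBij S M}

abbrev QIQ (S : Setup) (μ : V S → ℂ) :=
  Quot (fun M N : QIC S μ => repConj S M.1 N.1)

/-! ### `J`, `ε_𝐢`, and the equivalence relation `∼` -/

/-- `ε_𝐢 = Σ_{i ∈ I_irr} ε_{[i,j_i]}` for `𝐢 = ([i,j_i]) ∈ 𝒥`. -/
def epsJ (S : Setup) (I : ∀ i : Fin (S.p+1), Fin (S.m i)) : V S → ℤ
  | .inl ⟨i, j⟩ => if (j : ℕ) = (I i.1 : ℕ) then 1 else 0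
  | .inr _ => 0

/-- The reflection `s_𝐢`. -/
def sJ (S : Setup) (I : ∀ i : Fin (S.p+1), Fin (S.m i)) (β : V S → ℤ) : V S → ℤ :=
  fun b => β b - bform S β (epsJ S I) * epsJ S I b

/-- The quasi-fundamental set `F̃`. -/
def quasiFund (S : Setup) (β : V S → ℤ) : Prop :=
  inL S β ∧ (∀ a, 0 ≤ β a) ∧ β ≠ 0 ∧
  (∀ I : ∀ i : Fin (S.p+1), Fin (S.m i), bform S β (epsJ S I) ≤ 0) ∧
  (∀ (i : Fin (S.p+1)) (j : Fin (S.m i)) (κ : Fin (S.e i j - 1)),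
      bform S β (eps S (Sum.inr ⟨i, j, κ⟩)) ≤ 0) ∧
  connSupp S β

/-- `μ_𝐢 = Σ_{i ∈ I_irr} μ_{[i,j_i]}`. -/
noncomputable def muJ (S : Setup) (I : ∀ i : Fin (S.p+1), Fin (S.m i)) (μ : V S → ℂ) : ℂ :=
  ∑ i : {i : Fin (S.p+1) // Iirr S i}, μ (vI S i (I i.1))

/-- The transformed parameter `μ'` in the move `s_𝐢` on pairs. -/
noncomputable def muMove (S : Setup) (I : ∀ i : Fin (S.p+1), Fin (S.m i)) (μ : V S → ℂ) :
    V S → ℂ := fun a =>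
  match a with
  | .inl ⟨i, j⟩ =>
      if i.1 = 0 ∧ (j : ℕ) = (I 0 : ℕ) then μ a - 2 * muJ S I μ else μ a
  | .inr ⟨i, j, κ⟩ =>
      if j = I i ∧ (κ : ℕ) = 0 then μ a + muJ S I μ else μ a

/-- The reflected parameter `r_a(μ)` for a vertex `a`. -/
noncomputable def rvtx (S : Setup) (a : V S) (μ : V S → ℂ) : V S → ℂ :=
  fun b => μ b - ((bform S (eps S a) (eps S b) : ℤ) : ℂ) * μ a

/-- One move generating the relation `∼` on pairs `(β,μ)`. -/
def stepRel (S : Setup) :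
    ((V S → ℤ) × (V S → ℂ)) → ((V S → ℤ) × (V S → ℂ)) → Prop := fun x y =>
  (∃ (i : Fin (S.p+1)) (j : Fin (S.m i)) (κ : Fin (S.e i j - 1)),
      x.2 (Sum.inr ⟨i, j, κ⟩) ≠ 0 ∧
      y = (refl1 S (Sum.inr ⟨i, j, κ⟩) x.1, rvtx S (Sum.inr ⟨i, j, κ⟩) x.2)) ∨
  (∃ I : ∀ i : Fin (S.p+1), Fin (S.m i),
      muJ S I x.2 ≠ 0 ∧ y = (sJ S I x.1, muMove S I x.2))

/-- The smallest equivalence relation `∼` containing all the moves. -/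
def pairEquiv (S : Setup) :
    ((V S → ℤ) × (V S → ℂ)) → ((V S → ℤ) × (V S → ℂ)) → Prop :=
  Relation.EqvGen (stepRel S)

/-- The vector `z^{(i₀)}` for `i₀ ∈ I_irr ∖ {0}`. -/
def zvec (S : Setup) (i' : Fin (S.p+1)) : V S → ℂ
  | .inl ⟨i, _⟩ => if i.1 = i' then 1 else if i.1 = 0 then -1 else 0
  | .inr _ => 0


/-! ### Linear algebra for the legs -/

/-- Existence of a left inverse. -/
def LInv {a b : ℕ} (f : Matrix (Fin a) (Fin b) ℂ) : Prop := ∃ l : Matrix (Fin b) (Fin a) ℂ, l * f = 1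
/-- Existence of a right inverse. -/
def RInv {a b : ℕ} (f : Matrix (Fin a) (Fin b) ℂ) : Prop := ∃ l : Matrix (Fin b) (Fin a) ℂ, f * l = 1

theorem LInv.of_inj {a b : ℕ} {f : Matrix (Fin a) (Fin b) ℂ} (h : Function.Injective f.mulVec) :
    LInv f := by
  obtain ⟨g, hg⟩ := (Matrix.toLin' f).exists_leftInverse_of_injective
    (LinearMap.ker_eq_bot_of_injective (f := Matrix.toLin' f) h)
  refine ⟨LinearMap.toMatrix' g, ?_⟩
  apply Matrix.toLin'.injective
  rw [Matrix.toLin'_mul, Matrix.toLin'_toMatrix', hg, Matrix.toLin'_one]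

theorem RInv.of_surj {a b : ℕ} {f : Matrix (Fin a) (Fin b) ℂ} (h : Function.Surjective f.mulVec) :
    RInv f := by
  obtain ⟨g, hg⟩ := (Matrix.toLin' f).exists_rightInverse_of_surjective
    (LinearMap.range_eq_top_of_surjective (Matrix.toLin' f) h)
  refine ⟨LinearMap.toMatrix' g, ?_⟩
  apply Matrix.toLin'.injective
  rw [Matrix.toLin'_mul, Matrix.toLin'_toMatrix', hg, Matrix.toLin'_one]

theorem LInv.inj {a b : ℕ} {f : Matrix (Fin a) (Fin b) ℂ} (h : LInv f) :
    Function.Injective f.mulVec := by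
  obtain ⟨l, hl⟩ := h
  intro x y hxy
  have := congrArg l.mulVec hxy
  simpa [Matrix.mulVec_mulVec, hl] using this

theorem RInv.surj {a b : ℕ} {f : Matrix (Fin a) (Fin b) ℂ} (h : RInv f) :
    Function.Surjective f.mulVec := by
  obtain ⟨l, hl⟩ := h
  intro x
  exact ⟨l.mulVec x, by simp [Matrix.mulVec_mulVec, hl]⟩

theorem LInv.mul {a b c : ℕ} {f : Matrix (Fin a) (Fin b) ℂ} {g : Matrix (Fin b) (Fin c) ℂ}
    (hf : LInv f) (hg : LInv g) : LInv (f * g) := by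
  obtain ⟨l, hl⟩ := hf
  obtain ⟨l', hl'⟩ := hg
  refine ⟨l' * l, ?_⟩
  rw [Matrix.mul_assoc, ← Matrix.mul_assoc l, hl, Matrix.one_mul, hl']

theorem RInv.mul {a b c : ℕ} {f : Matrix (Fin a) (Fin b) ℂ} {g : Matrix (Fin b) (Fin c) ℂ}
    (hf : RInv f) (hg : RInv g) : RInv (f * g) := by
  obtain ⟨l, hl⟩ := hf
  obtain ⟨l', hl'⟩ := hg
  refine ⟨l' * l, ?_⟩
  rw [Matrix.mul_assoc, ← Matrix.mul_assoc g, hl', Matrix.one_mul, hl]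

theorem LInv.one {a : ℕ} : LInv (1 : Matrix (Fin a) (Fin a) ℂ) := ⟨1, by simp⟩
theorem RInv.one {a : ℕ} : RInv (1 : Matrix (Fin a) (Fin a) ℂ) := ⟨1, by simp⟩

/-- Full rank factorization. -/
theorem exists_fact {a b : ℕ} (P : Matrix (Fin a) (Fin b) ℂ) (r : ℕ) (hr : r = P.rank) :
    ∃ (i : Matrix (Fin a) (Fin r) ℂ) (s : Matrix (Fin r) (Fin b) ℂ), LInv i ∧ RInv s ∧ P = i * s := by
  let f := Matrix.toLin' P
  have hfr : Module.finrank ℂ (LinearMap.range f) = r := by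
    rw [hr, Matrix.rank]; rfl
  let φ : (LinearMap.range f) ≃ₗ[ℂ] (Fin r → ℂ) := LinearEquiv.ofFinrankEq _ _ (by simp [hfr])
  let i : (Fin r → ℂ) →ₗ[ℂ] (Fin a → ℂ) := (LinearMap.range f).subtype ∘ₗ φ.symm.toLinearMap
  let s : (Fin b → ℂ) →ₗ[ℂ] (Fin r → ℂ) := φ.toLinearMap ∘ₗ f.rangeRestrict
  refine ⟨LinearMap.toMatrix' i, LinearMap.toMatrix' s, LInv.of_inj ?_, RInv.of_surj ?_, ?_⟩
  · intro x y h
    have h' : i x = i y := by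
      rw [← LinearMap.toMatrix'_mulVec, ← LinearMap.toMatrix'_mulVec]; exact h
    exact φ.symm.injective (Subtype.ext h')
  · intro x
    obtain ⟨y, hy⟩ := f.surjective_rangeRestrict (φ.symm x)
    refine ⟨y, ?_⟩
    rw [LinearMap.toMatrix'_mulVec]
    simp [s, hy]
  · rw [← LinearMap.toMatrix'_comp]
    have : i ∘ₗ s = f := by
      ext x
      simp [i, s]
    rw [this]; simp [f]

theorem rank_of_fact {a b r : ℕ} (i : Matrix (Fin a) (Fin r) ℂ) (s : Matrix (Fin r) (Fin b) ℂ)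
    (hi : LInv i) (hs : RInv s) : (i * s).rank = r := by
  apply le_antisymm
  · refine (Matrix.rank_mul_le_left _ _).trans ?_
    simpa using Matrix.rank_le_width i
  · obtain ⟨l, hl⟩ := hi
    obtain ⟨t, ht⟩ := hs
    have h1 : (1 : Matrix (Fin r) (Fin r) ℂ) = l * (i * s) * t := by
      rw [← Matrix.mul_assoc, hl, Matrix.one_mul, ht]
    have h2 : (1 : Matrix (Fin r) (Fin r) ℂ).rank = r := by simp
    calc r = (1 : Matrix (Fin r) (Fin r) ℂ).rank := h2.symm
      _ = (l * (i * s) * t).rank := by rw [← h1]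
      _ ≤ (l * (i * s)).rank := Matrix.rank_mul_le_left _ _
      _ ≤ (i * s).rank := Matrix.rank_mul_le_right _ _

/-- Two injections into spaces of equal dimension differ by an isomorphism. -/
theorem exists_equiv_of_inj {E K K' : Type*} [AddCommGroup E] [Module ℂ E] [AddCommGroup K]
    [Module ℂ K] [AddCommGroup K'] [Module ℂ K'] [FiniteDimensional ℂ K] [FiniteDimensional ℂ K']
    (hK : Module.finrank ℂ K = Module.finrank ℂ K') (a : E →ₗ[ℂ] K) (a' : E →ₗ[ℂ] K')
    (ha : Function.Injective a) (ha' : Function.Injective a') :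
    ∃ θ : K ≃ₗ[ℂ] K', ∀ x, θ (a x) = a' x := by
  obtain ⟨C, hC⟩ := (LinearMap.range a).exists_isCompl
  obtain ⟨C', hC'⟩ := (LinearMap.range a').exists_isCompl
  have e1 := LinearMap.finrank_range_of_inj ha
  have e2 := LinearMap.finrank_range_of_inj ha'
  have h1 := Submodule.finrank_add_eq_of_isCompl hC
  have h2 := Submodule.finrank_add_eq_of_isCompl hC'
  let γ : C ≃ₗ[ℂ] C' := LinearEquiv.ofFinrankEq _ _ (by omega)
  let β : LinearMap.range a ≃ₗ[ℂ] LinearMap.range a' :=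
    (LinearEquiv.ofInjective a ha).symm.trans (LinearEquiv.ofInjective a' ha')
  let θ : K ≃ₗ[ℂ] K' := (Submodule.prodEquivOfIsCompl _ _ hC).symm.trans
    ((β.prodCongr γ).trans (Submodule.prodEquivOfIsCompl _ _ hC'))
  refine ⟨θ, fun x => ?_⟩
  have h3 : (Submodule.prodEquivOfIsCompl _ _ hC).symm (a x)
      = ((⟨a x, x, rfl⟩ : LinearMap.range a), (0 : C)) := by
    rw [LinearEquiv.symm_apply_eq]; simp
  have h4 : (LinearEquiv.ofInjective a ha).symm ⟨a x, x, rfl⟩ = x := by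
    rw [LinearEquiv.symm_apply_eq]; rfl
  simp [θ, h3, β, h4]

/-- Linear maps factor through a map with smaller kernel. -/
theorem exists_factor {A B C : Type*} [AddCommGroup A] [Module ℂ A] [AddCommGroup B]
    [Module ℂ B] [AddCommGroup C] [Module ℂ C] (s : A →ₗ[ℂ] B) (t : A →ₗ[ℂ] C)
    (h : ∀ x, s x = 0 → t x = 0) : ∃ H : B →ₗ[ℂ] C, ∀ x, H (s x) = t x := by
  obtain ⟨r, hr⟩ := s.rangeRestrict.exists_rightInverse_of_surjective
    (LinearMap.range_rangeRestrict s)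
  obtain ⟨H, hH⟩ := LinearMap.exists_extend (t ∘ₗ r)
  refine ⟨H, fun x => ?_⟩
  have h1 := LinearMap.congr_fun hH ⟨s x, x, rfl⟩
  have h2 := LinearMap.congr_fun hr ⟨s x, x, rfl⟩
  simp only [LinearMap.comp_apply, Submodule.subtype_apply] at h1 h2
  rw [h1]
  have h3 : s (r ⟨s x, x, rfl⟩) = s x := congrArg Subtype.val h2
  have := h (r ⟨s x, x, rfl⟩ - x) (by rw [map_sub, h3, sub_self])
  rw [map_sub, sub_eq_zero] at this
  exact this

/-- The extension lemma. -/
theorem exists_ext {U V : Type*} [AddCommGroup U] [Module ℂ U] [AddCommGroup V] [Module ℂ V]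
    [FiniteDimensional ℂ V] [FiniteDimensional ℂ U]
    (f f' : U →ₗ[ℂ] V) (g g' : V →ₗ[ℂ] U) (hf : Function.Injective f) (hf' : Function.Injective f')
    (hg : Function.Surjective g) (hg' : Function.Surjective g')
    (hgf : ∀ x, g (f x) = g' (f' x)) :
    ∃ H : V ≃ₗ[ℂ] V, (∀ x, H (f x) = f' x) ∧ ∀ v, g' (H v) = g v := by
  let K := LinearMap.ker g
  let K' := LinearMap.ker g'
  let E := LinearMap.ker (g ∘ₗ f)
  let a : E →ₗ[ℂ] K := LinearMap.restrict f (fun x hx => by simpa [E, K] using hx)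
  let a' : E →ₗ[ℂ] K' := LinearMap.restrict f' (fun x hx => by
    have : g (f x) = 0 := by simpa [E] using hx
    simpa [K', ← hgf] using this)
  have k1 := LinearMap.finrank_range_add_finrank_ker g
  have k2 := LinearMap.finrank_range_add_finrank_ker g'
  rw [LinearMap.range_eq_top_of_surjective g hg] at k1
  rw [LinearMap.range_eq_top_of_surjective g' hg'] at k2
  obtain ⟨θ, hθ⟩ := exists_equiv_of_inj (K := K) (K' := K')
    (by show Module.finrank ℂ (LinearMap.ker g) = Module.finrank ℂ (LinearMap.ker g'); omega) a a'
    (fun x y h => Subtype.ext (hf (congrArg Subtype.val h)))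
    (fun x y h => Subtype.ext (hf' (congrArg Subtype.val h)))
  let s : (U × K) →ₗ[ℂ] V := f.coprod K.subtype
  let t : (U × K) →ₗ[ℂ] V := f'.coprod (K'.subtype ∘ₗ θ.toLinearMap)
  have hst : ∀ x, s x = 0 → t x = 0 := by
    rintro ⟨u, k⟩ h
    have h1 : f u = -(k : V) := by
      simp only [s, LinearMap.coprod_apply, Submodule.subtype_apply] at h
      exact eq_neg_of_add_eq_zero_left h
    have hu : u ∈ E := by
      have : g (k : V) = 0 := k.2
      simp [E, h1, this]
    have h2 : a ⟨u, hu⟩ = -k := Subtype.ext h1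
    have h3 := hθ ⟨u, hu⟩
    rw [h2] at h3
    have h4 : -((θ k : K') : V) = f' u := by
      have := congrArg Subtype.val h3
      rw [map_neg] at this
      exact this
    simp [t, ← h4]
  obtain ⟨H0, hH0⟩ := exists_factor s t hst
  obtain ⟨r, hr⟩ := g'.exists_rightInverse_of_surjective (LinearMap.range_eq_top_of_surjective g' hg')
  let H : V →ₗ[ℂ] V := H0 + r ∘ₗ (g - g' ∘ₗ H0)
  have hr' : ∀ x, g' (r x) = x := fun x => LinearMap.congr_fun hr x
  have Hg : ∀ v, g' (H v) = g v := by
    intro v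
    simp [H, hr']
  have Hs : ∀ x, H (s x) = t x := by
    rintro ⟨u, k⟩
    have hk : g (k : V) = 0 := k.2
    have hk' : g' ((θ k : K') : V) = 0 := (θ k).2
    have h5 : g (s (u, k)) = g' (t (u, k)) := by
      simp [s, t, hk, hk', hgf]
    simp only [H, LinearMap.add_apply, LinearMap.comp_apply, LinearMap.sub_apply, hH0, h5, sub_self,
      map_zero, add_zero]
  have Hsurj : Function.Surjective H := by
    intro v'
    obtain ⟨v, hv⟩ := hg (g' v')
    have h6 : v' - H v ∈ K' := by simp [K', Hg, hv]
    have h7 := Hs (0, θ.symm ⟨v' - H v, h6⟩)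
    refine ⟨v + s (0, θ.symm ⟨v' - H v, h6⟩), ?_⟩
    rw [map_add, h7]
    simp [t]
  let He := LinearEquiv.ofBijective H ⟨LinearMap.injective_iff_surjective.mpr Hsurj, Hsurj⟩
  refine ⟨He, fun x => ?_, Hg⟩
  have := Hs (x, 0)
  change H (f x) = f' x
  simpa [s, t] using this

/-- Matrix version of the extension lemma. -/
theorem exists_ext_mat {a b : ℕ} (f f' : Matrix (Fin a) (Fin b) ℂ) (g g' : Matrix (Fin b) (Fin a) ℂ)
    (hf : LInv f) (hf' : LInv f') (hg : RInv g) (hg' : RInv g')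
    (h : (Matrix (Fin b) (Fin b) ℂ)ˣ) (hh : h.val * (g * f) = g' * f' * h.val) :
    ∃ H : (Matrix (Fin a) (Fin a) ℂ)ˣ, H.val * f = f' * h.val ∧ h.val * g = g' * H.val := by
  have hf2 : LInv (f' * h.val) := hf'.mul ⟨h⁻¹.val, by simp⟩
  have hg2 : RInv (h⁻¹.val * g') := RInv.mul ⟨h.val, by simp⟩ hg'
  obtain ⟨H, h1, h2⟩ := exists_ext (Matrix.toLin' f) (Matrix.toLin' (f' * h.val)) (Matrix.toLin' g)
    (Matrix.toLin' (h⁻¹.val * g')) hf.inj hf2.inj hg.surj hg2.surj (by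
      intro x
      simp only [← LinearMap.comp_apply, ← Matrix.toLin'_mul]
      congr 2
      rw [Matrix.mul_assoc, ← Matrix.mul_assoc g', ← hh, ← Matrix.mul_assoc, Units.inv_mul,
        Matrix.one_mul])
  let Hm := LinearMap.toMatrix' H.toLinearMap
  let Hi := LinearMap.toMatrix' H.symm.toLinearMap
  have e1 : Hm * Hi = 1 := by
    simp only [Hm, Hi]; rw [← LinearMap.toMatrix'_comp]; simp
  have e2 : Hi * Hm = 1 := by
    simp only [Hm, Hi]; rw [← LinearMap.toMatrix'_comp]; simp
  refine ⟨⟨Hm, Hi, e1, e2⟩, ?_, ?_⟩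
  · apply Matrix.toLin'.injective
    apply LinearMap.ext
    intro x
    rw [Matrix.toLin'_mul]
    simpa [Hm] using h1 x
  · have : g = h⁻¹.val * g' * Hm := by
      apply Matrix.toLin'.injective
      apply LinearMap.ext
      intro x
      rw [Matrix.toLin'_mul]
      have := (h2 x).symm
      rw [LinearMap.comp_apply, this]
      simp [Hm]
    conv_lhs => rw [this]
    rw [← Matrix.mul_assoc, ← Matrix.mul_assoc, Units.mul_inv, Matrix.one_mul]

/-! ### Chains -/

/-- Partial products `∏_{l<κ} (R - ξ_l)`. -/
def PP {N : ℕ} (R : Matrix (Fin N) (Fin N) ℂ) (ξ : ℕ → ℂ) : ℕ → Matrix (Fin N) (Fin N) ℂ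
  | 0 => 1
  | κ+1 => PP R ξ κ * (R - ξ κ • 1)

theorem PP_comm {N : ℕ} (R : Matrix (Fin N) (Fin N) ℂ) (ξ : ℕ → ℂ) (κ : ℕ) :
    R * PP R ξ κ = PP R ξ κ * R := by
  induction κ with
  | zero => simp [PP]
  | succ κ ih =>
    simp only [PP]
    rw [← Matrix.mul_assoc, ih, Matrix.mul_assoc, Matrix.mul_assoc]
    congr 1
    simp [Matrix.mul_sub, Matrix.sub_mul]

theorem PP_comm' {N : ℕ} (R : Matrix (Fin N) (Fin N) ℂ) (ξ : ℕ → ℂ) (κ : ℕ) (c : ℂ) :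
    (R - c • 1) * PP R ξ κ = PP R ξ κ * (R - c • 1) := by
  simp [Matrix.sub_mul, Matrix.mul_sub, PP_comm]

theorem PP_conj {N : ℕ} (R R' : Matrix (Fin N) (Fin N) ℂ) (ξ : ℕ → ℂ) (κ : ℕ)
    (h : Matrix (Fin N) (Fin N) ℂ) (hh : h * R = R' * h) : h * PP R ξ κ = PP R' ξ κ * h := by
  induction κ with
  | zero => simp [PP]
  | succ κ ih =>
    simp only [PP]
    rw [← Matrix.mul_assoc, ih, Matrix.mul_assoc, Matrix.mul_assoc]
    congr 1
    simp [Matrix.mul_sub, Matrix.sub_mul, hh]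

section chains
variable (D : ℕ → ℕ) (ξ : ℕ → ℂ) (f : ∀ κ, Matrix (Fin (D κ)) (Fin (D (κ+1))) ℂ)
  (g : ∀ κ, Matrix (Fin (D (κ+1))) (Fin (D κ)) ℂ)

/-- The moment map conditions along a leg. -/
def Chain : Prop := ∀ κ, f (κ+1) * g (κ+1) - g κ * f κ = (ξ κ - ξ (κ+1)) • 1

/-- composites of the `f`s. -/
def io : ∀ κ, Matrix (Fin (D 0)) (Fin (D κ)) ℂ
  | 0 => 1
  | κ+1 => io κ * f κ

/-- composites of the `g`s. -/
def so : ∀ κ, Matrix (Fin (D κ)) (Fin (D 0)) ℂ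
  | 0 => 1
  | κ+1 => g κ * so κ

/-- The base matrix. -/
def baseR : Matrix (Fin (D 0)) (Fin (D 0)) ℂ := f 0 * g 0 + ξ 0 • 1

variable {D ξ f g}

theorem io_g (h : Chain D ξ f g) (κ : ℕ) :
    io D f (κ+1) * g κ = (baseR D ξ f g - ξ κ • 1) * io D f κ := by
  induction κ with
  | zero => simp [io, baseR]
  | succ κ ih =>
    have h1 : f (κ+1) * g (κ+1) = g κ * f κ + (ξ κ - ξ (κ+1)) • 1 := by
      rw [← h κ]; abel
    calc io D f (κ+1+1) * g (κ+1) = io D f (κ+1) * (f (κ+1) * g (κ+1)) := by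
          simp only [io, Matrix.mul_assoc]
      _ = io D f (κ+1) * g κ * f κ + (ξ κ - ξ (κ+1)) • io D f (κ+1) := by
          rw [h1, Matrix.mul_add, Matrix.mul_assoc]; simp
      _ = _ := by
          rw [ih, Matrix.mul_assoc]
          change (baseR D ξ f g - ξ κ • 1) * io D f (κ+1) + _ = _
          simp only [Matrix.sub_mul, Matrix.smul_mul, Matrix.one_mul, sub_smul]
          abel

theorem f_so (h : Chain D ξ f g) (κ : ℕ) :
    f κ * so D g (κ+1) = so D g κ * (baseR D ξ f g - ξ κ • 1) := by
  induction κ with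
  | zero => simp [so, baseR]
  | succ κ ih =>
    have h1 : f (κ+1) * g (κ+1) = g κ * f κ + (ξ κ - ξ (κ+1)) • 1 := by
      rw [← h κ]; abel
    calc f (κ+1) * so D g (κ+1+1) = (f (κ+1) * g (κ+1)) * so D g (κ+1) := by
          simp only [so, Matrix.mul_assoc]
      _ = g κ * (f κ * so D g (κ+1)) + (ξ κ - ξ (κ+1)) • so D g (κ+1) := by
          rw [h1, Matrix.add_mul, Matrix.mul_assoc]; simp
      _ = _ := by
          rw [ih, ← Matrix.mul_assoc]
          change so D g (κ+1) * (baseR D ξ f g - ξ κ • 1) + _ = _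
          simp only [Matrix.mul_sub, Matrix.mul_smul, Matrix.mul_one, sub_smul]
          abel

theorem io_so (h : Chain D ξ f g) (κ : ℕ) :
    io D f κ * so D g κ = PP (baseR D ξ f g) ξ κ := by
  induction κ with
  | zero => simp [io, so, PP]
  | succ κ ih =>
    rw [show io D f (κ+1) = io D f κ * f κ from rfl, Matrix.mul_assoc, f_so h, ← Matrix.mul_assoc,
      ih]
    rfl

theorem io_LInv (hf : ∀ κ, LInv (f κ)) (κ : ℕ) : LInv (io D f κ) := by
  induction κ with
  | zero => exact LInv.one
  | succ κ ih => exact ih.mul (hf κ)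

theorem so_RInv (hg : ∀ κ, RInv (g κ)) (κ : ℕ) : RInv (so D g κ) := by
  induction κ with
  | zero => exact RInv.one
  | succ κ ih => exact (hg κ).mul ih

/-- Existence of legs. -/
theorem exists_chain (D : ℕ → ℕ) (ξ : ℕ → ℂ) (R : Matrix (Fin (D 0)) (Fin (D 0)) ℂ)
    (hD : ∀ κ, D (κ+1) = (PP R ξ (κ+1)).rank) :
    ∃ (f : ∀ κ, Matrix (Fin (D κ)) (Fin (D (κ+1))) ℂ)
      (g : ∀ κ, Matrix (Fin (D (κ+1))) (Fin (D κ)) ℂ),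
      Chain D ξ f g ∧ baseR D ξ f g = R ∧ (∀ κ, LInv (f κ)) ∧ (∀ κ, RInv (g κ)) := by
  have key : ∀ κ, ∃ (i : Matrix (Fin (D 0)) (Fin (D (κ+1))) ℂ)
      (s : Matrix (Fin (D (κ+1))) (Fin (D 0)) ℂ)
      (l : Matrix (Fin (D (κ+1))) (Fin (D 0)) ℂ) (r : Matrix (Fin (D 0)) (Fin (D (κ+1))) ℂ),
      l * i = 1 ∧ s * r = 1 ∧ PP R ξ (κ+1) = i * s := by
    intro κ
    obtain ⟨i, s, ⟨l, hl⟩, ⟨r, hr⟩, h⟩ := exists_fact (PP R ξ (κ+1)) (D (κ+1)) (hD κ)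
    exact ⟨i, s, l, r, hl, hr, h⟩
  choose i' s' l' r' hl' hr' hP' using key
  have key2 : ∃ (i : ∀ κ, Matrix (Fin (D 0)) (Fin (D κ)) ℂ)
      (s : ∀ κ, Matrix (Fin (D κ)) (Fin (D 0)) ℂ)
      (l : ∀ κ, Matrix (Fin (D κ)) (Fin (D 0)) ℂ) (r : ∀ κ, Matrix (Fin (D 0)) (Fin (D κ)) ℂ),
      (∀ κ, l κ * i κ = 1) ∧ (∀ κ, s κ * r κ = 1) ∧ (∀ κ, PP R ξ κ = i κ * s κ) ∧ i 0 = 1 := by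
    refine ⟨fun κ => Nat.casesOn κ 1 i', fun κ => Nat.casesOn κ 1 s', fun κ => Nat.casesOn κ 1 l',
      fun κ => Nat.casesOn κ 1 r', ?_, ?_, ?_, rfl⟩
    · rintro (_ | κ)
      · simp
      · exact hl' κ
    · rintro (_ | κ)
      · simp
      · exact hr' κ
    · rintro (_ | κ)
      · simp [PP]
      · exact hP' κ
  obtain ⟨i, s, l, r, hl, hr, hP, h0⟩ := key2
  have hi : ∀ κ, i κ = PP R ξ κ * r κ := by
    intro κ
    rw [hP, Matrix.mul_assoc, hr, Matrix.mul_one]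
  have hlP : ∀ κ, i κ * (l κ * PP R ξ κ) = PP R ξ κ := by
    intro κ
    rw [hP, ← Matrix.mul_assoc (l κ), hl, Matrix.one_mul]
  have hf : ∀ κ, i κ * (l κ * i (κ+1)) = i (κ+1) := by
    intro κ
    rw [hi (κ+1)]
    simp only [PP]
    simp only [← Matrix.mul_assoc] at hlP ⊢
    rw [hlP]
  have hRi : ∀ κ, (R - ξ κ • 1) * i κ = PP R ξ (κ+1) * r κ := by
    intro κ
    rw [hi κ, ← Matrix.mul_assoc, PP_comm']
    rfl
  have hg : ∀ κ, i (κ+1) * (l (κ+1) * ((R - ξ κ • 1) * i κ)) = (R - ξ κ • 1) * i κ := by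
    intro κ
    rw [hRi]
    have := hlP (κ+1)
    simp only [← Matrix.mul_assoc] at this ⊢
    rw [this]
  refine ⟨fun κ => l κ * i (κ+1), fun κ => l (κ+1) * ((R - ξ κ • 1) * i κ), ?_, ?_, ?_, ?_⟩
  · intro κ
    have inj : ∀ {b : ℕ} (A B : Matrix (Fin (D (κ+1))) (Fin b) ℂ), i (κ+1) * A = i (κ+1) * B → A = B := by
      intro b A B h
      have := congrArg (fun M => l (κ+1) * M) h
      simpa [← Matrix.mul_assoc, hl] using this
    apply inj
    rw [Matrix.mul_sub, ← Matrix.mul_assoc, hf, hg, ← Matrix.mul_assoc, hg, Matrix.mul_assoc, hf]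
    rw [Matrix.mul_smul, Matrix.mul_one]
    simp only [Matrix.sub_mul, Matrix.smul_mul, Matrix.one_mul, sub_smul]
    abel
  · have e1 : i 0 * (l 0 * i 1 * (l 1 * ((R - ξ 0 • 1) * i 0))) = (R - ξ 0 • 1) * i 0 := by
      rw [← Matrix.mul_assoc, hf 0]
      exact hg 0
    rw [h0, Matrix.one_mul, Matrix.mul_one] at e1
    simp only [baseR]
    rw [h0, Matrix.mul_one, e1]
    abel
  · intro κ
    refine ⟨l (κ+1) * i κ, ?_⟩
    rw [Matrix.mul_assoc, hf, hl]
  · intro κ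
    refine ⟨s κ * r (κ+1), ?_⟩
    rw [Matrix.mul_assoc, Matrix.mul_assoc, ← Matrix.mul_assoc (i κ), ← hP κ, ← Matrix.mul_assoc (R - _),
      PP_comm']
    change l (κ+1) * (PP R ξ (κ+1) * _) = 1
    rw [hP (κ+1), Matrix.mul_assoc, hr, Matrix.mul_one, hl]


/-- Uniqueness of legs, given a conjugation at the base. -/
theorem chain_unique {f' : ∀ κ, Matrix (Fin (D κ)) (Fin (D (κ+1))) ℂ}
    {g' : ∀ κ, Matrix (Fin (D (κ+1))) (Fin (D κ)) ℂ}
    (hc : Chain D ξ f g) (hc' : Chain D ξ f' g') (hf : ∀ κ, LInv (f κ)) (hg : ∀ κ, RInv (g κ))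
    (hf' : ∀ κ, LInv (f' κ)) (hg' : ∀ κ, RInv (g' κ))
    (h : (Matrix (Fin (D 0)) (Fin (D 0)) ℂ)ˣ)
    (hh : h.val * baseR D ξ f g = baseR D ξ f' g' * h.val) :
    ∃ H : ∀ κ, (Matrix (Fin (D κ)) (Fin (D κ)) ℂ)ˣ, H 0 = h ∧
      (∀ κ, (H κ).val * f κ = f' κ * (H (κ+1)).val) ∧
      (∀ κ, (H (κ+1)).val * g κ = g' κ * (H κ).val) := by
  choose l hl using io_LInv (D := D) (f := f) hf
  choose l' hl' using io_LInv (D := D) (f := f') hf'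
  choose r hr using so_RInv (D := D) (g := g) hg
  choose r' hr' using so_RInv (D := D) (g := g') hg'
  have ir : ∀ κ, io D f κ = PP (baseR D ξ f g) ξ κ * r κ := fun κ => by
    rw [← io_so hc, Matrix.mul_assoc, hr, Matrix.mul_one]
  have ir' : ∀ κ, io D f' κ = PP (baseR D ξ f' g') ξ κ * r' κ := fun κ => by
    rw [← io_so hc', Matrix.mul_assoc, hr', Matrix.mul_one]
  have hl0 : ∀ κ, io D f κ * (l κ * PP (baseR D ξ f g) ξ κ) = PP (baseR D ξ f g) ξ κ := fun κ => by
    rw [← io_so hc, ← Matrix.mul_assoc (l κ), hl, Matrix.one_mul]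
  have hl0' : ∀ κ, io D f' κ * (l' κ * PP (baseR D ξ f' g') ξ κ) = PP (baseR D ξ f' g') ξ κ :=
    fun κ => by
    rw [← io_so hc', ← Matrix.mul_assoc (l' κ), hl', Matrix.one_mul]
  have k1 : ∀ κ, io D f' κ * (l' κ * (h.val * io D f κ)) = h.val * io D f κ := fun κ => by
    have := hl0' κ
    rw [ir κ, ← Matrix.mul_assoc h.val, PP_conj _ _ _ _ _ hh]
    simp only [← Matrix.mul_assoc] at this ⊢
    rw [this]
  have hh' : h⁻¹.val * baseR D ξ f' g' = baseR D ξ f g * h⁻¹.val := by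
    have := congrArg (fun M => h⁻¹.val * M * h⁻¹.val) hh
    simp only [Matrix.mul_assoc, Units.mul_inv, Matrix.mul_one] at this
    rw [← Matrix.mul_assoc, Units.inv_mul, Matrix.one_mul] at this
    exact this.symm
  have k2 : ∀ κ, io D f κ * (l κ * (h⁻¹.val * io D f' κ)) = h⁻¹.val * io D f' κ := fun κ => by
    have := hl0 κ
    rw [ir' κ, ← Matrix.mul_assoc h⁻¹.val, PP_conj _ _ _ _ _ hh']
    simp only [← Matrix.mul_assoc] at this ⊢
    rw [this]
  have u1 : ∀ κ, (l' κ * (h.val * io D f κ)) * (l κ * (h⁻¹.val * io D f' κ)) = 1 := fun κ => by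
    have e : (l' κ * (h.val * io D f κ)) * (l κ * (h⁻¹.val * io D f' κ))
      = l' κ * (h.val * (io D f κ * (l κ * (h⁻¹.val * io D f' κ)))) := by
      simp only [Matrix.mul_assoc]
    rw [e, k2, ← Matrix.mul_assoc h.val, Units.mul_inv, Matrix.one_mul, hl']
  have u2 : ∀ κ, (l κ * (h⁻¹.val * io D f' κ)) * (l' κ * (h.val * io D f κ)) = 1 := fun κ => by
    have e : (l κ * (h⁻¹.val * io D f' κ)) * (l' κ * (h.val * io D f κ))
      = l κ * (h⁻¹.val * (io D f' κ * (l' κ * (h.val * io D f κ)))) := by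
      simp only [Matrix.mul_assoc]
    rw [e, k1, ← Matrix.mul_assoc h⁻¹.val, Units.inv_mul, Matrix.one_mul, hl]
  let H : ∀ κ, (Matrix (Fin (D κ)) (Fin (D κ)) ℂ)ˣ := fun κ => ⟨_, _, u1 κ, u2 κ⟩
  have kH : ∀ κ, io D f' κ * (H κ).val = h.val * io D f κ := k1
  have inj : ∀ κ {b : ℕ} (A B : Matrix (Fin (D κ)) (Fin b) ℂ), io D f' κ * A = io D f' κ * B →
      A = B := by
    intro κ b A B h
    have := congrArg (fun M => l' κ * M) h
    simpa only [← Matrix.mul_assoc, hl', Matrix.one_mul] using this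
  refine ⟨H, ?_, ?_, ?_⟩
  · apply Units.ext
    have := kH 0
    simpa only [io, Matrix.one_mul, Matrix.mul_one] using this
  · intro κ
    apply inj
    rw [← Matrix.mul_assoc, kH, ← Matrix.mul_assoc (io D f' κ)]
    change _ = io D f' (κ+1) * _
    rw [kH, Matrix.mul_assoc]
    rfl
  · intro κ
    apply inj
    rw [← Matrix.mul_assoc, kH, ← Matrix.mul_assoc, io_g hc', Matrix.mul_assoc, io_g hc,
      Matrix.mul_assoc, kH, ← Matrix.mul_assoc, ← Matrix.mul_assoc]
    congr 1
    simp [Matrix.mul_sub, Matrix.sub_mul, hh]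

/-- Legs with the same dimensions and parameters have similar bases. -/
theorem chain_sim {f' : ∀ κ, Matrix (Fin (D κ)) (Fin (D (κ+1))) ℂ}
    {g' : ∀ κ, Matrix (Fin (D (κ+1))) (Fin (D κ)) ℂ}
    (hc : Chain D ξ f g) (hc' : Chain D ξ f' g') (hf : ∀ κ, LInv (f κ)) (hg : ∀ κ, RInv (g κ))
    (hf' : ∀ κ, LInv (f' κ)) (hg' : ∀ κ, RInv (g' κ)) (e : ℕ) (he : D (e+1) = 0) :
    ∃ H : (Matrix (Fin (D 0)) (Fin (D 0)) ℂ)ˣ,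
      H.val * baseR D ξ f g = baseR D ξ f' g' * H.val := by
  have key : ∀ t, t ≤ e → ∃ H : (Matrix (Fin (D (e-t))) (Fin (D (e-t))) ℂ)ˣ,
      H.val * (f (e-t) * g (e-t)) = (f' (e-t) * g' (e-t)) * H.val := by
    intro t
    induction t with
    | zero =>
      intro _
      refine ⟨1, ?_⟩
      have : IsEmpty (Fin (D (e-0+1))) := by
        simp only [Nat.sub_zero, he]; infer_instance
      have z1 : f (e-0) * g (e-0) = 0 := by ext; simp [Matrix.mul_apply]
      have z2 : f' (e-0) * g' (e-0) = 0 := by ext; simp [Matrix.mul_apply]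
      rw [z1, z2]; simp
    | succ t ih =>
      intro ht
      have ih' := ih (by omega)
      obtain ⟨κ, hκ⟩ : ∃ κ, κ = e - (t+1) := ⟨_, rfl⟩
      have hκ1 : e - t = κ + 1 := by omega
      rw [← hκ]
      rw [hκ1] at ih'
      obtain ⟨H, hH⟩ := ih'
      have q1 : f (κ+1) * g (κ+1) = g κ * f κ + (ξ κ - ξ (κ+1)) • 1 := by rw [← hc κ]; abel
      have q2 : f' (κ+1) * g' (κ+1) = g' κ * f' κ + (ξ κ - ξ (κ+1)) • 1 := by rw [← hc' κ]; abel
      rw [q1, q2] at hH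
      have hH2 : H.val * (g κ * f κ) = g' κ * f' κ * H.val := by
        simpa [Matrix.mul_add, Matrix.add_mul] using hH
      obtain ⟨H2, h1, h2⟩ := exists_ext_mat (f κ) (f' κ) (g κ) (g' κ) (hf κ) (hf' κ) (hg κ) (hg' κ)
        H hH2
      refine ⟨H2, ?_⟩
      rw [← Matrix.mul_assoc, h1, Matrix.mul_assoc, h2, Matrix.mul_assoc]
  obtain ⟨H, hH⟩ := key e le_rfl
  generalize hz : e - e = z at H hH
  obtain rfl : z = 0 := by omega
  refine ⟨H, ?_⟩
  simp only [baseR, Matrix.mul_add, Matrix.add_mul]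
  rw [hH]
  simp

end chains


/-! ### Truncated polynomial rings -/

section trunc
variable {𝓐 : Type} [Ring 𝓐]

/-- Congruence modulo `X ^ k`. -/
def tcon (𝓐 : Type) [Ring 𝓐] (k : ℕ) : RingCon 𝓐[X] where
  r p q := ∀ l < k, p.coeff l = q.coeff l
  iseqv := ⟨fun _ _ _ => rfl, fun h l hl => (h l hl).symm, fun h h' l hl => (h l hl).trans (h' l hl)⟩
  add' := by
    intro a b c d h h' l hl
    simp [h l hl, h' l hl]
  mul' := by
    intro a b c d h h' l hl
    simp only [Polynomial.coeff_mul]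
    refine Finset.sum_congr rfl fun x hx => ?_
    have := Finset.HasAntidiagonal.mem_antidiagonal.mp hx
    rw [h _ (by omega), h' _ (by omega)]

/-- The truncated polynomial ring `𝓐[X]/X^k`. -/
abbrev TT (𝓐 : Type) [Ring 𝓐] (k : ℕ) : Type := (tcon 𝓐 k).Quotient

variable {k : ℕ}

/-- The quotient map. -/
def tmk (k : ℕ) : 𝓐[X] →+* TT 𝓐 k := (tcon 𝓐 k).mk'

theorem tmk_surj (p : TT 𝓐 k) : ∃ q, tmk k q = p := (tcon 𝓐 k).mk'_surjective p

theorem tmk_eq {p q : 𝓐[X]} : tmk k p = tmk k q ↔ ∀ l < k, p.coeff l = q.coeff l :=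
  (tcon 𝓐 k).eq

/-- Coefficients. -/
def cf (p : TT 𝓐 k) (l : ℕ) : 𝓐 :=
  Quotient.liftOn p (fun q : 𝓐[X] => if l < k then q.coeff l else 0) (by
    intro a b h
    by_cases hl : l < k
    · simp only [hl, if_true]; exact h l hl
    · simp [hl])

theorem cf_tmk (q : 𝓐[X]) (l : ℕ) : cf (tmk k q) l = if l < k then q.coeff l else 0 := rfl

theorem cf_tmk' (q : 𝓐[X]) {l : ℕ} (hl : l < k) : cf (tmk k q) l = q.coeff l := by
  rw [cf_tmk, if_pos hl]

theorem cf_ge (p : TT 𝓐 k) {l : ℕ} (hl : k ≤ l) : cf p l = 0 := by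
  obtain ⟨q, rfl⟩ := tmk_surj p
  rw [cf_tmk, if_neg (by omega)]

theorem cf_ext {p q : TT 𝓐 k} (h : ∀ l < k, cf p l = cf q l) : p = q := by
  obtain ⟨p, rfl⟩ := tmk_surj p
  obtain ⟨q, rfl⟩ := tmk_surj q
  rw [tmk_eq]
  intro l hl
  simpa [cf_tmk, hl] using h l hl

@[simp] theorem cf_add (p q : TT 𝓐 k) (l : ℕ) : cf (p + q) l = cf p l + cf q l := by
  obtain ⟨p, rfl⟩ := tmk_surj p
  obtain ⟨q, rfl⟩ := tmk_surj q
  rw [← map_add, cf_tmk, cf_tmk, cf_tmk]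
  split_ifs <;> simp

@[simp] theorem cf_zero (l : ℕ) : cf (0 : TT 𝓐 k) l = 0 := by
  rw [← map_zero (tmk k), cf_tmk]; simp

/-- Coefficient as an additive map. -/
def cfHom (l : ℕ) : TT 𝓐 k →+ 𝓐 where
  toFun p := cf p l
  map_zero' := cf_zero l
  map_add' p q := cf_add p q l

@[simp] theorem cf_neg (p : TT 𝓐 k) (l : ℕ) : cf (-p) l = - cf p l := map_neg (cfHom l) p
@[simp] theorem cf_sub (p q : TT 𝓐 k) (l : ℕ) : cf (p - q) l = cf p l - cf q l :=
  map_sub (cfHom l) p q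
theorem cf_sum {ι : Type*} (s : Finset ι) (p : ι → TT 𝓐 k) (l : ℕ) :
    cf (∑ i ∈ s, p i) l = ∑ i ∈ s, cf (p i) l := map_sum (cfHom l) p s

/-- Constants. -/
def tC (k : ℕ) : 𝓐 →+* TT 𝓐 k := (tmk k).comp Polynomial.C

/-- The variable. -/
def tx (𝓐 : Type) [Ring 𝓐] (k : ℕ) : TT 𝓐 k := tmk k X

theorem cf_mul (p q : TT 𝓐 k) {l : ℕ} (hl : l < k) :
    cf (p * q) l = ∑ x ∈ Finset.HasAntidiagonal.antidiagonal l, cf p x.1 * cf q x.2 := by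
  obtain ⟨p, rfl⟩ := tmk_surj p
  obtain ⟨q, rfl⟩ := tmk_surj q
  rw [← map_mul, cf_tmk' _ hl, Polynomial.coeff_mul]
  refine Finset.sum_congr rfl fun x hx => ?_
  have := Finset.HasAntidiagonal.mem_antidiagonal.mp hx
  rw [cf_tmk' _ (by omega), cf_tmk' _ (by omega)]

theorem cf_mul_zero (hk : 0 < k) (p q : TT 𝓐 k) : cf (p * q) 0 = cf p 0 * cf q 0 := by
  rw [cf_mul p q hk]; simp

@[simp] theorem cf_tC_mul (a : 𝓐) (p : TT 𝓐 k) (l : ℕ) : cf (tC k a * p) l = a * cf p l := by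
  obtain ⟨p, rfl⟩ := tmk_surj p
  change cf (tmk k (C a) * tmk k p) l = _
  rw [← map_mul, cf_tmk, cf_tmk]; split_ifs <;> simp

@[simp] theorem cf_mul_tC (a : 𝓐) (p : TT 𝓐 k) (l : ℕ) : cf (p * tC k a) l = cf p l * a := by
  obtain ⟨p, rfl⟩ := tmk_surj p
  change cf (tmk k p * tmk k (C a)) l = _
  rw [← map_mul, cf_tmk, cf_tmk]; split_ifs <;> simp

theorem tx_comm (p : TT 𝓐 k) : tx 𝓐 k * p = p * tx 𝓐 k := by
  obtain ⟨p, rfl⟩ := tmk_surj p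
  rw [tx, ← map_mul, ← map_mul, Polynomial.X_mul]

theorem txp_comm (r : ℕ) (p : TT 𝓐 k) : tx 𝓐 k ^ r * p = p * tx 𝓐 k ^ r :=
  (Commute.pow_left (tx_comm p) r)

theorem tx_pow_k : tx 𝓐 k ^ k = 0 := by
  apply cf_ext
  intro l hl
  rw [tx, ← map_pow, cf_tmk' _ hl, Polynomial.coeff_X_pow, if_neg (by omega), cf_zero]

theorem tx_pow_ge {r : ℕ} (h : k ≤ r) : tx 𝓐 k ^ r = 0 := by
  rw [show r = k + (r - k) by omega, pow_add, tx_pow_k, zero_mul]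

theorem cf_txp_mul (r : ℕ) (p : TT 𝓐 k) (l : ℕ) :
    cf (tx 𝓐 k ^ r * p) l = if r ≤ l ∧ l < k then cf p (l - r) else 0 := by
  obtain ⟨p, rfl⟩ := tmk_surj p
  rw [tx, ← map_pow, ← map_mul, cf_tmk, cf_tmk, Polynomial.coeff_X_pow_mul']
  split_ifs <;> first | rfl | omega

theorem cf_tx_mul (p : TT 𝓐 k) (l : ℕ) :
    cf (tx 𝓐 k * p) l = if 1 ≤ l ∧ l < k then cf p (l - 1) else 0 := by
  have := cf_txp_mul 1 p l
  rwa [pow_one] at this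

theorem cf_C_txp (a : 𝓐) (r l : ℕ) :
    cf (tC k a * tx 𝓐 k ^ r) l = if l = r ∧ l < k then a else 0 := by
  rw [tC, tx, ← map_pow]
  change cf (tmk k (C a) * _) l = _
  rw [← map_mul, cf_tmk, Polynomial.coeff_C_mul, Polynomial.coeff_X_pow]
  split_ifs <;> first | rfl | omega | simp

theorem cf_one (l : ℕ) : cf (1 : TT 𝓐 k) l = if l = 0 ∧ l < k then 1 else 0 := by
  have := cf_C_txp (k := k) (1 : 𝓐) 0 l
  simpa using this

theorem cf_tC (a : 𝓐) (l : ℕ) : cf (tC k a) l = if l = 0 ∧ l < k then a else 0 := by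
  have := cf_C_txp (k := k) a 0 l
  simpa using this

/-- Division by powers of the variable. -/
theorem exists_div {r : ℕ} {p : TT 𝓐 k} (h : ∀ l < r, cf p l = 0) :
    ∃ p' : TT 𝓐 k, p = tx 𝓐 k ^ r * p' ∧ ∀ l, r + l < k → cf p' l = cf p (r + l) := by
  obtain ⟨p, rfl⟩ := tmk_surj p
  refine ⟨tmk k (Polynomial.divX^[r] p), ?_, ?_⟩
  · apply cf_ext
    intro l hl
    rw [cf_txp_mul]
    split_ifs with h1
    · have : ∀ (r : ℕ) (p : 𝓐[X]) (l : ℕ), (Polynomial.divX^[r] p).coeff l = p.coeff (l + r) := by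
        intro r
        induction r with
        | zero => simp
        | succ r ih =>
          intro p l
          rw [Function.iterate_succ, Function.comp_apply, ih, Polynomial.coeff_divX]; rfl
      rw [cf_tmk' _ hl, cf_tmk' _ (by omega), this]
      congr 1; omega
    · exact h l (by omega)
  · intro l hl
    have : ∀ (r : ℕ) (p : 𝓐[X]) (l : ℕ), (Polynomial.divX^[r] p).coeff l = p.coeff (l + r) := by
      intro r
      induction r with
      | zero => simp
      | succ r ih =>
        intro p l
        rw [Function.iterate_succ, Function.comp_apply, ih, Polynomial.coeff_divX]; rfl
    rw [cf_tmk' _ hl, cf_tmk' _ (by omega), this, add_comm]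

theorem exists_div1 {p : TT 𝓐 k} (h : cf p 0 = 0) : ∃ p' : TT 𝓐 k, p = tx 𝓐 k * p' := by
  obtain ⟨p', h', -⟩ := exists_div (r := 1) (p := p) (by
    intro l hl; obtain rfl : l = 0 := by omega
    exact h)
  exact ⟨p', by simpa using h'⟩

/-- Contractions have fixed points. -/
theorem exists_fix (Φ : TT 𝓐 k → TT 𝓐 k)
    (h : ∀ r a b d, a - b = tx 𝓐 k ^ r * d → ∃ d', Φ a - Φ b = tx 𝓐 k ^ (r+1) * d') : ∃ a, Φ a = a := by
  have key : ∀ r, ∃ d, Φ^[r+1] 0 - Φ^[r] 0 = tx 𝓐 k ^ r * d := by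
    intro r
    induction r with
    | zero => exact ⟨Φ 0, by simp⟩
    | succ r ih =>
      obtain ⟨d, hd⟩ := ih
      obtain ⟨d', h1⟩ := h r _ _ _ hd
      refine ⟨d', ?_⟩
      rw [Function.iterate_succ_apply' Φ (r+1), ← h1, Function.iterate_succ_apply' Φ r]
  obtain ⟨d, hd⟩ := key k
  rw [tx_pow_k, zero_mul, sub_eq_zero, Function.iterate_succ_apply'] at hd
  exact ⟨_, hd⟩

/-- Units of the corner ring. -/
theorem exists_inv (hk : 0 < k) {E : 𝓐} (hE : E * E = E) {u : TT 𝓐 k} (h1 : tC k E * u = u)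
    (h2 : u * tC k E = u) (h0 : cf u 0 = E) :
    ∃ v : TT 𝓐 k, tC k E * v = v ∧ v * tC k E = v ∧ u * v = tC k E ∧ v * u = tC k E ∧
      cf v 0 = E := by
  obtain ⟨z, hz⟩ := exists_div1 (p := tC k E - u) (by rw [cf_sub, cf_tC, h0]; simp [hk])
  have hEE : tC k E * tC k E = tC k E := by rw [← map_mul, hE]
  have hnil : IsNilpotent (tx 𝓐 k * z) := ⟨k, by
    rw [Commute.mul_pow (tx_comm z), tx_pow_k, zero_mul]⟩
  obtain ⟨w, hw⟩ := hnil.isUnit_one_sub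
  have hw' : (w : TT 𝓐 k) = u + (1 - tC k E) := by rw [hw, ← hz]; abel
  have c1 : (w : TT 𝓐 k) * tC k E = u := by
    rw [hw', add_mul, sub_mul, one_mul, hEE, h2]; abel
  have c2 : tC k E * (w : TT 𝓐 k) = u := by
    rw [hw', mul_add, mul_sub, mul_one, hEE, h1]; abel
  have c3 : ↑w⁻¹ * tC k E = tC k E * ↑w⁻¹ := by
    have : (↑w⁻¹ : TT 𝓐 k) * (tC k E * w) * ↑w⁻¹ = ↑w⁻¹ * (w * tC k E) * ↑w⁻¹ := by rw [c1, c2]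
    rw [← mul_assoc ↑w⁻¹ (↑w : TT 𝓐 k), Units.inv_mul, one_mul, mul_assoc, mul_assoc, Units.mul_inv, mul_one] at this
    exact this
  have d1 : u * (tC k E * ↑w⁻¹) = tC k E := by
    rw [← mul_assoc, h2, ← c2, mul_assoc, Units.mul_inv, mul_one]
  have d2 : (tC k E * ↑w⁻¹) * u = tC k E := by
    rw [← c3, mul_assoc, h1, ← c1, ← mul_assoc, Units.inv_mul, one_mul]
  refine ⟨tC k E * ↑w⁻¹, ?_, ?_, d1, d2, ?_⟩
  · rw [← mul_assoc, hEE]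
  · rw [mul_assoc, c3, ← mul_assoc, hEE]
  · have := congrArg (fun p => cf p 0) d1
    simp only [cf_mul_zero hk, h0, cf_tC, hk, and_self, if_true] at this
    rw [cf_tC_mul]
    rw [← mul_assoc, hE] at this
    exact this

/-- Rewriting as a sum of monomials. -/
theorem eq_sum (p : TT 𝓐 k) : p = ∑ l ∈ Finset.range k, tC k (cf p l) * tx 𝓐 k ^ l := by
  apply cf_ext
  intro l hl
  rw [cf_sum]
  simp only [cf_C_txp]
  rw [Finset.sum_eq_single l]
  · simp [hl]
  · intro b _ hb
    rw [if_neg]; intro h; exact hb h.1.symm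
  · intro h; exact absurd (Finset.mem_range.mpr hl) h

section pairs
variable [Algebra ℂ 𝓐] (𝓑 : Subalgebra ℂ (𝓐 × 𝓐))

/-- Pairs of truncated polynomials whose first `N` coefficients are in `𝓑`. -/
def InB (N : ℕ) (p p' : TT 𝓐 k) : Prop := ∀ l < N, (cf p l, cf p' l) ∈ 𝓑

variable {𝓑} {N : ℕ} {p p' q q' : TT 𝓐 k}

theorem InB.add (h : InB 𝓑 N p p') (h' : InB 𝓑 N q q') : InB 𝓑 N (p + q) (p' + q') := fun l hl => by
  simpa using 𝓑.add_mem (h l hl) (h' l hl)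

theorem InB.sub (h : InB 𝓑 N p p') (h' : InB 𝓑 N q q') : InB 𝓑 N (p - q) (p' - q') := fun l hl => by
  simpa using 𝓑.sub_mem (h l hl) (h' l hl)

theorem InB.mul (h : InB 𝓑 N p p') (h' : InB 𝓑 N q q') : InB 𝓑 N (p * q) (p' * q') := fun l hl => by
  by_cases hk : l < k
  · rw [cf_mul _ _ hk, cf_mul _ _ hk]
    have : (∑ x ∈ Finset.HasAntidiagonal.antidiagonal l, (cf p x.1, cf p' x.1) * (cf q x.2, cf q' x.2)) ∈ 𝓑 := by
      apply 𝓑.sum_mem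
      intro x hx
      have := Finset.HasAntidiagonal.mem_antidiagonal.mp hx
      exact 𝓑.mul_mem (h _ (by omega)) (h' _ (by omega))
    convert this using 1
    ext <;> simp [Prod.fst_sum, Prod.snd_sum]
  · rw [cf_ge _ (by omega), cf_ge _ (by omega)]; exact 𝓑.zero_mem

theorem InB.C {a a' : 𝓐} (h : (a, a') ∈ 𝓑) : InB 𝓑 N (tC k a) (tC k a') := fun l _ => by
  rw [cf_tC, cf_tC]
  split_ifs
  · exact h
  · exact 𝓑.zero_mem

theorem InB.zero : InB 𝓑 N (0 : TT 𝓐 k) 0 := fun l _ => by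
  rw [cf_zero]; exact 𝓑.zero_mem

theorem InB.one : InB 𝓑 N (1 : TT 𝓐 k) 1 := by
  have := InB.C (k := k) (N := N) 𝓑.one_mem
  simpa using this

theorem InB.sum {ι : Type*} (s : Finset ι) (p p' : ι → TT 𝓐 k)
    (h : ∀ i ∈ s, InB 𝓑 N (p i) (p' i)) : InB 𝓑 N (∑ i ∈ s, p i) (∑ i ∈ s, p' i) := by
  classical
  induction s using Finset.induction_on with
  | empty => simpa using InB.zero
  | insert a s ha ih =>
    rw [Finset.sum_insert ha, Finset.sum_insert ha]
    exact (h a (by simp)).add (ih fun i hi => h i (by simp [hi]))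

theorem InB.txp (r : ℕ) : InB 𝓑 N (tx 𝓐 k ^ r) (tx 𝓐 k ^ r) := fun l _ => by
  have e : cf (tx 𝓐 k ^ r) l = if l = r ∧ l < k then 1 else 0 := by
    have := cf_C_txp (k := k) (1 : 𝓐) r l
    simpa using this
  rw [e]
  split_ifs
  · exact 𝓑.one_mem
  · exact 𝓑.zero_mem

theorem InB.tx_mul (h : InB 𝓑 N p p') : InB 𝓑 (N+1) (tx 𝓐 k * p) (tx 𝓐 k * p') := fun l hl => by
  rw [cf_tx_mul, cf_tx_mul]
  split_ifs
  · exact h _ (by omega)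
  · exact 𝓑.zero_mem

theorem InB.mono {N'} (h : InB 𝓑 N p p') (hN : N' ≤ N) : InB 𝓑 N' p p' := fun l hl => h l (by omega)

end pairs

end trunc

section scalars
variable {𝓐 : Type} [Ring 𝓐] [Algebra ℂ 𝓐] {k : ℕ}

/-- Scalar truncated polynomials. -/
def sc (𝓐 : Type) [Ring 𝓐] [Algebra ℂ 𝓐] (k : ℕ) (p : ℂ[X]) : TT 𝓐 k :=
  tmk k (p.map (algebraMap ℂ 𝓐))

theorem sc_comm (p : ℂ[X]) (a : TT 𝓐 k) : sc 𝓐 k p * a = a * sc 𝓐 k p := by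
  obtain ⟨a, rfl⟩ := tmk_surj a
  rw [sc, ← map_mul, ← map_mul]
  congr 1
  ext l
  rw [Polynomial.coeff_mul, Polynomial.coeff_mul, ← Finset.Nat.sum_antidiagonal_swap]
  refine Finset.sum_congr rfl fun x hx => ?_
  simp only [Polynomial.coeff_map, Prod.fst_swap, Prod.snd_swap]
  rw [Algebra.commutes]

theorem cf_sc (p : ℂ[X]) {l : ℕ} (hl : l < k) : cf (sc 𝓐 k p) l = algebraMap ℂ 𝓐 (p.coeff l) := by
  rw [sc, cf_tmk' _ hl, Polynomial.coeff_map]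

theorem InB.sc {𝓑 : Subalgebra ℂ (𝓐 × 𝓐)} {N : ℕ} (p : ℂ[X]) : InB 𝓑 N (sc 𝓐 k p) (sc 𝓐 k p) := by
  intro l _
  by_cases hk : l < k
  · rw [cf_sc p hk]
    exact 𝓑.algebraMap_mem (p.coeff l)
  · rw [cf_ge _ (by omega)]; exact 𝓑.zero_mem

end scalars


/-! ### Gluing two blocks -/

theorem cf_tx0 {𝓐 : Type} [Ring 𝓐] {k : ℕ} : cf (tx 𝓐 k) 0 = 0 := by
  have := cf_tx_mul (1 : TT 𝓐 k) 0
  simpa using this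

theorem mul_tx_l {𝓐 : Type} [Ring 𝓐] {k : ℕ} (p q : TT 𝓐 k) :
    p * (tx 𝓐 k * q) = tx 𝓐 k * (p * q) := by
  rw [← mul_assoc, ← tx_comm, mul_assoc]

theorem mul_txp_l {𝓐 : Type} [Ring 𝓐] {k : ℕ} (r : ℕ) (p q : TT 𝓐 k) :
    p * (tx 𝓐 k ^ r * q) = tx 𝓐 k ^ r * (p * q) := by
  rw [← mul_assoc, ← txp_comm, mul_assoc]

section glue
variable {𝓐 : Type} [Ring 𝓐] {k : ℕ}

/-- Corner elements. -/
def Crn (a b : 𝓐) (p : TT 𝓐 k) : Prop := tC k a * p = p ∧ p * tC k b = p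

theorem Crn.mulz {a b c d : 𝓐} {p q : TT 𝓐 k} (hp : Crn a b p) (hq : Crn c d q)
    (h : b * c = 0) : p * q = 0 := by
  rw [← hp.2, ← hq.1, mul_assoc, ← mul_assoc (tC k b), ← map_mul, h, map_zero, zero_mul, mul_zero]

theorem Crn.mul {a b c d : 𝓐} {p q : TT 𝓐 k} (hp : Crn a b p) (hq : Crn c d q) : Crn a d (p * q) :=
  ⟨by rw [← mul_assoc, hp.1], by rw [mul_assoc, hq.2]⟩

theorem Crn.add {a b : 𝓐} {p q : TT 𝓐 k} (hp : Crn a b p) (hq : Crn a b q) : Crn a b (p + q) :=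
  ⟨by rw [mul_add, hp.1, hq.1], by rw [add_mul, hp.2, hq.2]⟩

theorem Crn.sub {a b : 𝓐} {p q : TT 𝓐 k} (hp : Crn a b p) (hq : Crn a b q) : Crn a b (p - q) :=
  ⟨by rw [mul_sub, hp.1, hq.1], by rw [sub_mul, hp.2, hq.2]⟩

theorem Crn.zero {a b : 𝓐} : Crn a b (0 : TT 𝓐 k) := ⟨by simp, by simp⟩

theorem Crn.sum {ι : Type*} {a b : 𝓐} (s : Finset ι) (p : ι → TT 𝓐 k)
    (h : ∀ i ∈ s, Crn a b (p i)) : Crn a b (∑ i ∈ s, p i) :=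
  ⟨by rw [Finset.mul_sum]; exact Finset.sum_congr rfl fun i hi => (h i hi).1,
   by rw [Finset.sum_mul]; exact Finset.sum_congr rfl fun i hi => (h i hi).2⟩

theorem Crn.cent_mul {a b : 𝓐} {p s : TT 𝓐 k} (hs : ∀ q, s * q = q * s) (hp : Crn a b p) :
    Crn a b (s * p) :=
  ⟨by rw [← mul_assoc, ← hs, mul_assoc, hp.1], by rw [mul_assoc, hp.2]⟩

theorem Crn.cst {a b c : 𝓐} (h1 : a * c = c) (h2 : c * b = c) : Crn a b (tC k c) :=
  ⟨by rw [← map_mul, h1], by rw [← map_mul, h2]⟩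

theorem Crn.mul_cent {a b : 𝓐} {p s : TT 𝓐 k} (hs : ∀ q, s * q = q * s) (hp : Crn a b p) :
    Crn a b (p * s) := by rw [← hs]; exact hp.cent_mul hs

theorem Crn.coef {a b : 𝓐} {p : TT 𝓐 k} (hp : Crn a b p) (l : ℕ) :
    a * cf p l = cf p l ∧ cf p l * b = cf p l := by
  constructor
  · rw [← cf_tC_mul, hp.1]
  · rw [← cf_mul_tC, hp.2]

theorem Crn.divp {a b : 𝓐} {p : TT 𝓐 k} {r : ℕ} (ha : a * a = a) (hb : b * b = b)
    (h : Crn a b (tx 𝓐 k ^ r * p)) : ∃ q, Crn a b q ∧ tx 𝓐 k ^ r * p = tx 𝓐 k ^ r * q := by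
  refine ⟨tC k a * p * tC k b, ⟨?_, ?_⟩, ?_⟩
  · rw [← mul_assoc, ← mul_assoc, ← map_mul, ha]
  · rw [mul_assoc, ← map_mul, hb]
  · rw [← mul_assoc (tx 𝓐 k ^ r), ← mul_txp_l, h.1, h.2]

theorem Crn.div1 {a b : 𝓐} {p : TT 𝓐 k} (ha : a * a = a) (hb : b * b = b)
    (h : Crn a b (tx 𝓐 k * p)) : ∃ q, Crn a b q ∧ tx 𝓐 k * p = tx 𝓐 k * q := by
  have := Crn.divp (r := 1) (p := p) ha hb (by simpa using h)
  simpa using this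

/-- Conjugates by corner units. -/
def NNc (E : 𝓐) (Bm A : TT 𝓐 k) : Prop :=
  ∃ u v : TT 𝓐 k, Crn E E u ∧ Crn E E v ∧ u * v = tC k E ∧ v * u = tC k E ∧ cf u 0 = E ∧
    A = u * Bm * v

/-- The data for gluing. -/
structure Glue (k K : ℕ) (e1 e2 T2 S : 𝓐) (s : TT 𝓐 k) : Prop where
  hk : K ≤ k
  h2 : 2 ≤ K
  e11 : e1 * e1 = e1
  e22 : e2 * e2 = e2
  e12 : e1 * e2 = 0
  e21 : e2 * e1 = 0
  eT : e2 * T2 = T2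
  Te : T2 * e2 = T2
  eS : e2 * S = S
  Se : S * e2 = S
  TS : T2 * S = e2
  ST : S * T2 = e2
  hs : ∀ p, s * p = p * s

/-- Leading form of the first block. -/
def Form1 (r : ℕ) (e1 : 𝓐) (s A1 : TT 𝓐 k) : Prop :=
  ∃ B1, Crn e1 e1 B1 ∧ A1 = s * tC k e1 + tx 𝓐 k ^ r * (tx 𝓐 k * B1)

/-- Leading form of the second block. -/
def Form2 (r : ℕ) (e2 T2 : 𝓐) (s A2 : TT 𝓐 k) : Prop :=
  ∃ B2, Crn e2 e2 B2 ∧ A2 = s * tC k e2 + tx 𝓐 k ^ r * (tC k T2 + tx 𝓐 k * B2)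

variable {K : ℕ} {e1 e2 T2 S : 𝓐} {s : TT 𝓐 k}

theorem Form1.crn {r : ℕ} {A1 : TT 𝓐 k} (e11 : e1 * e1 = e1) (hs : ∀ p, s * p = p * s)
    (h : Form1 r e1 s A1) : Crn e1 e1 A1 := by
  obtain ⟨B, hB, rfl⟩ := h
  exact (Crn.cent_mul hs (Crn.cst e11 e11)).add
    ((Crn.cent_mul (tx_comm) hB).cent_mul (txp_comm r))

theorem Form2.crn {r : ℕ} {A2 : TT 𝓐 k} (e22 : e2 * e2 = e2) (eT : e2 * T2 = T2)
    (Te : T2 * e2 = T2) (hs : ∀ p, s * p = p * s)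
    (h : Form2 r e2 T2 s A2) : Crn e2 e2 A2 := by
  obtain ⟨B, hB, rfl⟩ := h
  exact (Crn.cent_mul hs (Crn.cst e22 e22)).add
    (((Crn.cst eT Te).add (Crn.cent_mul (tx_comm) hB)).cent_mul (txp_comm r))

theorem form1_conj {r : ℕ} {M A : TT 𝓐 k} (hs : ∀ p, s * p = p * s)
    (hM : Form1 r e1 s M) (h : NNc e1 M A) : Form1 r e1 s A := by
  obtain ⟨B, hB, rfl⟩ := hM
  obtain ⟨u, v, hu, hv, huv, -, -, rfl⟩ := h
  refine ⟨u * B * v, (hu.mul hB).mul hv, ?_⟩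
  rw [mul_add, add_mul, ← mul_assoc u, ← hs, mul_assoc s, hu.2, mul_assoc s, huv]
  congr 1
  rw [← mul_assoc u, ← txp_comm, mul_assoc (tx 𝓐 k ^ r) u, ← mul_assoc u, ← tx_comm]
  simp only [mul_assoc]

theorem form2_conj {r : ℕ} {M A : TT 𝓐 k} (hk : 0 < k) (e22 : e2 * e2 = e2) (eT : e2 * T2 = T2)
    (Te : T2 * e2 = T2) (hs : ∀ p, s * p = p * s)
    (hM : Form2 r e2 T2 s M) (h : NNc e2 M A) : Form2 r e2 T2 s A := by
  obtain ⟨B, hB, rfl⟩ := hM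
  obtain ⟨u, v, hu, hv, huv, hvu, hu0, rfl⟩ := h
  have hv0 : cf v 0 = e2 := by
    have := congrArg (fun p => cf p 0) huv
    simp only [cf_mul_zero hk, hu0, cf_tC, hk, and_self, if_true] at this
    rw [(hv.coef 0).1] at this; exact this
  have key : cf (u * (tC k T2 + tx 𝓐 k * B) * v - tC k T2) 0 = 0 := by
    simp only [cf_mul_zero hk, cf_add, cf_sub, hu0, hv0, cf_tC, cf_tx0]
    simp [hk, eT, Te]
  obtain ⟨B', hB'⟩ := exists_div1 key
  have hc : Crn e2 e2 (u * (tC k T2 + tx 𝓐 k * B) * v - tC k T2) :=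
    ((hu.mul ((Crn.cst eT Te).add (Crn.cent_mul (tx_comm) hB))).mul hv).sub (Crn.cst eT Te)
  rw [hB'] at hc
  obtain ⟨B'', hB'', h3⟩ := hc.div1 e22 e22
  refine ⟨B'', hB'', ?_⟩
  rw [mul_add, add_mul, ← mul_assoc u, ← hs, mul_assoc s, hu.2, mul_assoc s, huv, mul_txp_l,
    mul_assoc (tx 𝓐 k ^ r)]
  congr 2
  rw [← h3, ← hB']; abel

/-- Solving the linear equation. -/
theorem glue_solve (G : Glue k K e1 e2 T2 S s) {A1 A2 Y' : TT 𝓐 k} (h1 : Form1 (k-K) e1 s A1)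
    (h2 : Form2 (k-K) e2 T2 s A2) (hY : Crn e1 e2 Y') :
    ∃ X, Crn e1 e2 X ∧ cf X 0 = 0 ∧ X * A2 - A1 * X = tx 𝓐 k ^ (k-K) * (tx 𝓐 k * Y') := by
  obtain ⟨B1, hB1, rfl⟩ := h1
  obtain ⟨B2, hB2, rfl⟩ := h2
  obtain ⟨X, hX⟩ := exists_fix (fun X => tx 𝓐 k * (tC k e1 * (Y' - X * B2 + B1 * X) * tC k S)) (by
    intro r a b d h
    refine ⟨tC k e1 * (B1 * d - d * B2) * tC k S, ?_⟩
    obtain rfl : a = b + tx 𝓐 k ^ r * d := by rw [← h]; abel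
    rw [pow_succ', mul_assoc (tx 𝓐 k) (tx 𝓐 k ^ r), ← mul_sub]
    refine congrArg (fun z => tx 𝓐 k * z) ?_
    simp only [mul_add, add_mul, mul_sub, sub_mul, mul_assoc, mul_txp_l]
    abel)
  have hc : Crn e1 e2 X := by
    rw [← hX]
    refine Crn.cent_mul tx_comm ⟨?_, ?_⟩
    · simp only [← mul_assoc]; rw [← map_mul, G.e11]
    · simp only [mul_assoc]; rw [← map_mul, G.Se]
  refine ⟨X, hc, ?_, ?_⟩
  · rw [← hX, cf_tx_mul]; simp
  · have h1 : X * tC k T2 = tx 𝓐 k * (Y' - X * B2 + B1 * X) := by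
      have hi : Crn e1 e2 (Y' - X * B2 + B1 * X) :=
        (hY.sub (hc.mul hB2)).add (hB1.mul hc)
      conv_lhs => rw [← hX]
      rw [hi.1, mul_assoc, mul_assoc, ← map_mul, G.ST, hi.2]
    have e1' : X * (s * tC k e2) = s * X := by rw [← mul_assoc, ← G.hs, mul_assoc, hc.2]
    have e2' : s * tC k e1 * X = s * X := by rw [mul_assoc, hc.1]
    rw [mul_add, add_mul, e1', e2', mul_txp_l, mul_add, h1]
    simp only [mul_add, mul_sub, mul_assoc, mul_tx_l]
    abel

/-- Block upper triangular elements are conjugate to block diagonal ones. -/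
theorem glue_conj (G : Glue k K e1 e2 T2 S s) {A1 A2 Y' W M1 M2 : TT 𝓐 k}
    (h1 : Form1 (k-K) e1 s A1) (h2 : Form2 (k-K) e2 T2 s A2) (hY : Crn e1 e2 Y')
    (hW : Crn e2 e1 W) (hW0 : cf W 0 = 0) (hM1 : Crn e1 e1 M1) (hM2 : Crn e2 e2 M2)
    (n1 : NNc e1 M1 A1) (n2 : NNc e2 M2 A2) :
    NNc (e1 + e2) (M1 + M2)
      ((1 + W) * (A1 + A2 + tx 𝓐 k ^ (k-K) * (tx 𝓐 k * Y')) * (1 - W)) := by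
  have hk : 0 < k := by have := G.hk; have := G.h2; omega
  obtain ⟨X, hX, hX0, hXe⟩ := glue_solve G h1 h2 hY
  have cA1 := h1.crn G.e11 G.hs
  have cA2 := h2.crn G.e22 G.eT G.Te G.hs
  obtain ⟨u1, v1, hu1, hv1, huv1, hvu1, h01, rfl⟩ := n1
  obtain ⟨u2, v2, hu2, hv2, huv2, hvu2, h02, rfl⟩ := n2
  rw [← hXe]
  have XX : X * X = 0 := hX.mulz hX G.e21
  have WW : W * W = 0 := hW.mulz hW G.e12
  have a1 := hu1.mulz hv2 G.e12
  have a2 := hu2.mulz hv1 G.e21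
  have a3 := hv1.mulz hu2 G.e12
  have a4 := hv2.mulz hu1 G.e21
  have m1 := hu1.mulz hM2 G.e12
  have m2 := hu2.mulz hM1 G.e21
  have m3 := (hu1.mul hM1).mulz hv2 G.e12
  have m4 := (hu2.mul hM2).mulz hv1 G.e21
  have x1 : X * (u1 * M1 * v1) = 0 := hX.mulz cA1 G.e21
  have x2 : (u2 * M2 * v2) * X = 0 := cA2.mulz hX G.e21
  have EX : tC k (e1 + e2) * X = X := by
    rw [map_add, add_mul, hX.1, (Crn.cst G.e22 G.e22).mulz hX G.e21, add_zero]
  have XE : X * tC k (e1 + e2) = X := by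
    rw [map_add, mul_add, hX.2, hX.mulz (Crn.cst G.e11 G.e11) G.e21, zero_add]
  have EW : tC k (e1 + e2) * W = W := by
    rw [map_add, add_mul, hW.1, (Crn.cst G.e11 G.e11).mulz hW G.e12, zero_add]
  have WE : W * tC k (e1 + e2) = W := by
    rw [map_add, mul_add, hW.2, hW.mulz (Crn.cst G.e22 G.e22) G.e12, add_zero]
  have Eu : tC k (e1 + e2) * (u1 + u2) = u1 + u2 := by
    rw [map_add, add_mul, mul_add, mul_add, hu1.1, hu2.1, (Crn.cst G.e11 G.e11).mulz hu2 G.e12,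
      (Crn.cst G.e22 G.e22).mulz hu1 G.e21]; abel
  have uE : (u1 + u2) * tC k (e1 + e2) = u1 + u2 := by
    rw [map_add, add_mul, mul_add, mul_add, hu1.2, hu2.2, hu1.mulz (Crn.cst G.e22 G.e22) G.e12,
      hu2.mulz (Crn.cst G.e11 G.e11) G.e21]; abel
  have Ev : tC k (e1 + e2) * (v1 + v2) = v1 + v2 := by
    rw [map_add, add_mul, mul_add, mul_add, hv1.1, hv2.1, (Crn.cst G.e11 G.e11).mulz hv2 G.e12,
      (Crn.cst G.e22 G.e22).mulz hv1 G.e21]; abel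
  have vE : (v1 + v2) * tC k (e1 + e2) = v1 + v2 := by
    rw [map_add, add_mul, mul_add, mul_add, hv1.2, hv2.2, hv1.mulz (Crn.cst G.e22 G.e22) G.e12,
      hv2.mulz (Crn.cst G.e11 G.e11) G.e21]; abel
  have X1 : (1 + X) * (1 - X) = 1 := by
    rw [add_mul, mul_sub, mul_sub, XX]; simp
  have X2 : (1 - X) * (1 + X) = 1 := by
    rw [sub_mul, mul_add, mul_add, XX]; simp
  have W1 : (1 + W) * (1 - W) = 1 := by
    rw [add_mul, mul_sub, mul_sub, WW]; simp
  have W2 : (1 - W) * (1 + W) = 1 := by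
    rw [sub_mul, mul_add, mul_add, WW]; simp
  have uv : (u1 + u2) * (v1 + v2) = tC k (e1 + e2) := by
    rw [add_mul, mul_add, mul_add, huv1, huv2, a1, a2, map_add]; abel
  have vu : (v1 + v2) * (u1 + u2) = tC k (e1 + e2) := by
    rw [add_mul, mul_add, mul_add, hvu1, hvu2, a3, a4, map_add]; abel
  have cX : tC k (e1 + e2) * (1 + X) = (1 + X) * tC k (e1 + e2) := by
    rw [mul_add, add_mul, EX, XE]; simp
  have cW : tC k (e1 + e2) * (1 + W) = (1 + W) * tC k (e1 + e2) := by
    rw [mul_add, add_mul, EW, WE]; simp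
  have cX' : tC k (e1 + e2) * (1 - X) = (1 - X) * tC k (e1 + e2) := by
    rw [mul_sub, sub_mul, EX, XE]; simp
  have cW' : tC k (e1 + e2) * (1 - W) = (1 - W) * tC k (e1 + e2) := by
    rw [mul_sub, sub_mul, EW, WE]; simp
  refine ⟨(1 + W) * (1 + X) * (u1 + u2), (v1 + v2) * (1 - X) * (1 - W), ⟨?_, ?_⟩, ⟨?_, ?_⟩, ?_, ?_,
    ?_, ?_⟩
  · rw [← mul_assoc, ← mul_assoc, cW, mul_assoc (1 + W), cX, ← mul_assoc, mul_assoc _ _ (u1 + u2), Eu]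
  · rw [mul_assoc, uE]
  · rw [← mul_assoc, ← mul_assoc, Ev]
  · rw [mul_assoc, ← cW', ← mul_assoc, mul_assoc (v1 + v2), ← cX', ← mul_assoc, vE]
  · calc (1 + W) * (1 + X) * (u1 + u2) * ((v1 + v2) * (1 - X) * (1 - W))
        = (1 + W) * (1 + X) * ((u1 + u2) * (v1 + v2)) * (1 - X) * (1 - W) := by
          simp only [mul_assoc]
      _ = (1 + W) * ((1 + X) * (1 - X)) * (1 - W) * tC k (e1 + e2) := by
          rw [uv, mul_assoc _ (tC k (e1 + e2)), cX', mul_assoc, mul_assoc, mul_assoc _ _ (1 - W), cW']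
          simp only [mul_assoc]
      _ = tC k (e1 + e2) := by rw [X1, mul_one, W1, one_mul]
  · calc (v1 + v2) * (1 - X) * (1 - W) * ((1 + W) * (1 + X) * (u1 + u2))
        = (v1 + v2) * (1 - X) * ((1 - W) * (1 + W)) * (1 + X) * (u1 + u2) := by
          simp only [mul_assoc]
      _ = (v1 + v2) * ((1 - X) * (1 + X)) * (u1 + u2) := by
          rw [W2, mul_one]; simp only [mul_assoc]
      _ = tC k (e1 + e2) := by rw [X2, mul_one, vu]
  · simp only [cf_mul_zero hk, cf_add, hW0, hX0, h01, h02, cf_one, hk]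
    simp
  · have uMv : (u1 + u2) * (M1 + M2) * (v1 + v2) = u1 * M1 * v1 + u2 * M2 * v2 := by
      have : (u1 + u2) * (M1 + M2) = u1 * M1 + u2 * M2 := by
        simp only [add_mul, mul_add, m1, m2, add_zero, zero_add]
      rw [this]
      simp only [add_zero, zero_add, add_mul, mul_add, m3, m4]
    have : (1 + X) * (u1 * M1 * v1 + u2 * M2 * v2) * (1 - X) = u1 * M1 * v1 + u2 * M2 * v2
        + (X * (u2 * M2 * v2) - u1 * M1 * v1 * X) := by
      have x3 : X * (u2 * M2 * v2) * X = 0 := by rw [mul_assoc, x2, mul_zero]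
      simp only [add_mul, mul_add, mul_sub, one_mul, mul_one, x1, x2, x3, zero_mul]
      abel
    rw [← this, ← uMv]
    simp only [mul_assoc]

end glue


section glueC
variable {𝓐 : Type} [Ring 𝓐] {k : ℕ}

/-- Element with given coefficients. -/
def mkc (k : ℕ) (a : ℕ → 𝓐) : TT 𝓐 k := ∑ l ∈ Finset.range k, tC k (a l) * tx 𝓐 k ^ l

theorem cf_mkc (a : ℕ → 𝓐) {l : ℕ} (hl : l < k) : cf (mkc k a) l = a l := by
  rw [mkc, cf_sum]
  simp only [cf_C_txp]
  rw [Finset.sum_eq_single l]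
  · simp [hl]
  · intro b _ hb; rw [if_neg (by rintro ⟨h, _⟩; exact hb h.symm)]
  · intro h; exact absurd (Finset.mem_range.2 hl) h

theorem Crn.of_cf {a b : 𝓐} {p : TT 𝓐 k} (h : ∀ l < k, a * cf p l = cf p l ∧ cf p l * b = cf p l) :
    Crn a b p :=
  ⟨cf_ext fun l hl => by rw [cf_tC_mul, (h l hl).1], cf_ext fun l hl => by rw [cf_mul_tC, (h l hl).2]⟩

theorem Crn.mkc {a b : 𝓐} {c : ℕ → 𝓐} (h : ∀ l < k, a * c l = c l ∧ c l * b = c l) :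
    Crn a b (mkc k c) := Crn.of_cf fun l hl => by rw [cf_mkc _ hl]; exact h l hl

/-- The glued element. -/
def gl (W A1 A2 Y : TT 𝓐 k) : TT 𝓐 k := (1 + W) * (A1 + A2 + Y) * (1 - W)

/-- Congruence of the first coefficients. -/
def Md (N : ℕ) (p q : TT 𝓐 k) : Prop := ∀ l < N, cf p l = cf q l

theorem Md.refl (N : ℕ) (p : TT 𝓐 k) : Md N p p := fun _ _ => rfl
theorem Md.add {N : ℕ} {p q p' q' : TT 𝓐 k} (h : Md N p p') (h' : Md N q q') : Md N (p + q) (p' + q') :=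
  fun l hl => by rw [cf_add, cf_add, h l hl, h' l hl]
theorem Md.sub {N : ℕ} {p q p' q' : TT 𝓐 k} (h : Md N p p') (h' : Md N q q') : Md N (p - q) (p' - q') :=
  fun l hl => by rw [cf_sub, cf_sub, h l hl, h' l hl]
theorem Md.mul {N : ℕ} {p q p' q' : TT 𝓐 k} (h : Md N p p') (h' : Md N q q') : Md N (p * q) (p' * q') :=
  fun l hl => by
    by_cases hk : l < k
    · rw [cf_mul _ _ hk, cf_mul _ _ hk]
      refine Finset.sum_congr rfl fun x hx => ?_
      have := Finset.HasAntidiagonal.mem_antidiagonal.1 hx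
      rw [h _ (by omega), h' _ (by omega)]
    · rw [cf_ge _ (by omega), cf_ge _ (by omega)]
theorem Md.tx {N : ℕ} {p p' : TT 𝓐 k} (h : Md N p p') : Md (N+1) (tx 𝓐 k * p) (tx 𝓐 k * p') :=
  fun l hl => by
    rw [cf_tx_mul, cf_tx_mul]
    split_ifs
    · exact h _ (by omega)
    · rfl
theorem Md.eqp {N r : ℕ} {p p' : TT 𝓐 k} (h : Md N p p') (hr : k ≤ r + N) :
    DS.tx 𝓐 k ^ r * p = DS.tx 𝓐 k ^ r * p' := cf_ext fun l hl => by
  rw [cf_txp_mul, cf_txp_mul]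
  split_ifs
  · exact h _ (by omega)
  · rfl

variable {K : ℕ} {e1 e2 T2 S : 𝓐} {s : TT 𝓐 k}

theorem gl_expand (e12 : e1 * e2 = 0) (e21 : e2 * e1 = 0) {W A1 A2 Y : TT 𝓐 k} (hW : Crn e2 e1 W)
    (h1 : Crn e1 e1 A1) (h2 : Crn e2 e2 A2) (hY : Crn e1 e2 Y) :
    gl W A1 A2 Y = (A1 - Y * W) + Y + (W * A1 - A2 * W - W * Y * W) + (A2 + W * Y) := by
  have a1 := hW.mulz h2 e12
  have a2 := h1.mulz hW e12
  have a3 : W * A1 * W = 0 := by rw [mul_assoc, a2, mul_zero]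
  simp only [gl, add_mul, mul_add, mul_sub, one_mul, mul_one, a1, a2, a3, zero_mul]
  abel

theorem four11 (e12 : e1 * e2 = 0) (e21 : e2 * e1 = 0) (e11 : e1 * e1 = e1)
    {p q r t : TT 𝓐 k} (hp : Crn e1 e1 p)
    (hq : Crn e1 e2 q) (hr : Crn e2 e1 r) (ht : Crn e2 e2 t) :
    tC k e1 * (p + q + r + t) * tC k e1 = p := by
  have c := Crn.cst (k := k) e11 e11
  simp only [mul_add, add_mul, hp.1, hp.2, hq.1, hq.mulz c e21, c.mulz hr e12, c.mulz ht e12, zero_mul,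
    add_zero]

theorem four12 (e12 : e1 * e2 = 0) (e11 : e1 * e1 = e1) (e22 : e2 * e2 = e2)
    {p q r t : TT 𝓐 k} (hp : Crn e1 e1 p)
    (hq : Crn e1 e2 q) (hr : Crn e2 e1 r) (ht : Crn e2 e2 t) :
    tC k e1 * (p + q + r + t) * tC k e2 = q := by
  have c := Crn.cst (k := k) e11 e11
  have c2 := Crn.cst (k := k) e22 e22
  simp only [mul_add, add_mul, hp.1, hq.1, hq.2, hp.mulz c2 e12, c.mulz hr e12, c.mulz ht e12, zero_mul,
    add_zero, zero_add]

theorem four21 (e12 : e1 * e2 = 0) (e21 : e2 * e1 = 0) (e11 : e1 * e1 = e1) (e22 : e2 * e2 = e2)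
    {p q r t : TT 𝓐 k} (hp : Crn e1 e1 p)
    (hq : Crn e1 e2 q) (hr : Crn e2 e1 r) (ht : Crn e2 e2 t) :
    tC k e2 * (p + q + r + t) * tC k e1 = r := by
  have : p + q + r + t = t + r + q + p := by abel
  rw [this]; exact four12 e21 e22 e11 ht hr hq hp

theorem four22 (e12 : e1 * e2 = 0) (e21 : e2 * e1 = 0) (e22 : e2 * e2 = e2)
    {p q r t : TT 𝓐 k} (hp : Crn e1 e1 p)
    (hq : Crn e1 e2 q) (hr : Crn e2 e1 r) (ht : Crn e2 e2 t) :
    tC k e2 * (p + q + r + t) * tC k e2 = t := by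
  have : p + q + r + t = t + r + q + p := by abel
  rw [this]; exact four11 e21 e12 e22 ht hr hq hp

theorem Crn.tx {a b : 𝓐} {p : TT 𝓐 k} (h : Crn a b p) : Crn a b (tx 𝓐 k * p) := h.cent_mul tx_comm
theorem Crn.txp {a b : 𝓐} {p : TT 𝓐 k} (r : ℕ) (h : Crn a b p) : Crn a b (DS.tx 𝓐 k ^ r * p) :=
  h.cent_mul (txp_comm r)

/-- Two-sum formula for the top coefficient of `Y * W`. -/
theorem cf_YW {W Y : TT 𝓐 k} (h2 : 2 ≤ K) (hk : K ≤ k) (hW : cf W 0 = 0) (hY : ∀ l ≤ k - K, cf Y l = 0) :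
    cf (Y * W) (k-1) = ∑ t ∈ Finset.range (K-2), cf Y (k-2-t) * cf W (t+1) := by
  rw [cf_mul _ _ (by omega), ← Finset.Nat.sum_antidiagonal_swap,
    Finset.Nat.sum_antidiagonal_eq_sum_range_succ_mk, show (k-1).succ = (k-1) + 1 by omega,
    Finset.sum_range_succ']
  simp only [Prod.fst_swap, Prod.snd_swap, hW, mul_zero, add_zero]
  symm
  refine Finset.sum_subset_zero_on_sdiff (by intro t ht; simp at *; omega) ?_ ?_
  · intro t ht
    simp at ht
    rw [hY _ (by omega), zero_mul]
  · intro t ht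
    rw [show k - 1 - (t+1) = k-2-t by omega]

theorem cf_WY {W Y : TT 𝓐 k} (h2 : 2 ≤ K) (hk : K ≤ k) (hW : cf W 0 = 0) (hY : ∀ l ≤ k - K, cf Y l = 0) :
    cf (W * Y) (k-1) = ∑ t ∈ Finset.range (K-2), cf W (t+1) * cf Y (k-2-t) := by
  rw [cf_mul _ _ (by omega), 
    Finset.Nat.sum_antidiagonal_eq_sum_range_succ_mk, show (k-1).succ = (k-1) + 1 by omega,
    Finset.sum_range_succ']
  simp only [hW, zero_mul, add_zero]
  symm
  refine Finset.sum_subset_zero_on_sdiff (by intro t ht; simp at *; omega) ?_ ?_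
  · intro t ht
    simp at ht
    rw [hY _ (by omega), mul_zero]
  · intro t ht
    rw [show k - 1 - (t+1) = k-2-t by omega]

theorem cf_xx {r : ℕ} (Y' : TT 𝓐 k) {l : ℕ} (hl : l ≤ r) : cf (tx 𝓐 k ^ r * (tx 𝓐 k * Y')) l = 0 := by
  rw [cf_txp_mul]
  split_ifs with h
  · rw [cf_tx_mul, if_neg (by omega)]
  · rfl

theorem WA_form (G : Glue k K e1 e2 T2 S s) {W A1 A2 B1 B2 : TT 𝓐 k}
    (hW : Crn e2 e1 W) (h1 : A1 = s * tC k e1 + tx 𝓐 k ^ (k-K) * (tx 𝓐 k * B1))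
    (h2 : A2 = s * tC k e2 + tx 𝓐 k ^ (k-K) * (tC k T2 + tx 𝓐 k * B2)) :
    W * A1 - A2 * W = tx 𝓐 k ^ (k-K) * (tx 𝓐 k * (W * B1 - B2 * W) - tC k T2 * W) := by
  subst h1 h2
  have e1' : W * (s * tC k e1) = s * W := by rw [← mul_assoc, ← G.hs, mul_assoc, hW.2]
  have e2' : s * tC k e2 * W = s * W := by rw [mul_assoc, hW.1]
  rw [mul_add, add_mul, e1', e2', mul_txp_l, mul_tx_l]
  simp only [mul_add, add_mul, mul_sub, mul_assoc]
  abel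

theorem gl21_form (G : Glue k K e1 e2 T2 S s) {W A1 A2 B1 B2 Y' : TT 𝓐 k}
    (hW : Crn e2 e1 W) (h1 : A1 = s * tC k e1 + tx 𝓐 k ^ (k-K) * (tx 𝓐 k * B1))
    (h2 : A2 = s * tC k e2 + tx 𝓐 k ^ (k-K) * (tC k T2 + tx 𝓐 k * B2)) :
    W * A1 - A2 * W - W * (tx 𝓐 k ^ (k-K) * (tx 𝓐 k * Y')) * W =
      tx 𝓐 k ^ (k-K) * (tx 𝓐 k * (W * B1 - B2 * W - W * Y' * W) - tC k T2 * W) := by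
  rw [WA_form G hW h1 h2, mul_txp_l, mul_tx_l]
  simp only [mul_sub, mul_assoc]
  abel

/-- Dependence on `W` only modulo `x^K`. -/
theorem gl_congr (G : Glue k K e1 e2 T2 S s) {W W' A1 A2 Y' : TT 𝓐 k}
    (hW : Crn e2 e1 W) (hW' : Crn e2 e1 W') (h1 : Form1 (k-K) e1 s A1)
    (h2 : Form2 (k-K) e2 T2 s A2) (hY : Crn e1 e2 Y') (h : ∀ l < K, cf W l = cf W' l) :
    gl W A1 A2 (tx 𝓐 k ^ (k-K) * (tx 𝓐 k * Y')) = gl W' A1 A2 (tx 𝓐 k ^ (k-K) * (tx 𝓐 k * Y')) := by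
  have c1 := h1.crn G.e11 G.hs
  have c2 := h2.crn G.e22 G.eT G.Te G.hs
  obtain ⟨B1, hB1, h1⟩ := h1
  obtain ⟨B2, hB2, h2⟩ := h2
  have hYc : Crn e1 e2 (tx 𝓐 k ^ (k-K) * (tx 𝓐 k * Y')) := (hY.tx).txp _
  rw [gl_expand G.e12 G.e21 hW c1 c2 hYc, gl_expand G.e12 G.e21 hW' c1 c2 hYc,
    gl21_form G hW h1 h2, gl21_form G hW' h1 h2]
  have hM : Md K W W' := h
  have hx : Md K (tx 𝓐 k) (tx 𝓐 k) := Md.refl _ _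
  have hR := fun p : TT 𝓐 k => Md.refl K p
  have i1 := ((hx.mul (((hM.mul (hR B1)).sub ((hR B2).mul hM)).sub ((hM.mul (hR Y')).mul hM))).sub
    ((hR (tC k T2)).mul hM)).eqp (r := k - K) (by omega)
  have i2 := (hx.mul (hM.mul (hR Y'))).eqp (r := k - K) (by omega)
  have i3 := (hx.mul ((hR Y').mul hM)).eqp (r := k - K) (by omega)
  have j1 : ∀ V : TT 𝓐 k, V * (tx 𝓐 k ^ (k-K) * (tx 𝓐 k * Y')) = tx 𝓐 k ^ (k-K) * (tx 𝓐 k * (V * Y')) :=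
    fun V => by rw [mul_txp_l, mul_tx_l]
  have j2 : ∀ V : TT 𝓐 k, (tx 𝓐 k ^ (k-K) * (tx 𝓐 k * Y')) * V = tx 𝓐 k ^ (k-K) * (tx 𝓐 k * (Y' * V)) :=
    fun V => by simp only [mul_assoc]
  rw [i1, j1, j1, j2, j2, i2, i3]

variable (K e1 e2 S)

/-- Lower part of `W`. -/
def gWp (k : ℕ) (w : ℕ → 𝓐) : TT 𝓐 k :=
  mkc k (fun l => if l = 0 then 0 else if l < K - 1 then w (l-1) else 0)
/-- The upper block. -/
def gY (k : ℕ) (y : ℕ → 𝓐) (z : 𝓐) : TT 𝓐 k :=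
  mkc k (fun l => if l = k - 1 then z else if k - K < l then y (k-2-l) else 0)
/-- The lower block. -/
def gW (A1 A2 : TT 𝓐 k) (w y : ℕ → 𝓐) (Z : 𝓐) : TT 𝓐 k :=
  gWp K k w + tC k (S * (cf (gWp K k w * A1 - A2 * gWp K k w
    - gWp K k w * gY K k y (e1 * Z * e2) * gWp K k w) (k-1) - e2 * Z * e1)) * tx 𝓐 k ^ (K-1)
/-- The glued element from data. -/
def gF (A1 A2 : TT 𝓐 k) (w y : ℕ → 𝓐) (Z : 𝓐) : TT 𝓐 k :=
  gl (gW K e1 e2 S A1 A2 w y Z) A1 A2 (gY K k y (e1 * Z * e2))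

variable {K e1 e2 S}

theorem gY_form (G : Glue k K e1 e2 T2 S s) {y : ℕ → 𝓐} {z : 𝓐} (hz : e1 * z = z ∧ z * e2 = z)
    (hy : ∀ t < K - 2, e1 * y t = y t ∧ y t * e2 = y t) :
    ∃ Y', Crn e1 e2 Y' ∧ gY K k y z = tx 𝓐 k ^ (k-K) * (tx 𝓐 k * Y') := by
  have hk := G.hk
  have h2 := G.h2
  have hc : Crn e1 e2 (gY K k y z) := by
    apply Crn.mkc
    intro l hl
    split_ifs with h h'
    · exact hz
    · exact hy _ (by omega)
    · simp
  obtain ⟨p, hp, -⟩ := exists_div (r := k - K + 1) (p := gY K k y z) (fun l hl => by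
    rw [gY, cf_mkc _ (by omega), if_neg (by omega), if_neg (by omega)])
  rw [hp] at hc ⊢
  obtain ⟨q, hq, h3⟩ := hc.divp G.e11 G.e22
  exact ⟨q, hq, by rw [h3, pow_succ, mul_assoc]⟩

theorem gWp_crn {w : ℕ → 𝓐}
    (hw : ∀ t < K - 2, e2 * w t = w t ∧ w t * e1 = w t) : Crn e2 e1 (gWp K k w) := by
  apply Crn.mkc
  intro l hl
  split_ifs with h h'
  · simp
  · exact hw _ (by omega)
  · simp

theorem gWp_zero (hk : 0 < k) (w : ℕ → 𝓐) : cf (gWp K k w) 0 = 0 := by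
  rw [gWp, cf_mkc _ hk]; simp

theorem gW_crn (G : Glue k K e1 e2 T2 S s) {A1 A2 : TT 𝓐 k} {w y : ℕ → 𝓐} {Z : 𝓐}
    (h1 : Form1 (k-K) e1 s A1)
    (h2 : Form2 (k-K) e2 T2 s A2)
    (hw : ∀ t < K - 2, e2 * w t = w t ∧ w t * e1 = w t)
    (hy : ∀ t < K - 2, e1 * y t = y t ∧ y t * e2 = y t) : Crn e2 e1 (gW K e1 e2 S A1 A2 w y Z) := by
  have c1 := h1.crn G.e11 G.hs
  have c2 := h2.crn G.e22 G.eT G.Te G.hs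
  obtain ⟨Y', hY', hY⟩ := gY_form G (z := e1 * Z * e2) ⟨by rw [← mul_assoc, ← mul_assoc, G.e11],
    by rw [mul_assoc, G.e22]⟩ hy
  have cY : Crn e1 e2 (gY K k y (e1 * Z * e2)) := by rw [hY]; exact (hY'.tx).txp _
  have cW := gWp_crn (k := k) hw
  refine cW.add (Crn.mul_cent (fun q => txp_comm _ q) (Crn.cst ?_ ?_))
  · rw [← mul_assoc, G.eS]
  · have := (((cW.mul c1).sub (c2.mul cW)).sub ((cW.mul cY).mul cW)).coef (k-1)
    rw [mul_assoc, sub_mul, this.2, mul_assoc _ e1, G.e11]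

theorem gW_zero (hk : 0 < k) (hK : 2 ≤ K) {A1 A2 : TT 𝓐 k} {w y : ℕ → 𝓐} {Z : 𝓐} :
    cf (gW K e1 e2 S A1 A2 w y Z) 0 = 0 := by
  rw [gW, cf_add, gWp_zero hk, cf_C_txp, if_neg (by omega), add_zero]

theorem gW_cf (hk : K ≤ k) {A1 A2 : TT 𝓐 k} {w y : ℕ → 𝓐} {Z : 𝓐} {t : ℕ}
    (ht : t < K - 2) :
    cf (gW K e1 e2 S A1 A2 w y Z) (t+1) = w t := by
  rw [gW, cf_add, cf_C_txp, if_neg (by omega), add_zero, gWp, cf_mkc _ (by omega), if_neg (by omega),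
    if_pos (by omega)]; simp

theorem gY_cf (hk : K ≤ k) {y : ℕ → 𝓐} {z : 𝓐} {t : ℕ} (ht : t < K - 2) :
    cf (gY K k y z) (k-2-t) = y t := by
  rw [gY, cf_mkc _ (by omega), if_neg (by omega), if_pos (by omega)]; congr 1; omega

theorem gY_top (hk : 0 < k) {y : ℕ → 𝓐} {z : 𝓐} : cf (gY K k y z) (k-1) = z := by
  rw [gY, cf_mkc _ (by omega), if_pos rfl]

/-- Changing the last relevant coefficient of `W`. -/
theorem top21 (G : Glue k K e1 e2 T2 S s) {W W' A1 A2 Y' : TT 𝓐 k}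
    (hW : Crn e2 e1 W) (hW' : Crn e2 e1 W') (h1 : Form1 (k-K) e1 s A1)
    (h2 : Form2 (k-K) e2 T2 s A2) (h : ∀ l < K - 1, cf W l = cf W' l) :
    cf (W * A1 - A2 * W - W * (tx 𝓐 k ^ (k-K) * (tx 𝓐 k * Y')) * W) (k-1) =
    cf (W' * A1 - A2 * W' - W' * (tx 𝓐 k ^ (k-K) * (tx 𝓐 k * Y')) * W') (k-1)
      - T2 * (cf W (K-1) - cf W' (K-1)) := by
  have hk := G.hk
  have hK := G.h2
  obtain ⟨B1, hB1, h1⟩ := h1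
  obtain ⟨B2, hB2, h2⟩ := h2
  rw [gl21_form G hW h1 h2, gl21_form G hW' h1 h2]
  have hM : Md (K-1) W W' := h
  have hR := fun p : TT 𝓐 k => Md.refl (K-1) p
  have i1 := (((hM.mul (hR B1)).sub ((hR B2).mul hM)).sub ((hM.mul (hR Y')).mul hM)).tx (K-1) (by omega)
  rw [cf_txp_mul, cf_txp_mul, if_pos (by omega), show k - 1 - (k - K) = K - 1 by omega, if_pos (by omega),
    cf_sub, i1, cf_sub, cf_tC_mul, cf_tC_mul, mul_sub T2]
  abel

theorem gF_blocks (G : Glue k K e1 e2 T2 S s) {A1 A2 W Y : TT 𝓐 k}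
    (c1 : Crn e1 e1 A1) (c2 : Crn e2 e2 A2) (cW : Crn e2 e1 W) (cY : Crn e1 e2 Y) :
    tC k e1 * gl W A1 A2 Y * tC k e1 = A1 - Y * W ∧
    tC k e1 * gl W A1 A2 Y * tC k e2 = Y ∧
    tC k e2 * gl W A1 A2 Y * tC k e1 = W * A1 - A2 * W - W * Y * W ∧
    tC k e2 * gl W A1 A2 Y * tC k e2 = A2 + W * Y ∧
    gl W A1 A2 Y = (A1 - Y * W) + Y + (W * A1 - A2 * W - W * Y * W) + (A2 + W * Y) := by
  have e := gl_expand G.e12 G.e21 cW c1 c2 cY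
  have k1 := c1.sub (cY.mul cW)
  have k2 := ((cW.mul c1).sub (c2.mul cW)).sub ((cW.mul cY).mul cW)
  have k3 := c2.add (cW.mul cY)
  rw [e]
  exact ⟨four11 G.e12 G.e21 G.e11 k1 cY k2 k3, four12 G.e12 G.e11 G.e22 k1 cY k2 k3,
    four21 G.e12 G.e21 G.e11 G.e22 k1 cY k2 k3, four22 G.e12 G.e21 G.e22 k1 cY k2 k3, rfl⟩

/-- Packaged facts on the data. -/
theorem gF_data (G : Glue k K e1 e2 T2 S s) {A1 A2 : TT 𝓐 k} {w y : ℕ → 𝓐} {Z : 𝓐}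
    (h1 : Form1 (k-K) e1 s A1)
    (h2 : Form2 (k-K) e2 T2 s A2)
    (hw : ∀ t < K - 2, e2 * w t = w t ∧ w t * e1 = w t)
    (hy : ∀ t < K - 2, e1 * y t = y t ∧ y t * e2 = y t) :
    ∃ W Y', Crn e2 e1 W ∧ Crn e1 e2 Y' ∧ cf W 0 = 0 ∧
      W = gW K e1 e2 S A1 A2 w y Z ∧
      gY K k y (e1 * Z * e2) = tx 𝓐 k ^ (k-K) * (tx 𝓐 k * Y') ∧
      gF K e1 e2 S A1 A2 w y Z = gl W A1 A2 (tx 𝓐 k ^ (k-K) * (tx 𝓐 k * Y')) ∧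
      cf (W * A1 - A2 * W - W * (tx 𝓐 k ^ (k-K) * (tx 𝓐 k * Y')) * W) (k-1) = e2 * Z * e1 := by
  have hk := G.hk
  have hK := G.h2
  obtain ⟨Y', hY', hY⟩ := gY_form G (z := e1 * Z * e2) ⟨by rw [← mul_assoc, ← mul_assoc, G.e11],
    by rw [mul_assoc, G.e22]⟩ hy
  have cW := gW_crn G (Z := Z) h1 h2 hw hy
  have cWp := gWp_crn (k := k) hw
  refine ⟨_, Y', cW, hY', gW_zero (by omega) hK, rfl, hY, by rw [gF, hY], ?_⟩
  have := top21 G (Y' := Y') cW cWp h1 h2 (fun l hl => by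
    rw [gW, cf_add, cf_C_txp, if_neg (by omega), add_zero])
  rw [this]
  have e : cf (gW K e1 e2 S A1 A2 w y Z) (K-1) - cf (gWp K k w) (K-1) =
      S * (cf (gWp K k w * A1 - A2 * gWp K k w
    - gWp K k w * gY K k y (e1 * Z * e2) * gWp K k w) (k-1) - e2 * Z * e1) := by
    rw [gW, cf_add, cf_C_txp, if_pos (by omega)]; abel
  rw [e, hY, ← mul_assoc T2, G.TS]
  have cY : Crn e1 e2 (tx 𝓐 k ^ (k-K) * (tx 𝓐 k * Y')) := (hY'.tx).txp _
  have c1 := h1.crn G.e11 G.hs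
  have c2 := h2.crn G.e22 G.eT G.Te G.hs
  have := (((cWp.mul c1).sub (c2.mul cWp)).sub ((cWp.mul cY).mul cWp)).coef (k-1)
  rw [mul_sub, this.1, ← mul_assoc e2, ← mul_assoc e2, G.e22]
  abel

theorem gF_top (G : Glue k K e1 e2 T2 S s) {A1 A2 : TT 𝓐 k} {w y : ℕ → 𝓐} {Z : 𝓐}
    (h1 : Form1 (k-K) e1 s A1)
    (h2 : Form2 (k-K) e2 T2 s A2)
    (hw : ∀ t < K - 2, e2 * w t = w t ∧ w t * e1 = w t)
    (hy : ∀ t < K - 2, e1 * y t = y t ∧ y t * e2 = y t)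
    (t1 : cf A1 (k-1) = e1 * Z * e1 + ∑ t ∈ Finset.range (K-2), y t * w t)
    (t2 : cf A2 (k-1) = e2 * Z * e2 - ∑ t ∈ Finset.range (K-2), w t * y t)
    (hZ : (e1 + e2) * Z * (e1 + e2) = Z) :
    cf (gF K e1 e2 S A1 A2 w y Z) (k-1) = Z := by
  have hk := G.hk
  have hK := G.h2
  obtain ⟨W, Y', cW, hY', W0, rfl, hY, hF, h21⟩ := gF_data G (Z := Z) h1 h2 hw hy
  have cY : Crn e1 e2 (tx 𝓐 k ^ (k-K) * (tx 𝓐 k * Y')) := (hY'.tx).txp _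
  have c1 := h1.crn G.e11 G.hs
  have c2 := h2.crn G.e22 G.eT G.Te G.hs
  rw [hF, gl_expand G.e12 G.e21 cW c1 c2 cY, cf_add, cf_add, cf_add, h21]
  rw [← hY, cf_sub, cf_add, cf_YW hK hk W0, cf_WY hK hk W0, gY_top (by omega), t1, t2]
  · have s1 : ∑ t ∈ Finset.range (K-2), cf (gY K k y (e1 * Z * e2)) (k-2-t) *
        cf (gW K e1 e2 S A1 A2 w y Z) (t+1) = ∑ t ∈ Finset.range (K-2), y t * w t := by
      refine Finset.sum_congr rfl fun t ht => ?_
      rw [gY_cf hk (by simpa using ht), gW_cf hk (by simpa using ht)]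
    have s2 : ∑ t ∈ Finset.range (K-2), 
        cf (gW K e1 e2 S A1 A2 w y Z) (t+1) * cf (gY K k y (e1 * Z * e2)) (k-2-t) 
          = ∑ t ∈ Finset.range (K-2), w t * y t := by
      refine Finset.sum_congr rfl fun t ht => ?_
      rw [gY_cf hk (by simpa using ht), gW_cf hk (by simpa using ht)]
    rw [s1, s2]
    conv_rhs => rw [← hZ]
    simp only [mul_add, add_mul]
    abel
  · intro l hl; rw [hY]; exact cf_xx _ hl
  · intro l hl; rw [hY]; exact cf_xx _ hl

/-- Representation of glued elements by data. -/
theorem gF_repr (G : Glue k K e1 e2 T2 S s) {A1 A2 W Y' : TT 𝓐 k}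
    (h1 : Form1 (k-K) e1 s A1)
    (h2 : Form2 (k-K) e2 T2 s A2) (cW : Crn e2 e1 W) (W0 : cf W 0 = 0) (hY' : Crn e1 e2 Y')
    {A : TT 𝓐 k} (hA : A = gl W A1 A2 (tx 𝓐 k ^ (k-K) * (tx 𝓐 k * Y'))) :
    ∃ w y : ℕ → 𝓐, (∀ t, e2 * w t = w t ∧ w t * e1 = w t) ∧
      (∀ t, e1 * y t = y t ∧ y t * e2 = y t) ∧
      A = gF K e1 e2 S A1 A2 w y (cf A (k-1)) ∧
      cf A1 (k-1) = e1 * cf A (k-1) * e1 + ∑ t ∈ Finset.range (K-2), y t * w t ∧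
      cf A2 (k-1) = e2 * cf A (k-1) * e2 - ∑ t ∈ Finset.range (K-2), w t * y t := by
  have hk := G.hk
  have hK := G.h2
  have cY : Crn e1 e2 (tx 𝓐 k ^ (k-K) * (tx 𝓐 k * Y')) := (hY'.tx).txp _
  have c1 := h1.crn G.e11 G.hs
  have c2 := h2.crn G.e22 G.eT G.Te G.hs
  obtain ⟨b1, b2, b3, b4, -⟩ := gF_blocks G c1 c2 cW cY
  rw [← hA] at b1 b2 b3 b4
  have tp : ∀ W', Crn e2 e1 W' → _ := fun W' cW' => top21 G (Y' := Y') cW cW' h1 h2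
  have cg : ∀ W', Crn e2 e1 W' → _ := fun W' cW' => gl_congr G cW cW' h1 h2 hY'
  have Y0 : ∀ l ≤ k - K, cf (tx 𝓐 k ^ (k-K) * (tx 𝓐 k * Y')) l = 0 := fun l hl => cf_xx _ hl
  generalize tx 𝓐 k ^ (k-K) * (tx 𝓐 k * Y') = Y at *
  have hw : ∀ t, e2 * cf W (t+1) = cf W (t+1) ∧ cf W (t+1) * e1 = cf W (t+1) := fun t => cW.coef _
  have hy : ∀ t, e1 * cf Y (k-2-t) = cf Y (k-2-t) ∧ cf Y (k-2-t) * e2 = cf Y (k-2-t) := fun t => cY.coef _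
  refine ⟨fun t => cf W (t+1), fun t => cf Y (k-2-t), hw, hy, ?_, ?_, ?_⟩
  · obtain ⟨W', Y'', cW', hY'', W0', rfl, hY, hF, h21⟩ := gF_data G (Z := cf A (k-1)) h1 h2
      (w := fun t => cf W (t+1)) (y := fun t => cf Y (k-2-t)) (fun t _ => hw t) (fun t _ => hy t)
    have hz : e1 * cf A (k-1) * e2 = cf Y (k-1) := by
      rw [← b2]; simp
    have hYY : tx 𝓐 k ^ (k-K) * (tx 𝓐 k * Y'') = Y := by
      rw [← hY, hz]
      refine cf_ext fun l hl => ?_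
      rw [gY, cf_mkc _ hl]
      split_ifs with h h'
      · rw [h]
      · congr 1; omega
      · rw [Y0 _ (by omega)]
    rw [hF, hYY]
    refine hA.trans (cg _ cW' ?_)
    rw [hYY] at h21
    clear hF hYY hY
    have hlow : ∀ l < K - 1, cf W l = cf (gW K e1 e2 S A1 A2 (fun t => cf W (t+1))
        (fun t => cf Y (k-2-t)) (cf A (k-1))) l := by
      intro l hl
      rcases l with _ | l
      · rw [W0', W0]
      · rw [gW_cf hk (by omega)]
    intro l hl
    rcases lt_or_ge l (K-1) with h | h
    · exact hlow l h
    · obtain rfl : l = K - 1 := by omega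
      have := tp _ cW' hlow
      rw [h21, ← b3] at this
      simp only [cf_mul_tC, cf_tC_mul] at this
      have h3 : T2 * (cf W (K-1) - cf (gW K e1 e2 S A1 A2 (fun t => cf W (t+1))
        (fun t => cf Y (k-2-t)) (cf A (k-1))) (K-1)) = 0 := by
        have h4 := sub_eq_zero.2 this.symm
        rw [sub_sub_cancel_left, neg_eq_zero] at h4
        exact h4
      have h4 := congrArg (fun z => S * z) h3
      simp only [← mul_assoc, G.ST, mul_zero, mul_sub, (cW.coef _).1, (cW'.coef _).1] at h4
      exact sub_eq_zero.1 h4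
  · rw [← cf_YW hK hk W0 Y0]
    have := congrArg (fun p => cf p (k-1)) b1
    simp only [cf_mul_tC, cf_tC_mul, cf_sub] at this
    rw [this]; abel
  · rw [← cf_WY hK hk W0 Y0]
    have := congrArg (fun p => cf p (k-1)) b4
    simp only [cf_mul_tC, cf_tC_mul, cf_add] at this
    rw [this]; abel

end glueC


section glueD
variable {𝓐 : Type} [Ring 𝓐] {k : ℕ}
variable {K : ℕ} {e1 e2 T2 S : 𝓐} {s : TT 𝓐 k}

theorem crn_proj {a b : 𝓐} (ha : a * a = a) (hb : b * b = b) (p : TT 𝓐 k) :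
    Crn a b (tC k a * p * tC k b) :=
  ⟨by rw [← mul_assoc, ← mul_assoc, ← map_mul, ha], by rw [mul_assoc, ← map_mul, hb]⟩

/-- Inverting the gluing. -/
theorem glue_inv (G : Glue k K e1 e2 T2 S s) {M1 M2 A : TT 𝓐 k}
    (h1 : Form1 (k-K) e1 s M1) (h2 : Form2 (k-K) e2 T2 s M2) (h : NNc (e1 + e2) (M1 + M2) A) :
    ∃ W Y' A1 A2, Crn e2 e1 W ∧ cf W 0 = 0 ∧ Crn e1 e2 Y' ∧ NNc e1 M1 A1 ∧ NNc e2 M2 A2 ∧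
      A = gl W A1 A2 (tx 𝓐 k ^ (k-K) * (tx 𝓐 k * Y')) := by
  have hk : 0 < k := by have := G.hk; have := G.h2; omega
  have cM1 := h1.crn G.e11 G.hs
  have cM2 := h2.crn G.e22 G.eT G.Te G.hs
  obtain ⟨u, v, hu, hv, huv, hvu, h0, rfl⟩ := h
  set f1 := tC k e1 with hf1
  set f2 := tC k e2 with hf2
  have f11 : f1 * f1 = f1 := by rw [hf1, ← map_mul, G.e11]
  have f22 : f2 * f2 = f2 := by rw [hf2, ← map_mul, G.e22]
  have f12 : f1 * f2 = 0 := by rw [hf1, hf2, ← map_mul, G.e12, map_zero]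
  have f21 : f2 * f1 = 0 := by rw [hf1, hf2, ← map_mul, G.e21, map_zero]
  have hE : tC k (e1 + e2) = f1 + f2 := map_add _ _ _
  obtain ⟨v1, hv1, hv1', huv1, hvu1, hv10⟩ := exists_inv hk G.e11 (u := f1 * u * f1)
    (crn_proj G.e11 G.e11 u).1 (crn_proj G.e11 G.e11 u).2
    (by rw [cf_mul_tC, cf_tC_mul, h0, mul_add, G.e11, G.e12, add_zero, G.e11])
  set W := f2 * u * v1 with hWd
  have cW : Crn e2 e1 W := ⟨by rw [hWd, ← hf2, ← mul_assoc, ← mul_assoc, f22], by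
    rw [hWd, mul_assoc, hv1']⟩
  have W0 : cf W 0 = 0 := by
    rw [hWd, cf_mul_zero hk, cf_tC_mul, h0, hv10, mul_add, G.e21, G.e22, zero_add, G.e21]
  have WW : W * W = 0 := cW.mulz cW G.e12
  have W1 : (1 + W) * (1 - W) = 1 := by
    rw [add_mul, mul_sub, mul_sub, WW]; simp
  have W2 : (1 - W) * (1 + W) = 1 := by
    rw [sub_mul, mul_add, mul_add, WW]; simp
  have fW1 : f1 * W = 0 := by rw [← cW.1, ← mul_assoc, f12, zero_mul]
  have fW2 : f2 * W = W := cW.1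
  have Wf1 : W * f1 = W := cW.2
  have Wf2 : W * f2 = 0 := by rw [← Wf1, mul_assoc, f12, mul_zero]
  -- the upper triangular pair
  set a := (1 - W) * u with ha
  set b := v * (1 + W) with hb
  have aE : a * (f1 + f2) = a := by rw [ha, ← hE, mul_assoc, hu.2]
  have bE : (f1 + f2) * b = b := by rw [hb, ← hE, ← mul_assoc, hv.1]
  have EW : (f1 + f2) * W = W := by rw [add_mul, fW1, fW2, zero_add]
  have WE : W * (f1 + f2) = W := by rw [mul_add, Wf1, Wf2, add_zero]
  have Ea : (f1 + f2) * a = a := by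
    have cE : (f1+f2)*(1-W) = (1-W)*(f1+f2) := by
      rw [mul_sub, sub_mul (1:TT 𝓐 k), EW, WE, mul_one, one_mul]
    rw [ha, ← mul_assoc, cE, mul_assoc, ← hE, hu.1]
  have ab : a * b = f1 + f2 := by
    calc a * b = (1 - W) * (u * v) * (1 + W) := by simp only [ha, hb, mul_assoc]
      _ = (1 - W) * ((f1 + f2) * (1 + W)) := by rw [huv, hE, mul_assoc]
      _ = (1 - W) * ((1 + W) * (f1 + f2)) := by
          congr 1; rw [mul_add (f1+f2), add_mul (1:TT 𝓐 k), mul_one, one_mul, EW, WE]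
      _ = f1 + f2 := by rw [← mul_assoc, W2, one_mul]
  have ba : b * a = f1 + f2 := by
    calc b * a = v * ((1 + W) * (1 - W)) * u := by simp only [ha, hb, mul_assoc]
      _ = f1 + f2 := by rw [W1, mul_one, hvu, hE]
  have a21 : f2 * a * f1 = 0 := by
    have : W * (f1 * u * f1) = f2 * u * f1 := by
      rw [hWd, mul_assoc, hvu1, ]
    calc f2 * a * f1 = f2 * u * f1 - f2 * W * u * f1 := by
          simp only [ha, mul_sub, sub_mul, mul_one, one_mul, mul_assoc]
      _ = f2 * u * f1 - W * (f1 * u * f1) := by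
          congr 1; rw [fW2]; conv_lhs => rw [← Wf1]
          simp only [mul_assoc]
      _ = 0 := by rw [this, sub_self]
  -- blocks of a
  have da : a * f1 = f1 * a * f1 := by
    conv_lhs => rw [← Ea, add_mul, add_mul, a21, add_zero]
  have b21 : f2 * b * f1 = 0 := by
    have e1' : f2 * (b * a) * f1 = 0 := by rw [ba, mul_add, add_mul, f21, f22, zero_mul, f21, add_zero]
    have e2' : f2 * (b * a) * f1 = f2 * b * f1 * (f1 * a * f1) := by
      calc f2 * (b * a) * f1 = f2 * b * (a * f1) := by simp only [mul_assoc]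
        _ = f2 * b * f1 * (f1 * a * f1) := by
          have : f1 * a * f1 = f1 * (f1 * a * f1) := by
            rw [mul_assoc f1 a f1, ← mul_assoc f1 f1, f11]
          rw [da, mul_assoc (f2 * b) f1, ← this]
    have e3 : f1 * a * f1 = f1 * u * f1 := by
      rw [ha, ← mul_assoc, mul_sub, mul_one, fW1, sub_zero]
    rw [e3] at e2'
    calc f2 * b * f1 = f2 * b * f1 * f1 := by rw [mul_assoc _ f1, f11]
      _ = f2 * b * f1 * (f1 * u * f1 * v1) := by rw [huv1]
      _ = 0 := by rw [← mul_assoc, ← e2', e1', zero_mul]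
  have db : b * f1 = f1 * b * f1 := by
    conv_lhs => rw [← bE, add_mul, add_mul, b21, add_zero]
  have Eb : b * (f1 + f2) = b := by
    rw [hb, ← hE, mul_assoc]
    have : (1 + W) * tC k (e1 + e2) = tC k (e1 + e2) * (1 + W) := by
      rw [hE, mul_add (f1+f2), add_mul (1:TT 𝓐 k), mul_one, one_mul, EW, WE]
    rw [this, ← mul_assoc, hv.2]
  have da2 : f2 * a = f2 * a * f2 := by
    conv_lhs => rw [← aE, ← mul_assoc, mul_add, a21, zero_add]
  have db2 : f2 * b = f2 * b * f2 := by
    conv_lhs => rw [← Eb, ← mul_assoc, mul_add, b21, zero_add]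
  have cf1 : Crn e1 e1 f1 := Crn.cst G.e11 G.e11
  have cf2 : Crn e2 e2 f2 := Crn.cst G.e22 G.e22
  have a0 : cf a 0 = e1 + e2 := by
    rw [ha, cf_mul_zero hk, cf_sub, W0, h0, cf_one]; simp [hk]
  have b0 : cf b 0 = e1 + e2 := by
    have hv0 : cf v 0 = e1 + e2 := by
      have := congrArg (fun p => cf p 0) huv
      simp only [cf_mul_zero hk, h0, cf_tC, hk, and_self, if_true] at this
      rw [(hv.coef 0).1] at this; exact this
    rw [hb, cf_mul_zero hk, cf_add, W0, hv0, cf_one]; simp [hk]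
  -- the conjugated matrix
  have hM1f : M1 * f1 = M1 := cM1.2
  have hfM1 : f1 * M1 = M1 := cM1.1
  have hM2f : M2 * f2 = M2 := cM2.2
  have hfM2 : f2 * M2 = M2 := cM2.1
  have M2f1 : M2 * f1 = 0 := by rw [← hM2f, mul_assoc, f21, mul_zero]
  have f2M1 : f2 * M1 = 0 := by rw [← hfM1, ← mul_assoc, f21, zero_mul]
  have A11 : f1 * (a * (M1 + M2) * b) * f1 = (f1 * a * f1) * M1 * (f1 * b * f1) := by
    have z1 : M2 * (f1 * b * f1) = 0 := by
      rw [mul_assoc f1 b f1, ← mul_assoc M2 f1, M2f1, zero_mul]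
    calc f1 * (a * (M1 + M2) * b) * f1 = f1 * a * (M1 + M2) * (b * f1) := by simp only [mul_assoc]
      _ = f1 * a * (M1 * (f1 * b * f1)) := by rw [db, mul_assoc, add_mul, z1, add_zero]
      _ = f1 * a * ((f1 * M1) * (f1 * b * f1)) := by rw [hfM1]
      _ = _ := by simp only [mul_assoc]
  have A22 : f2 * (a * (M1 + M2) * b) * f2 = (f2 * a * f2) * M2 * (f2 * b * f2) := by
    have z1 : f2 * a * f2 * M1 = 0 := by
      rw [mul_assoc _ f2, f2M1, mul_zero]
    calc f2 * (a * (M1 + M2) * b) * f2 = (f2 * a) * (M1 + M2) * b * f2 := by simp only [mul_assoc]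
      _ = f2 * a * f2 * M2 * b * f2 := by
          rw [show f2 * a * (M1 + M2) = f2 * a * f2 * M2 from by rw [mul_add, (show f2 * a * M1 = 0 by rw [da2]; exact z1), zero_add, ← da2]]
      _ = f2 * a * f2 * (M2 * f2) * b * f2 := by rw [hM2f]
      _ = _ := by simp only [mul_assoc]
  have A21 : f2 * (a * (M1 + M2) * b) * f1 = 0 := by
    have z1 : f2 * a * f2 * M1 = 0 := by
      rw [mul_assoc _ f2, f2M1, mul_zero]
    have z2 : M2 * (f1 * b * f1) = 0 := by
      rw [mul_assoc f1 b f1, ← mul_assoc M2 f1, M2f1, zero_mul]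
    calc f2 * (a * (M1 + M2) * b) * f1 = (f2 * a) * (M1 + M2) * (b * f1) := by simp only [mul_assoc]
      _ = f2 * a * f2 * M2 * (f1 * b * f1) := by
          rw [show f2 * a * (M1 + M2) = f2 * a * f2 * M2 from by rw [mul_add, (show f2 * a * M1 = 0 by rw [da2]; exact z1), zero_add, ← da2], db]
      _ = 0 := by rw [mul_assoc, z2, mul_zero]
  have A12 : ∃ Y', Crn e1 e2 Y' ∧ f1 * (a * (M1 + M2) * b) * f2 = tx 𝓐 k ^ (k-K) * (tx 𝓐 k * Y') := by
    obtain ⟨B1, hB1, rfl⟩ := h1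
    obtain ⟨B2, hB2, rfl⟩ := h2
    set N := tx 𝓐 k * B1 + (tC k T2 + tx 𝓐 k * B2) with hN
    have e : a * (s * tC k e1 + tx 𝓐 k ^ (k-K) * (tx 𝓐 k * B1) + (s * tC k e2 +
        tx 𝓐 k ^ (k-K) * (tC k T2 + tx 𝓐 k * B2))) * b = s * (f1 + f2) + tx 𝓐 k ^ (k-K) * (a * N * b) := by
      have : s * tC k e1 + tx 𝓐 k ^ (k-K) * (tx 𝓐 k * B1) + (s * tC k e2 +
        tx 𝓐 k ^ (k-K) * (tC k T2 + tx 𝓐 k * B2)) = s * (f1 + f2) + tx 𝓐 k ^ (k-K) * N := by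
        rw [hN]; simp only [mul_add]; abel
      rw [this, mul_add, add_mul, ← mul_assoc a, ← G.hs, mul_assoc s, aE, mul_assoc, ab, mul_txp_l, mul_assoc]
    rw [e]
    have e2' : f1 * (s * (f1 + f2) + tx 𝓐 k ^ (k-K) * (a * N * b)) * f2 =
        tx 𝓐 k ^ (k-K) * (f1 * (a * N * b) * f2) := by
      rw [mul_add, add_mul, ← mul_assoc f1 s, ← G.hs, mul_assoc s, mul_add f1, f11, f12, add_zero,
        mul_assoc s, f12, mul_zero, zero_add, mul_txp_l, mul_assoc]
    rw [e2']
    have c0 : cf (f1 * (a * N * b) * f2) 0 = 0 := by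
      rw [cf_mul_tC, cf_tC_mul, cf_mul_zero hk, cf_mul_zero hk, a0, b0, hN]
      simp only [cf_add, cf_tC, cf_tx_mul]
      simp [hk, ← mul_assoc, mul_add, G.e11, G.e12, G.eT]
      rw [← G.eT, ← mul_assoc, G.e12, zero_mul]; simp
    have cc := crn_proj G.e11 G.e22 (a * N * b)
    rw [← hf1, ← hf2] at cc
    obtain ⟨p, hp⟩ := exists_div1 c0
    rw [hp] at cc ⊢
    obtain ⟨q, hq, h3⟩ := cc.div1 G.e11 G.e22
    exact ⟨q, hq, by rw [h3]⟩
  obtain ⟨Y', hY', A12⟩ := A12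
  refine ⟨W, Y', (f1 * a * f1) * M1 * (f1 * b * f1), (f2 * a * f2) * M2 * (f2 * b * f2), cW, W0, hY',
    ⟨f1 * a * f1, f1 * b * f1, crn_proj G.e11 G.e11 a, crn_proj G.e11 G.e11 b, ?_, ?_, ?_, rfl⟩,
    ⟨f2 * a * f2, f2 * b * f2, crn_proj G.e22 G.e22 a, crn_proj G.e22 G.e22 b, ?_, ?_, ?_, rfl⟩, ?_⟩
  · rw [← da, ← hf1]
    calc a * f1 * (f1 * b * f1) = a * (f1 * f1 * b * f1) := by simp only [mul_assoc]
      _ = f1 := by rw [f11, ← db, ← mul_assoc, ab, add_mul, f11, f21, add_zero]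
  · rw [← db, ← hf1]
    calc b * f1 * (f1 * a * f1) = b * (f1 * f1 * a * f1) := by simp only [mul_assoc]
      _ = f1 := by rw [f11, ← da, ← mul_assoc, ba, add_mul, f11, f21, add_zero]
  · rw [cf_mul_tC, cf_tC_mul, a0, mul_add, G.e11, G.e12, add_zero, G.e11]
  · rw [← db2, ← hf2]
    calc f2 * a * f2 * (f2 * b) = f2 * a * (f2 * f2) * b := by simp only [mul_assoc]
      _ = f2 := by rw [f22, ← da2, mul_assoc, ab, mul_add, f22, f21, zero_add]
  · rw [← da2, ← hf2]
    calc f2 * b * f2 * (f2 * a) = f2 * b * (f2 * f2) * a := by simp only [mul_assoc]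
      _ = f2 := by rw [f22, ← db2, mul_assoc, ba, mul_add, f22, f21, zero_add]
  · rw [cf_mul_tC, cf_tC_mul, a0, mul_add, G.e21, G.e22, zero_add, G.e22]
  · rw [← A11, ← A22, ← A12]
    have hh : f1 * (a * (M1 + M2) * b) * f1 + f2 * (a * (M1 + M2) * b) * f2 + f1 * (a * (M1 + M2) * b) * f2
      = a * (M1 + M2) * b := by
      have t : (f1 + f2) * (a * (M1 + M2) * b) * (f1 + f2) = a * (M1 + M2) * b := by
        rw [mul_assoc a, ← mul_assoc (f1+f2) a, Ea, mul_assoc a, mul_assoc (M1+M2), Eb]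
      conv_rhs => rw [← t]
      rw [add_mul f1 f2, add_mul (f1 * (a * (M1 + M2) * b)), mul_add (f1 * (a * (M1 + M2) * b)), mul_add (f2 * (a * (M1 + M2) * b)), A21]; abel
    rw [gl, hh, ha, hb]
    calc u * (M1 + M2) * v = 1 * u * (M1 + M2) * v * 1 := by rw [one_mul, mul_one]
      _ = ((1 + W) * (1 - W)) * u * (M1 + M2) * v * ((1 + W) * (1 - W)) := by rw [W1]
      _ = _ := by simp only [mul_assoc]

end glueD

section glueE
variable {𝓐 : Type} [Ring 𝓐] [Algebra ℂ 𝓐] {k : ℕ} {𝓑 : Subalgebra ℂ (𝓐 × 𝓐)}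
variable {K : ℕ} {e1 e2 T2 S : 𝓐} {s : TT 𝓐 k}

theorem mem_mul' {a a' b b' : 𝓐} (h : (a, a') ∈ 𝓑) (h' : (b, b') ∈ 𝓑) : (a * b, a' * b') ∈ 𝓑 := by
  simpa using 𝓑.mul_mem h h'
theorem mem_sub' {a a' b b' : 𝓐} (h : (a, a') ∈ 𝓑) (h' : (b, b') ∈ 𝓑) : (a - b, a' - b') ∈ 𝓑 := by
  simpa using 𝓑.sub_mem h h'
theorem mem_add' {a a' b b' : 𝓐} (h : (a, a') ∈ 𝓑) (h' : (b, b') ∈ 𝓑) : (a + b, a' + b') ∈ 𝓑 := by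
  simpa using 𝓑.add_mem h h'
theorem mem_sum' {ι : Type*} {s : Finset ι} {f g : ι → 𝓐} (h : ∀ i ∈ s, (f i, g i) ∈ 𝓑) :
    (∑ i ∈ s, f i, ∑ i ∈ s, g i) ∈ 𝓑 := by
  have := 𝓑.sum_mem h
  have e : (∑ i ∈ s, f i, ∑ i ∈ s, g i) = ∑ i ∈ s, (f i, g i) := by
    ext
    · simp [Prod.fst_sum]
    · simp [Prod.snd_sum]
  rwa [e]
theorem mem_smul' (c : ℂ) {a a' : 𝓐} (h : (a, a') ∈ 𝓑) : (c • a, c • a') ∈ 𝓑 := 𝓑.smul_mem h c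

theorem InB.mkc {a a' : ℕ → 𝓐} (h : ∀ l < k, (a l, a' l) ∈ 𝓑) (N : ℕ) : InB 𝓑 N (mkc k a) (mkc k a') := by
  intro l _
  by_cases hl : l < k
  · rw [cf_mkc _ hl, cf_mkc _ hl]; exact h l hl
  · rw [cf_ge _ (by omega), cf_ge _ (by omega)]; exact 𝓑.zero_mem

theorem gF_E (hk : 0 < k) {A1 A2 A1' A2' : TT 𝓐 k} {w y w' y' : ℕ → 𝓐} {Z Z' : 𝓐}
    (m1 : (e1, e1) ∈ 𝓑) (m2 : (e2, e2) ∈ 𝓑) (mS : (S, S) ∈ 𝓑)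
    (i1 : InB 𝓑 k A1 A1') (i2 : InB 𝓑 k A2 A2')
    (hw : ∀ t < K - 2, (w t, w' t) ∈ 𝓑) (hy : ∀ t < K - 2, (y t, y' t) ∈ 𝓑) (hZ : (Z, Z') ∈ 𝓑)
    (hK : K ≤ k) :
    InB 𝓑 k (gF K e1 e2 S A1 A2 w y Z) (gF K e1 e2 S A1' A2' w' y' Z') := by
  have iY : InB 𝓑 k (gY K k y (e1 * Z * e2)) (gY K k y' (e1 * Z' * e2)) := by
    apply InB.mkc
    intro l hl
    split_ifs with h h'
    · exact mem_mul' (mem_mul' m1 hZ) m2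
    · exact hy _ (by omega)
    · exact 𝓑.zero_mem
  have iWp : InB 𝓑 k (gWp K k w) (gWp K k w') := by
    apply InB.mkc
    intro l hl
    split_ifs with h h'
    · exact 𝓑.zero_mem
    · exact hw _ (by omega)
    · exact 𝓑.zero_mem
  have iW : InB 𝓑 k (gW K e1 e2 S A1 A2 w y Z) (gW K e1 e2 S A1' A2' w' y' Z') := by
    refine iWp.add (InB.mul (InB.C ?_) (InB.txp _))
    exact mem_mul' mS (mem_sub' (((iWp.mul i1).sub (i2.mul iWp)).sub ((iWp.mul iY).mul iWp) _ (by omega))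
      (mem_mul' (mem_mul' m2 hZ) m1))
  exact ((InB.one.add iW).mul ((i1.add i2).add iY)).mul (InB.one.sub iW)

theorem InB.divp {r N : ℕ} {p p' : TT 𝓐 k} (h : InB 𝓑 k (tx 𝓐 k ^ r * p) (tx 𝓐 k ^ r * p'))
    (hN : r + N ≤ k) : InB 𝓑 N p p' := by
  intro l hl
  have := h (r + l) (by omega)
  rw [cf_txp_mul, cf_txp_mul, if_pos (by omega), if_pos (by omega)] at this
  simpa using this

theorem InB.txp_mul {r N : ℕ} {p p' : TT 𝓐 k} (h : InB 𝓑 N p p')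
    (hN : k ≤ r + N) : InB 𝓑 k (DS.tx 𝓐 k ^ r * p) (DS.tx 𝓐 k ^ r * p') := by
  intro l hl
  rw [cf_txp_mul, cf_txp_mul]
  split_ifs
  · exact h _ (by omega)
  · exact 𝓑.zero_mem

/-- The first relevant coefficient. -/
theorem gl_T (G : Glue k K e1 e2 T2 S s) {W A1 A2 Y' : TT 𝓐 k}
    (hW : Crn e2 e1 W) (W0 : cf W 0 = 0) (h1 : Form1 (k-K) e1 s A1)
    (h2 : Form2 (k-K) e2 T2 s A2) (hY : Crn e1 e2 Y') :
    cf (gl W A1 A2 (tx 𝓐 k ^ (k-K) * (tx 𝓐 k * Y'))) (k-K) = cf s (k-K) * (e1 + e2) + T2 := by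
  have hk := G.hk
  have hK := G.h2
  have c1 := h1.crn G.e11 G.hs
  have c2 := h2.crn G.e22 G.eT G.Te G.hs
  have cY : Crn e1 e2 (tx 𝓐 k ^ (k-K) * (tx 𝓐 k * Y')) := (hY.tx).txp _
  rw [gl_expand G.e12 G.e21 hW c1 c2 cY]
  obtain ⟨B1, hB1, h1⟩ := h1
  obtain ⟨B2, hB2, h2⟩ := h2
  have y1 : tx 𝓐 k ^ (k-K) * (tx 𝓐 k * Y') * W = tx 𝓐 k ^ (k-K) * (tx 𝓐 k * (Y' * W)) := by
    simp only [mul_assoc]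
  have y2 : W * (tx 𝓐 k ^ (k-K) * (tx 𝓐 k * Y')) = tx 𝓐 k ^ (k-K) * (tx 𝓐 k * (W * Y')) := by
    rw [mul_txp_l, mul_tx_l]
  rw [gl21_form G hW h1 h2, y1, y2]
  have hk0 : 0 < k := by omega
  rw [cf_add, cf_add, cf_add, cf_sub, cf_add, cf_xx _ le_rfl, cf_xx _ le_rfl, cf_xx _ le_rfl,
    h1, h2, cf_add, cf_add, cf_xx _ le_rfl, cf_txp_mul, cf_txp_mul, if_pos ⟨le_rfl, by omega⟩,
    if_pos ⟨le_rfl, by omega⟩, Nat.sub_self, cf_sub, cf_add, cf_tx_mul, cf_tx_mul,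
    if_neg (by omega), if_neg (by omega), cf_tC_mul, W0, cf_mul_tC, cf_mul_tC, cf_tC]
  simp [hk0, mul_add, add_assoc]

/-- Recovering the data. -/
theorem gl_G (G : Glue k K e1 e2 T2 S s) {W A1 A2 Y' W' A1' A2' Y'' : TT 𝓐 k}
    (ms : InB 𝓑 k s s)
    (m1 : (e1, e1) ∈ 𝓑) (m2 : (e2, e2) ∈ 𝓑) (mS : (S, S) ∈ 𝓑) (mT : (T2, T2) ∈ 𝓑)
    (hW : Crn e2 e1 W) (W0 : cf W 0 = 0) (h1 : Form1 (k-K) e1 s A1)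
    (h2 : Form2 (k-K) e2 T2 s A2) (hY : Crn e1 e2 Y')
    (hW' : Crn e2 e1 W') (W0' : cf W' 0 = 0) (h1' : Form1 (k-K) e1 s A1')
    (h2' : Form2 (k-K) e2 T2 s A2') (hY' : Crn e1 e2 Y'')
    (h : InB 𝓑 k (gl W A1 A2 (tx 𝓐 k ^ (k-K) * (tx 𝓐 k * Y')))
      (gl W' A1' A2' (tx 𝓐 k ^ (k-K) * (tx 𝓐 k * Y'')))) :
    InB 𝓑 K W W' ∧ InB 𝓑 k (tx 𝓐 k ^ (k-K) * (tx 𝓐 k * Y')) (tx 𝓐 k ^ (k-K) * (tx 𝓐 k * Y'')) ∧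
      InB 𝓑 k A1 A1' ∧ InB 𝓑 k A2 A2' := by
  have hk := G.hk
  have hK := G.h2
  have c1 := h1.crn G.e11 G.hs
  have c2 := h2.crn G.e22 G.eT G.Te G.hs
  have cY : Crn e1 e2 (tx 𝓐 k ^ (k-K) * (tx 𝓐 k * Y')) := (hY.tx).txp _
  have c1' := h1'.crn G.e11 G.hs
  have c2' := h2'.crn G.e22 G.eT G.Te G.hs
  have cY' : Crn e1 e2 (tx 𝓐 k ^ (k-K) * (tx 𝓐 k * Y'')) := (hY'.tx).txp _
  obtain ⟨b1, b2, b3, b4, -⟩ := gF_blocks G c1 c2 hW cY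
  obtain ⟨b1', b2', b3', b4', -⟩ := gF_blocks G c1' c2' hW' cY'
  have mf1 : InB 𝓑 k (tC k e1) (tC k e1) := InB.C m1
  have mf2 : InB 𝓑 k (tC k e2) (tC k e2) := InB.C m2
  have i11 := (mf1.mul h).mul mf1
  have i12 := (mf1.mul h).mul mf2
  have i21 := (mf2.mul h).mul mf1
  have i22 := (mf2.mul h).mul mf2
  rw [b1, b1'] at i11
  rw [b2, b2'] at i12
  rw [b3, b3'] at i21
  rw [b4, b4'] at i22
  obtain ⟨B1, hB1, q1⟩ := h1
  obtain ⟨B2, hB2, q2⟩ := h2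
  obtain ⟨B1', hB1', q1'⟩ := h1'
  obtain ⟨B2', hB2', q2'⟩ := h2'
  have j12 : InB 𝓑 (K-1) Y' Y'' := by
    have : InB 𝓑 k (tx 𝓐 k ^ (k-K+1) * Y') (tx 𝓐 k ^ (k-K+1) * Y'') := by
      rw [pow_succ, mul_assoc, mul_assoc]; exact i12
    exact this.divp (by omega)
  have j11 : InB 𝓑 (K-1) (B1 - Y' * W) (B1' - Y'' * W') := by
    have : InB 𝓑 k (tx 𝓐 k ^ (k-K+1) * (B1 - Y' * W)) (tx 𝓐 k ^ (k-K+1) * (B1' - Y'' * W')) := by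
      have := i11.sub (ms.mul mf1)
      rw [q1, q1'] at this
      convert this using 1
      · rw [pow_succ]; simp only [mul_sub, mul_assoc]; abel
      · rw [pow_succ]; simp only [mul_sub, mul_assoc]; abel
    exact this.divp (by omega)
  have j22 : InB 𝓑 (K-1) (B2 + W * Y') (B2' + W' * Y'') := by
    have : InB 𝓑 k (tx 𝓐 k ^ (k-K+1) * (B2 + W * Y')) (tx 𝓐 k ^ (k-K+1) * (B2' + W' * Y'')) := by
      have := (i22.sub (ms.mul mf2)).sub ((InB.txp (k-K)).mul (InB.C mT))
      rw [q2, q2'] at this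
      convert this using 1
      · rw [pow_succ, mul_txp_l, mul_tx_l]; simp only [mul_add, mul_assoc]; abel
      · rw [pow_succ, mul_txp_l, mul_tx_l]; simp only [mul_add, mul_assoc]; abel
    exact this.divp (by omega)
  rw [gl21_form G hW q1 q2, gl21_form G hW' q1' q2'] at i21
  have j21 := i21.divp (N := K) (by omega)
  have key : ∀ l ≤ K, InB 𝓑 l W W' := by
    intro l
    induction l with
    | zero => intro _ l hl; omega
    | succ l ih =>
      intro hl
      have ih := ih (by omega)
      have d := (((ih.mul (j11.mono (show l ≤ K - 1 by omega))).sub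
        ((j22.mono (show l ≤ K - 1 by omega)).mul ih)).add
          ((ih.mul (j12.mono (show l ≤ K - 1 by omega))).mul ih)).tx_mul
      have d2 := (InB.C mS).mul (d.sub (j21.mono (show l + 1 ≤ K by omega)))
      convert d2 using 1
      · have : tx 𝓐 k * (W * (B1 - Y' * W) - (B2 + W * Y') * W + W * Y' * W) -
          (tx 𝓐 k * (W * B1 - B2 * W - W * Y' * W) - tC k T2 * W) = tC k T2 * W := by
          simp only [mul_add, add_mul, mul_sub, mul_assoc]; abel
        rw [this, ← mul_assoc, ← map_mul, G.ST, hW.1]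
      · have : tx 𝓐 k * (W' * (B1' - Y'' * W') - (B2' + W' * Y'') * W' + W' * Y'' * W') -
          (tx 𝓐 k * (W' * B1' - B2' * W' - W' * Y'' * W') - tC k T2 * W') = tC k T2 * W' := by
          simp only [mul_add, add_mul, mul_sub, mul_assoc]; abel
        rw [this, ← mul_assoc, ← map_mul, G.ST, hW'.1]
  have iW := key K le_rfl
  refine ⟨iW, i12, ?_, ?_⟩
  · have e : InB 𝓑 k (tx 𝓐 k ^ (k-K) * (tx 𝓐 k * (Y' * W))) (tx 𝓐 k ^ (k-K) * (tx 𝓐 k * (Y'' * W'))) :=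
      (((j12.mul (iW.mono (by omega))).tx_mul).mono (show K ≤ K - 1 + 1 by omega)).txp_mul (by omega)
    convert i11.add e using 1 <;> simp only [mul_assoc] <;> abel
  · have e : InB 𝓑 k (tx 𝓐 k ^ (k-K) * (tx 𝓐 k * (W * Y'))) (tx 𝓐 k ^ (k-K) * (tx 𝓐 k * (W' * Y''))) :=
      (((InB.mul (iW.mono (by omega)) j12).tx_mul).mono (show K ≤ K - 1 + 1 by omega)).txp_mul (by omega)
    convert i22.sub e using 1 
    · rw [mul_txp_l, mul_tx_l]; abel
    · rw [mul_txp_l, mul_tx_l]; abel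

end glueE


section locE
variable {𝓐 : Type} [Ring 𝓐] [Algebra ℂ 𝓐] {k m : ℕ}

theorem form1_of {K : ℕ} {e1 : 𝓐} {s A : TT 𝓐 k} (hs : ∀ p, s * p = p * s) (e11 : e1 * e1 = e1)
    (c : Crn e1 e1 A) (h : ∀ l, l < k → l ≤ k - K → cf A l = cf s l * e1) : Form1 (k-K) e1 s A := by
  have c' : Crn e1 e1 (A - s * tC k e1) := c.sub (Crn.cent_mul hs (Crn.cst e11 e11))
  obtain ⟨p, hp, -⟩ := exists_div (r := k - K + 1) (p := A - s * tC k e1) (by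
    intro l hl
    by_cases hlk : l < k
    · rw [cf_sub, cf_mul_tC, h l hlk (by omega), sub_self]
    · exact cf_ge _ (by omega))
  rw [hp] at c'
  obtain ⟨B, hB, hB'⟩ := c'.divp e11 e11
  refine ⟨B, hB, ?_⟩
  rw [← mul_assoc, ← pow_succ, ← hB', ← hp]; abel

theorem form2_of {K : ℕ} {e2 T2 : 𝓐} {s A : TT 𝓐 k} (hs : ∀ p, s * p = p * s) (e11 : e2 * e2 = e2)
    (eT : e2 * T2 = T2) (Te : T2 * e2 = T2)
    (c : Crn e2 e2 A) (h : ∀ l, l < k → l ≤ k - K → cf A l = cf s l * e2 + if l = k - K then T2 else 0) :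
    Form2 (k-K) e2 T2 s A := by
  have c' : Crn e2 e2 (A - s * tC k e2 - tC k T2 * tx 𝓐 k ^ (k-K)) :=
    (c.sub (Crn.cent_mul hs (Crn.cst e11 e11))).sub (Crn.mul_cent (txp_comm _) (Crn.cst eT Te))
  obtain ⟨p, hp, -⟩ := exists_div (r := k - K + 1) (p := A - s * tC k e2 - tC k T2 * tx 𝓐 k ^ (k-K)) (by
    intro l hl
    by_cases hlk : l < k
    · rw [cf_sub, cf_sub, cf_mul_tC, h l hlk (by omega), cf_C_txp]
      simp [hlk]
    · exact cf_ge _ (by omega))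
  rw [hp] at c'
  obtain ⟨B, hB, hB'⟩ := c'.divp e11 e11
  refine ⟨B, hB, ?_⟩
  rw [mul_add, ← mul_assoc _ _ B, ← pow_succ, ← hB', ← hp, txp_comm]; abel

/-! idempotent systems -/
/-- An orthogonal system of idempotents. -/
def Orth (e : Fin m → 𝓐) : Prop := ∀ j j', e j * e j' = if j = j' then e j else 0

/-- The partial sum of idempotents. -/
def eJ (e : Fin m → 𝓐) (J : Finset (Fin m)) : 𝓐 := ∑ j ∈ J, e j
/-- The block diagonal part. -/
def dg (e : Fin m → 𝓐) (J : Finset (Fin m)) (Z : 𝓐) : 𝓐 := ∑ j ∈ J, e j * Z * e j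
/-- The sign. -/
def sg (j j' : Fin m) : ℂ := if j < j' then 1 else -1
/-- Crossing degree. -/
def dq (q : Fin m → ℂ[X]) (j j' : Fin m) : ℕ := (q j - q j').natDegree - 2
/-- Normal form. -/
def BB (k : ℕ) (e : Fin m → 𝓐) (q : Fin m → ℂ[X]) (J : Finset (Fin m)) (R : 𝓐) : TT 𝓐 k :=
  mkc k (fun l => (∑ j ∈ J, (q j).coeff (k - l) • e j) + if l = k - 1 then R else 0)
/-- cross terms of the moment map -/
def mX (q : Fin m → ℂ[X]) (J J' : Finset (Fin m)) (Γ : Fin m → Fin m → ℕ → 𝓐) : 𝓐 :=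
  ∑ j ∈ J, ∑ j' ∈ J', ∑ t ∈ Finset.range (dq q j j'), sg j j' • (Γ j j' t * Γ j' j t)
/-- validity of data -/
def Val (e : Fin m → 𝓐) (q : Fin m → ℂ[X]) (J : Finset (Fin m)) (Γ : Fin m → Fin m → ℕ → 𝓐) : Prop :=
  ∀ j ∈ J, ∀ j' ∈ J, ∀ t < dq q j j', e j' * Γ j j' t = Γ j j' t ∧ Γ j j' t * e j = Γ j j' t

variable {e : Fin m → 𝓐} {q : Fin m → ℂ[X]} {J J' : Finset (Fin m)}

theorem Orth.self (h : Orth e) (j) : e j * e j = e j := by rw [h, if_pos rfl]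

theorem Orth.mul_eJ (h : Orth e) (j) : e j * eJ e J = if j ∈ J then e j else 0 := by
  rw [eJ, Finset.mul_sum]; simp_rw [h j]; simp

theorem Orth.eJ_mul (h : Orth e) (j) : eJ e J * e j = if j ∈ J then e j else 0 := by
  rw [eJ, Finset.sum_mul]; simp_rw [h _ j]
  rw [Finset.sum_ite_eq']

theorem Orth.smul_mul_smul (h : Orth e) (a b : Fin m → ℂ) :
    (∑ j ∈ J, a j • e j) * (∑ j ∈ J, b j • e j) = ∑ j ∈ J, (a j * b j) • e j := by
  rw [Finset.sum_mul_sum]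
  refine Finset.sum_congr rfl fun j hj => ?_
  simp only [smul_mul_smul_comm, h j, smul_ite, smul_zero]
  rw [Finset.sum_ite_eq, if_pos hj]

theorem eJ_eq_smul : eJ e J = ∑ j ∈ J, (1:ℂ) • e j := by simp [eJ]

theorem Orth.eJ_eJ (h : Orth e) : eJ e J * eJ e J = eJ e J := by
  rw [eJ_eq_smul, h.smul_mul_smul]; simp

theorem Orth.eJ_disj (h : Orth e) (hd : Disjoint J J') : eJ e J * eJ e J' = 0 := by
  rw [eJ, Finset.sum_mul]
  refine Finset.sum_eq_zero fun j hj => ?_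
  rw [h.mul_eJ, if_neg (Finset.disjoint_left.1 hd hj)]

theorem Orth.eJ_smul (h : Orth e) (a : Fin m → ℂ) : eJ e J * (∑ j ∈ J, a j • e j) = ∑ j ∈ J, a j • e j := by
  rw [eJ_eq_smul, h.smul_mul_smul]; simp

theorem Orth.smul_eJ (h : Orth e) (a : Fin m → ℂ) : (∑ j ∈ J, a j • e j) * eJ e J = ∑ j ∈ J, a j • e j := by
  rw [eJ_eq_smul, h.smul_mul_smul]; simp

theorem Orth.eJ_dg (h : Orth e) (Z : 𝓐) : eJ e J * dg e J Z = dg e J Z := by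
  rw [dg, Finset.mul_sum]
  refine Finset.sum_congr rfl fun j hj => ?_
  rw [← mul_assoc, ← mul_assoc, h.eJ_mul, if_pos hj]

theorem Orth.dg_eJ (h : Orth e) (Z : 𝓐) : dg e J Z * eJ e J = dg e J Z := by
  rw [dg, Finset.sum_mul]
  refine Finset.sum_congr rfl fun j hj => ?_
  rw [mul_assoc, h.mul_eJ, if_pos hj]

theorem Orth.mul_dg (h : Orth e) (Z : 𝓐) (j) : e j * dg e J Z = if j ∈ J then e j * Z * e j else 0 := by
  rw [dg, Finset.mul_sum]
  simp_rw [← mul_assoc, h j, ite_mul, zero_mul]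
  rw [Finset.sum_ite_eq]

theorem Orth.dg_mul (h : Orth e) (Z : 𝓐) (j) : dg e J Z * e j = if j ∈ J then e j * Z * e j else 0 := by
  rw [dg, Finset.sum_mul]
  simp_rw [mul_assoc, h _ j, mul_ite, mul_zero]
  rw [Finset.sum_ite_eq']

theorem Orth.dg_dg (h : Orth e) (Z : 𝓐) : dg e J (dg e J Z) = dg e J Z := by
  have : ∀ j ∈ J, e j * dg e J Z * e j = e j * Z * e j := fun j hj => by
    rw [h.mul_dg, if_pos hj, mul_assoc, h.self]
  exact Finset.sum_congr rfl this

theorem dg_add (Z Z' : 𝓐) : dg e J (Z + Z') = dg e J Z + dg e J Z' := by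
  simp [dg, mul_add, add_mul, Finset.sum_add_distrib]
theorem dg_sub (Z Z' : 𝓐) : dg e J (Z - Z') = dg e J Z - dg e J Z' := by
  simp [dg, mul_sub, sub_mul, Finset.sum_sub_distrib]
theorem Orth.dg_corner (h : Orth e) (Z : 𝓐) : dg e J (eJ e J * Z * eJ e J) = dg e J Z := by
  refine Finset.sum_congr rfl fun j hj => ?_
  rw [← mul_assoc, ← mul_assoc, h.mul_eJ, mul_assoc _ (eJ e J) (e j), h.eJ_mul, if_pos hj]

theorem cf_BB {R : 𝓐} {l : ℕ} (hl : l < k) :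
    cf (BB k e q J R) l = (∑ j ∈ J, (q j).coeff (k - l) • e j) + if l = k - 1 then R else 0 := by
  rw [BB, cf_mkc _ hl]

theorem BB_crn (h : Orth e) {R : 𝓐} (h1 : eJ e J * R = R) (h2 : R * eJ e J = R) :
    Crn (eJ e J) (eJ e J) (BB k e q J R) := by
  apply Crn.mkc
  intro l hl
  rw [mul_add, add_mul, h.eJ_smul, h.smul_eJ]
  split_ifs <;> simp [h1, h2]

theorem BB_union (hd : Disjoint J J') (R R' : 𝓐) :
    BB k e q (J ∪ J') (R + R') = BB k e q J R + BB k e q J' R' := by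
  apply cf_ext
  intro l hl
  rw [cf_add, cf_BB hl, cf_BB hl, cf_BB hl, Finset.sum_union hd]
  split_ifs <;> abel

theorem eJ_union (hd : Disjoint J J') : eJ e (J ∪ J') = eJ e J + eJ e J' := Finset.sum_union hd
theorem dg_union (hd : Disjoint J J') (Z : 𝓐) : dg e (J ∪ J') Z = dg e J Z + dg e J' Z :=
  Finset.sum_union hd
theorem mX_union {J1 J2 J3 J4} (hd : Disjoint J1 J2) (hd' : Disjoint J3 J4) (Γ : Fin m → Fin m → ℕ → 𝓐) :
    mX q (J1 ∪ J2) (J3 ∪ J4) Γ = mX q J1 J3 Γ + mX q J1 J4 Γ + (mX q J2 J3 Γ + mX q J2 J4 Γ) := by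
  simp only [mX]
  rw [Finset.sum_union hd]
  simp_rw [Finset.sum_union hd', Finset.sum_add_distrib]

theorem Val.mono {Γ : Fin m → Fin m → ℕ → 𝓐} (h : Val e q J Γ) (hJ : J' ⊆ J) : Val e q J' Γ :=
  fun j hj j' hj' t ht => h j (hJ hj) j' (hJ hj') t ht

theorem Orth.corner_mX (h : Orth e) {Γ : Fin m → Fin m → ℕ → 𝓐} (hv : Val e q J Γ) :
    dg e J (mX q J J Γ) = mX q J J Γ := by
  have key : ∀ i, ∀ j ∈ J, ∀ j' ∈ J, ∀ t < dq q j j', e i * (Γ j j' t * Γ j' j t) * e i =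
      if i = j' then Γ j j' t * Γ j' j t else 0 := by
    intro i j hj j' hj' t ht
    have ht' : t < dq q j' j := by
      rw [dq, ← natDegree_neg, neg_sub] ; exact ht
    have a := (hv j hj j' hj' t ht).1
    have b := (hv j' hj' j hj t ht').2
    rw [← a, ← b]
    have : e i * (e j' * Γ j j' t * (Γ j' j t * e j')) * e i =
      (e i * e j') * (Γ j j' t * Γ j' j t) * (e j' * e i) := by simp only [mul_assoc]
    rw [this, h, h]
    split_ifs with h1 h2 h3
    · subst h1; simp only [mul_assoc]
    · exact absurd h1.symm h2
    · simp
    · simp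
  rw [dg]
  have : ∀ i ∈ J, e i * mX q J J Γ * e i = ∑ j ∈ J, ∑ j' ∈ J, ∑ t ∈ Finset.range (dq q j j'),
      if i = j' then sg j j' • (Γ j j' t * Γ j' j t) else 0 := by
    intro i hi
    simp only [mX, Finset.mul_sum, Finset.sum_mul]
    refine Finset.sum_congr rfl fun j hj => Finset.sum_congr rfl fun j' hj' =>
      Finset.sum_congr rfl fun t ht => ?_
    rw [mul_smul_comm, smul_mul_assoc, key i j hj j' hj' t (Finset.mem_range.1 ht)]
    simp
  rw [Finset.sum_congr rfl this, Finset.sum_comm]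
  refine Finset.sum_congr rfl fun j hj => ?_
  rw [Finset.sum_comm]
  refine Finset.sum_congr rfl fun j' hj' => ?_
  rw [Finset.sum_comm]
  refine Finset.sum_congr rfl fun t ht => ?_
  rw [Finset.sum_ite_eq', if_pos hj']

theorem dq_symm (j j' : Fin m) : dq q j j' = dq q j' j := by
  rw [dq, dq, ← natDegree_neg, neg_sub]
theorem dq_self (j : Fin m) : dq q j j = 0 := by simp [dq]

end locE


section locF
variable {𝓐 : Type} [Ring 𝓐] [Algebra ℂ 𝓐] {k m : ℕ}
variable {e : Fin m → 𝓐} {q : Fin m → ℂ[X]} {J J' : Finset (Fin m)}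

theorem idem_mem (h : Orth e) {𝓑 : Subalgebra ℂ (𝓐 × 𝓐)} (t : Fin m → ℂ) (ht : ∀ j ∈ J, t j ≠ 0)
    (hT : (∑ j ∈ J, t j • e j, ∑ j ∈ J, t j • e j) ∈ 𝓑) (f : ℂ → ℂ) :
    (∑ j ∈ J, f (t j) • e j, ∑ j ∈ J, f (t j) • e j) ∈ 𝓑 := by
  classical
  set T := ∑ j ∈ J, t j • e j with hTd
  have hpow : ∀ n : ℕ, T ^ (n+1) = ∑ j ∈ J, (t j ^ (n+1)) • e j := by
    intro n
    induction n with
    | zero => simp [hTd]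
    | succ n ih => rw [pow_succ, ih, hTd, h.smul_mul_smul]; simp [pow_succ]
  have hp : ∀ p : ℂ[X], aeval T (p * X) = ∑ j ∈ J, (p * X).eval (t j) • e j := by
    intro p
    induction p using Polynomial.induction_on' with
    | add p r hp hr => rw [add_mul, map_add, hp, hr, ← Finset.sum_add_distrib]; simp [add_smul]
    | monomial n a =>
      rw [monomial_mul_X, aeval_monomial, hpow, Finset.mul_sum]
      refine Finset.sum_congr rfl fun j _ => ?_
      rw [eval_monomial, mul_smul, ← Algebra.smul_def, ]
  have hm : ∀ p : ℂ[X], (aeval T p, aeval T p) ∈ 𝓑 := by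
    intro p
    have e1 : (aeval T p, aeval T p) = aeval (T, T) p := by
      have := aeval_algHom_apply ((AlgHom.id ℂ 𝓐).prod (AlgHom.id ℂ 𝓐)) T p
      simpa using this.symm
    rw [e1]
    have := Polynomial.aeval_mem_adjoin_singleton (p := p) ℂ ((T, T) : 𝓐 × 𝓐)
    exact (Algebra.adjoin_le (by simpa using hT)) this
  have := hm (Lagrange.interpolate (J.image t) id (fun c => f c / c) * X)
  rw [hp] at this
  have e2 : ∑ j ∈ J, f (t j) • e j = ∑ j ∈ J, (Lagrange.interpolate (J.image t) id (fun c => f c / c) * X).eval (t j) • e j := by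
    refine Finset.sum_congr rfl fun j hj => ?_
    have := Lagrange.eval_interpolate_at_node (s := J.image t) (v := id) (r := fun c => f c / c) (i := t j)
      (Function.injective_id.injOn) (Finset.mem_image_of_mem t hj)
    simp only [id] at this
    rw [eval_mul, eval_X]
    erw [this]
    rw [div_mul_cancel₀ _ (ht j hj)]
  rw [e2]; exact this

/-- The specification of the local parametrization. -/
structure LSpec (k : ℕ) (e : Fin m → 𝓐) (q : Fin m → ℂ[X]) (J : Finset (Fin m))
    (F : (Fin m → Fin m → ℕ → 𝓐) → 𝓐 → TT 𝓐 k) : Prop where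
  a : ∀ Γ Z, Val e q J Γ → eJ e J * Z = Z → Z * eJ e J = Z → cf (F Γ Z) (k-1) = Z
  b : ∀ Γ Z, Val e q J Γ → eJ e J * Z = Z → Z * eJ e J = Z →
    NNc (eJ e J) (BB k e q J (dg e J Z - mX q J J Γ)) (F Γ Z)
  c : ∀ R A, dg e J R = R → NNc (eJ e J) (BB k e q J R) A →
    ∃ Γ, Val e q J Γ ∧ A = F Γ (cf A (k-1)) ∧ R = dg e J (cf A (k-1)) - mX q J J Γ
  E : ∀ (𝓑 : Subalgebra ℂ (𝓐 × 𝓐)) Γ Γ' Z Z', (∀ j ∈ J, (e j, e j) ∈ 𝓑) →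
    (∀ j ∈ J, ∀ j' ∈ J, ∀ t < dq q j j', (Γ j j' t, Γ' j j' t) ∈ 𝓑) → (Z, Z') ∈ 𝓑 →
    InB 𝓑 k (F Γ Z) (F Γ' Z')
  G : ∀ (𝓑 : Subalgebra ℂ (𝓐 × 𝓐)) Γ Γ' Z Z', (eJ e J, eJ e J) ∈ 𝓑 → Val e q J Γ → Val e q J Γ' →
    eJ e J * Z = Z → Z * eJ e J = Z → eJ e J * Z' = Z' → Z' * eJ e J = Z' →
    InB 𝓑 k (F Γ Z) (F Γ' Z') → (∀ j ∈ J, (e j, e j) ∈ 𝓑) ∧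
    (∀ j ∈ J, ∀ j' ∈ J, ∀ t < dq q j j', (Γ j j' t, Γ' j j' t) ∈ 𝓑)

theorem LSpec.loc {F} (L : LSpec k e q J F) {Γ Γ' : Fin m → Fin m → ℕ → 𝓐} {Z : 𝓐}
    (h : ∀ j ∈ J, ∀ j' ∈ J, ∀ t < dq q j j', Γ j j' t = Γ' j j' t) : F Γ Z = F Γ' Z := by
  let 𝓑 : Subalgebra ℂ (𝓐 × 𝓐) := AlgHom.equalizer (AlgHom.fst ℂ 𝓐 𝓐) (AlgHom.snd ℂ 𝓐 𝓐)
  have hB : ∀ a b : 𝓐, (a, b) ∈ 𝓑 ↔ a = b := by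
    intro a b; simp [𝓑, AlgHom.mem_equalizer]
  apply cf_ext
  intro l hl
  rw [← hB]
  exact L.E 𝓑 Γ Γ' Z Z (fun j _ => (hB _ _).2 rfl) (fun j hj j' hj' t ht => (hB _ _).2 (h j hj j' hj' t ht))
    ((hB _ _).2 rfl) l hl

theorem lspec_base (hk : 0 < k) (h : Orth e) (hq1 : ∀ j, (q j).coeff 1 = 0) (hJ : J.card ≤ 1) :
    LSpec k e q J (fun _ Z => BB k e q J Z) := by
  have hcase : J = ∅ ∨ ∃ i, J = {i} := by
    rcases Nat.le_one_iff_eq_zero_or_eq_one.1 hJ with h | h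
    · exact Or.inl (Finset.card_eq_zero.1 h)
    · exact Or.inr (Finset.card_eq_one.1 h)
  have hd : ∀ j ∈ J, ∀ j' ∈ J, dq q j j' = 0 := by
    intro j hj j' hj'
    rw [Finset.card_le_one.1 hJ j hj j' hj', dq_self]
  have hmX : ∀ Γ, mX q J J Γ = (0 : 𝓐) := by
    intro Γ
    refine Finset.sum_eq_zero fun j hj => Finset.sum_eq_zero fun j' hj' => ?_
    rw [hd j hj j' hj']; rfl
  have htop : ∀ Z : 𝓐, cf (BB k e q J Z) (k-1) = Z := by
    intro Z
    rw [cf_BB (by omega), if_pos rfl, show k - (k-1) = 1 by omega]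
    simp [hq1]
  have hself : ∀ Z : 𝓐, eJ e J * Z = Z → Z * eJ e J = Z → dg e J Z = Z := by
    intro Z h1 h2
    have h3 : eJ e J * Z * eJ e J = Z := by rw [h1, h2]
    rcases hcase with rfl | ⟨i, rfl⟩
    · simpa [eJ, dg] using h3
    · simpa [eJ, dg] using h3
  refine ⟨fun _ Z _ _ _ => htop Z, ?_, ?_, ?_, ?_⟩
  · intro Γ Z _ h1 h2
    rw [hmX, sub_zero, hself Z h1 h2]
    have := BB_crn (k := k) (q := q) h h1 h2
    refine ⟨tC k (eJ e J), tC k (eJ e J), Crn.cst h.eJ_eJ h.eJ_eJ, Crn.cst h.eJ_eJ h.eJ_eJ, ?_, ?_, ?_, ?_⟩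
    · rw [← map_mul, h.eJ_eJ]
    · rw [← map_mul, h.eJ_eJ]
    · rw [cf_tC, if_pos ⟨rfl, hk⟩]
    · rw [this.1, this.2]
  · intro R A hR hA
    have h1 : eJ e J * R = R := by rw [← hR, h.eJ_dg]
    have h2 : R * eJ e J = R := by rw [← hR, h.dg_eJ]
    suffices hAB : A = BB k e q J R by
      refine ⟨fun _ _ _ => 0, ?_, ?_, ?_⟩
      · intro j hj j' hj' t ht; rw [hd j hj j' hj'] at ht; omega
      · rw [hAB, htop]
      · rw [hAB, htop, hmX, sub_zero, hR]
    obtain ⟨u, v, hu, hv, huv, hvu, h0, rfl⟩ := hA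
    have hv0 : cf v 0 = eJ e J := by
      have := congrArg (fun p => cf p 0) huv
      simp only [cf_mul_zero hk, h0, cf_tC, hk, and_self, if_true] at this
      rw [(hv.coef 0).1] at this; exact this
    have hB : ∃ s : TT 𝓐 k, (∀ p, s * p = p * s) ∧ BB k e q J R = s * tC k (eJ e J) + tC k R * tx 𝓐 k ^ (k-1) := by
      rcases hcase with rfl | ⟨i, rfl⟩
      · refine ⟨0, by simp, cf_ext fun l hl => ?_⟩
        rw [cf_BB hl, cf_add, cf_C_txp]; simp [hl]
      · refine ⟨sc 𝓐 k ((q i).reflect k), sc_comm _, cf_ext fun l hl => ?_⟩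
        rw [cf_BB hl, cf_add, cf_C_txp, cf_mul_tC, cf_sc _ hl, coeff_reflect, revAt_le hl.le]
        simp [hl, eJ, Algebra.smul_def]
    obtain ⟨s, hs, hB⟩ := hB
    rw [hB, mul_add, add_mul]
    congr 1
    · rw [← mul_assoc, ← hs, mul_assoc s, hu.2, mul_assoc, huv]
    · have : u * (tC k R * tx 𝓐 k ^ (k-1)) * v = tx 𝓐 k ^ (k-1) * (u * tC k R * v) := by
        rw [← txp_comm, mul_txp_l]; simp only [mul_assoc]
      rw [this]
      apply cf_ext
      intro l hl
      rw [cf_txp_mul, cf_C_txp]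
      by_cases hl' : l = k - 1
      · subst hl'
        rw [if_pos ⟨le_rfl, hl⟩, if_pos ⟨rfl, hl⟩, Nat.sub_self, cf_mul_zero hk, cf_mul_tC, h0, hv0, h1, h2]
      · rw [if_neg (by omega), if_neg (by omega)]
  · intro 𝓑 Γ Γ' Z Z' he _ hZ
    apply InB.mkc
    intro l hl
    refine mem_add' (mem_sum' fun j hj => mem_smul' _ (he j hj)) ?_
    split_ifs
    · exact hZ
    · exact 𝓑.zero_mem
  · intro 𝓑 Γ Γ' Z Z' he _ _ _ _ _ _ _
    refine ⟨fun j hj => ?_, fun j hj j' hj' t ht => ?_⟩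
    · rcases hcase with rfl | ⟨i, rfl⟩
      · simp at hj
      · rw [Finset.mem_singleton.1 hj]; simpa [eJ] using he
    · rw [hd j hj j' hj'] at ht; omega

end locF


section locG
variable {𝓐 : Type} [Ring 𝓐] [Algebra ℂ 𝓐] {k m : ℕ}
variable {e : Fin m → 𝓐} {q : Fin m → ℂ[X]} {J J1 J2 : Finset (Fin m)}

/-- Sum of the arrows from `J1` to `J2`. -/
def wG (J1 J2 : Finset (Fin m)) (Γ : Fin m → Fin m → ℕ → 𝓐) (t : ℕ) : 𝓐 :=
  ∑ j ∈ J1, ∑ j' ∈ J2, Γ j j' t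
/-- Signed sum of the arrows from `J2` to `J1`. -/
def yG (J1 J2 : Finset (Fin m)) (Γ : Fin m → Fin m → ℕ → 𝓐) (t : ℕ) : 𝓐 :=
  ∑ j ∈ J1, ∑ j' ∈ J2, sg j j' • Γ j' j t

theorem sg_sg (j j' : Fin m) : sg j j' * sg j j' = 1 := by unfold sg; split_ifs <;> norm_num
theorem sg_neg {j j' : Fin m} (h : j ≠ j') : sg j' j = - sg j j' := by
  unfold sg
  rcases lt_or_gt_of_ne h with h1 | h1
  · rw [if_pos h1, if_neg (by exact not_lt.2 h1.le)]
  · rw [if_pos h1, if_neg (by exact not_lt.2 h1.le)]; simp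

/-- Validity of cross data. -/
def CrV (e : Fin m → 𝓐) (J1 J2 : Finset (Fin m)) (Γ : Fin m → Fin m → ℕ → 𝓐) (t : ℕ) : Prop :=
  ∀ j ∈ J1, ∀ j' ∈ J2, (e j' * Γ j j' t = Γ j j' t ∧ Γ j j' t * e j = Γ j j' t) ∧
    (e j * Γ j' j t = Γ j' j t ∧ Γ j' j t * e j' = Γ j' j t)

variable {Γ : Fin m → Fin m → ℕ → 𝓐} {t : ℕ}

theorem CrV.w (h : Orth e) (hv : CrV e J1 J2 Γ t) :
    eJ e J2 * wG J1 J2 Γ t = wG J1 J2 Γ t ∧ wG J1 J2 Γ t * eJ e J1 = wG J1 J2 Γ t := by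
  constructor
  · simp only [wG, Finset.mul_sum]
    refine Finset.sum_congr rfl fun j hj => Finset.sum_congr rfl fun j' hj' => ?_
    rw [← (hv j hj j' hj').1.1, ← mul_assoc, h.eJ_mul, if_pos hj']
  · simp only [wG, Finset.sum_mul]
    refine Finset.sum_congr rfl fun j hj => Finset.sum_congr rfl fun j' hj' => ?_
    rw [← (hv j hj j' hj').1.2, mul_assoc, h.mul_eJ, if_pos hj]

theorem CrV.y (h : Orth e) (hv : CrV e J1 J2 Γ t) :
    eJ e J1 * yG J1 J2 Γ t = yG J1 J2 Γ t ∧ yG J1 J2 Γ t * eJ e J2 = yG J1 J2 Γ t := by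
  constructor
  · simp only [yG, Finset.mul_sum]
    refine Finset.sum_congr rfl fun j hj => Finset.sum_congr rfl fun j' hj' => ?_
    rw [mul_smul_comm, ← (hv j hj j' hj').2.1, ← mul_assoc, h.eJ_mul, if_pos hj]
  · simp only [yG, Finset.sum_mul]
    refine Finset.sum_congr rfl fun j hj => Finset.sum_congr rfl fun j' hj' => ?_
    rw [smul_mul_assoc, ← (hv j hj j' hj').2.2, mul_assoc, h.mul_eJ, if_pos hj']

theorem CrV.wl (h : Orth e) (hv : CrV e J1 J2 Γ t) {a : Fin m} (ha : a ∈ J2) :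
    e a * wG J1 J2 Γ t = ∑ j ∈ J1, Γ j a t := by
  simp only [wG, Finset.mul_sum]
  refine Finset.sum_congr rfl fun j hj => ?_
  rw [Finset.sum_eq_single a]
  · exact (hv j hj a ha).1.1
  · intro b hb hba
    rw [← (hv j hj b hb).1.1, ← mul_assoc, h, if_neg (Ne.symm hba), zero_mul]
  · exact fun hh => absurd ha hh

theorem CrV.wr (h : Orth e) (hv : CrV e J1 J2 Γ t) {a : Fin m} (ha : a ∈ J1) :
    wG J1 J2 Γ t * e a = ∑ j ∈ J2, Γ a j t := by
  simp only [wG, Finset.sum_mul]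
  rw [Finset.sum_eq_single a]
  · exact Finset.sum_congr rfl fun j hj => (hv a ha j hj).1.2
  · intro b hb hba
    refine Finset.sum_eq_zero fun j hj => ?_
    rw [← (hv b hb j hj).1.2, mul_assoc, h, if_neg hba, mul_zero]
  · exact fun hh => absurd ha hh

theorem CrV.yl (h : Orth e) (hv : CrV e J1 J2 Γ t) {a : Fin m} (ha : a ∈ J1) :
    e a * yG J1 J2 Γ t = ∑ j ∈ J2, sg a j • Γ j a t := by
  simp only [yG, Finset.mul_sum, mul_smul_comm]
  rw [Finset.sum_eq_single a]
  · exact Finset.sum_congr rfl fun j hj => by rw [(hv a ha j hj).2.1]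
  · intro b hb hba
    refine Finset.sum_eq_zero fun j hj => ?_
    rw [← (hv b hb j hj).2.1, ← mul_assoc, h, if_neg (Ne.symm hba), zero_mul, smul_zero]
  · exact fun hh => absurd ha hh

theorem CrV.yr (h : Orth e) (hv : CrV e J1 J2 Γ t) {a : Fin m} (ha : a ∈ J2) :
    yG J1 J2 Γ t * e a = ∑ j ∈ J1, sg j a • Γ a j t := by
  simp only [yG, Finset.sum_mul, smul_mul_assoc]
  refine Finset.sum_congr rfl fun j hj => ?_
  rw [Finset.sum_eq_single a]
  · rw [(hv j hj a ha).2.2]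
  · intro b hb hba
    rw [← (hv j hj b hb).2.2, mul_assoc, h, if_neg hba, mul_zero, smul_zero]
  · exact fun hh => absurd ha hh

theorem CrV.wc (h : Orth e) (hv : CrV e J1 J2 Γ t) {a b : Fin m} (ha : a ∈ J1) (hb : b ∈ J2) :
    e b * wG J1 J2 Γ t * e a = Γ a b t := by
  rw [hv.wl h hb, Finset.sum_mul, Finset.sum_eq_single a]
  · exact (hv a ha b hb).1.2
  · intro c hc hca
    rw [← (hv c hc b hb).1.2, mul_assoc, h, if_neg hca, mul_zero]
  · exact fun hh => absurd ha hh

theorem CrV.yc (h : Orth e) (hv : CrV e J1 J2 Γ t) {a b : Fin m} (ha : a ∈ J1) (hb : b ∈ J2) :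
    e a * yG J1 J2 Γ t * e b = sg a b • Γ b a t := by
  rw [hv.yl h ha, Finset.sum_mul, Finset.sum_eq_single b]
  · rw [smul_mul_assoc, (hv a ha b hb).2.2]
  · intro c hc hca
    rw [← (hv a ha c hc).2.2, smul_mul_assoc, mul_assoc, h, if_neg hca, mul_zero, smul_zero]
  · exact fun hh => absurd hb hh

theorem dg_yw (h : Orth e) (hd : Disjoint J1 J2) {N : ℕ} (hv : ∀ t < N, CrV e J1 J2 Γ t)
    (hN : ∀ j ∈ J1, ∀ j' ∈ J2, dq q j j' = N) :
    dg e J1 (∑ t ∈ Finset.range N, yG J1 J2 Γ t * wG J1 J2 Γ t) = - mX q J2 J1 Γ := by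
  have key : ∀ a ∈ J1, ∀ t ∈ Finset.range N, e a * (yG J1 J2 Γ t * wG J1 J2 Γ t) * e a =
      ∑ j ∈ J2, -(sg j a • (Γ j a t * Γ a j t)) := by
    intro a ha t ht
    have hv := hv t (Finset.mem_range.1 ht)
    rw [mul_assoc, mul_assoc, ← mul_assoc (e a), hv.yl h ha, hv.wr h ha, Finset.sum_mul_sum]
    refine Finset.sum_congr rfl fun j hj => ?_
    rw [Finset.sum_eq_single j]
    · rw [sg_neg (j := a) (j' := j) (fun hh => Finset.disjoint_left.1 hd ha (hh ▸ hj))]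
      rw [smul_mul_assoc, neg_smul, neg_neg]
    · intro b hb hbj
      rw [← (hv a ha j hj).2.2, ← (hv a ha b hb).1.1, smul_mul_assoc, mul_assoc, ← mul_assoc (e j),
        h, if_neg (Ne.symm hbj)]; simp
    · exact fun hh => absurd hj hh
  rw [dg]
  have : ∀ a ∈ J1, e a * (∑ t ∈ Finset.range N, yG J1 J2 Γ t * wG J1 J2 Γ t) * e a =
      ∑ j ∈ J2, ∑ t ∈ Finset.range N, -(sg j a • (Γ j a t * Γ a j t)) := by
    intro a ha
    rw [Finset.mul_sum, Finset.sum_mul, Finset.sum_congr rfl (key a ha), Finset.sum_comm]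
  rw [Finset.sum_congr rfl this, mX, Finset.sum_comm]
  simp only [Finset.sum_neg_distrib]
  congr 1
  refine Finset.sum_congr rfl fun j hj => Finset.sum_congr rfl fun a ha => ?_
  rw [dq_symm, hN a ha j hj]

theorem dg_wy (h : Orth e) {N : ℕ} (hv : ∀ t < N, CrV e J1 J2 Γ t)
    (hN : ∀ j ∈ J1, ∀ j' ∈ J2, dq q j j' = N) :
    dg e J2 (∑ t ∈ Finset.range N, wG J1 J2 Γ t * yG J1 J2 Γ t) = mX q J1 J2 Γ := by
  have key : ∀ a ∈ J2, ∀ t ∈ Finset.range N, e a * (wG J1 J2 Γ t * yG J1 J2 Γ t) * e a =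
      ∑ j ∈ J1, (sg j a • (Γ j a t * Γ a j t)) := by
    intro a ha t ht
    have hv := hv t (Finset.mem_range.1 ht)
    rw [mul_assoc, mul_assoc, ← mul_assoc (e a), hv.wl h ha, hv.yr h ha, Finset.sum_mul_sum]
    refine Finset.sum_congr rfl fun j hj => ?_
    rw [Finset.sum_eq_single j]
    · rw [mul_smul_comm]
    · intro b hb hbj
      rw [← (hv j hj a ha).1.2, ← (hv b hb a ha).2.1, mul_smul_comm, mul_assoc, ← mul_assoc (e j),
        h, if_neg (Ne.symm hbj)]; simp
    · exact fun hh => absurd hj hh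
  rw [dg]
  have : ∀ a ∈ J2, e a * (∑ t ∈ Finset.range N, wG J1 J2 Γ t * yG J1 J2 Γ t) * e a =
      ∑ j ∈ J1, ∑ t ∈ Finset.range N, (sg j a • (Γ j a t * Γ a j t)) := by
    intro a ha
    rw [Finset.mul_sum, Finset.sum_mul, Finset.sum_congr rfl (key a ha), Finset.sum_comm]
  rw [Finset.sum_congr rfl this, mX, Finset.sum_comm]
  refine Finset.sum_congr rfl fun j hj => Finset.sum_congr rfl fun a ha => ?_
  rw [hN j hj a ha]

theorem Val.cross (hv : Val e q (J1 ∪ J2) Γ) {N : ℕ} (hN : ∀ j ∈ J1, ∀ j' ∈ J2, dq q j j' = N) :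
    ∀ t < N, CrV e J1 J2 Γ t := by
  intro t ht j hj j' hj'
  exact ⟨hv j (Finset.mem_union_left _ hj) j' (Finset.mem_union_right _ hj') t (by rwa [hN j hj j' hj']),
    hv j' (Finset.mem_union_right _ hj') j (Finset.mem_union_left _ hj) t (by rwa [dq_symm, hN j hj j' hj'])⟩

end locG


section locH
variable {𝓐 : Type} [Ring 𝓐] [Algebra ℂ 𝓐] {k m : ℕ}

/-- Splitting data. -/
structure Stp (k K : ℕ) (e : Fin m → 𝓐) (q : Fin m → ℂ[X]) (J1 J2 : Finset (Fin m)) (r : ℂ[X])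
    (t : Fin m → ℂ) : Prop where
  h : Orth e
  hK : 2 ≤ K
  hKk : K ≤ k
  hd : Disjoint J1 J2
  c1 : ∀ j ∈ J1, ∀ l, K ≤ l → (q j).coeff l = r.coeff l
  c2 : ∀ j ∈ J2, ∀ l, K < l → (q j).coeff l = r.coeff l
  c3 : ∀ j ∈ J2, (q j).coeff K = r.coeff K + t j
  ht : ∀ j ∈ J2, t j ≠ 0
  hN : ∀ j ∈ J1, ∀ j' ∈ J2, dq q j j' = K - 2

variable {e : Fin m → 𝓐} {q : Fin m → ℂ[X]} {J J1 J2 : Finset (Fin m)} {K : ℕ} {r : ℂ[X]}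
  {t : Fin m → ℂ}

theorem Stp.glue (P : Stp k K e q J1 J2 r t) :
    Glue k K (eJ e J1) (eJ e J2) (∑ j ∈ J2, t j • e j) (∑ j ∈ J2, (t j)⁻¹ • e j)
      (sc 𝓐 k (r.reflect k)) where
  hk := P.hKk
  h2 := P.hK
  e11 := P.h.eJ_eJ
  e22 := P.h.eJ_eJ
  e12 := P.h.eJ_disj P.hd
  e21 := P.h.eJ_disj P.hd.symm
  eT := P.h.eJ_smul _
  Te := P.h.smul_eJ _
  eS := P.h.eJ_smul _
  Se := P.h.smul_eJ _
  TS := by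
    rw [P.h.smul_mul_smul, eJ_eq_smul]
    exact Finset.sum_congr rfl fun j hj => by rw [mul_inv_cancel₀ (P.ht j hj)]
  ST := by
    rw [P.h.smul_mul_smul, eJ_eq_smul]
    exact Finset.sum_congr rfl fun j hj => by rw [inv_mul_cancel₀ (P.ht j hj)]
  hs := sc_comm _

theorem Stp.form1 (P : Stp k K e q J1 J2 r t) {R : 𝓐} (h1 : eJ e J1 * R = R) (h2 : R * eJ e J1 = R) :
    Form1 (k-K) (eJ e J1) (sc 𝓐 k (r.reflect k)) (BB k e q J1 R) := by
  have hK := P.hK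
  have hk := P.hKk
  refine form1_of (sc_comm _) P.h.eJ_eJ (BB_crn P.h h1 h2) fun l hl hl' => ?_
  rw [cf_BB hl, if_neg (by omega), add_zero, cf_sc _ hl, coeff_reflect, revAt_le hl.le, eJ,
    ← Algebra.smul_def, Finset.smul_sum]
  exact Finset.sum_congr rfl fun j hj => by rw [P.c1 j hj _ (by omega)]

theorem Stp.form2 (P : Stp k K e q J1 J2 r t) {R : 𝓐} (h1 : eJ e J2 * R = R) (h2 : R * eJ e J2 = R) :
    Form2 (k-K) (eJ e J2) (∑ j ∈ J2, t j • e j) (sc 𝓐 k (r.reflect k)) (BB k e q J2 R) := by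
  have hK := P.hK
  have hk := P.hKk
  refine form2_of (sc_comm _) P.h.eJ_eJ P.glue.eT P.glue.Te (BB_crn P.h h1 h2) fun l hl hl' => ?_
  rw [cf_BB hl, if_neg (by omega), add_zero, cf_sc _ hl, coeff_reflect, revAt_le hl.le, eJ,
    ← Algebra.smul_def, Finset.smul_sum]
  split_ifs with hlK
  · rw [← Finset.sum_add_distrib]
    refine Finset.sum_congr rfl fun j hj => ?_
    rw [hlK, show k - (k - K) = K by omega, P.c3 j hj, add_smul]
  · rw [add_zero]
    exact Finset.sum_congr rfl fun j hj => by rw [P.c2 j hj _ (by omega)]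

/-- First corner residue. -/
def Z1f (K : ℕ) (e : Fin m → 𝓐) (J1 J2 : Finset (Fin m)) (Γ : Fin m → Fin m → ℕ → 𝓐) (Z : 𝓐) : 𝓐 :=
  eJ e J1 * Z * eJ e J1 + ∑ t ∈ Finset.range (K-2), yG J1 J2 Γ t * wG J1 J2 Γ t
/-- Second corner residue. -/
def Z2f (K : ℕ) (e : Fin m → 𝓐) (J1 J2 : Finset (Fin m)) (Γ : Fin m → Fin m → ℕ → 𝓐) (Z : 𝓐) : 𝓐 :=
  eJ e J2 * Z * eJ e J2 - ∑ t ∈ Finset.range (K-2), wG J1 J2 Γ t * yG J1 J2 Γ t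

variable {Γ Γ' : Fin m → Fin m → ℕ → 𝓐} {Z Z' : 𝓐}

theorem Stp.Z1c (P : Stp k K e q J1 J2 r t) (hv : ∀ t < K - 2, CrV e J1 J2 Γ t) :
    eJ e J1 * Z1f K e J1 J2 Γ Z = Z1f K e J1 J2 Γ Z ∧ Z1f K e J1 J2 Γ Z * eJ e J1 = Z1f K e J1 J2 Γ Z := by
  constructor
  · rw [Z1f, mul_add, ← mul_assoc, ← mul_assoc, P.h.eJ_eJ, Finset.mul_sum]
    congr 1
    refine Finset.sum_congr rfl fun t ht => ?_
    rw [← mul_assoc, ((hv t (Finset.mem_range.1 ht)).y P.h).1]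
  · rw [Z1f, add_mul, mul_assoc, P.h.eJ_eJ, Finset.sum_mul]
    congr 1
    refine Finset.sum_congr rfl fun t ht => ?_
    rw [mul_assoc, ((hv t (Finset.mem_range.1 ht)).w P.h).2]

theorem Stp.Z2c (P : Stp k K e q J1 J2 r t) (hv : ∀ t < K - 2, CrV e J1 J2 Γ t) :
    eJ e J2 * Z2f K e J1 J2 Γ Z = Z2f K e J1 J2 Γ Z ∧ Z2f K e J1 J2 Γ Z * eJ e J2 = Z2f K e J1 J2 Γ Z := by
  constructor
  · rw [Z2f, mul_sub, ← mul_assoc, ← mul_assoc, P.h.eJ_eJ, Finset.mul_sum]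
    congr 1
    refine Finset.sum_congr rfl fun t ht => ?_
    rw [← mul_assoc, ((hv t (Finset.mem_range.1 ht)).w P.h).1]
  · rw [Z2f, sub_mul, mul_assoc, P.h.eJ_eJ, Finset.sum_mul]
    congr 1
    refine Finset.sum_congr rfl fun t ht => ?_
    rw [mul_assoc, ((hv t (Finset.mem_range.1 ht)).y P.h).2]

theorem Stp.dgZ1 (P : Stp k K e q J1 J2 r t) (hv : ∀ t < K - 2, CrV e J1 J2 Γ t) :
    dg e J1 (Z1f K e J1 J2 Γ Z) = dg e J1 Z - mX q J2 J1 Γ := by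
  rw [Z1f, dg_add, P.h.dg_corner, dg_yw P.h P.hd hv P.hN, sub_eq_add_neg]
theorem Stp.dgZ2 (P : Stp k K e q J1 J2 r t) (hv : ∀ t < K - 2, CrV e J1 J2 Γ t) :
    dg e J2 (Z2f K e J1 J2 Γ Z) = dg e J2 Z - mX q J1 J2 Γ := by
  rw [Z2f, dg_sub, P.h.dg_corner, dg_wy P.h hv P.hN]

theorem Stp.split (P : Stp k K e q J1 J2 r t) (hv : ∀ t < K - 2, CrV e J1 J2 Γ t) :
    dg e (J1 ∪ J2) Z - mX q (J1 ∪ J2) (J1 ∪ J2) Γ =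
      (dg e J1 (Z1f K e J1 J2 Γ Z) - mX q J1 J1 Γ) + (dg e J2 (Z2f K e J1 J2 Γ Z) - mX q J2 J2 Γ) := by
  rw [P.dgZ1 hv, P.dgZ2 hv, dg_union P.hd, mX_union P.hd P.hd]; abel

/-- The glued map. -/
def FF (k K : ℕ) (e : Fin m → 𝓐) (J1 J2 : Finset (Fin m)) (t : Fin m → ℂ)
    (F1 F2 : (Fin m → Fin m → ℕ → 𝓐) → 𝓐 → TT 𝓐 k) (Γ : Fin m → Fin m → ℕ → 𝓐) (Z : 𝓐) : TT 𝓐 k :=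
  gF K (eJ e J1) (eJ e J2) (∑ j ∈ J2, (t j)⁻¹ • e j) (F1 Γ (Z1f K e J1 J2 Γ Z))
    (F2 Γ (Z2f K e J1 J2 Γ Z)) (wG J1 J2 Γ) (yG J1 J2 Γ) Z

variable {F1 F2 : (Fin m → Fin m → ℕ → 𝓐) → 𝓐 → TT 𝓐 k}

theorem Stp.R1c (P : Stp k K e q J1 J2 r t) (hv : Val e q J1 Γ) :
    dg e J1 (dg e J1 Z - mX q J1 J1 Γ) = dg e J1 Z - mX q J1 J1 Γ := by
  rw [dg_sub, P.h.dg_dg, P.h.corner_mX hv]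

theorem Stp.forms (P : Stp k K e q J1 J2 r t) (L1 : LSpec k e q J1 F1) (L2 : LSpec k e q J2 F2)
    (hv : Val e q (J1 ∪ J2) Γ) :
    let A1 := F1 Γ (Z1f K e J1 J2 Γ Z)
    let A2 := F2 Γ (Z2f K e J1 J2 Γ Z)
    let R1 := dg e J1 (Z1f K e J1 J2 Γ Z) - mX q J1 J1 Γ
    let R2 := dg e J2 (Z2f K e J1 J2 Γ Z) - mX q J2 J2 Γ
    NNc (eJ e J1) (BB k e q J1 R1) A1 ∧ NNc (eJ e J2) (BB k e q J2 R2) A2 ∧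
    Form1 (k-K) (eJ e J1) (sc 𝓐 k (r.reflect k)) A1 ∧
    Form2 (k-K) (eJ e J2) (∑ j ∈ J2, t j • e j) (sc 𝓐 k (r.reflect k)) A2 ∧
    Crn (eJ e J1) (eJ e J1) (BB k e q J1 R1) ∧ Crn (eJ e J2) (eJ e J2) (BB k e q J2 R2) := by
  intro A1 A2 R1 R2
  have hk : 0 < k := by have := P.hK; have := P.hKk; omega
  have hc := hv.cross P.hN
  have v1 := hv.mono (Finset.subset_union_left (s₁ := J1) (s₂ := J2))
  have v2 := hv.mono (Finset.subset_union_right (s₁ := J1) (s₂ := J2))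
  have n1 := L1.b Γ (Z1f K e J1 J2 Γ Z) v1 (P.Z1c hc).1 (P.Z1c hc).2
  have n2 := L2.b Γ (Z2f K e J1 J2 Γ Z) v2 (P.Z2c hc).1 (P.Z2c hc).2
  have r1 : dg e J1 R1 = R1 := by
    simp only [R1]; rw [dg_sub, P.h.dg_dg, P.h.corner_mX v1]
  have r2 : dg e J2 R2 = R2 := by
    simp only [R2]; rw [dg_sub, P.h.dg_dg, P.h.corner_mX v2]
  have a1 : eJ e J1 * R1 = R1 := by rw [← r1, P.h.eJ_dg]
  have a2 : R1 * eJ e J1 = R1 := by rw [← r1, P.h.dg_eJ]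
  have b1 : eJ e J2 * R2 = R2 := by rw [← r2, P.h.eJ_dg]
  have b2 : R2 * eJ e J2 = R2 := by rw [← r2, P.h.dg_eJ]
  exact ⟨n1, n2, form1_conj (sc_comm _) (P.form1 a1 a2) n1,
    form2_conj hk P.glue.e22 P.glue.eT P.glue.Te (sc_comm _) (P.form2 b1 b2) n2,
    BB_crn P.h a1 a2, BB_crn P.h b1 b2⟩

theorem lspec_step (P : Stp k K e q J1 J2 r t) (L1 : LSpec k e q J1 F1) (L2 : LSpec k e q J2 F2) :
    LSpec k e q (J1 ∪ J2) (FF k K e J1 J2 t F1 F2) := by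
  classical
  have hk : 0 < k := by have := P.hK; have := P.hKk; omega
  have G := P.glue
  have hu : eJ e (J1 ∪ J2) = eJ e J1 + eJ e J2 := eJ_union P.hd
  have ml : ∀ {j}, j ∈ J1 → j ∈ J1 ∪ J2 := fun h => Finset.mem_union_left _ h
  have mr : ∀ {j}, j ∈ J2 → j ∈ J1 ∪ J2 := fun h => Finset.mem_union_right _ h
  refine ⟨?_, ?_, ?_, ?_, ?_⟩
  · intro Γ Z hv h1 h2
    obtain ⟨n1, n2, f1, f2, b1, b2⟩ := P.forms (Z := Z) L1 L2 hv
    have hc := hv.cross P.hN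
    refine gF_top G f1 f2 (fun t ht => (hc t ht).w P.h) (fun t ht => (hc t ht).y P.h) ?_ ?_ ?_
    · exact L1.a Γ _ (hv.mono Finset.subset_union_left) (P.Z1c hc).1 (P.Z1c hc).2
    · exact L2.a Γ _ (hv.mono Finset.subset_union_right) (P.Z2c hc).1 (P.Z2c hc).2
    · rw [← hu, h1, h2]
  · intro Γ Z hv h1 h2
    obtain ⟨n1, n2, f1, f2, b1, b2⟩ := P.forms (Z := Z) L1 L2 hv
    have hc := hv.cross P.hN
    obtain ⟨W, Y', cW, cY, W0, -, -, hF, -⟩ := gF_data G (Z := Z) f1 f2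
      (fun t ht => (hc t ht).w P.h) (fun t ht => (hc t ht).y P.h)
    have := glue_conj G f1 f2 cY cW W0 b1 b2 n1 n2
    rw [hu, P.split hc, BB_union P.hd, FF, hF]
    exact this
  · intro R A hR hA
    rw [dg_union P.hd] at hR
    rw [hu, ← hR, BB_union P.hd] at hA
    obtain ⟨W, Y', A1, A2, cW, W0, cY, n1, n2, hgl⟩ := glue_inv G
      (P.form1 (P.h.eJ_dg R) (P.h.dg_eJ R)) (P.form2 (P.h.eJ_dg R) (P.h.dg_eJ R)) hA
    have f1 := form1_conj (sc_comm _) (P.form1 (P.h.eJ_dg R) (P.h.dg_eJ R)) n1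
    have f2 := form2_conj hk P.glue.e22 P.glue.eT P.glue.Te (sc_comm _)
      (P.form2 (P.h.eJ_dg R) (P.h.dg_eJ R)) n2
    obtain ⟨w, y, hw, hy, hAF, t1, t2⟩ := gF_repr G f1 f2 cW W0 cY hgl
    obtain ⟨Γ1, v1, hA1, hR1⟩ := L1.c _ A1 (P.h.dg_dg R) n1
    obtain ⟨Γ2, v2, hA2, hR2⟩ := L2.c _ A2 (P.h.dg_dg R) n2
    set Γ : Fin m → Fin m → ℕ → 𝓐 := fun j j' t =>
      if j ∈ J1 then (if j' ∈ J1 then Γ1 j j' t else e j' * w t * e j)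
      else (if j' ∈ J1 then sg j' j • (e j' * y t * e j) else Γ2 j j' t) with hΓ
    have dj : ∀ {j}, j ∈ J2 → j ∉ J1 := fun h h' => Finset.disjoint_left.1 P.hd h' h
    have g11 : ∀ j ∈ J1, ∀ j' ∈ J1, ∀ t, Γ j j' t = Γ1 j j' t := fun j hj j' hj' t => by
      simp [hΓ, hj, hj']
    have g22 : ∀ j ∈ J2, ∀ j' ∈ J2, ∀ t, Γ j j' t = Γ2 j j' t := fun j hj j' hj' t => by
      simp [hΓ, dj hj, dj hj']
    have g12 : ∀ j ∈ J1, ∀ j' ∈ J2, ∀ t, Γ j j' t = e j' * w t * e j := fun j hj j' hj' t => by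
      simp [hΓ, hj, dj hj']
    have g21 : ∀ j ∈ J2, ∀ j' ∈ J1, ∀ t, Γ j j' t = sg j' j • (e j' * y t * e j) := fun j hj j' hj' t => by
      simp [hΓ, dj hj, hj']
    have hc : ∀ t < K - 2, CrV e J1 J2 Γ t := by
      intro t _ j hj j' hj'
      rw [g12 j hj j' hj', g21 j' hj' j hj]
      refine ⟨⟨?_, ?_⟩, ?_, ?_⟩
      · rw [← mul_assoc, ← mul_assoc, P.h.self]
      · rw [mul_assoc, P.h.self]
      · rw [mul_smul_comm, ← mul_assoc, ← mul_assoc, P.h.self]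
      · rw [smul_mul_assoc, mul_assoc, P.h.self]
    have hwG : ∀ t, wG J1 J2 Γ t = w t := by
      intro t
      have : wG J1 J2 Γ t = eJ e J2 * w t * eJ e J1 := by
        rw [wG, eJ, eJ, Finset.sum_mul, Finset.sum_mul_sum, Finset.sum_comm]
        exact Finset.sum_congr rfl fun j hj => Finset.sum_congr rfl fun j' hj' => g12 j' hj' j hj t
      rw [this, (hw t).1, (hw t).2]
    have hyG : ∀ t, yG J1 J2 Γ t = y t := by
      intro t
      have : yG J1 J2 Γ t = eJ e J1 * y t * eJ e J2 := by
        rw [yG, eJ, eJ, Finset.sum_mul, Finset.sum_mul_sum]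
        refine Finset.sum_congr rfl fun j hj => Finset.sum_congr rfl fun j' hj' => ?_
        rw [g21 j' hj' j hj t, smul_smul, sg_sg, one_smul]
      rw [this, (hy t).1, (hy t).2]
    have z1 : Z1f K e J1 J2 Γ (cf A (k-1)) = cf A1 (k-1) := by
      rw [Z1f, t1]; simp only [hwG, hyG]
    have z2 : Z2f K e J1 J2 Γ (cf A (k-1)) = cf A2 (k-1) := by
      rw [Z2f, t2]; simp only [hwG, hyG]
    have mx1 : mX q J1 J1 Γ = mX q J1 J1 Γ1 :=
      Finset.sum_congr rfl fun j hj => Finset.sum_congr rfl fun j' hj' => Finset.sum_congr rfl fun t _ => by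
        rw [g11 j hj j' hj', g11 j' hj' j hj]
    have mx2 : mX q J2 J2 Γ = mX q J2 J2 Γ2 :=
      Finset.sum_congr rfl fun j hj => Finset.sum_congr rfl fun j' hj' => Finset.sum_congr rfl fun t _ => by
        rw [g22 j hj j' hj', g22 j' hj' j hj]
    refine ⟨Γ, ?_, ?_, ?_⟩
    · intro j hj j' hj' t ht
      rcases Finset.mem_union.1 hj with hj | hj <;> rcases Finset.mem_union.1 hj' with hj' | hj'
      · rw [g11 j hj j' hj']; exact v1 j hj j' hj' t ht
      · exact (hc t (by rwa [P.hN j hj j' hj'] at ht) j hj j' hj').1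
      · exact (hc t (by rwa [dq_symm, P.hN j' hj' j hj] at ht) j' hj' j hj).2
      · rw [g22 j hj j' hj']; exact v2 j hj j' hj' t ht
    · rw [FF, z1, z2, L1.loc (Γ' := Γ1) (fun j hj j' hj' t _ => g11 j hj j' hj' t),
        L2.loc (Γ' := Γ2) (fun j hj j' hj' t _ => g22 j hj j' hj' t), ← hA1, ← hA2,
        show wG J1 J2 Γ = w from funext hwG, show yG J1 J2 Γ = y from funext hyG]
      exact hAF
    · rw [P.split hc, z1, z2, mx1, mx2, ← hR1, ← hR2, hR]
  · intro 𝓑 Γ Γ' Z Z' he hg hZ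
    have m1 : (eJ e J1, eJ e J1) ∈ 𝓑 := mem_sum' fun j hj => he j (ml hj)
    have m2 : (eJ e J2, eJ e J2) ∈ 𝓑 := mem_sum' fun j hj => he j (mr hj)
    have mw : ∀ t < K - 2, (wG J1 J2 Γ t, wG J1 J2 Γ' t) ∈ 𝓑 := fun t ht =>
      mem_sum' fun j hj => mem_sum' fun j' hj' => hg j (ml hj) j' (mr hj') t (by rwa [P.hN j hj j' hj'])
    have my : ∀ t < K - 2, (yG J1 J2 Γ t, yG J1 J2 Γ' t) ∈ 𝓑 := fun t ht =>
      mem_sum' fun j hj => mem_sum' fun j' hj' => mem_smul' _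
        (hg j' (mr hj') j (ml hj) t (by rwa [dq_symm, P.hN j hj j' hj']))
    refine gF_E hk m1 m2 (mem_sum' fun j hj => mem_smul' _ (he j (mr hj))) ?_ ?_ mw my hZ P.hKk
    · refine L1.E 𝓑 _ _ _ _ (fun j hj => he j (ml hj))
        (fun j hj j' hj' t ht => hg j (ml hj) j' (ml hj') t ht) ?_
      exact mem_add' (mem_mul' (mem_mul' m1 hZ) m1) (mem_sum' fun t ht =>
        mem_mul' (my t (Finset.mem_range.1 ht)) (mw t (Finset.mem_range.1 ht)))
    · refine L2.E 𝓑 _ _ _ _ (fun j hj => he j (mr hj))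
        (fun j hj j' hj' t ht => hg j (mr hj) j' (mr hj') t ht) ?_
      exact mem_sub' (mem_mul' (mem_mul' m2 hZ) m2) (mem_sum' fun t ht =>
        mem_mul' (mw t (Finset.mem_range.1 ht)) (my t (Finset.mem_range.1 ht)))
  · intro 𝓑 Γ Γ' Z Z' hE hv hv' h1 h2 h1' h2' hI
    obtain ⟨-, -, f1, f2, -, -⟩ := P.forms (Z := Z) L1 L2 hv
    obtain ⟨-, -, f1', f2', -, -⟩ := P.forms (Z := Z') L1 L2 hv'
    have hc := hv.cross P.hN
    have hc' := hv'.cross P.hN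
    obtain ⟨W, Y', cW, cY, W0, hWd, hYd, hF, -⟩ := gF_data G (Z := Z) f1 f2
      (fun t ht => (hc t ht).w P.h) (fun t ht => (hc t ht).y P.h)
    obtain ⟨W', Y'', cW', cY', W0', hWd', hYd', hF', -⟩ := gF_data G (Z := Z') f1' f2'
      (fun t ht => (hc' t ht).w P.h) (fun t ht => (hc' t ht).y P.h)
    rw [FF, FF, hF, hF'] at hI
    have hlt : k - K < k := by have := P.hK; have := P.hKk; omega
    have mT : (∑ j ∈ J2, t j • e j, ∑ j ∈ J2, t j • e j) ∈ 𝓑 := by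
      have := hI (k-K) hlt
      rw [gl_T G cW W0 f1 f2 cY, gl_T G cW' W0' f1' f2' cY', cf_sc _ hlt, ← Algebra.smul_def, ← hu] at this
      have h3 := mem_sub' this (mem_smul' ((r.reflect k).coeff (k-K)) hE)
      simpa using h3
    have mS := idem_mem P.h t P.ht mT (fun c => c⁻¹)
    have m2 : (eJ e J2, eJ e J2) ∈ 𝓑 := by
      have := idem_mem P.h t P.ht mT (fun c => 1)
      rwa [← eJ_eq_smul] at this
    have m1 : (eJ e J1, eJ e J1) ∈ 𝓑 := by
      have := mem_sub' hE m2
      rw [hu] at this; simpa using this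
    obtain ⟨iW, iY, i1, i2⟩ := gl_G G (InB.sc _) m1 m2 mS mT cW W0 f1 f2 cY cW' W0' f1' f2' cY' hI
    obtain ⟨p1, p2⟩ := L1.G 𝓑 _ _ _ _ m1 (hv.mono Finset.subset_union_left)
      (hv'.mono Finset.subset_union_left) (P.Z1c hc).1 (P.Z1c hc).2 (P.Z1c hc').1 (P.Z1c hc').2 i1
    obtain ⟨q1, q2⟩ := L2.G 𝓑 _ _ _ _ m2 (hv.mono Finset.subset_union_right)
      (hv'.mono Finset.subset_union_right) (P.Z2c hc).1 (P.Z2c hc).2 (P.Z2c hc').1 (P.Z2c hc').2 i2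
    have mw : ∀ t < K - 2, (wG J1 J2 Γ t, wG J1 J2 Γ' t) ∈ 𝓑 := fun t ht => by
      have := iW (t+1) (by omega)
      rwa [hWd, hWd', gW_cf P.hKk ht, gW_cf P.hKk ht] at this
    have my : ∀ t < K - 2, (yG J1 J2 Γ t, yG J1 J2 Γ' t) ∈ 𝓑 := fun t ht => by
      have := iY (k-2-t) (by omega)
      rwa [← hYd, ← hYd', gY_cf P.hKk ht, gY_cf P.hKk ht] at this
    refine ⟨fun j hj => ?_, fun j hj j' hj' t ht => ?_⟩
    · rcases Finset.mem_union.1 hj with hj | hj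
      · exact p1 j hj
      · exact q1 j hj
    · rcases Finset.mem_union.1 hj with hj | hj <;> rcases Finset.mem_union.1 hj' with hj' | hj'
      · exact p2 j hj j' hj' t ht
      · rw [P.hN j hj j' hj'] at ht
        rw [← (hc t ht).wc P.h hj hj', ← (hc' t ht).wc P.h hj hj']
        exact mem_mul' (mem_mul' (q1 j' hj') (mw t ht)) (p1 j hj)
      · rw [dq_symm, P.hN j' hj' j hj] at ht
        have e1 : ∀ x : 𝓐, x = sg j' j • (sg j' j • x) := fun x => by rw [smul_smul, sg_sg, one_smul]
        rw [e1 (Γ j j' t), e1 (Γ' j j' t), ← (hc t ht).yc P.h hj' hj, ← (hc' t ht).yc P.h hj' hj]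
        exact mem_smul' _ (mem_mul' (mem_mul' (p1 j' hj') (my t ht)) (q1 j hj))
      · exact q2 j hj j' hj' t ht

theorem lspec_exists (hk : 0 < k) (h : Orth e) (hq0 : ∀ j, (q j).coeff 0 = 0)
    (hq1 : ∀ j, (q j).coeff 1 = 0) (hdeg : ∀ j, (q j).natDegree ≤ k)
    (hdist : ∀ j j', j ≠ j' → q j ≠ q j') :
    ∀ (N : ℕ) (J : Finset (Fin m)), J.card ≤ N → ∃ F, LSpec k e q J F := by
  classical
  intro N
  induction N with
  | zero => exact fun J hJ => ⟨_, lspec_base hk h hq1 (by omega)⟩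
  | succ N ih =>
    intro J hJ
    by_cases hJ1 : J.card ≤ 1
    · exact ⟨_, lspec_base hk h hq1 hJ1⟩
    obtain ⟨a, ha, b, hb, hab⟩ := Finset.one_lt_card.1 (not_le.1 hJ1)
    obtain ⟨⟨j1, j2⟩, hmem, hmax⟩ := Finset.exists_max_image (J ×ˢ J)
      (fun x => (q x.1 - q x.2).natDegree) ⟨(a, b), Finset.mem_product.2 ⟨ha, hb⟩⟩
    rw [Finset.mem_product] at hmem
    set K := (q j1 - q j2).natDegree with hKd
    have hmax' : ∀ i ∈ J, ∀ j ∈ J, (q i - q j).natDegree ≤ K := fun i hi j hj =>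
      hmax (i, j) (Finset.mem_product.2 ⟨hi, hj⟩)
    have hdeg2 : ∀ i j, i ≠ j → 2 ≤ (q i - q j).natDegree := by
      intro i j hij
      by_contra hlt
      apply hdist i j hij
      rw [← sub_eq_zero]
      have : (q i - q j).coeff (q i - q j).natDegree = 0 := by
        rw [coeff_sub]
        interval_cases hh : (q i - q j).natDegree
        · simp [hq0]
        · simp [hq1]
      exact leadingCoeff_eq_zero.1 this
    have hK2 : 2 ≤ K := (hdeg2 a b hab).trans (hmax' a ha b hb)
    have hKk : K ≤ k := (natDegree_sub_le _ _).trans (max_le (hdeg _) (hdeg _))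
    set J1 := J.filter (fun j => (q j).coeff K = (q j1).coeff K) with hJ1d
    set J2 := J.filter (fun j => ¬ (q j).coeff K = (q j1).coeff K) with hJ2d
    have hun : J1 ∪ J2 = J := Finset.filter_union_filter_not_eq _ _
    have hj1 : j1 ∈ J1 := Finset.mem_filter.2 ⟨hmem.1, rfl⟩
    have hj2 : j2 ∈ J2 := by
      refine Finset.mem_filter.2 ⟨hmem.2, fun hh => ?_⟩
      have h0 : (q j1 - q j2).leadingCoeff = 0 := by
        rw [leadingCoeff, ← hKd, coeff_sub, hh, sub_self]
      rw [leadingCoeff_eq_zero] at h0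
      rw [hKd, h0] at hK2; simp at hK2
    have hd : Disjoint J1 J2 := Finset.disjoint_filter_filter_not _ _ _
    have hhi : ∀ j ∈ J, ∀ l, K < l → (q j).coeff l = (q j1).coeff l := by
      intro j hj l hl
      have := coeff_eq_zero_of_natDegree_lt (lt_of_le_of_lt (hmax' j hj j1 hmem.1) hl)
      rwa [coeff_sub, sub_eq_zero] at this
    have P : Stp k K e q J1 J2 (q j1) (fun j => (q j).coeff K - (q j1).coeff K) := by
      refine ⟨h, hK2, hKk, hd, ?_, ?_, ?_, ?_, ?_⟩
      · intro j hj l hl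
        rcases hl.eq_or_lt with rfl | hl
        · exact (Finset.mem_filter.1 hj).2
        · exact hhi j (Finset.mem_filter.1 hj).1 l hl
      · exact fun j hj l hl => hhi j (Finset.mem_filter.1 hj).1 l hl
      · intro j hj; ring
      · exact fun j hj => sub_ne_zero.2 (Finset.mem_filter.1 hj).2
      · intro j hj j' hj'
        rw [dq]
        congr 1
        refine le_antisymm (hmax' j (Finset.mem_filter.1 hj).1 j' (Finset.mem_filter.1 hj').1) ?_
        apply le_natDegree_of_ne_zero
        rw [coeff_sub, (Finset.mem_filter.1 hj).2]
        exact sub_ne_zero.2 (Ne.symm (Finset.mem_filter.1 hj').2)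
    have hcard : J1.card + J2.card = J.card := by rw [← Finset.card_union_of_disjoint hd, hun]
    have c1 : 0 < J1.card := Finset.card_pos.2 ⟨_, hj1⟩
    have c2 : 0 < J2.card := Finset.card_pos.2 ⟨_, hj2⟩
    obtain ⟨F1, L1⟩ := ih J1 (by omega)
    obtain ⟨F2, L2⟩ := ih J2 (by omega)
    have := lspec_step P L1 L2
    rw [hun] at this
    exact ⟨_, this⟩

end locH


/-- Extended eigenvalue list. -/
def xiN (S : Setup) (i : Fin (S.p+1)) (j : Fin (S.m i)) : ℕ → ℂ :=
  fun l => if h : l < S.e i j then S.xi i j ⟨l, h⟩ else 0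

/-- Leg dimensions. -/
def DD (S : Setup) (i : Fin (S.p+1)) (j : Fin (S.m i)) : ℕ → ℕ
  | 0 => S.nn i j
  | κ+1 => ((((List.finRange (S.e i j)).take (κ + 1)).map
          fun l => S.R i j - S.xi i j l • 1).prod).rank

theorem take_PP (S : Setup) (i : Fin (S.p+1)) (j : Fin (S.m i)) (κ : ℕ) (h : κ ≤ S.e i j) :
    (((List.finRange (S.e i j)).take κ).map fun l => S.R i j - S.xi i j l • 1).prod
      = PP (S.R i j) (xiN S i j) κ := by
  induction κ with
  | zero => simp [PP]
  | succ κ ih =>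
    have hk : κ < S.e i j := by omega
    rw [List.take_add_one, List.map_append, List.prod_append, ih (by omega)]
    simp [PP, xiN, hk]

theorem PP_e (S : Setup) (i : Fin (S.p+1)) (j : Fin (S.m i)) (κ : ℕ) (h : S.e i j ≤ κ) :
    PP (S.R i j) (xiN S i j) κ = 0 := by
  induction κ, h using Nat.le_induction with
  | base =>
    rw [← take_PP S i j _ le_rfl, List.take_of_length_le (by simp)]
    exact S.hxi i j
  | succ κ _ ih => simp [PP, ih]

theorem DD_succ (S : Setup) (i : Fin (S.p+1)) (j : Fin (S.m i)) (κ : ℕ) :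
    DD S i j (κ+1) = (PP (S.R i j) (xiN S i j) (κ+1)).rank := by
  simp only [DD]
  by_cases h : κ + 1 ≤ S.e i j
  · rw [take_PP S i j _ h]
  · rw [PP_e S i j _ (by omega), List.take_of_length_le (by simp; omega), S.hxi i j]

theorem DD_ge (S : Setup) (i : Fin (S.p+1)) (j : Fin (S.m i)) (κ : ℕ) (h : S.e i j ≤ κ + 1) :
    DD S i j (κ+1) = 0 := by
  rw [DD_succ, PP_e S i j _ h, Matrix.rank_zero]

/-- Block inclusion. -/
def In0 (S : Setup) (i : Fin (S.p+1)) (j : Fin (S.m i)) : Matrix (Fin S.n) (Fin (S.nn i j)) ℂ :=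
  Matrix.of fun a x => if a = S.emb i ⟨j, x⟩ then 1 else 0

/-- Block projection. -/
def Pr0 (S : Setup) (i : Fin (S.p+1)) (j : Fin (S.m i)) : Matrix (Fin (S.nn i j)) (Fin S.n) ℂ :=
  Matrix.of fun x a => if a = S.emb i ⟨j, x⟩ then 1 else 0

theorem Pr_In_0 (S : Setup) (i : Fin (S.p+1)) (j : Fin (S.m i)) : Pr0 S i j * In0 S i j = 1 := by
  ext x y
  simp [Matrix.mul_apply, Pr0, In0, Matrix.one_apply, eq_comm]

theorem Pr_In_ne_0 (S : Setup) (i : Fin (S.p+1)) (j j' : Fin (S.m i)) (h : j ≠ j') :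
    Pr0 S i j * In0 S i j' = 0 := by
  ext x y
  simp [Matrix.mul_apply, Pr0, In0]
  exact fun h' => absurd h'.symm h

/-- Block inclusion. -/
def In (S : Setup) (i : Fin (S.p+1)) (j : Fin (S.m i)) : Matrix (Fin S.n) (Fin (DD S i j 0)) ℂ :=
  In0 S i j

/-- Block projection. -/
def Pr (S : Setup) (i : Fin (S.p+1)) (j : Fin (S.m i)) : Matrix (Fin (DD S i j 0)) (Fin S.n) ℂ :=
  Pr0 S i j

theorem Pr_In (S : Setup) (i : Fin (S.p+1)) (j : Fin (S.m i)) : Pr S i j * In S i j = 1 :=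
  Pr_In_0 S i j

theorem Pr_In_ne (S : Setup) (i : Fin (S.p+1)) (j j' : Fin (S.m i)) (h : j ≠ j') :
    Pr S i j * In S i j' = 0 := Pr_In_ne_0 S i j j' h

theorem sum_In_Pr (S : Setup) (i : Fin (S.p+1)) : ∑ j, In S i j * Pr S i j = 1 := by
  ext a b
  simp only [Matrix.sum_apply, Matrix.mul_apply, In, Pr]
  change ∑ j, ∑ x : Fin (S.nn i j), (if a = S.emb i ⟨j, x⟩ then (1:ℂ) else 0) * (if b = S.emb i ⟨j, x⟩ then 1 else 0) = _
  rw [← Fintype.sum_sigma (fun x : Σ j : Fin (S.m i), Fin (S.nn i j) =>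
    (if a = S.emb i ⟨x.1, x.2⟩ then (1:ℂ) else 0) * (if b = S.emb i ⟨x.1, x.2⟩ then 1 else 0))]
  rw [← Equiv.sum_comp (S.emb i).symm]
  simp [Matrix.one_apply]

/-- Block idempotents. -/
def eP (S : Setup) (i : Fin (S.p+1)) (j : Fin (S.m i)) : Matrix (Fin S.n) (Fin S.n) ℂ :=
  In S i j * Pr S i j

theorem eP_orth (S : Setup) (i : Fin (S.p+1)) : Orth (eP S i) := by
  intro j j'
  unfold eP
  by_cases h : j = j'
  · subst h
    rw [if_pos rfl, Matrix.mul_assoc, ← Matrix.mul_assoc (Pr S i j), Pr_In, Matrix.one_mul]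
  · rw [if_neg h, Matrix.mul_assoc, ← Matrix.mul_assoc (Pr S i j), Pr_In_ne _ _ _ _ h,
      Matrix.zero_mul, Matrix.mul_zero]

theorem eJ_univ (S : Setup) (i : Fin (S.p+1)) : eJ (eP S i) Finset.univ = 1 := sum_In_Pr S i

theorem eP_In (S : Setup) (i : Fin (S.p+1)) (j : Fin (S.m i)) : eP S i j * In S i j = In S i j := by
  rw [eP, Matrix.mul_assoc, Pr_In, Matrix.mul_one]
theorem Pr_eP (S : Setup) (i : Fin (S.p+1)) (j : Fin (S.m i)) : Pr S i j * eP S i j = Pr S i j := by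
  rw [eP, ← Matrix.mul_assoc, Pr_In, Matrix.one_mul]

theorem m_reg {S : Setup} {i : Fin (S.p+1)} (h : ¬ Iirr S i) : S.m i = 1 := by
  have := S.hm i
  simp only [Iirr, not_or] at h
  omega

theorem ne0_reg {S : Setup} {i : Fin (S.p+1)} (h : ¬ Iirr S i) : i ≠ 0 := by
  simp only [Iirr, not_or] at h
  exact h.2

theorem sub_reg {S : Setup} {i : Fin (S.p+1)} (h : ¬ Iirr S i) (j j' : Fin (S.m i)) : j = j' := by
  have := m_reg h
  ext; omega

theorem eP_reg {S : Setup} {i : Fin (S.p+1)} (h : ¬ Iirr S i) (j : Fin (S.m i)) :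
    In S i j * Pr S i j = 1 := by
  rw [← sum_In_Pr S i, Finset.sum_eq_single j]
  · intro b _ hb; exact absurd (sub_reg h b j) hb
  · simp

/-! ### accessors of representations -/

/-- Arrow matrices with natural number labels. -/
def fN {S : Setup} {β : V S → ℕ} (M : Rep S β) (a b : V S) (t : ℕ) :
    Matrix (Fin (β b)) (Fin (β a)) ℂ := if h : t < arr S a b then M.f a b ⟨t, h⟩ else 0
/-- Reverse arrow matrices with natural number labels. -/
def gN {S : Setup} {β : V S → ℕ} (M : Rep S β) (a b : V S) (t : ℕ) :
    Matrix (Fin (β a)) (Fin (β b)) ℂ := if h : t < arr S a b then M.g a b ⟨t, h⟩ else 0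

theorem fN_fin {S : Setup} {β : V S → ℕ} (M : Rep S β) (a b : V S) (ρ : Fin (arr S a b)) :
    M.f a b ρ = fN M a b ρ := by simp [fN]
theorem gN_fin {S : Setup} {β : V S → ℕ} (M : Rep S β) (a b : V S) (ρ : Fin (arr S a b)) :
    M.g a b ρ = gN M a b ρ := by simp [gN]
theorem fN_ge {S : Setup} {β : V S → ℕ} (M : Rep S β) (a b : V S) (t : ℕ) (h : ¬ t < arr S a b) :
    fN M a b t = 0 := by simp [fN, h]
theorem gN_ge {S : Setup} {β : V S → ℕ} (M : Rep S β) (a b : V S) (t : ℕ) (h : ¬ t < arr S a b) :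
    gN M a b t = 0 := by simp [gN, h]

theorem moment_N {S : Setup} {β : V S → ℕ} (M : Rep S β) (c : V S) :
    moment S M c = (∑ a : V S, ∑ t ∈ Finset.range (arr S a c), fN M a c t * gN M a c t)
    - ∑ b : V S, ∑ t ∈ Finset.range (arr S c b), gN M c b t * fN M c b t := by
  unfold moment
  simp only [Finset.sum_range, fN_fin, gN_fin]

/-- vertex `[i,j,κ+1]` -/
abbrev vR (S : Setup) (i : Fin (S.p+1)) (j : Fin (S.m i)) (κ : ℕ) (h : κ < S.e i j - 1) : V S :=
  Sum.inr ⟨i, j, ⟨κ, h⟩⟩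

/-! ### arrow counts -/

theorem arr_intra (S : Setup) (i : {i : Fin (S.p+1) // Iirr S i}) (j j' : Fin (S.m i.1)) :
    arr S (vI S i j) (vI S i j') = if j < j' then dcnt S i.1 j j' else 0 := by
  have h : ¬ (i.1 = 0 ∧ i.1 ≠ 0) := by tauto
  simp only [vI, arr, if_neg h, zero_add, dif_pos]
  rfl

theorem arr_cross (S : Setup) (i : {i : Fin (S.p+1) // Iirr S i}) (hi : i.1 ≠ 0)
    (j : Fin (S.m 0)) (j' : Fin (S.m i.1)) : arr S (v0 S j) (vI S i j') = 1 := by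
  have h : i0 S ≠ i := by rintro rfl; exact hi rfl
  have h' : (i0 S).1 = 0 ∧ i.1 ≠ 0 := ⟨rfl, hi⟩
  simp only [v0, vI, arr, dif_neg h, if_pos h']

theorem arr_bb (S : Setup) (i i' : {i : Fin (S.p+1) // Iirr S i}) (j : Fin (S.m i.1))
    (j' : Fin (S.m i'.1)) (h : i ≠ i') (h' : ¬ (i.1 = 0 ∧ i'.1 ≠ 0)) :
    arr S (vI S i j) (vI S i' j') = 0 := by
  simp only [vI, arr, dif_neg h, if_neg h']

theorem arr_br (S : Setup) (b : Vb S) (r : Vr S) : arr S (.inl b) (.inr r) = 0 := rfl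

theorem arr_rb (S : Setup) (i : Fin (S.p+1)) (hi : Iirr S i) (j : Fin (S.m i)) (κ : ℕ)
    (h : κ < S.e i j - 1) (b : Vb S) :
    arr S (vR S i j κ h) (.inl b) = if b = ⟨⟨i, hi⟩, j⟩ ∧ κ = 0 then 1 else 0 := by
  obtain ⟨⟨i', hi'⟩, j'⟩ := b
  simp only [arr, hi, not_true, false_and, if_false, add_zero]
  congr 1
  apply propext
  constructor
  · rintro ⟨h1, h2, h3⟩
    subst h1
    exact ⟨by rw [Fin.ext h2], h3⟩
  · rintro ⟨h1, h3⟩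
    cases h1
    exact ⟨rfl, rfl, h3⟩

theorem arr_rb_reg (S : Setup) (i : Fin (S.p+1)) (hi : ¬ Iirr S i) (j : Fin (S.m i)) (κ : ℕ)
    (h : κ < S.e i j - 1) (b : Vb S) :
    arr S (vR S i j κ h) (.inl b) = if b.1.1 = 0 ∧ κ = 0 then 1 else 0 := by
  obtain ⟨⟨i', hi'⟩, j'⟩ := b
  have h1 : i ≠ i' := by rintro rfl; exact hi hi'
  have h2 : (j:ℕ) = 0 := by have := m_reg hi; omega
  simp [arr, hi, h1, h2]

theorem arr_rr (S : Setup) (i : Fin (S.p+1)) (j : Fin (S.m i)) (κ : ℕ)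
    (h : κ < S.e i j - 1) (i' : Fin (S.p+1)) (j' : Fin (S.m i')) (κ' : ℕ)
    (h' : κ' < S.e i' j' - 1) :
    arr S (vR S i j κ h) (vR S i' j' κ' h') =
      if i = i' ∧ (j:ℕ) = (j':ℕ) ∧ κ = κ' + 1 then 1 else 0 := rfl

theorem arr_cases (S : Setup) (a b : V S) (t : ℕ) (ht : t < arr S a b) :
    (∃ (i : {i : Fin (S.p+1) // Iirr S i}) (j : Fin (S.m 0)) (j' : Fin (S.m i.1)),
      i.1 ≠ 0 ∧ a = v0 S j ∧ b = vI S i j' ∧ t = 0) ∨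
    (∃ (i : {i : Fin (S.p+1) // Iirr S i}) (j j' : Fin (S.m i.1)),
      j < j' ∧ a = vI S i j ∧ b = vI S i j' ∧ t < dcnt S i.1 j j') ∨
    (∃ (i : Fin (S.p+1)) (hi : Iirr S i) (j : Fin (S.m i)) (h : 0 < S.e i j - 1),
      a = vR S i j 0 h ∧ b = vI S ⟨i, hi⟩ j ∧ t = 0) ∨
    (∃ (i : Fin (S.p+1)) (_ : ¬ Iirr S i) (j : Fin (S.m i)) (h : 0 < S.e i j - 1) (j' : Fin (S.m 0)),
      a = vR S i j 0 h ∧ b = v0 S j' ∧ t = 0) ∨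
    (∃ (i : Fin (S.p+1)) (j : Fin (S.m i)) (κ : ℕ) (h : κ + 1 < S.e i j - 1),
      a = vR S i j (κ+1) h ∧ b = vR S i j κ (by omega) ∧ t = 0) := by
  rcases a with ⟨i, j⟩ | ⟨i, j, κ, hκ⟩
  · rcases b with ⟨i', j'⟩ | r
    · by_cases h : i = i'
      · subst h
        have := arr_intra S i j j'
        simp only [vI] at this
        rw [this] at ht
        right; left
        split_ifs at ht with hj
        · exact ⟨i, j, j', hj, rfl, rfl, ht⟩
        · omega
      · by_cases h' : i.1 = 0 ∧ i'.1 ≠ 0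
        · left
          obtain ⟨i, hi⟩ := i
          obtain ⟨rfl, h'⟩ := h'
          have h2 : arr S (.inl ⟨⟨0, hi⟩, j⟩) (.inl ⟨i', j'⟩) = 1 := arr_cross S i' h' j j'
          rw [h2] at ht
          exact ⟨i', j, j', h', rfl, rfl, by omega⟩
        · have := arr_bb S i i' j j' h h'
          simp only [vI] at this
          omega
    · rw [arr_br] at ht; omega
  · rcases b with b | ⟨i', j', κ', hκ'⟩
    · by_cases hi : Iirr S i
      · rw [arr_rb S i hi j κ hκ b] at ht
        split_ifs at ht with h
        · obtain ⟨rfl, rfl⟩ := h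
          right; right; left
          exact ⟨i, hi, j, hκ, rfl, rfl, by omega⟩
        · omega
      · rw [arr_rb_reg S i hi j κ hκ b] at ht
        split_ifs at ht with h
        · obtain ⟨⟨i', hi'⟩, j'⟩ := b
          obtain ⟨h1, rfl⟩ := h
          simp only at h1
          subst h1
          right; right; right; left
          exact ⟨i, hi, j, hκ, j', rfl, rfl, by omega⟩
        · omega
    · have := arr_rr S i j κ hκ i' j' κ' hκ'
      rw [this] at ht
      split_ifs at ht with h
      · obtain ⟨rfl, h2, rfl⟩ := h
        have h2 := Fin.ext h2
        subst h2
        right; right; right; right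
        exact ⟨i, j, κ', hκ, rfl, rfl, by omega⟩
      · omega



section quiB
variable {S : Setup} (M : Rep S (alN S))

theorem blk (S : Setup) (i i' : Fin (S.p+1))
    (X : ∀ (a : Fin (S.m i)) (b : Fin (S.m i')), Matrix (Fin (DD S i' b 0)) (Fin (DD S i a 0)) ℂ)
    (a : Fin (S.m i)) (b : Fin (S.m i')) :
    Pr S i' b * (∑ a', ∑ b', In S i' b' * X a' b' * Pr S i a') * In S i a = X a b := by
  rw [Matrix.mul_sum, Matrix.sum_mul, Finset.sum_eq_single a]
  · rw [Matrix.mul_sum, Matrix.sum_mul, Finset.sum_eq_single b]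
    · rw [Matrix.mul_assoc, Matrix.mul_assoc, Pr_In, Matrix.mul_one, ← Matrix.mul_assoc, Pr_In,
        Matrix.one_mul]
    · intro b' _ hb
      rw [Matrix.mul_assoc (In S i' b'), ← Matrix.mul_assoc (Pr S i' b), Pr_In_ne _ _ _ _ hb.symm,
        Matrix.zero_mul, Matrix.zero_mul]
    · simp
  · intro a' _ ha
    rw [Matrix.mul_sum, Matrix.sum_mul]
    refine Finset.sum_eq_zero fun b' _ => ?_
    rw [Matrix.mul_assoc, Matrix.mul_assoc, Pr_In_ne _ _ _ _ ha, Matrix.mul_zero, Matrix.mul_zero]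
  · simp

/-- typed accessors -/
def aP (i : Fin (S.p+1)) (hi : Iirr S i) (j : Fin (S.m 0)) (j' : Fin (S.m i)) :
    Matrix (Fin (DD S i j' 0)) (Fin (DD S 0 j 0)) ℂ := fN M (v0 S j) (vI S ⟨i, hi⟩ j') 0
/-- typed accessors -/
def aQ (i : Fin (S.p+1)) (hi : Iirr S i) (j : Fin (S.m 0)) (j' : Fin (S.m i)) :
    Matrix (Fin (DD S 0 j 0)) (Fin (DD S i j' 0)) ℂ := gN M (v0 S j) (vI S ⟨i, hi⟩ j') 0
/-- typed accessors -/
def aF (i : Fin (S.p+1)) (hi : Iirr S i) (j j' : Fin (S.m i)) (t : ℕ) :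
    Matrix (Fin (DD S i j' 0)) (Fin (DD S i j 0)) ℂ := fN M (vI S ⟨i, hi⟩ j) (vI S ⟨i, hi⟩ j') t
/-- typed accessors -/
def aG (i : Fin (S.p+1)) (hi : Iirr S i) (j j' : Fin (S.m i)) (t : ℕ) :
    Matrix (Fin (DD S i j' 0)) (Fin (DD S i j 0)) ℂ := gN M (vI S ⟨i, hi⟩ j') (vI S ⟨i, hi⟩ j) t
/-- typed accessors -/
def aL (i : Fin (S.p+1)) (j : Fin (S.m i)) (h : 0 < S.e i j - 1) (i' : Fin (S.p+1))
    (hi : Iirr S i') (j' : Fin (S.m i')) :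
    Matrix (Fin (DD S i' j' 0)) (Fin (DD S i j 1)) ℂ := fN M (vR S i j 0 h) (vI S ⟨i', hi⟩ j') 0
/-- typed accessors -/
def aR (i : Fin (S.p+1)) (j : Fin (S.m i)) (h : 0 < S.e i j - 1) (i' : Fin (S.p+1))
    (hi : Iirr S i') (j' : Fin (S.m i')) :
    Matrix (Fin (DD S i j 1)) (Fin (DD S i' j' 0)) ℂ := gN M (vR S i j 0 h) (vI S ⟨i', hi⟩ j') 0
/-- typed accessors -/
def aLL (i : Fin (S.p+1)) (j : Fin (S.m i)) (κ : ℕ) (h : κ + 1 < S.e i j - 1) :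
    Matrix (Fin (DD S i j (κ+1))) (Fin (DD S i j (κ+2))) ℂ :=
  fN M (vR S i j (κ+1) h) (vR S i j κ (by omega)) 0
/-- typed accessors -/
def aRR (i : Fin (S.p+1)) (j : Fin (S.m i)) (κ : ℕ) (h : κ + 1 < S.e i j - 1) :
    Matrix (Fin (DD S i j (κ+2))) (Fin (DD S i j (κ+1))) ℂ :=
  gN M (vR S i j (κ+1) h) (vR S i j κ (by omega)) 0

/-- cross map -/
def mP (i : Fin (S.p+1)) : Matrix (Fin S.n) (Fin S.n) ℂ :=
  if h : Iirr S i ∧ i ≠ 0 then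
    ∑ j : Fin (S.m 0), ∑ j' : Fin (S.m i),
      In S i j' * aP M i h.1 j j' * Pr S 0 j
  else 1

/-- reverse cross map -/
def mQ (i : Fin (S.p+1)) : Matrix (Fin S.n) (Fin S.n) ℂ :=
  if h : Iirr S i ∧ i ≠ 0 then
    ∑ j' : Fin (S.m i), ∑ j : Fin (S.m 0),
      In S 0 j * aQ M i h.1 j j' * Pr S i j'
  else 0

/-- intra maps -/
def mG (i : Fin (S.p+1)) (j j' : Fin (S.m i)) (t : ℕ) : Matrix (Fin S.n) (Fin S.n) ℂ :=
  if h : Iirr S i then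
    if j < j' then
      In S i j' * aF M i h j j' t * Pr S i j
    else
      In S i j' * aG M i h j j' t * Pr S i j
  else 0

/-- leg maps -/
def mf (i : Fin (S.p+1)) (j : Fin (S.m i)) :
    ∀ κ, Matrix (Fin (DD S i j κ)) (Fin (DD S i j (κ+1))) ℂ
  | 0 => if h : 0 < S.e i j - 1 then
      (if hi : Iirr S i then
        aL M i j h i hi j
      else Pr S i j * ∑ j', In S 0 j' * aL M i j h 0 (i0 S).2 j')
      else 0
  | κ+1 => if h : κ + 1 < S.e i j - 1 then
      aLL M i j κ h
      else 0

/-- reverse leg maps -/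
def mg (i : Fin (S.p+1)) (j : Fin (S.m i)) :
    ∀ κ, Matrix (Fin (DD S i j (κ+1))) (Fin (DD S i j κ)) ℂ
  | 0 => if h : 0 < S.e i j - 1 then
      (if hi : Iirr S i then
        aR M i j h i hi j
      else (∑ j', aR M i j h 0 (i0 S).2 j' * Pr S 0 j') * In S i j)
      else 0
  | κ+1 => if h : κ + 1 < S.e i j - 1 then
      aRR M i j κ h
      else 0

/-! extraction -/

theorem ex_P (i : {i : Fin (S.p+1) // Iirr S i}) (hi : i.1 ≠ 0) (j : Fin (S.m 0))
    (j' : Fin (S.m i.1)) :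
    fN M (v0 S j) (vI S i j') 0 = Pr S i.1 j' * mP M i.1 * In S 0 j := by
  rw [mP, dif_pos ⟨i.2, hi⟩, blk S 0 i.1 (aP M i.1 i.2) j j', aP]

theorem ex_Q (i : {i : Fin (S.p+1) // Iirr S i}) (hi : i.1 ≠ 0) (j : Fin (S.m 0))
    (j' : Fin (S.m i.1)) :
    gN M (v0 S j) (vI S i j') 0 = Pr S 0 j * mQ M i.1 * In S i.1 j' := by
  rw [mQ, dif_pos ⟨i.2, hi⟩, blk S i.1 0 (fun j' j => aQ M i.1 i.2 j j') j' j, aQ]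

theorem pr_mul_in {i : Fin (S.p+1)} {j j' : Fin (S.m i)}
    (X : Matrix (Fin (DD S i j' 0)) (Fin (DD S i j 0)) ℂ) :
    Pr S i j' * (In S i j' * X * Pr S i j) * In S i j = X := by
  rw [Matrix.mul_assoc, Matrix.mul_assoc, Pr_In, Matrix.mul_one, ← Matrix.mul_assoc, Pr_In,
        Matrix.one_mul]

theorem ex_Gf (i : {i : Fin (S.p+1) // Iirr S i}) (j j' : Fin (S.m i.1)) (h : j < j') (t : ℕ) :
    fN M (vI S i j) (vI S i j') t = Pr S i.1 j' * mG M i.1 j j' t * In S i.1 j := by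
  rw [mG, dif_pos i.2, if_pos h, pr_mul_in]
  rfl

theorem ex_Gg (i : {i : Fin (S.p+1) // Iirr S i}) (j j' : Fin (S.m i.1)) (h : j < j') (t : ℕ) :
    gN M (vI S i j) (vI S i j') t = Pr S i.1 j * mG M i.1 j' j t * In S i.1 j' := by
  rw [mG, dif_pos i.2, if_neg (by omega), pr_mul_in]
  rfl

theorem ex_f0 (i : Fin (S.p+1)) (hi : Iirr S i) (j : Fin (S.m i)) (h : 0 < S.e i j - 1) :
    fN M (vR S i j 0 h) (vI S ⟨i, hi⟩ j) 0 = mf M i j 0 := by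
  rw [mf, dif_pos h, dif_pos hi]; rfl
theorem ex_g0 (i : Fin (S.p+1)) (hi : Iirr S i) (j : Fin (S.m i)) (h : 0 < S.e i j - 1) :
    gN M (vR S i j 0 h) (vI S ⟨i, hi⟩ j) 0 = mg M i j 0 := by
  rw [mg, dif_pos h, dif_pos hi]; rfl

theorem ex_f0r (i : Fin (S.p+1)) (hi : ¬ Iirr S i) (j : Fin (S.m i)) (h : 0 < S.e i j - 1)
    (j' : Fin (S.m 0)) :
    fN M (vR S i j 0 h) (v0 S j') 0 = Pr S 0 j' * (In S i j * mf M i j 0) := by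
  rw [mf, dif_pos h, dif_neg hi, ← Matrix.mul_assoc (In S i j), eP_reg hi, Matrix.one_mul,
    Matrix.mul_sum, Finset.sum_eq_single j']
  · rw [← Matrix.mul_assoc, Pr_In, Matrix.one_mul]
    rfl
  · intro b _ hb
    rw [← Matrix.mul_assoc, Pr_In_ne _ _ _ _ hb.symm, Matrix.zero_mul]
  · simp

theorem ex_g0r (i : Fin (S.p+1)) (hi : ¬ Iirr S i) (j : Fin (S.m i)) (h : 0 < S.e i j - 1)
    (j' : Fin (S.m 0)) :
    gN M (vR S i j 0 h) (v0 S j') 0 = (mg M i j 0 * Pr S i j) * In S 0 j' := by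
  rw [mg, dif_pos h, dif_neg hi, Matrix.mul_assoc _ (In S i j), eP_reg hi, Matrix.mul_one,
    Matrix.sum_mul, Finset.sum_eq_single j']
  · rw [Matrix.mul_assoc, Pr_In, Matrix.mul_one]
    rfl
  · intro b _ hb
    rw [Matrix.mul_assoc, Pr_In_ne _ _ _ _ hb, Matrix.mul_zero]
  · simp

theorem ex_f (i : Fin (S.p+1)) (j : Fin (S.m i)) (κ : ℕ) (h : κ + 1 < S.e i j - 1) :
    fN M (vR S i j (κ+1) h) (vR S i j κ (by omega)) 0 = mf M i j (κ+1) := by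
  rw [mf, dif_pos h]; rfl
theorem ex_g (i : Fin (S.p+1)) (j : Fin (S.m i)) (κ : ℕ) (h : κ + 1 < S.e i j - 1) :
    gN M (vR S i j (κ+1) h) (vR S i j κ (by omega)) 0 = mg M i j (κ+1) := by
  rw [mg, dif_pos h]; rfl

theorem mat_ext0 {a b : ℕ} (hb : b = 0) (X Y : Matrix (Fin a) (Fin b) ℂ) : X = Y := by
  subst hb; ext x y; exact y.elim0
theorem mat_ext0' {a b : ℕ} (ha : a = 0) (X Y : Matrix (Fin a) (Fin b) ℂ) : X = Y := by
  subst ha; ext x y; exact x.elim0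

theorem mG_val (i : Fin (S.p+1)) (j j' : Fin (S.m i)) (t : ℕ) :
    eP S i j' * mG M i j j' t = mG M i j j' t ∧ mG M i j j' t * eP S i j = mG M i j j' t := by
  unfold mG
  split_ifs
  · constructor
    · rw [← Matrix.mul_assoc, ← Matrix.mul_assoc, eP_In]
    · rw [Matrix.mul_assoc, Pr_eP]
  · constructor
    · rw [← Matrix.mul_assoc, ← Matrix.mul_assoc, eP_In]
    · rw [Matrix.mul_assoc, Pr_eP]
  · simp

theorem mG_Val (i : Fin (S.p+1)) : Val (eP S i) (S.q i) Finset.univ (mG M i) :=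
  fun j _ j' _ t _ => mG_val M i j j' t

/-! leg sums -/
theorem legIrr (i : Fin (S.p+1)) (hi : Iirr S i) (j : Fin (S.m i)) :
    ∑ κ : Fin (S.e i j - 1), ∑ t ∈ Finset.range (arr S (Sum.inr ⟨i, j, κ⟩) (vI S ⟨i, hi⟩ j)),
      fN M (Sum.inr ⟨i, j, κ⟩) (vI S ⟨i, hi⟩ j) t * gN M (Sum.inr ⟨i, j, κ⟩) (vI S ⟨i, hi⟩ j) t
    = mf M i j 0 * mg M i j 0 := by
  by_cases h : 0 < S.e i j - 1
  · rw [Finset.sum_eq_single ⟨0, h⟩]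
    · have := arr_rb S i hi j 0 h ⟨⟨i, hi⟩, j⟩
      simp only [and_self, if_true] at this
      rw [show arr S (Sum.inr ⟨i, j, ⟨0, h⟩⟩) (vI S ⟨i, hi⟩ j) = 1 from this]
      rw [Finset.sum_range_one]
      rw [show fN M (Sum.inr ⟨i, j, ⟨0, h⟩⟩) (vI S ⟨i, hi⟩ j) 0 = _ from ex_f0 M i hi j h,
        show gN M (Sum.inr ⟨i, j, ⟨0, h⟩⟩) (vI S ⟨i, hi⟩ j) 0 = _ from ex_g0 M i hi j h]
      rfl
    · rintro ⟨κ, hκ⟩ _ hne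
      have := arr_rb S i hi j κ hκ ⟨⟨i, hi⟩, j⟩
      rw [if_neg (by rintro ⟨-, rfl⟩; exact hne rfl)] at this
      rw [show arr S (Sum.inr ⟨i, j, ⟨κ, hκ⟩⟩) (vI S ⟨i, hi⟩ j) = 0 from this]
      simp
    · simp
  · have : IsEmpty (Fin (S.e i j - 1)) := ⟨fun x => by have := x.2; omega⟩
    rw [Finset.univ_eq_empty, Finset.sum_empty, mf, dif_neg h, Matrix.zero_mul]
    rfl

theorem legIrr0 (i : Fin (S.p+1)) (hi : Iirr S i) (j : Fin (S.m i)) (b : Vb S)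
    (hb : b ≠ ⟨⟨i, hi⟩, j⟩) (κ : Fin (S.e i j - 1)) :
    arr S (Sum.inr ⟨i, j, κ⟩) (Sum.inl b) = 0 := by
  have := arr_rb S i hi j κ.1 κ.2 b
  rwa [if_neg (fun h => hb h.1)] at this

theorem legReg (i : Fin (S.p+1)) (hi : ¬ Iirr S i) (j : Fin (S.m i)) (j' : Fin (S.m 0)) :
    ∑ κ : Fin (S.e i j - 1), ∑ t ∈ Finset.range (arr S (Sum.inr ⟨i, j, κ⟩) (v0 S j')),
      fN M (Sum.inr ⟨i, j, κ⟩) (v0 S j') t * gN M (Sum.inr ⟨i, j, κ⟩) (v0 S j') t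
    = Pr S 0 j' * (In S i j * (mf M i j 0 * mg M i j 0) * Pr S i j) * In S 0 j' := by
  by_cases h : 0 < S.e i j - 1
  · rw [Finset.sum_eq_single ⟨0, h⟩]
    · have := arr_rb_reg S i hi j 0 h ⟨i0 S, j'⟩
      rw [if_pos ⟨rfl, rfl⟩] at this
      rw [show arr S (Sum.inr ⟨i, j, ⟨0, h⟩⟩) (v0 S j') = 1 from this]
      rw [Finset.sum_range_one]
      rw [show fN M (Sum.inr ⟨i, j, ⟨0, h⟩⟩) (v0 S j') 0 = _ from ex_f0r M i hi j h j',
        show gN M (Sum.inr ⟨i, j, ⟨0, h⟩⟩) (v0 S j') 0 = _ from ex_g0r M i hi j h j']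
      change (Pr S 0 j' * (In S i j * mf M i j 0)) * (mg M i j 0 * Pr S i j * In S 0 j') = _
      simp only [Matrix.mul_assoc]
    · rintro ⟨κ, hκ⟩ _ hne
      have := arr_rb_reg S i hi j κ hκ ⟨i0 S, j'⟩
      rw [if_neg (by rintro ⟨-, rfl⟩; exact hne rfl)] at this
      rw [show arr S (Sum.inr ⟨i, j, ⟨κ, hκ⟩⟩) (v0 S j') = 0 from this]
      simp
    · simp
  · have : IsEmpty (Fin (S.e i j - 1)) := ⟨fun x => by have := x.2; omega⟩
    rw [Finset.univ_eq_empty, Finset.sum_empty, mf, dif_neg h, Matrix.zero_mul, Matrix.mul_zero,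
      Matrix.zero_mul, Matrix.mul_zero, Matrix.zero_mul]
    rfl

theorem legReg0 (i : Fin (S.p+1)) (hi : ¬ Iirr S i) (j : Fin (S.m i)) (b : Vb S)
    (hb : b.1.1 ≠ 0) (κ : Fin (S.e i j - 1)) :
    arr S (Sum.inr ⟨i, j, κ⟩) (Sum.inl b) = 0 := by
  have := arr_rb_reg S i hi j κ.1 κ.2 b
  rwa [if_neg (fun h => hb h.1)] at this

end quiB


section quiC
variable {S : Setup} (M : Rep S (alN S))

theorem Pr_eP_ne (S : Setup) (i : Fin (S.p+1)) (j j' : Fin (S.m i)) (h : j ≠ j') :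
    Pr S i j * eP S i j' = 0 := by
  rw [eP, ← Matrix.mul_assoc, Pr_In_ne _ _ _ _ h, Matrix.zero_mul]

theorem Pr_mX (i : Fin (S.p+1)) (j' : Fin (S.m i)) :
    Pr S i j' * mX (S.q i) Finset.univ Finset.univ (mG M i) * In S i j' =
      ∑ j, ∑ t ∈ Finset.range (dq (S.q i) j j'),
        sg j j' • (Pr S i j' * (mG M i j j' t * mG M i j' j t) * In S i j') := by
  unfold mX
  rw [Matrix.mul_sum, Matrix.sum_mul]
  refine Finset.sum_congr rfl fun j _ => ?_
  rw [Matrix.mul_sum, Matrix.sum_mul, Finset.sum_eq_single j']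
  · rw [Matrix.mul_sum, Matrix.sum_mul]
    refine Finset.sum_congr rfl fun t _ => ?_
    rw [Matrix.mul_smul, Matrix.smul_mul]
  · intro b _ hb
    rw [Matrix.mul_sum, Matrix.sum_mul]
    refine Finset.sum_eq_zero fun t _ => ?_
    rw [← (mG_val M i j b t).1, Matrix.mul_smul, Matrix.mul_assoc (eP S i b),
      ← Matrix.mul_assoc (Pr S i j'), Pr_eP_ne _ _ _ _ hb.symm]
    simp
  · simp

theorem pgi (i : Fin (S.p+1)) (j j' : Fin (S.m i)) (t : ℕ) :
    (Pr S i j' * mG M i j j' t * In S i j) * (Pr S i j * mG M i j' j t * In S i j') =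
      Pr S i j' * (mG M i j j' t * mG M i j' j t) * In S i j' := by
  conv_rhs => rw [← (mG_val M i j j' t).2, eP]
  simp only [Matrix.mul_assoc]

theorem intra (i : {i : Fin (S.p+1) // Iirr S i}) (j' : Fin (S.m i.1)) :
    (∑ j, ∑ t ∈ Finset.range (arr S (vI S i j) (vI S i j')),
        fN M (vI S i j) (vI S i j') t * gN M (vI S i j) (vI S i j') t)
      - (∑ j, ∑ t ∈ Finset.range (arr S (vI S i j') (vI S i j)),
        gN M (vI S i j') (vI S i j) t * fN M (vI S i j') (vI S i j) t)
      = Pr S i.1 j' * mX (S.q i.1) Finset.univ Finset.univ (mG M i.1) * In S i.1 j' := by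
  rw [Pr_mX, ← Finset.sum_sub_distrib]
  refine Finset.sum_congr rfl fun j _ => ?_
  rw [arr_intra, arr_intra]
  rcases lt_trichotomy j j' with h | h | h
  · rw [if_pos h, if_neg (by omega), Finset.range_zero, Finset.sum_empty, sub_zero]
    refine Finset.sum_congr rfl fun t _ => ?_
    rw [ex_Gf M i j j' h, ex_Gg M i j j' h]
    refine (pgi M i.1 j j' t).trans ?_
    simp [sg, h]
  · subst h
    rw [if_neg (by omega), Finset.range_zero, Finset.sum_empty, Finset.sum_empty, sub_zero]
    rw [dq_self]; simp; rfl
  · rw [if_pos h, if_neg (by omega), Finset.range_zero, Finset.sum_empty, zero_sub, dq_symm,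
      ← Finset.sum_neg_distrib]
    refine Finset.sum_congr rfl fun t _ => ?_
    rw [ex_Gf M i j' j h, ex_Gg M i j' j h]
    refine (congrArg Neg.neg (pgi M i.1 j j' t)).trans ?_
    simp [sg, not_lt_of_gt h]
    rfl

theorem sum_mid {a b : ℕ} (i : Fin (S.p+1)) (X : Matrix (Fin a) (Fin S.n) ℂ)
    (Y : Matrix (Fin S.n) (Fin b) ℂ) :
    ∑ j, (X * In S i j) * (Pr S i j * Y) = X * Y := by
  have : ∀ j, (X * In S i j) * (Pr S i j * Y) = X * (In S i j * Pr S i j) * Y := by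
    intro j; simp only [Matrix.mul_assoc]
  simp only [this]
  rw [← Matrix.sum_mul, ← Matrix.mul_sum, sum_In_Pr, Matrix.mul_one]

theorem crossIn (i : {i : Fin (S.p+1) // Iirr S i}) (hi : i.1 ≠ 0) (j' : Fin (S.m i.1)) :
    (∑ j, ∑ t ∈ Finset.range (arr S (v0 S j) (vI S i j')),
        fN M (v0 S j) (vI S i j') t * gN M (v0 S j) (vI S i j') t)
      = Pr S i.1 j' * (mP M i.1 * mQ M i.1) * In S i.1 j' := by
  have : Pr S i.1 j' * (mP M i.1 * mQ M i.1) * In S i.1 j' =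
    (Pr S i.1 j' * mP M i.1) * (mQ M i.1 * In S i.1 j') := by simp only [Matrix.mul_assoc]
  rw [this, ← sum_mid 0]
  refine Finset.sum_congr rfl fun j _ => ?_
  rw [arr_cross S i hi, Finset.sum_range_one, ex_P M i hi, ex_Q M i hi, Matrix.mul_assoc (Pr S 0 j)]
  rfl

theorem crossOut (i : {i : Fin (S.p+1) // Iirr S i}) (hi : i.1 ≠ 0) (j : Fin (S.m 0)) :
    (∑ j', ∑ t ∈ Finset.range (arr S (v0 S j) (vI S i j')),
        gN M (v0 S j) (vI S i j') t * fN M (v0 S j) (vI S i j') t)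
      = Pr S 0 j * (mQ M i.1 * mP M i.1) * In S 0 j := by
  have : Pr S 0 j * (mQ M i.1 * mP M i.1) * In S 0 j =
    (Pr S 0 j * mQ M i.1) * (mP M i.1 * In S 0 j) := by simp only [Matrix.mul_assoc]
  rw [this, ← sum_mid i.1]
  refine Finset.sum_congr rfl fun j' _ => ?_
  rw [arr_cross S i hi, Finset.sum_range_one, ex_P M i hi, ex_Q M i hi,
    Matrix.mul_assoc (Pr S i.1 j')]
  rfl

theorem add_add_sub_aux {G : Type*} [AddCommGroup G] (a b c d : G) :
    a + b + c - (d + 0) = a + (b - d) + c := by abel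

theorem sub_aux2 {G : Type*} [AddCommGroup G] (a b c d : G) :
    a + c - (b + d + 0) = a - b - d + c := by abel

theorem m1 (i : {i : Fin (S.p+1) // Iirr S i}) (hi : i.1 ≠ 0) (j' : Fin (S.m i.1)) :
    moment S M (vI S i j') =
      Pr S i.1 j' * (mP M i.1 * mQ M i.1) * In S i.1 j'
      + Pr S i.1 j' * mX (S.q i.1) Finset.univ Finset.univ (mG M i.1) * In S i.1 j'
      + mf M i.1 j' 0 * mg M i.1 j' 0 := by
  have h0 : i0 S ≠ i := by rintro rfl; exact hi rfl
  rw [moment_N, Fintype.sum_sum_type, Fintype.sum_sum_type]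
  have hA : ∑ x, ∑ t ∈ Finset.range (arr S (Sum.inl x) (vI S i j')),
      fN M (Sum.inl x) (vI S i j') t * gN M (Sum.inl x) (vI S i j') t
      = (id (Pr S i.1 j' * (mP M i.1 * mQ M i.1) * In S i.1 j') :
          Matrix (Fin (alN S (vI S i j'))) (Fin (alN S (vI S i j'))) ℂ) +
        (∑ j, ∑ t ∈ Finset.range (arr S (vI S i j) (vI S i j')),
        fN M (vI S i j) (vI S i j') t * gN M (vI S i j) (vI S i j') t) := by
    rw [Fintype.sum_sigma, Fintype.sum_eq_add (i0 S) i h0]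
    · exact congrArg₂ (· + ·) (crossIn M i hi j') rfl
    · rintro x ⟨h1, h2⟩
      refine Finset.sum_eq_zero fun y _ => ?_
      have h3 : ¬ (x.1 = 0 ∧ i.1 ≠ 0) := fun h => h1 (Subtype.ext h.1)
      have := arr_bb S x i y j' h2 h3
      rw [show arr S (Sum.inl ⟨x, y⟩) (vI S i j') = 0 from this]; simp
  have hB : ∑ x, ∑ t ∈ Finset.range (arr S (vI S i j') (Sum.inl x)),
      gN M (vI S i j') (Sum.inl x) t * fN M (vI S i j') (Sum.inl x) t
      = (∑ j, ∑ t ∈ Finset.range (arr S (vI S i j') (vI S i j)),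
        gN M (vI S i j') (vI S i j) t * fN M (vI S i j') (vI S i j) t) := by
    rw [Fintype.sum_sigma, Fintype.sum_eq_single i]
    · rfl
    · intro x hx
      refine Finset.sum_eq_zero fun y _ => ?_
      have h3 : ¬ (i.1 = 0 ∧ x.1 ≠ 0) := fun h => hi h.1
      have := arr_bb S i x j' y hx.symm h3
      rw [show arr S (vI S i j') (Sum.inl ⟨x, y⟩) = 0 from this]; simp
  have hC : ∑ x, ∑ t ∈ Finset.range (arr S (Sum.inr x) (vI S i j')),
      fN M (Sum.inr x) (vI S i j') t * gN M (Sum.inr x) (vI S i j') t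
      = mf M i.1 j' 0 * mg M i.1 j' 0 := by
    rw [Fintype.sum_sigma, Fintype.sum_eq_single i.1]
    · rw [Fintype.sum_sigma, Fintype.sum_eq_single j']
      · exact legIrr M i.1 i.2 j'
      · intro j hj
        refine Finset.sum_eq_zero fun κ _ => ?_
        rw [show arr S (Sum.inr ⟨i.1, j, κ⟩) (vI S i j') = 0 from
          legIrr0 i.1 i.2 j _ (by intro h; cases h; exact hj rfl) κ]
        simp
    · intro x hx
      rw [Fintype.sum_sigma]
      refine Finset.sum_eq_zero fun j _ => Finset.sum_eq_zero fun κ _ => ?_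
      have : arr S (Sum.inr ⟨x, j, κ⟩) (vI S i j') = 0 := by
        by_cases hx' : Iirr S x
        · exact legIrr0 x hx' j _ (by intro h; cases h; exact hx rfl) κ
        · exact legReg0 x hx' j _ hi κ
      rw [this]; simp
  have hD : ∑ x, ∑ t ∈ Finset.range (arr S (vI S i j') (Sum.inr x)),
      gN M (vI S i j') (Sum.inr x) t * fN M (vI S i j') (Sum.inr x) t = 0 := by
    refine Finset.sum_eq_zero fun x _ => ?_
    rw [show arr S (vI S i j') (Sum.inr x) = 0 from rfl]; simp
  refine (congrArg₂ (· - ·) (congrArg₂ (· + ·) hA hC) (congrArg₂ (· + ·) hB hD)).trans ?_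
  have hI := intra M i j'
  refine Eq.trans ?_ (congrArg (fun X : Matrix (Fin (DD S i.1 j' 0)) (Fin (DD S i.1 j' 0)) ℂ =>
    Pr S i.1 j' * (mP M i.1 * mQ M i.1) * In S i.1 j' + X + mf M i.1 j' 0 * mg M i.1 j' 0) hI)
  simp only [id]
  exact add_add_sub_aux _ _ _ _

theorem m2 (j : Fin (S.m 0)) :
    moment S M (v0 S j) =
      Pr S 0 j * mX (S.q 0) Finset.univ Finset.univ (mG M 0) * In S 0 j
      - Pr S 0 j * (∑ i, mQ M i * mP M i) * In S 0 j
      + (mf M 0 j 0 * mg M 0 j 0 +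
        ∑ i, Pr S 0 j * (if Iirr S i then 0 else
          ∑ j', In S i j' * (mf M i j' 0 * mg M i j' 0) * Pr S i j') * In S 0 j) := by
  rw [moment_N, Fintype.sum_sum_type, Fintype.sum_sum_type]
  have hA : ∑ x, ∑ t ∈ Finset.range (arr S (Sum.inl x) (v0 S j)),
      fN M (Sum.inl x) (v0 S j) t * gN M (Sum.inl x) (v0 S j) t
      = (∑ y, ∑ t ∈ Finset.range (arr S (vI S (i0 S) y) (vI S (i0 S) j)),
        fN M (vI S (i0 S) y) (vI S (i0 S) j) t * gN M (vI S (i0 S) y) (vI S (i0 S) j) t) := by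
    rw [Fintype.sum_sigma, Fintype.sum_eq_single (i0 S)]
    · rfl
    · rintro x hx
      refine Finset.sum_eq_zero fun y _ => ?_
      have h3 : ¬ (x.1 = 0 ∧ (i0 S).1 ≠ 0) := fun h => hx (Subtype.ext h.1)
      have := arr_bb S x (i0 S) y j hx h3
      rw [show arr S (Sum.inl ⟨x, y⟩) (v0 S j) = 0 from this]; simp
  have hB : ∑ x, ∑ t ∈ Finset.range (arr S (v0 S j) (Sum.inl x)),
      gN M (v0 S j) (Sum.inl x) t * fN M (v0 S j) (Sum.inl x) t
      = (∑ y, ∑ t ∈ Finset.range (arr S (vI S (i0 S) j) (vI S (i0 S) y)),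
        gN M (vI S (i0 S) j) (vI S (i0 S) y) t * fN M (vI S (i0 S) j) (vI S (i0 S) y) t)
       + (id (Pr S 0 j * (∑ i, mQ M i * mP M i) * In S 0 j) :
          Matrix (Fin (alN S (vI S (i0 S) j))) (Fin (alN S (vI S (i0 S) j))) ℂ) := by
    rw [Fintype.sum_sigma, Fintype.sum_eq_add_sum_compl (i0 S)]
    refine congrArg₂ (· + ·) rfl ?_
    have e1 : ∑ i, mQ M i * mP M i = ∑ x : {i // Iirr S i}, mQ M x.1 * mP M x.1 := by
      rw [← Finset.sum_subtype (Finset.univ.filter (Iirr S)) (by simp) (fun i => mQ M i * mP M i)]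
      rw [Finset.sum_filter]
      refine Finset.sum_congr rfl fun i _ => ?_
      split_ifs with h
      · rfl
      · rw [mQ, dif_neg (fun h' => h h'.1), Matrix.zero_mul]
    rw [e1, Fintype.sum_eq_add_sum_compl (i0 S)]
    rw [show mQ M (i0 S).1 = 0 by rw [mQ, dif_neg (fun h => h.2 rfl)], Matrix.zero_mul, zero_add,
      Matrix.mul_sum, Matrix.sum_mul]
    refine Finset.sum_congr rfl fun x hx => ?_
    have hx0 : x.1 ≠ 0 := by
      intro h
      simp only [Finset.mem_compl, Finset.mem_singleton] at hx
      exact hx (Subtype.ext h)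
    exact crossOut M x hx0 j
  have hC : ∑ x, ∑ t ∈ Finset.range (arr S (Sum.inr x) (v0 S j)),
      fN M (Sum.inr x) (v0 S j) t * gN M (Sum.inr x) (v0 S j) t
      = mf M 0 j 0 * mg M 0 j 0 +
        ∑ i, Pr S 0 j * (if Iirr S i then 0 else
          ∑ j', In S i j' * (mf M i j' 0 * mg M i j' 0) * Pr S i j') * In S 0 j := by
    rw [Fintype.sum_sigma, Fintype.sum_eq_add_sum_compl 0]
    refine Eq.trans ?_ (congrArg (fun X => mf M 0 j 0 * mg M 0 j 0 + X)
      (Fintype.sum_eq_add_sum_compl 0 (fun i => Pr S 0 j * (if Iirr S i then 0 else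
          ∑ j', In S i j' * (mf M i j' 0 * mg M i j' 0) * Pr S i j') * In S 0 j)).symm)
    have hz : Pr S 0 j * (if Iirr S 0 then 0 else
          ∑ j', In S 0 j' * (mf M 0 j' 0 * mg M 0 j' 0) * Pr S 0 j') * In S 0 j = 0 := by
      rw [if_pos (show Iirr S 0 from (i0 S).2), Matrix.mul_zero, Matrix.zero_mul]
    refine congrArg₂ (fun (x y : Matrix (Fin (DD S 0 j 0)) (Fin (DD S 0 j 0)) ℂ) => x + y) ?_ ?_
    · rw [Fintype.sum_sigma, Fintype.sum_eq_single j]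
      · exact legIrr M 0 (i0 S).2 j
      · intro y hy
        refine Finset.sum_eq_zero fun κ _ => ?_
        rw [show arr S (Sum.inr ⟨0, y, κ⟩) (v0 S j) = 0 from
          legIrr0 0 (i0 S).2 y _ (by intro h; cases h; exact hy rfl) κ]
        simp
    · refine Eq.trans ?_ ((congrArg (· + _) hz).trans (zero_add _)).symm
      refine Finset.sum_congr rfl fun x hx => ?_
      have hx0 : x ≠ 0 := by simpa using hx
      rw [Fintype.sum_sigma]
      by_cases hx' : Iirr S x
      · rw [if_pos hx', Matrix.mul_zero, Matrix.zero_mul]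
        refine Finset.sum_eq_zero fun y _ => Finset.sum_eq_zero fun κ _ => ?_
        rw [show arr S (Sum.inr ⟨x, y, κ⟩) (v0 S j) = 0 from
          legIrr0 x hx' y _ (by intro h; cases h; exact hx0 rfl) κ]
        simp
        rfl
      · rw [if_neg hx', Matrix.mul_sum, Matrix.sum_mul]
        exact Finset.sum_congr rfl fun y _ => legReg M x hx' y j
  have hD : ∑ x, ∑ t ∈ Finset.range (arr S (v0 S j) (Sum.inr x)),
      gN M (v0 S j) (Sum.inr x) t * fN M (v0 S j) (Sum.inr x) t = 0 := by
    refine Finset.sum_eq_zero fun x _ => ?_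
    rw [show arr S (v0 S j) (Sum.inr x) = 0 from rfl]; simp
  have hI := intra M (i0 S) j
  refine (congrArg₂ (· - ·) (congrArg₂ (· + ·) hA hC) (congrArg₂ (· + ·) hB hD)).trans ?_
  refine Eq.trans ?_ (congrArg (fun X : Matrix (Fin (DD S 0 j 0)) (Fin (DD S 0 j 0)) ℂ =>
    X - Pr S 0 j * (∑ i, mQ M i * mP M i) * In S 0 j
      + (mf M 0 j 0 * mg M 0 j 0 +
        ∑ i, Pr S 0 j * (if Iirr S i then 0 else
          ∑ j', In S i j' * (mf M i j' 0 * mg M i j' 0) * Pr S i j') * In S 0 j)) hI)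
  exact sub_aux2 _ _ _ _

theorem m3 (i : Fin (S.p+1)) (j : Fin (S.m i)) (κ : ℕ) (h : κ < S.e i j - 1) :
    moment S M (vR S i j κ h) = mf M i j (κ+1) * mg M i j (κ+1) - mg M i j κ * mf M i j κ := by
  rw [moment_N, Fintype.sum_sum_type, Fintype.sum_sum_type]
  have hA : ∑ b, ∑ t ∈ Finset.range (arr S (Sum.inl b) (vR S i j κ h)),
      fN M (Sum.inl b) (vR S i j κ h) t * gN M (Sum.inl b) (vR S i j κ h) t = 0 := by
    refine Finset.sum_eq_zero fun x _ => ?_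
    rw [show arr S (Sum.inl x) (vR S i j κ h) = 0 from rfl]; simp
  have hB : ∑ r, ∑ t ∈ Finset.range (arr S (Sum.inr r) (vR S i j κ h)),
      fN M (Sum.inr r) (vR S i j κ h) t * gN M (Sum.inr r) (vR S i j κ h) t =
      mf M i j (κ+1) * mg M i j (κ+1) := by
    by_cases h' : κ + 1 < S.e i j - 1
    · rw [Fintype.sum_eq_single ⟨i, j, ⟨κ+1, h'⟩⟩]
      · have := arr_rr S i j (κ+1) h' i j κ h
        rw [if_pos ⟨rfl, rfl, rfl⟩] at this
        rw [show arr S (Sum.inr ⟨i, j, ⟨κ+1, h'⟩⟩) (vR S i j κ h) = 1 from this,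
          Finset.sum_range_one, ← ex_f M i j κ h', ← ex_g M i j κ h']
        rfl
      · rintro ⟨i', j', κ', hκ'⟩ hne
        have := arr_rr S i' j' κ' hκ' i j κ h
        rw [if_neg] at this
        · rw [show arr S (Sum.inr ⟨i', j', ⟨κ', hκ'⟩⟩) (vR S i j κ h) = 0 from this]; simp
        · rintro ⟨rfl, h2, rfl⟩
          have := Fin.ext h2
          subst this
          exact hne rfl
    · have hz : mf M i j (κ+1) = 0 := by rw [mf, dif_neg h']
      rw [hz, Matrix.zero_mul]
      refine Finset.sum_eq_zero ?_
      rintro ⟨i', j', κ', hκ'⟩ _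
      have := arr_rr S i' j' κ' hκ' i j κ h
      rw [if_neg] at this
      · rw [show arr S (Sum.inr ⟨i', j', ⟨κ', hκ'⟩⟩) (vR S i j κ h) = 0 from this]; simp
      · rintro ⟨rfl, h2, rfl⟩
        have := Fin.ext h2
        subst this
        omega
  have hC : ∑ b, ∑ t ∈ Finset.range (arr S (vR S i j κ h) (Sum.inl b)),
      gN M (vR S i j κ h) (Sum.inl b) t * fN M (vR S i j κ h) (Sum.inl b) t
      = if κ = 0 then mg M i j κ * mf M i j κ else 0 := by
    by_cases hκ : κ = 0
    · subst hκ
      rw [if_pos rfl]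
      by_cases hi : Iirr S i
      · rw [Fintype.sum_eq_single ⟨⟨i, hi⟩, j⟩]
        · have := arr_rb S i hi j 0 h ⟨⟨i, hi⟩, j⟩
          rw [if_pos ⟨rfl, rfl⟩] at this
          rw [this, Finset.sum_range_one, ← ex_f0 M i hi j h, ← ex_g0 M i hi j h]
          rfl
        · intro b hb
          have := arr_rb S i hi j 0 h b
          rw [if_neg (fun h => hb h.1)] at this
          rw [this]; simp
      · rw [Fintype.sum_sigma, Fintype.sum_eq_single (i0 S)]
        · have : mg M i j 0 * mf M i j 0 =
            (mg M i j 0 * Pr S i j) * (In S i j * mf M i j 0) := by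
            rw [Matrix.mul_assoc, ← Matrix.mul_assoc (Pr S i j), Pr_In, Matrix.one_mul]
          rw [this, ← sum_mid 0]
          refine Finset.sum_congr rfl fun y _ => ?_
          have := arr_rb_reg S i hi j 0 h ⟨i0 S, y⟩
          rw [if_pos ⟨rfl, rfl⟩] at this
          rw [this, Finset.sum_range_one]
          exact congrArg₂ (· * ·) (ex_g0r M i hi j h y) (ex_f0r M i hi j h y)
        · intro x hx
          refine Finset.sum_eq_zero fun y _ => ?_
          have := arr_rb_reg S i hi j 0 h ⟨x, y⟩
          rw [if_neg (fun h => hx (Subtype.ext h.1))] at this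
          rw [this]; simp
    · rw [if_neg hκ]
      refine Finset.sum_eq_zero fun b _ => ?_
      by_cases hi : Iirr S i
      · have := arr_rb S i hi j κ h b
        rw [if_neg (fun h => hκ h.2)] at this
        rw [this]; simp
      · have := arr_rb_reg S i hi j κ h b
        rw [if_neg (fun h => hκ h.2)] at this
        rw [this]; simp
  have hD : ∑ r, ∑ t ∈ Finset.range (arr S (vR S i j κ h) (Sum.inr r)),
      gN M (vR S i j κ h) (Sum.inr r) t * fN M (vR S i j κ h) (Sum.inr r) t
      = if κ = 0 then 0 else mg M i j κ * mf M i j κ := by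
    rcases κ with _ | κ
    · rw [if_pos rfl]
      refine Finset.sum_eq_zero ?_
      rintro ⟨i', j', κ', hκ'⟩ _
      have := arr_rr S i j 0 h i' j' κ' hκ'
      rw [if_neg (by omega)] at this
      rw [show arr S (vR S i j 0 h) (Sum.inr ⟨i', j', ⟨κ', hκ'⟩⟩) = 0 from this]; simp
    · rw [if_neg (by omega), Fintype.sum_eq_single ⟨i, j, ⟨κ, by omega⟩⟩]
      · have := arr_rr S i j (κ+1) h i j κ (by omega)
        rw [if_pos ⟨rfl, rfl, rfl⟩] at this
        rw [show arr S (vR S i j (κ+1) h) (Sum.inr ⟨i, j, ⟨κ, by omega⟩⟩) = 1 from this,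
          Finset.sum_range_one, ← ex_f M i j κ h, ← ex_g M i j κ h]
        rfl
      · rintro ⟨i', j', κ', hκ'⟩ hne
        have := arr_rr S i j (κ+1) h i' j' κ' hκ'
        rw [if_neg] at this
        · rw [show arr S (vR S i j (κ+1) h) (Sum.inr ⟨i', j', ⟨κ', hκ'⟩⟩) = 0 from this]; simp
        · rintro ⟨rfl, h2, h3⟩
          have := Fin.ext h2
          subst this
          have h4 : κ' = κ := by omega
          subst h4
          exact hne rfl
  rw [hA, hB, hC, hD]
  change (0 : Matrix (Fin (DD S i j (κ+1))) (Fin (DD S i j (κ+1))) ℂ) + _ - (_ + _) = _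
  rw [zero_add]
  congr 1
  split_ifs <;> simp

end quiC


section quiD
variable {S : Setup} (M : Rep S (alN S)) (c : Fin (S.p+1) → ℂ)

/-- total shift -/
def csum (S : Setup) (c : Fin (S.p+1) → ℂ) : ℂ := ∑ i, if Iirr S i ∧ i ≠ 0 then c i else 0

/-- The shifted parameter. -/
def lamp (S : Setup) (c : Fin (S.p+1) → ℂ) : V S → ℂ
  | .inl ⟨i, j⟩ => lam S (.inl ⟨i, j⟩) + (if i.1 = 0 then - csum S c else c i.1)
  | .inr r => lam S (.inr r)

/-- base of the leg -/
def bR (i : Fin (S.p+1)) (j : Fin (S.m i)) : Matrix (Fin (DD S i j 0)) (Fin (DD S i j 0)) ℂ :=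
  baseR (DD S i j) (xiN S i j) (mf M i j) (mg M i j)

/-- assembled leg -/
def leg (i : Fin (S.p+1)) : Matrix (Fin S.n) (Fin S.n) ℂ :=
  ∑ j, In S i j * bR M i j * Pr S i j

/-- the residues -/
def mZ (i : Fin (S.p+1)) : Matrix (Fin S.n) (Fin S.n) ℂ :=
  if i = 0 then (∑ i', mQ M i' * mP M i') - csum S c • 1 - ∑ i', (if Iirr S i' then 0 else leg M i')
  else if Iirr S i then c i • 1 - mP M i * mQ M i else leg M i

/-- the main relation -/
def star (i : Fin (S.p+1)) (j : Fin (S.m i)) : Prop :=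
  Pr S i j * (mZ M c i - mX (S.q i) Finset.univ Finset.univ (mG M i)) * In S i j = bR M i j

theorem lamp_irr (i : {i : Fin (S.p+1) // Iirr S i}) (hi : i.1 ≠ 0) (j : Fin (S.m i.1)) :
    lamp S c (vI S i j) = - xiN S i.1 j 0 + c i.1 := by
  simp only [vI, lamp, lam, hi, dif_neg, not_false_eq_true, if_neg, xiN, S.he i.1 j, dif_pos]

theorem lamp_zero (j : Fin (S.m 0)) :
    lamp S c (v0 S j) = - xiN S 0 j 0 - (∑ i, if Iirr S i then 0 else xiN S i ⟨0, S.hm i⟩ 0)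
      - csum S c := by
  simp only [v0, lamp, lam, i0, if_true, dif_pos, xiN, S.he, Fin.cast_eq_self]
  rw [Finset.sum_filter]
  simp only [ite_not]
  ring

theorem lamp_leg (i : Fin (S.p+1)) (j : Fin (S.m i)) (κ : ℕ) (h : κ < S.e i j - 1) :
    lamp S c (vR S i j κ h) = xiN S i j κ - xiN S i j (κ+1) := by
  simp only [vR, lamp, lam, xiN]
  rw [dif_pos (by omega), dif_pos (by omega)]

theorem mX_reg (i : Fin (S.p+1)) (hi : ¬ Iirr S i) :
    mX (S.q i) Finset.univ Finset.univ (mG M i) = 0 := by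
  unfold mX
  refine Finset.sum_eq_zero fun j _ => Finset.sum_eq_zero fun j' _ => ?_
  rw [sub_reg hi j j', dq_self]; simp

theorem Pr_leg (i : Fin (S.p+1)) (j : Fin (S.m i)) : Pr S i j * leg M i * In S i j = bR M i j := by
  rw [leg, Matrix.mul_sum, Matrix.sum_mul, Finset.sum_eq_single j]
  · rw [show Pr S i j * (In S i j * bR M i j * Pr S i j) * In S i j =
      (Pr S i j * In S i j) * bR M i j * (Pr S i j * In S i j) by simp only [Matrix.mul_assoc],
      Pr_In, Matrix.one_mul, Matrix.mul_one]
  · intro b _ hb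
    rw [Matrix.mul_assoc (In S i b), ← Matrix.mul_assoc (Pr S i j), Pr_In_ne _ _ _ _ hb.symm]
    simp
  · simp

theorem star_reg (i : Fin (S.p+1)) (hi : ¬ Iirr S i) (j : Fin (S.m i)) : star M c i j := by
  rw [star, mX_reg M i hi, sub_zero, mZ, if_neg (ne0_reg hi), if_neg hi, Pr_leg]

theorem aux_s1 {m : ℕ} (A B F : Matrix (Fin m) (Fin m) ℂ) (x c : ℂ) :
    A + B + F = (-x + c) • (1 : Matrix (Fin m) (Fin m) ℂ) ↔ c • 1 - A - B = F + x • 1 := by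
  rw [add_smul, neg_smul]
  constructor
  · intro h
    rw [← sub_eq_zero] at h ⊢
    rw [← neg_eq_zero, ← h]
    abel
  · intro h
    rw [← sub_eq_zero] at h ⊢
    rw [← neg_eq_zero, ← h]
    abel

theorem aux_s2 {m : ℕ} (X Y F L : Matrix (Fin m) (Fin m) ℂ) (x y c : ℂ) :
    X - Y + (F + L) = (-y - x - c) • (1 : Matrix (Fin m) (Fin m) ℂ) ↔
      Y - c • 1 - (L + x • 1) - X = F + y • 1 := by
  rw [sub_smul, sub_smul, neg_smul]
  constructor
  · intro h
    rw [← sub_eq_zero] at h ⊢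
    rw [← neg_eq_zero, ← h]
    abel
  · intro h
    rw [← sub_eq_zero] at h ⊢
    rw [← neg_eq_zero, ← h]
    abel

theorem star_irr (i : {i : Fin (S.p+1) // Iirr S i}) (hi : i.1 ≠ 0) (j : Fin (S.m i.1)) :
    moment S M (vI S i j) = lamp S c (vI S i j) • 1 ↔ star M c i.1 j := by
  rw [m1 M i hi, lamp_irr c i hi, star, mZ, if_neg hi, if_pos i.2, bR, baseR]
  have e1 : Pr S i.1 j * (c i.1 • 1 - mP M i.1 * mQ M i.1 -
      mX (S.q i.1) Finset.univ Finset.univ (mG M i.1)) * In S i.1 j =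
      c i.1 • 1 - Pr S i.1 j * (mP M i.1 * mQ M i.1) * In S i.1 j
       - Pr S i.1 j * mX (S.q i.1) Finset.univ Finset.univ (mG M i.1) * In S i.1 j := by
    simp only [Matrix.mul_sub, Matrix.sub_mul, Matrix.mul_smul, Matrix.smul_mul, Matrix.mul_one,
      Pr_In]
  rw [e1]
  exact aux_s1 _ _ _ _ _

theorem leg_reg (i : Fin (S.p+1)) (hi : ¬ Iirr S i) : leg M i =
    (∑ j', In S i j' * (mf M i j' 0 * mg M i j' 0) * Pr S i j') + xiN S i ⟨0, S.hm i⟩ 0 • 1 := by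
  rw [leg, ← sum_In_Pr S i, Finset.smul_sum, ← Finset.sum_add_distrib]
  refine Finset.sum_congr rfl fun j _ => ?_
  rw [bR, baseR, sub_reg hi ⟨0, S.hm i⟩ j, Matrix.mul_add, Matrix.add_mul]
  simp

theorem star_zero (j : Fin (S.m 0)) :
    moment S M (v0 S j) = lamp S c (v0 S j) • 1 ↔ star M c 0 j := by
  rw [m2 M, lamp_zero c, star, mZ, if_pos rfl, bR, baseR]
  have e1 : ∑ i', (if Iirr S i' then 0 else leg M i') =
      (∑ i', (if Iirr S i' then 0 else
        ∑ j', In S i' j' * (mf M i' j' 0 * mg M i' j' 0) * Pr S i' j')) +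
      (∑ i, if Iirr S i then 0 else xiN S i ⟨0, S.hm i⟩ 0) •
        (1 : Matrix (Fin S.n) (Fin S.n) ℂ) := by
    rw [Finset.sum_smul, ← Finset.sum_add_distrib]
    refine Finset.sum_congr rfl fun i _ => ?_
    split_ifs with h
    · simp
    · exact leg_reg M i h
  rw [e1, ← Matrix.sum_mul, ← Matrix.mul_sum]
  generalize (∑ i', (if Iirr S i' then 0 else
        ∑ j', In S i' j' * (mf M i' j' 0 * mg M i' j' 0) * Pr S i' j')) = L
  generalize (∑ i, if Iirr S i then 0 else xiN S i ⟨0, S.hm i⟩ 0) = x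
  generalize (∑ i', mQ M i' * mP M i') = Y
  simp only [Matrix.mul_sub, Matrix.sub_mul, Matrix.mul_add, Matrix.add_mul, Matrix.mul_smul,
    Matrix.smul_mul, Matrix.mul_one, Pr_In]
  exact aux_s2 _ _ _ _ _ _ _

theorem mom_iff : onMu S (lamp S c) M ↔ (∀ i j, star M c i j) ∧
    ∀ i j, Chain (DD S i j) (xiN S i j) (mf M i j) (mg M i j) := by
  constructor
  · intro h
    constructor
    · intro i j
      by_cases hi : Iirr S i
      · by_cases h0 : i = 0
        · subst h0
          exact (star_zero M c j).1 (h _)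
        · exact (star_irr M c ⟨i, hi⟩ h0 j).1 (h _)
      · exact star_reg M c i hi j
    · intro i j κ
      by_cases hκ : κ < S.e i j - 1
      · have := h (vR S i j κ hκ)
        rw [m3 M, lamp_leg] at this
        exact this
      · exact mat_ext0 (DD_ge S i j κ (by omega)) _ _
  · rintro ⟨h1, h2⟩ a
    rcases a with ⟨i, j⟩ | ⟨i, j, κ, hκ⟩
    · by_cases h0 : i.1 = 0
      · obtain ⟨i, hi⟩ := i
        simp only at h0
        subst h0
        exact (star_zero M c j).2 (h1 0 j)
      · exact (star_irr M c i h0 j).2 (h1 _ _)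
    · change moment S M (vR S i j κ hκ) = lamp S c (vR S i j κ hκ) • 1
      rw [m3 M, lamp_leg]
      exact h2 i j κ

end quiD


section quiE

/-- linear relations on `ℂ^a` -/
abbrev Rl (a : ℕ) := Submodule ℂ ((Fin a → ℂ) × (Fin a → ℂ))

/-- a pair of matrices maps the relation `U` into the relation `U'` -/
def Pv {a b : ℕ} (X X' : Matrix (Fin b) (Fin a) ℂ) (U : Rl a) (U' : Rl b) : Prop :=
  ∀ v ∈ U, (X *ᵥ v.1, X' *ᵥ v.2) ∈ U'

/-- the preimage of a relation -/
def cm {a b : ℕ} (X X' : Matrix (Fin b) (Fin a) ℂ) (U' : Rl b) : Rl a :=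
  U'.comap ((Matrix.toLin' X).prodMap (Matrix.toLin' X'))

/-- the image of a relation -/
def mp {a b : ℕ} (X X' : Matrix (Fin b) (Fin a) ℂ) (U : Rl a) : Rl b :=
  U.map ((Matrix.toLin' X).prodMap (Matrix.toLin' X'))

section
variable {a b d : ℕ} {U : Rl a} {U' : Rl b} {U'' : Rl d}

theorem mem_cm {X X' : Matrix (Fin b) (Fin a) ℂ} {v} : v ∈ cm X X' U' ↔ (X *ᵥ v.1, X' *ᵥ v.2) ∈ U' := by
  simp [cm]

theorem mem_mp {X X' : Matrix (Fin b) (Fin a) ℂ} {w} :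
    w ∈ mp X X' U ↔ ∃ v ∈ U, (X *ᵥ v.1, X' *ᵥ v.2) = w := by
  simp [mp]

theorem Pv.cm {X X' : Matrix (Fin b) (Fin a) ℂ} : Pv X X' (cm X X' U') U' := fun _ h => mem_cm.1 h

theorem Pv.mp {X X' : Matrix (Fin b) (Fin a) ℂ} : Pv X X' U (mp X X' U) :=
  fun v h => mem_mp.2 ⟨v, h, rfl⟩

theorem Pv.of_mp {X X' : Matrix (Fin b) (Fin a) ℂ} {Y Y' : Matrix (Fin d) (Fin b) ℂ}
    (h : Pv (Y * X) (Y' * X') U U'') : Pv Y Y' (DS.mp X X' U) U'' := by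
  intro w hw
  obtain ⟨v, hv, rfl⟩ := mem_mp.1 hw
  simpa [Matrix.mulVec_mulVec] using h v hv

theorem Pv.to_cm {X X' : Matrix (Fin b) (Fin a) ℂ} {Y Y' : Matrix (Fin d) (Fin b) ℂ}
    (h : Pv (Y * X) (Y' * X') U U'') : Pv X X' U (DS.cm Y Y' U'') := by
  intro v hv
  rw [mem_cm]
  simpa [Matrix.mulVec_mulVec] using h v hv

theorem Pv.mul {X X' : Matrix (Fin b) (Fin a) ℂ} {Y Y' : Matrix (Fin d) (Fin b) ℂ}
    (h' : Pv Y Y' U' U'') (h : Pv X X' U U') : Pv (Y * X) (Y' * X') U U'' := by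
  intro v hv
  simpa [Matrix.mulVec_mulVec] using h' _ (h v hv)

theorem Pv.add {X X' Y Y' : Matrix (Fin b) (Fin a) ℂ}
    (h' : Pv Y Y' U U') (h : Pv X X' U U') : Pv (Y + X) (Y' + X') U U' := by
  intro v hv
  have := U'.add_mem (h' v hv) (h v hv)
  simpa [Matrix.add_mulVec] using this

theorem Pv.sub {X X' Y Y' : Matrix (Fin b) (Fin a) ℂ}
    (h' : Pv Y Y' U U') (h : Pv X X' U U') : Pv (Y - X) (Y' - X') U U' := by
  intro v hv
  have := U'.sub_mem (h' v hv) (h v hv)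
  simpa [Matrix.sub_mulVec] using this

theorem Pv.smul {X X' : Matrix (Fin b) (Fin a) ℂ} (c : ℂ) (h : Pv X X' U U') :
    Pv (c • X) (c • X') U U' := by
  intro v hv
  have := U'.smul_mem c (h v hv)
  simpa [Matrix.smul_mulVec] using this

theorem Pv.neg {X X' : Matrix (Fin b) (Fin a) ℂ} (h : Pv X X' U U') : Pv (-X) (-X') U U' := by
  intro v hv
  have := U'.neg_mem (h v hv)
  simpa [Matrix.neg_mulVec] using this

theorem Pv.zero : Pv (0 : Matrix (Fin b) (Fin a) ℂ) 0 U U' := by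
  intro v _
  rw [Matrix.zero_mulVec, Matrix.zero_mulVec]
  exact U'.zero_mem

theorem Pv.one : Pv (1 : Matrix (Fin a) (Fin a) ℂ) 1 U U := by
  intro v hv
  simpa using hv

theorem Pv.sum {ι : Type*} (s : Finset ι) {X X' : ι → Matrix (Fin b) (Fin a) ℂ}
    (h : ∀ i ∈ s, Pv (X i) (X' i) U U') : Pv (∑ i ∈ s, X i) (∑ i ∈ s, X' i) U U' := by
  classical
  induction s using Finset.induction_on with
  | empty => simpa using Pv.zero
  | insert x s hx ih =>
    rw [Finset.sum_insert hx, Finset.sum_insert hx]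
    exact (h x (Finset.mem_insert_self _ _)).add (ih fun i hi => h i (Finset.mem_insert_of_mem hi))

theorem Pv.dim0 (hb : b = 0) {X X' : Matrix (Fin b) (Fin a) ℂ} : Pv X X' U U' := by
  subst hb
  intro v _
  have : ((X *ᵥ v.1, X' *ᵥ v.2) : (Fin 0 → ℂ) × (Fin 0 → ℂ)) = 0 := Subsingleton.elim _ _
  rw [this]; exact U'.zero_mem

theorem Pv.dim0' (ha : a = 0) {X X' : Matrix (Fin b) (Fin a) ℂ} : Pv X X' U U' := by
  subst ha
  rw [mat_ext0 rfl X 0, mat_ext0 rfl X' 0]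
  exact Pv.zero
end

variable {S : Setup}

/-- a relation between representations -/
def isRel {β : V S → ℕ} (M M' : Rep S β) (W : ∀ a, Rl (β a)) : Prop :=
  ∀ a b ρ, Pv (M.f a b ρ) (M'.f a b ρ) (W a) (W b) ∧ Pv (M.g a b ρ) (M'.g a b ρ) (W b) (W a)

theorem isRel_N {β : V S → ℕ} {M M' : Rep S β} {W : ∀ a, Rl (β a)} (h : isRel M M' W) (a b : V S)
    (t : ℕ) : Pv (fN M a b t) (fN M' a b t) (W a) (W b) ∧ Pv (gN M a b t) (gN M' a b t) (W b) (W a) := by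
  by_cases ht : t < arr S a b
  · have := h a b ⟨t, ht⟩
    rw [fN_fin, fN_fin, gN_fin, gN_fin] at this
    exact this
  · rw [fN_ge _ _ _ _ ht, fN_ge _ _ _ _ ht, gN_ge _ _ _ _ ht, gN_ge _ _ _ _ ht]
    exact ⟨Pv.zero, Pv.zero⟩

/-- the relation data in matrix form -/
structure RelData (M M' : Rep S (alN S)) (U : Fin (S.p+1) → Rl S.n)
    (L : ∀ (i : Fin (S.p+1)) (j : Fin (S.m i)) (κ : ℕ), Rl (DD S i j κ)) : Prop where
  reg : ∀ i, ¬ Iirr S i → U i = U 0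
  inn : ∀ i j, Pv (In S i j) (In S i j) (L i j 0) (U i)
  pr : ∀ i j, Pv (Pr S i j) (Pr S i j) (U i) (L i j 0)
  P : ∀ i, Pv (mP M i) (mP M' i) (U 0) (U i)
  Q : ∀ i, Pv (mQ M i) (mQ M' i) (U i) (U 0)
  G : ∀ i j j' t, t < dq (S.q i) j j' → Pv (mG M i j j' t) (mG M' i j j' t) (U i) (U i)
  f : ∀ i j κ, Pv (mf M i j κ) (mf M' i j κ) (L i j (κ+1)) (L i j κ)
  g : ∀ i j κ, Pv (mg M i j κ) (mg M' i j κ) (L i j κ) (L i j (κ+1))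

/-- assemble the relation -/
def mkW (L : ∀ (i : Fin (S.p+1)) (j : Fin (S.m i)) (κ : ℕ), Rl (DD S i j κ)) :
    ∀ a : V S, Rl (alN S a)
  | .inl ⟨i, j⟩ => L i.1 j 0
  | .inr ⟨i, j, κ⟩ => L i j (κ+1)

theorem RelData.isRel {M M' : Rep S (alN S)} {U : Fin (S.p+1) → Rl S.n}
    {L : ∀ (i : Fin (S.p+1)) (j : Fin (S.m i)) (κ : ℕ), Rl (DD S i j κ)}
    (h : RelData M M' U L) : isRel M M' (mkW L) := by
  intro a b ρ
  rw [fN_fin, fN_fin, gN_fin, gN_fin]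
  obtain ⟨t, ht⟩ := ρ
  simp only
  rcases arr_cases S a b t ht with ⟨i, j, j', hi, rfl, rfl, rfl⟩ | ⟨i, j, j', hj, rfl, rfl, h'⟩ |
    ⟨i, hi, j, h1, rfl, rfl, rfl⟩ | ⟨i, hi, j, h1, j', rfl, rfl, rfl⟩ | ⟨i, j, κ, h1, rfl, hb, rfl⟩
  · rw [ex_P M i hi, ex_P M' i hi, ex_Q M i hi, ex_Q M' i hi]
    exact ⟨((h.pr i.1 j').mul (h.P i.1)).mul (h.inn 0 j),
      ((h.pr 0 j).mul (h.Q i.1)).mul (h.inn i.1 j')⟩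
  · rw [ex_Gf M i j j' hj, ex_Gf M' i j j' hj, ex_Gg M i j j' hj, ex_Gg M' i j j' hj]
    have h2 : t < dq (S.q i.1) j j' := h'
    exact ⟨((h.pr i.1 j').mul (h.G i.1 j j' t h2)).mul (h.inn i.1 j),
      ((h.pr i.1 j).mul (h.G i.1 j' j t (by rwa [dq_symm]))).mul (h.inn i.1 j')⟩
  · rw [ex_f0 M i hi j h1, ex_f0 M' i hi j h1, ex_g0 M i hi j h1, ex_g0 M' i hi j h1]
    exact ⟨h.f i j 0, h.g i j 0⟩
  · rw [ex_f0r M i hi j h1, ex_f0r M' i hi j h1, ex_g0r M i hi j h1, ex_g0r M' i hi j h1]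
    have h3 := h.inn i j
    have h4 := h.pr i j
    rw [h.reg i hi] at h3 h4
    exact ⟨(h.pr 0 j').mul (h3.mul (h.f i j 0)), ((h.g i j 0).mul h4).mul (h.inn 0 j')⟩
  · obtain ⟨w, hw⟩ : ∃ w : κ < S.e i j - 1, b = vR S i j κ w := ⟨_, hb⟩
    clear hb
    subst hw
    rw [ex_f M i j κ h1, ex_f M' i j κ h1, ex_g M i j κ h1, ex_g M' i j κ h1]
    exact ⟨h.f i j (κ+1), h.g i j (κ+1)⟩

/-- vertex relation, retyped -/
def wI (W : ∀ a : V S, Rl (alN S a)) (i : Fin (S.p+1)) (hi : Iirr S i) (j : Fin (S.m i)) :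
    Rl (DD S i j 0) := W (vI S ⟨i, hi⟩ j)
/-- vertex relation, retyped -/
def wR (W : ∀ a : V S, Rl (alN S a)) (i : Fin (S.p+1)) (j : Fin (S.m i)) (κ : ℕ)
    (h : κ < S.e i j - 1) : Rl (DD S i j (κ+1)) := W (vR S i j κ h)

/-- total relation -/
def UI (W : ∀ a : V S, Rl (alN S a)) (i : Fin (S.p+1)) (hi : Iirr S i) : Rl S.n :=
  ⨅ j, cm (Pr S i j) (Pr S i j) (wI W i hi j)
/-- total relation -/
def UW (W : ∀ a : V S, Rl (alN S a)) (i : Fin (S.p+1)) : Rl S.n :=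
  if hi : Iirr S i then UI W i hi else UI W 0 (i0 S).2

/-- leg relation -/
def LW (W : ∀ a : V S, Rl (alN S a)) (i : Fin (S.p+1)) (j : Fin (S.m i)) :
    ∀ κ, Rl (DD S i j κ)
  | 0 => if hi : Iirr S i then wI W i hi j else cm (In S i j) (In S i j) (UI W 0 (i0 S).2)
  | κ+1 => if h : κ < S.e i j - 1 then wR W i j κ h else ⊤

theorem UI_pr (W : ∀ a : V S, Rl (alN S a)) (i : Fin (S.p+1)) (hi : Iirr S i) (j : Fin (S.m i)) :
    Pv (Pr S i j) (Pr S i j) (UI W i hi) (wI W i hi j) := by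
  intro v hv
  have := (Submodule.mem_iInf _).1 hv j
  exact mem_cm.1 this

theorem UI_in (W : ∀ a : V S, Rl (alN S a)) (i : Fin (S.p+1)) (hi : Iirr S i) (j : Fin (S.m i)) :
    Pv (In S i j) (In S i j) (wI W i hi j) (UI W i hi) := by
  intro v hv
  refine (Submodule.mem_iInf _).2 fun j' => mem_cm.2 ?_
  simp only [Matrix.mulVec_mulVec]
  by_cases h : j' = j
  · subst h; simpa [Pr_In] using hv
  · rw [Pr_In_ne _ _ _ _ h, Matrix.zero_mulVec, Matrix.zero_mulVec]
    exact Submodule.zero_mem _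

theorem UW_irr (W : ∀ a : V S, Rl (alN S a)) (i : Fin (S.p+1)) (hi : Iirr S i) :
    UW W i = UI W i hi := dif_pos hi
theorem UW_reg (W : ∀ a : V S, Rl (alN S a)) (i : Fin (S.p+1)) (hi : ¬ Iirr S i) :
    UW W i = UI W 0 (i0 S).2 := dif_neg hi

theorem relData_of {M M' : Rep S (alN S)} {W : ∀ a, Rl (alN S a)} (h : isRel M M' W) :
    RelData M M' (UW W) (LW W) where
  reg i hi := by rw [UW_reg W i hi, UW_irr W 0 (i0 S).2]
  inn i j := by
    by_cases hi : Iirr S i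
    · rw [UW_irr W i hi, LW, dif_pos hi]; exact UI_in W i hi j
    · rw [UW_reg W i hi, LW, dif_neg hi]; exact Pv.cm
  pr i j := by
    by_cases hi : Iirr S i
    · rw [UW_irr W i hi, LW, dif_pos hi]; exact UI_pr W i hi j
    · rw [UW_reg W i hi, LW, dif_neg hi]
      apply Pv.to_cm
      rw [eP_reg hi]; exact Pv.one
  P i := by
    rw [UW_irr W 0 (i0 S).2]
    by_cases hi : Iirr S i ∧ i ≠ 0
    · rw [UW_irr W i hi.1, mP, mP, dif_pos hi, dif_pos hi]
      refine Pv.sum _ fun j _ => Pv.sum _ fun j' _ => ?_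
      refine ((UI_in W i hi.1 j').mul (U' := wI W i hi.1 j') ?_).mul (UI_pr W 0 (i0 S).2 j)
      exact (isRel_N h (v0 S j) (vI S ⟨i, hi.1⟩ j') 0).1
    · rw [mP, mP, dif_neg hi, dif_neg hi]
      have : UW W i = UI W 0 (i0 S).2 := by
        by_cases hi' : Iirr S i
        · have : i = 0 := by by_contra h; exact hi ⟨hi', h⟩
          subst this
          exact UW_irr W 0 hi'
        · exact UW_reg W i hi'
      rw [this]; exact Pv.one
  Q i := by
    rw [UW_irr W 0 (i0 S).2]
    by_cases hi : Iirr S i ∧ i ≠ 0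
    · rw [UW_irr W i hi.1, mQ, mQ, dif_pos hi, dif_pos hi]
      refine Pv.sum _ fun j' _ => Pv.sum _ fun j _ => ?_
      refine ((UI_in W 0 (i0 S).2 j).mul (U' := wI W 0 (i0 S).2 j) ?_).mul (UI_pr W i hi.1 j')
      exact (isRel_N h (v0 S j) (vI S ⟨i, hi.1⟩ j') 0).2
    · rw [mQ, mQ, dif_neg hi, dif_neg hi]
      exact Pv.zero
  G i j j' t _ := by
    by_cases hi : Iirr S i
    · rw [UW_irr W i hi, mG, mG, dif_pos hi, dif_pos hi]
      split_ifs with hj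
      · refine ((UI_in W i hi j').mul (U' := wI W i hi j') ?_).mul (UI_pr W i hi j)
        exact (isRel_N h (vI S ⟨i, hi⟩ j) (vI S ⟨i, hi⟩ j') t).1
      · refine ((UI_in W i hi j').mul (U' := wI W i hi j') ?_).mul (UI_pr W i hi j)
        exact (isRel_N h (vI S ⟨i, hi⟩ j') (vI S ⟨i, hi⟩ j) t).2
    · rw [mG, mG, dif_neg hi, dif_neg hi]; exact Pv.zero
  f i j κ := by
    rcases κ with _ | κ
    · by_cases hκ : 0 < S.e i j - 1
      · rw [mf, mf, dif_pos hκ, dif_pos hκ, LW, LW, dif_pos hκ]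
        by_cases hi : Iirr S i
        · rw [dif_pos hi, dif_pos hi, dif_pos hi]
          exact (isRel_N h (vR S i j 0 hκ) (vI S ⟨i, hi⟩ j) 0).1
        · rw [dif_neg hi, dif_neg hi, dif_neg hi]
          apply Pv.to_cm
          rw [← Matrix.mul_assoc, ← Matrix.mul_assoc, eP_reg hi, Matrix.one_mul, Matrix.one_mul]
          refine Pv.sum _ fun j' _ => ?_
          exact (UI_in W 0 (i0 S).2 j').mul (isRel_N h (vR S i j 0 hκ) (v0 S j') 0).1
      · exact Pv.dim0' (DD_ge S i j 0 (by omega))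
    · by_cases hκ : κ + 1 < S.e i j - 1
      · rw [mf, mf, dif_pos hκ, dif_pos hκ, LW, LW, dif_pos hκ, dif_pos (by omega)]
        exact (isRel_N h (vR S i j (κ+1) hκ) (vR S i j κ (by omega)) 0).1
      · exact Pv.dim0' (DD_ge S i j (κ+1) (by omega))
  g i j κ := by
    rcases κ with _ | κ
    · by_cases hκ : 0 < S.e i j - 1
      · rw [mg, mg, dif_pos hκ, dif_pos hκ, LW, LW, dif_pos hκ]
        by_cases hi : Iirr S i
        · rw [dif_pos hi, dif_pos hi, dif_pos hi]
          exact (isRel_N h (vR S i j 0 hκ) (vI S ⟨i, hi⟩ j) 0).2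
        · rw [dif_neg hi, dif_neg hi, dif_neg hi]
          refine Pv.mul (U' := UI W 0 (i0 S).2) ?_ Pv.cm
          refine Pv.sum _ fun j' _ => ?_
          refine Pv.mul (U' := wI W 0 (i0 S).2 j') ?_ (UI_pr W 0 (i0 S).2 j')
          exact (isRel_N h (vR S i j 0 hκ) (v0 S j') 0).2
      · exact Pv.dim0 (DD_ge S i j 0 (by omega))
    · by_cases hκ : κ + 1 < S.e i j - 1
      · rw [mg, mg, dif_pos hκ, dif_pos hκ, LW, LW, dif_pos hκ, dif_pos (by omega)]
        exact (isRel_N h (vR S i j (κ+1) hκ) (vR S i j κ (by omega)) 0).2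
      · exact Pv.dim0 (DD_ge S i j (κ+1) (by omega))

theorem mkW_LW (W : ∀ a : V S, Rl (alN S a)) : mkW (LW W) = W := by
  funext a
  rcases a with ⟨i, j⟩ | ⟨i, j, κ, hκ⟩
  · rw [mkW, LW, dif_pos i.2]; rfl
  · rw [mkW, LW, dif_pos hκ]; rfl

end quiE


section quiF
variable {S : Setup}

/-- the matrix algebra -/
abbrev Mn (S : Setup) : Type := Matrix (Fin S.n) (Fin S.n) ℂ

theorem FS_ex (S : Setup) (i : Fin (S.p+1)) :
    ∃ F, LSpec (S.kk i) (eP S i) (S.q i) Finset.univ F :=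
  lspec_exists (S.hkk i) (eP_orth S i) (S.hq0 i) (S.hq1 i) (S.hqdeg i) (S.hqdist i) _ _ le_rfl

/-- the local parametrization -/
def FS (S : Setup) (i : Fin (S.p+1)) :
    (Fin (S.m i) → Fin (S.m i) → ℕ → Mn S) → Mn S → TT (Mn S) (S.kk i) :=
  Classical.choose (FS_ex S i)

theorem FSs (S : Setup) (i : Fin (S.p+1)) :
    LSpec (S.kk i) (eP S i) (S.q i) Finset.univ (FS S i) := Classical.choose_spec (FS_ex S i)

/-- the pairs preserving a relation -/
def Prs {a : ℕ} (U : Rl a) :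
    Subalgebra ℂ (Matrix (Fin a) (Fin a) ℂ × Matrix (Fin a) (Fin a) ℂ) where
  carrier := {x | Pv x.1 x.2 U U}
  mul_mem' h h' := Pv.mul h h'
  add_mem' h h' := Pv.add h h'
  algebraMap_mem' r := by
    have := (Pv.one (U := U)).smul r
    rw [← Algebra.algebraMap_eq_smul_one] at this
    exact this

theorem mem_Prs {a : ℕ} {U : Rl a} {X X' : Matrix (Fin a) (Fin a) ℂ} :
    (X, X') ∈ Prs U ↔ Pv X X' U U := Iff.rfl

/-- the local element -/
def FM (M : Rep S (alN S)) (c : Fin (S.p+1) → ℂ) (i : Fin (S.p+1)) : TT (Mn S) (S.kk i) :=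
  FS S i (mG M i) (mZ M c i)

/-- the conjugated local element -/
def ta (M : Rep S (alN S)) (c : Fin (S.p+1) → ℂ) (i : Fin (S.p+1)) : TT (Mn S) (S.kk i) :=
  tC _ (mP M i)⁻¹ * FM M c i * tC _ (mP M i)

theorem cf_ta (M : Rep S (alN S)) (c : Fin (S.p+1) → ℂ) (i : Fin (S.p+1)) (l : ℕ) :
    cf (ta M c i) l = (mP M i)⁻¹ * cf (FM M c i) l * mP M i := by
  rw [ta, cf_mul_tC, cf_tC_mul]

theorem FM_res (M : Rep S (alN S)) (c : Fin (S.p+1) → ℂ) (i : Fin (S.p+1)) :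
    cf (FM M c i) (S.kk i - 1) = mZ M c i :=
  (FSs S i).a _ _ (mG_Val M i) (by rw [eJ_univ, Matrix.one_mul]) (by rw [eJ_univ, Matrix.mul_one])

/-- invertibility of the cross maps -/
def BijM (M : Rep S (alN S)) : Prop := ∀ i, IsUnit (mP M i).det

theorem mP_triv (M : Rep S (alN S)) {i : Fin (S.p+1)} (hi : ¬ (Iirr S i ∧ i ≠ 0)) : mP M i = 1 :=
  dif_neg hi
theorem mQ_triv (M : Rep S (alN S)) {i : Fin (S.p+1)} (hi : ¬ (Iirr S i ∧ i ≠ 0)) : mQ M i = 0 :=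
  dif_neg hi

theorem Pv_mX {M M' : Rep S (alN S)} {i : Fin (S.p+1)} {U : Rl S.n}
    (h : ∀ j j' t, t < dq (S.q i) j j' → Pv (mG M i j j' t) (mG M' i j j' t) U U) :
    Pv (mX (S.q i) Finset.univ Finset.univ (mG M i)) (mX (S.q i) Finset.univ Finset.univ (mG M' i))
      U U := by
  refine Pv.sum _ fun j _ => Pv.sum _ fun j' _ => Pv.sum _ fun t ht => Pv.smul _ ?_
  have ht := Finset.mem_range.1 ht
  exact (h j j' t ht).mul (h j' j t (by rwa [dq_symm]))

/-- the relation on the total space at `i` -/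
def fU (M M' : Rep S (alN S)) (U0 : Rl S.n) (i : Fin (S.p+1)) : Rl S.n :=
  cm (mP M i)⁻¹ (mP M' i)⁻¹ U0
/-- the relation on the legs -/
def fL (M M' : Rep S (alN S)) (U0 : Rl S.n) (i : Fin (S.p+1)) (j : Fin (S.m i)) (κ : ℕ) :
    Rl (DD S i j κ) :=
  mp (so (DD S i j) (mg M i j) κ * Pr S i j) (so (DD S i j) (mg M' i j) κ * Pr S i j) (fU M M' U0 i)

theorem fU_triv (M M' : Rep S (alN S)) (U0 : Rl S.n) {i : Fin (S.p+1)} (hi : ¬ (Iirr S i ∧ i ≠ 0)) :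
    fU M M' U0 i = U0 := by
  ext v
  rw [fU, mem_cm, mP_triv M hi, mP_triv M' hi]
  simp

theorem fU_zero (M M' : Rep S (alN S)) (U0 : Rl S.n) : fU M M' U0 0 = U0 :=
  fU_triv M M' U0 (fun h => h.2 rfl)

theorem f_step (M : Rep S (alN S)) (c : Fin (S.p+1) → ℂ) (h : onMu S (lamp S c) M)
    (i : Fin (S.p+1)) (j : Fin (S.m i)) (κ : ℕ) :
    mf M i j κ * (so (DD S i j) (mg M i j) (κ+1) * Pr S i j) =
      (so (DD S i j) (mg M i j) κ * Pr S i j) *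
        ((mZ M c i - mX (S.q i) Finset.univ Finset.univ (mG M i)) * eP S i j - xiN S i j κ • 1) := by
  obtain ⟨h1, h2⟩ := (mom_iff M c).1 h
  have h3 : Pr S i j * (mZ M c i - mX (S.q i) Finset.univ Finset.univ (mG M i)) * In S i j =
    baseR (DD S i j) (xiN S i j) (mf M i j) (mg M i j) := h1 i j
  rw [← Matrix.mul_assoc, f_so (h2 i j), ← h3, eP]
  simp only [Matrix.mul_sub, Matrix.sub_mul, Matrix.mul_assoc, Matrix.mul_smul, Matrix.smul_mul,
    Matrix.mul_one, Matrix.one_mul]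

theorem fwd {M M' : Rep S (alN S)} {c : Fin (S.p+1) → ℂ} (hM : onMu S (lamp S c) M)
    (hM' : onMu S (lamp S c) M') (hB : BijM M) (hB' : BijM M') (U0 : Rl S.n)
    (h : ∀ i l, l < S.kk i → Pv (cf (ta M c i) l) (cf (ta M' c i) l) U0 U0) :
    RelData M M' (fU M M' U0) (fL M M' U0) := by
  have hPi : ∀ i, Pv (mP M i)⁻¹ (mP M' i)⁻¹ (fU M M' U0 i) U0 := fun i => Pv.cm
  have hP : ∀ i, Pv (mP M i) (mP M' i) U0 (fU M M' U0 i) := fun i => by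
    apply Pv.to_cm
    rw [Matrix.nonsing_inv_mul _ (hB i), Matrix.nonsing_inv_mul _ (hB' i)]
    exact Pv.one
  have hF : ∀ i, InB (Prs (fU M M' U0 i)) (S.kk i) (FM M c i) (FM M' c i) := by
    intro i l hl
    rw [mem_Prs]
    have e : ∀ N : Rep S (alN S), BijM N →
        cf (FM N c i) l = (mP N i) * cf (ta N c i) l * (mP N i)⁻¹ := by
      intro N hN
      rw [cf_ta, Matrix.mul_assoc, Matrix.mul_assoc, Matrix.mul_nonsing_inv _ (hN i),
        Matrix.mul_one, ← Matrix.mul_assoc, Matrix.mul_nonsing_inv _ (hN i), Matrix.one_mul]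
    rw [e M hB, e M' hB']
    exact ((hP i).mul (h i l hl)).mul (hPi i)
  have hZ : ∀ i, Pv (mZ M c i) (mZ M' c i) (fU M M' U0 i) (fU M M' U0 i) := by
    intro i
    have := hF i (S.kk i - 1) (by have := S.hkk i; omega)
    rwa [FM_res, FM_res] at this
  have hG : ∀ i, (∀ j ∈ Finset.univ, (eP S i j, eP S i j) ∈ Prs (fU M M' U0 i)) ∧
    (∀ j ∈ Finset.univ, ∀ j' ∈ Finset.univ, ∀ t < dq (S.q i) j j',
      (mG M i j j' t, mG M' i j j' t) ∈ Prs (fU M M' U0 i)) := by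
    intro i
    refine (FSs S i).G (Prs (fU M M' U0 i)) _ _ _ _ ?_ (mG_Val M i) (mG_Val M' i) ?_ ?_ ?_ ?_ (hF i)
    · rw [eJ_univ]; exact Pv.one
    all_goals rw [eJ_univ]
    all_goals first | exact Matrix.one_mul _ | exact Matrix.mul_one _
  have hE : ∀ i j, Pv (eP S i j) (eP S i j) (fU M M' U0 i) (fU M M' U0 i) :=
    fun i j => (hG i).1 j (Finset.mem_univ _)
  have hΓ : ∀ i j j' t, t < dq (S.q i) j j' →
      Pv (mG M i j j' t) (mG M' i j j' t) (fU M M' U0 i) (fU M M' U0 i) :=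
    fun i j j' t ht => (hG i).2 j (Finset.mem_univ _) j' (Finset.mem_univ _) t ht
  exact {
    reg := fun i hi => by rw [fU_zero, fU_triv _ _ _ (fun h => hi h.1)]
    inn := fun i j => by
      apply Pv.of_mp
      simp only [so, Matrix.one_mul]
      exact hE i j
    pr := fun i j => by
      have : Pv (so (DD S i j) (mg M i j) 0 * Pr S i j) (so (DD S i j) (mg M' i j) 0 * Pr S i j)
        (fU M M' U0 i) (fL M M' U0 i j 0) := Pv.mp
      simpa only [so, Matrix.one_mul] using this
    P := fun i => by rw [fU_zero]; exact hP i
    Q := fun i => by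
      rw [fU_zero]
      by_cases hi : Iirr S i ∧ i ≠ 0
      · have e : ∀ N : Rep S (alN S), BijM N → mQ N i = (mP N i)⁻¹ * (c i • 1 - mZ N c i) := by
          intro N hN
          rw [mZ, if_neg hi.2, if_pos hi.1, sub_sub_cancel, ← Matrix.mul_assoc,
            Matrix.nonsing_inv_mul _ (hN i), Matrix.one_mul]
        rw [e M hB, e M' hB']
        exact (hPi i).mul ((Pv.one.smul _).sub (hZ i))
      · rw [mQ_triv M hi, mQ_triv M' hi]; exact Pv.zero
    G := fun i j j' t ht => hΓ i j j' t ht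
    f := fun i j κ => by
      apply Pv.of_mp
      rw [f_step M c hM, f_step M' c hM']
      exact Pv.mp.mul ((((hZ i).sub (Pv_mX (hΓ i))).mul (hE i j)).sub (Pv.one.smul _))
    g := fun i j κ => by
      apply Pv.of_mp
      rw [← Matrix.mul_assoc, ← Matrix.mul_assoc]
      exact Pv.mp }

theorem bwd {M M' : Rep S (alN S)} (c : Fin (S.p+1) → ℂ) {U : Fin (S.p+1) → Rl S.n}
    {L : ∀ (i : Fin (S.p+1)) (j : Fin (S.m i)) (κ : ℕ), Rl (DD S i j κ)}
    (h : RelData M M' U L) (i : Fin (S.p+1)) : InB (Prs (U i)) (S.kk i) (FM M c i) (FM M' c i) := by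
  have hleg : ∀ i, Pv (leg M i) (leg M' i) (U i) (U i) := by
    intro i
    refine Pv.sum _ fun j _ => ?_
    refine ((h.inn i j).mul ?_).mul (h.pr i j)
    exact ((h.f i j 0).mul (h.g i j 0)).add (Pv.one.smul _)
  apply (FSs S i).E
  · exact fun j _ => (h.inn i j).mul (h.pr i j)
  · exact fun j _ j' _ t ht => h.G i j j' t ht
  · rw [mem_Prs]
    by_cases hi : i = 0
    · subst hi
      rw [mZ, mZ, if_pos rfl, if_pos rfl]
      refine Pv.sub (Pv.sub (Pv.sum _ fun i _ => (h.Q i).mul (h.P i)) (Pv.one.smul _)) ?_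
      refine Pv.sum _ fun i _ => ?_
      split_ifs with hi
      · exact Pv.zero
      · have := hleg i
        rwa [h.reg i hi] at this
    · rw [mZ, mZ, if_neg hi, if_neg hi]
      split_ifs with hi'
      · exact (Pv.one.smul _).sub ((h.P i).mul (h.Q i))
      · exact hleg i

theorem bwd_ta {M M' : Rep S (alN S)} (c : Fin (S.p+1) → ℂ) {U : Fin (S.p+1) → Rl S.n}
    {L : ∀ (i : Fin (S.p+1)) (j : Fin (S.m i)) (κ : ℕ), Rl (DD S i j κ)}
    (h : RelData M M' U L) (hPi : ∀ i, Pv (mP M i)⁻¹ (mP M' i)⁻¹ (U i) (U 0))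
    (i : Fin (S.p+1)) (l : ℕ) : Pv (cf (ta M c i) l) (cf (ta M' c i) l) (U 0) (U 0) := by
  by_cases hl : l < S.kk i
  · rw [cf_ta, cf_ta]
    exact ((hPi i).mul (bwd c h i l hl)).mul (h.P i)
  · rw [cf_ge _ (by omega), cf_ge _ (by omega)]
    exact Pv.zero

end quiF


section quiG
variable {S : Setup}

/-- first projection -/
def p1 {a : ℕ} (U : Rl a) : Submodule ℂ (Fin a → ℂ) := U.map (LinearMap.fst ℂ _ _)
/-- second projection -/
def p2 {a : ℕ} (U : Rl a) : Submodule ℂ (Fin a → ℂ) := U.map (LinearMap.snd ℂ _ _)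
/-- first kernel -/
def n1 {a : ℕ} (U : Rl a) : Submodule ℂ (Fin a → ℂ) := U.comap (LinearMap.inl ℂ _ _)
/-- second kernel -/
def n2 {a : ℕ} (U : Rl a) : Submodule ℂ (Fin a → ℂ) := U.comap (LinearMap.inr ℂ _ _)

theorem mem_p1 {a : ℕ} {U : Rl a} {v} : v ∈ p1 U ↔ ∃ w, (v, w) ∈ U := by
  simp [p1]
theorem mem_p2 {a : ℕ} {U : Rl a} {v} : v ∈ p2 U ↔ ∃ w, (w, v) ∈ U := by
  simp [p2]
theorem mem_n1 {a : ℕ} {U : Rl a} {v} : v ∈ n1 U ↔ (v, 0) ∈ U := by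
  simp [n1]
theorem mem_n2 {a : ℕ} {U : Rl a} {v} : v ∈ n2 U ↔ (0, v) ∈ U := by
  simp [n2]

theorem Pv.p1 {a b : ℕ} {X X' : Matrix (Fin b) (Fin a) ℂ} {U : Rl a} {U' : Rl b} (h : Pv X X' U U') :
    ∀ v ∈ p1 U, X *ᵥ v ∈ DS.p1 U' := by
  intro v hv
  obtain ⟨w, hw⟩ := mem_p1.1 hv
  exact mem_p1.2 ⟨_, h _ hw⟩
theorem Pv.p2 {a b : ℕ} {X X' : Matrix (Fin b) (Fin a) ℂ} {U : Rl a} {U' : Rl b} (h : Pv X X' U U') :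
    ∀ v ∈ p2 U, X' *ᵥ v ∈ DS.p2 U' := by
  intro v hv
  obtain ⟨w, hw⟩ := mem_p2.1 hv
  exact mem_p2.2 ⟨_, h _ hw⟩
theorem Pv.n1 {a b : ℕ} {X X' : Matrix (Fin b) (Fin a) ℂ} {U : Rl a} {U' : Rl b} (h : Pv X X' U U') :
    ∀ v ∈ n1 U, X *ᵥ v ∈ DS.n1 U' := by
  intro v hv
  have := h _ (mem_n1.1 hv)
  simp only [Matrix.mulVec_zero] at this
  exact mem_n1.2 this
theorem Pv.n2 {a b : ℕ} {X X' : Matrix (Fin b) (Fin a) ℂ} {U : Rl a} {U' : Rl b} (h : Pv X X' U U') :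
    ∀ v ∈ n2 U, X' *ᵥ v ∈ DS.n2 U' := by
  intro v hv
  have := h _ (mem_n2.1 hv)
  simp only [Matrix.mulVec_zero] at this
  exact mem_n2.2 this

/-- relations that are graphs of isomorphisms -/
structure GR {a : ℕ} (U : Rl a) : Prop where
  s1 : p1 U = ⊤
  s2 : p2 U = ⊤
  k1 : n1 U = ⊥
  k2 : n2 U = ⊥

theorem GR.exists_unit {a : ℕ} {U : Rl a} (h : GR U) :
    ∃ g : (Matrix (Fin a) (Fin a) ℂ)ˣ, ∀ v w, (v, w) ∈ U ↔ w = g.val *ᵥ v := by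
  have hs : ∀ v, ∃ w, (v, w) ∈ U := fun v => mem_p1.1 (by rw [h.s1]; trivial)
  choose f hf using hs
  have huniq : ∀ v w, (v, w) ∈ U → w = f v := by
    intro v w hw
    have := U.sub_mem hw (hf v)
    simp only [Prod.mk_sub_mk, sub_self] at this
    have := mem_n2.2 this
    rw [h.k2, Submodule.mem_bot, sub_eq_zero] at this
    exact this
  let F : (Fin a → ℂ) →ₗ[ℂ] (Fin a → ℂ) :=
    { toFun := f
      map_add' := fun x y => by
        refine (huniq _ _ ?_).symm
        exact U.add_mem (hf x) (hf y)
      map_smul' := fun c x => by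
        refine (huniq _ _ ?_).symm
        exact U.smul_mem c (hf x) }
  have hF : (LinearMap.toMatrix' F).mulVec = f := by
    funext v
    rw [LinearMap.toMatrix'_mulVec]; rfl
  have hinj : Function.Injective (LinearMap.toMatrix' F).mulVec := by
    rw [hF]
    intro x y hxy
    have := U.sub_mem (hf x) (hf y)
    rw [Prod.mk_sub_mk, hxy, sub_self] at this
    have := mem_n1.2 this
    rw [h.k1, Submodule.mem_bot, sub_eq_zero] at this
    exact this
  have hu : IsUnit (LinearMap.toMatrix' F) := Matrix.mulVec_injective_iff_isUnit.1 hinj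
  refine ⟨hu.unit, fun v w => ?_⟩
  rw [IsUnit.unit_spec, hF]
  exact ⟨huniq v w, fun h => h ▸ hf v⟩

theorem graph_GR {a : ℕ} {U : Rl a} (g : (Matrix (Fin a) (Fin a) ℂ)ˣ)
    (h : ∀ v w, (v, w) ∈ U ↔ w = g.val *ᵥ v) : GR U where
  s1 := by
    rw [eq_top_iff]; intro v _; exact mem_p1.2 ⟨_, (h _ _).2 rfl⟩
  s2 := by
    rw [eq_top_iff]; intro v _
    refine mem_p2.2 ⟨(g⁻¹).val *ᵥ v, (h _ _).2 ?_⟩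
    rw [Matrix.mulVec_mulVec, Units.mul_inv, Matrix.one_mulVec]
  k1 := by
    rw [eq_bot_iff]; intro v hv
    have := (h _ _).1 (mem_n1.1 hv)
    have h2 := congrArg ((g⁻¹).val.mulVec) this
    rw [Matrix.mulVec_mulVec, Units.inv_mul, Matrix.one_mulVec, Matrix.mulVec_zero] at h2
    exact h2.symm
  k2 := by
    rw [eq_bot_iff]; intro v hv
    have := (h _ _).1 (mem_n2.1 hv)
    rw [Matrix.mulVec_zero] at this
    exact this

/-- the graph of a matrix -/
def gph {a : ℕ} (g : Matrix (Fin a) (Fin a) ℂ) : Rl a := LinearMap.graph (Matrix.toLin' g)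
theorem mem_gph {a : ℕ} {g : Matrix (Fin a) (Fin a) ℂ} {v w} : (v, w) ∈ gph g ↔ w = g *ᵥ v := by
  simp [gph, LinearMap.mem_graph_iff]

theorem Pv_graph {a b : ℕ} {X X' : Matrix (Fin b) (Fin a) ℂ} {U : Rl a} {U' : Rl b}
    {g : Matrix (Fin a) (Fin a) ℂ} {g' : Matrix (Fin b) (Fin b) ℂ}
    (h : ∀ v w, (v, w) ∈ U ↔ w = g *ᵥ v) (h' : ∀ v w, (v, w) ∈ U' ↔ w = g' *ᵥ v) :
    Pv X X' U U' ↔ X' * g = g' * X := by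
  constructor
  · intro hp
    apply Matrix.toLin'.injective
    apply LinearMap.ext
    intro v
    have := (h' _ _).1 (hp _ ((h v _).2 rfl))
    simpa [Matrix.mulVec_mulVec] using this
  · rintro he ⟨v, w⟩ hv
    rw [h] at hv
    subst hv
    rw [h']
    simp [Matrix.mulVec_mulVec, he]

theorem isRel_p1 {M M' : Rep S (alN S)} {W : ∀ a, Rl (alN S a)} (h : isRel M M' W) :
    isSubrep S M (fun a => p1 (W a)) := fun a b ρ => ⟨(h a b ρ).1.p1, (h a b ρ).2.p1⟩
theorem isRel_n1 {M M' : Rep S (alN S)} {W : ∀ a, Rl (alN S a)} (h : isRel M M' W) :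
    isSubrep S M (fun a => n1 (W a)) := fun a b ρ => ⟨(h a b ρ).1.n1, (h a b ρ).2.n1⟩
theorem isRel_p2 {M M' : Rep S (alN S)} {W : ∀ a, Rl (alN S a)} (h : isRel M M' W) :
    isSubrep S M' (fun a => p2 (W a)) := fun a b ρ => ⟨(h a b ρ).1.p2, (h a b ρ).2.p2⟩
theorem isRel_n2 {M M' : Rep S (alN S)} {W : ∀ a, Rl (alN S a)} (h : isRel M M' W) :
    isSubrep S M' (fun a => n2 (W a)) := fun a b ρ => ⟨(h a b ρ).1.n2, (h a b ρ).2.n2⟩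

/-- a nonzero vertex over `0` -/
theorem exists_vertex (S : Setup) : ∃ j : Fin (S.m 0), 0 < alN S (v0 S j) := by
  obtain ⟨j, x⟩ := (S.emb 0).symm ⟨0, S.hn⟩
  exact ⟨j, x.pos⟩

theorem bot_ne_top {a : ℕ} (h : 0 < a) : (⊥ : Submodule ℂ (Fin a → ℂ)) ≠ ⊤ := by
  haveI : Nonempty (Fin a) := ⟨⟨0, h⟩⟩
  exact _root_.bot_ne_top

/-- a subrepresentation which is everything over `0` -/
theorem irr_top {M : Rep S (alN S)} (h : irredRep S M) {W} (hW : isSubrep S M W)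
    (h0 : ∀ j, W (v0 S j) = ⊤) : ∀ a, W a = ⊤ := by
  rcases h W hW with h1 | h1
  · obtain ⟨j, hj⟩ := exists_vertex S
    exact absurd ((h1 _).symm.trans (h0 j)) (bot_ne_top hj)
  · exact h1
theorem irr_bot {M : Rep S (alN S)} (h : irredRep S M) {W} (hW : isSubrep S M W)
    (h0 : ∀ j, W (v0 S j) = ⊥) : ∀ a, W a = ⊥ := by
  rcases h W hW with h1 | h1
  · exact h1
  · obtain ⟨j, hj⟩ := exists_vertex S
    exact absurd ((h0 j).symm.trans (h1 _)) (bot_ne_top hj)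

/-- Schur's lemma for relations -/
theorem schur {M M' : Rep S (alN S)} (hM : irredRep S M) (hM' : irredRep S M')
    {W : ∀ a, Rl (alN S a)} (h : isRel M M' W) (h0 : ∀ j, GR (W (v0 S j))) : repConj S M M' := by
  have hG : ∀ a, GR (W a) := fun a => {
    s1 := irr_top hM (isRel_p1 h) (fun j => (h0 j).s1) a
    s2 := irr_top hM' (isRel_p2 h) (fun j => (h0 j).s2) a
    k1 := irr_bot hM (isRel_n1 h) (fun j => (h0 j).k1) a
    k2 := irr_bot hM' (isRel_n2 h) (fun j => (h0 j).k2) a }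
  choose g hg using fun a => (hG a).exists_unit
  refine ⟨g, fun a b ρ => ?_, fun a b ρ => ?_⟩
  · have := (Pv_graph (hg a) (hg b)).1 (h a b ρ).1
    rw [← this, Matrix.mul_assoc, Units.mul_inv, Matrix.mul_one]
  · have := (Pv_graph (hg b) (hg a)).1 (h a b ρ).2
    rw [← this, Matrix.mul_assoc, Units.mul_inv, Matrix.mul_one]

theorem vec_ext (i : Fin (S.p+1)) (v : Fin S.n → ℂ) : v = ∑ j, In S i j *ᵥ (Pr S i j *ᵥ v) := by
  conv_lhs => rw [← Matrix.one_mulVec v, ← sum_In_Pr S i, Matrix.sum_mulVec]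
  simp only [Matrix.mulVec_mulVec]

/-- T3, first half -/
theorem T3a {M M' : Rep S (alN S)} {c : Fin (S.p+1) → ℂ} (hM : onMu S (lamp S c) M)
    (hM' : onMu S (lamp S c) M') (hB : BijM M) (hB' : BijM M') (hI : irredRep S M)
    (hI' : irredRep S M') (h : (Mn S)ˣ) (hh : ∀ i l, cf (ta M' c i) l * h.val = h.val * cf (ta M c i) l) :
    repConj S M M' := by
  have hd := fwd hM hM' hB hB' (gph h.val)
    (fun i l _ => (Pv_graph (fun _ _ => mem_gph) (fun _ _ => mem_gph)).2 (hh i l))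
  have hU : fU M M' (gph h.val) 0 = gph h.val := fU_zero _ _ _
  have hGU : GR (gph h.val) := graph_GR h (fun _ _ => mem_gph)
  refine schur hI hI' hd.isRel fun j => ?_
  have hinn := hd.inn 0 j
  have hpr := hd.pr 0 j
  rw [hU] at hinn hpr
  change GR (fL M M' (gph h.val) 0 j 0)
  have hPI : ∀ v, Pr S 0 j *ᵥ (In S 0 j *ᵥ v) = v := fun v => by
    rw [Matrix.mulVec_mulVec, Pr_In, Matrix.one_mulVec]
  have hz : ∀ v, In S 0 j *ᵥ v = 0 → v = 0 := fun v hv => by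
    rw [← hPI v, hv, Matrix.mulVec_zero]
  constructor
  · rw [eq_top_iff]; intro v _
    have := hpr.p1 (In S 0 j *ᵥ v) (by rw [hGU.s1]; trivial)
    rwa [hPI] at this
  · rw [eq_top_iff]; intro v _
    have := hpr.p2 (In S 0 j *ᵥ v) (by rw [hGU.s2]; trivial)
    rwa [hPI] at this
  · rw [eq_bot_iff]; intro v hv
    have := hinn.n1 v hv
    rw [hGU.k1] at this
    exact hz v this
  · rw [eq_bot_iff]; intro v hv
    have := hinn.n2 v hv
    rw [hGU.k2] at this
    exact hz v this

/-- T3, second half -/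
theorem T3b {M M' : Rep S (alN S)} (c : Fin (S.p+1) → ℂ) (hB : BijM M) (hB' : BijM M')
    (hc : repConj S M M') :
    ∃ h : (Mn S)ˣ, ∀ i l, cf (ta M' c i) l * h.val = h.val * cf (ta M c i) l := by
  obtain ⟨g, hf, hg⟩ := hc
  have hW : isRel M M' (fun a => gph (g a).val) := by
    intro a b ρ
    rw [Pv_graph (fun _ _ => mem_gph) (fun _ _ => mem_gph),
      Pv_graph (fun _ _ => mem_gph) (fun _ _ => mem_gph), hf, hg]
    constructor <;> rw [Matrix.mul_assoc, Units.inv_mul, Matrix.mul_one]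
  have hd := relData_of hW
  set W : ∀ a, Rl (alN S a) := fun a => gph (g a).val with hWd
  have hGW : ∀ a, GR (W a) := fun a => graph_GR (g a) (fun _ _ => mem_gph)
  have hUI : ∀ i hi, GR (UI W i hi) := by
    intro i hi
    have hGj : ∀ j, GR (wI W i hi j) := fun j => hGW _
    constructor
    · rw [eq_top_iff]; intro v _
      rw [vec_ext i v]
      refine Submodule.sum_mem _ fun j _ => ?_
      exact (UI_in W i hi j).p1 _ (by rw [(hGj j).s1]; trivial)
    · rw [eq_top_iff]; intro v _
      rw [vec_ext i v]
      refine Submodule.sum_mem _ fun j _ => ?_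
      exact (UI_in W i hi j).p2 _ (by rw [(hGj j).s2]; trivial)
    · rw [eq_bot_iff]; intro v hv
      rw [Submodule.mem_bot, vec_ext i v]
      refine Finset.sum_eq_zero fun j _ => ?_
      have := (UI_pr W i hi j).n1 _ hv
      rw [(hGj j).k1, Submodule.mem_bot] at this
      rw [this, Matrix.mulVec_zero]
    · rw [eq_bot_iff]; intro v hv
      rw [Submodule.mem_bot, vec_ext i v]
      refine Finset.sum_eq_zero fun j _ => ?_
      have := (UI_pr W i hi j).n2 _ hv
      rw [(hGj j).k2, Submodule.mem_bot] at this
      rw [this, Matrix.mulVec_zero]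
  have hU : ∀ i, GR (UW W i) := by
    intro i
    by_cases hi : Iirr S i
    · rw [UW_irr W i hi]; exact hUI _ _
    · rw [UW_reg W i hi]; exact hUI _ _
  choose h hh using fun i => (hU i).exists_unit
  have hPi : ∀ i, Pv (mP M i)⁻¹ (mP M' i)⁻¹ (UW W i) (UW W 0) := by
    intro i
    have h1 := (Pv_graph (hh 0) (hh i)).1 (hd.P i)
    rw [Pv_graph (hh i) (hh 0)]
    calc (mP M' i)⁻¹ * (h i).val = (mP M' i)⁻¹ * ((h i).val * mP M i) * (mP M i)⁻¹ := by
          rw [Matrix.mul_assoc, Matrix.mul_assoc, Matrix.mul_nonsing_inv _ (hB i), Matrix.mul_one]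
      _ = (h 0).val * (mP M i)⁻¹ := by
          rw [← h1, ← Matrix.mul_assoc, Matrix.nonsing_inv_mul _ (hB' i), Matrix.one_mul]
  refine ⟨h 0, fun i l => ?_⟩
  exact (Pv_graph (hh 0) (hh 0)).1 (bwd_ta c hd hPi i l)

/-- the double of a subspace -/
abbrev dbl {a : ℕ} (W : Submodule ℂ (Fin a → ℂ)) : Rl a := W.prod W

theorem Pv_dbl {a b : ℕ} {X : Matrix (Fin b) (Fin a) ℂ} {W : Submodule ℂ (Fin a → ℂ)}
    {W' : Submodule ℂ (Fin b → ℂ)} : Pv X X (dbl W) (dbl W') ↔ ∀ v ∈ W, X *ᵥ v ∈ W' := by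
  constructor
  · intro h v hv
    exact (Submodule.mem_prod.1 (h (v, v) ⟨hv, hv⟩)).1
  · rintro h ⟨v, w⟩ ⟨hv, hw⟩
    exact ⟨h v hv, h w hw⟩

theorem p1_dbl {a : ℕ} (W : Submodule ℂ (Fin a → ℂ)) : p1 (dbl W) = W := by
  ext v
  rw [mem_p1]
  exact ⟨fun ⟨w, hw⟩ => hw.1, fun hv => ⟨v, hv, hv⟩⟩

/-- irreducibility of the tuple -/
theorem T1irr {M : Rep S (alN S)} {c : Fin (S.p+1) → ℂ} (hM : onMu S (lamp S c) M) (hB : BijM M)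
    (hI : irredRep S M) (W0 : Submodule ℂ (Fin S.n → ℂ))
    (h : ∀ i l, l < S.kk i → ∀ v ∈ W0, cf (ta M c i) l *ᵥ v ∈ W0) : W0 = ⊥ ∨ W0 = ⊤ := by
  have hd := fwd hM hM hB hB (dbl W0) (fun i l hl => Pv_dbl.2 (h i l hl))
  have hU : fU M M (dbl W0) 0 = dbl W0 := fU_zero _ _ _
  rcases hI _ (isRel_p1 hd.isRel) with h1 | h1
  · left
    rw [eq_bot_iff]; intro v hv
    rw [Submodule.mem_bot, vec_ext 0 v]
    refine Finset.sum_eq_zero fun j _ => ?_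
    have hpr := hd.pr 0 j
    rw [hU] at hpr
    have h2 := hpr.p1 v (by rwa [p1_dbl])
    have h3 : p1 (fL M M (dbl W0) 0 j 0) = ⊥ := h1 (v0 S j)
    rw [h3, Submodule.mem_bot] at h2
    rw [h2, Matrix.mulVec_zero]
  · right
    rw [eq_top_iff]; intro v _
    rw [vec_ext 0 v]
    refine Submodule.sum_mem _ fun j _ => ?_
    have hin := hd.inn 0 j
    rw [hU] at hin
    have h3 : p1 (fL M M (dbl W0) 0 j 0) = ⊤ := h1 (v0 S j)
    have := hin.p1 (Pr S 0 j *ᵥ v) (by rw [h3]; trivial)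
    rwa [p1_dbl] at this

theorem legs_R {M : Rep S (alN S)} (hc : ∀ i j, Chain (DD S i j) (xiN S i j) (mf M i j) (mg M i j))
    (hI : irredRep S M) (i : Fin (S.p+1)) (j : Fin (S.m i)) (κ : ℕ) : RInv (mg M i j κ) := by
  let L : ∀ (i : Fin (S.p+1)) (j : Fin (S.m i)) (κ : ℕ), Rl (DD S i j κ) :=
    fun i j κ => mp (so (DD S i j) (mg M i j) κ) (so (DD S i j) (mg M i j) κ) ⊤
  have hL0 : ∀ i j, L i j 0 = ⊤ := by
    intro i j
    rw [eq_top_iff]; intro v _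
    refine mem_mp.2 ⟨v, trivial, ?_⟩
    simp [so]
  have htop : ∀ {a b : ℕ} {X X' : Matrix (Fin b) (Fin a) ℂ} {U : Rl a}, Pv X X' U ⊤ :=
    fun _ _ => trivial
  have hd : RelData M M (fun _ => ⊤) L := {
    reg := fun _ _ => rfl
    inn := fun i j => htop
    pr := fun i j => by rw [hL0]; exact htop
    P := fun i => htop
    Q := fun i => htop
    G := fun i j j' t _ => htop
    f := fun i j κ => by
      apply Pv.of_mp
      rw [f_so (hc i j)]
      exact Pv.mp.mul htop
    g := fun i j κ => by
      apply Pv.of_mp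
      exact Pv.mp }
  have hall := irr_top hI (isRel_p1 hd.isRel) (fun j => by
    change p1 (L 0 j 0) = ⊤
    rw [hL0, eq_top_iff]; intro v _; exact mem_p1.2 ⟨0, trivial⟩)
  by_cases hκ : κ < S.e i j - 1
  · apply RInv.of_surj
    intro v
    have h1 : p1 (L i j (κ+1)) = ⊤ := hall (vR S i j κ hκ)
    have h2 : v ∈ p1 (L i j (κ+1)) := by rw [h1]; trivial
    obtain ⟨w, hw⟩ := mem_p1.1 h2
    obtain ⟨u, _, hu⟩ := mem_mp.1 hw
    have h3 := congrArg Prod.fst hu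
    refine ⟨so (DD S i j) (mg M i j) κ *ᵥ u.1, ?_⟩
    rw [Matrix.mulVec_mulVec]
    exact h3
  · exact ⟨0, mat_ext0 (DD_ge S i j κ (by omega)) _ _⟩

theorem legs_L {M : Rep S (alN S)} (hc : ∀ i j, Chain (DD S i j) (xiN S i j) (mf M i j) (mg M i j))
    (hI : irredRep S M) (i : Fin (S.p+1)) (j : Fin (S.m i)) (κ : ℕ) : LInv (mf M i j κ) := by
  let L : ∀ (i : Fin (S.p+1)) (j : Fin (S.m i)) (κ : ℕ), Rl (DD S i j κ) :=
    fun i j κ => cm (io (DD S i j) (mf M i j) κ) (io (DD S i j) (mf M i j) κ) ⊥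
  have hL0 : ∀ i j, L i j 0 = ⊥ := by
    intro i j
    rw [eq_bot_iff]; intro v hv
    have := mem_cm.1 hv
    simpa [io] using this
  have hbot : ∀ {a b : ℕ} {X X' : Matrix (Fin b) (Fin a) ℂ} {U : Rl b}, Pv X X' ⊥ U := by
    intro a b X X' U v hv
    rw [Submodule.mem_bot] at hv
    subst hv
    simp only [Prod.fst_zero, Prod.snd_zero, Matrix.mulVec_zero]
    exact U.zero_mem
  have hd : RelData M M (fun _ => ⊥) L := {
    reg := fun _ _ => rfl
    inn := fun i j => by rw [hL0]; exact hbot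
    pr := fun i j => hbot
    P := fun i => hbot
    Q := fun i => hbot
    G := fun i j j' t _ => hbot
    f := fun i j κ => by
      apply Pv.to_cm
      exact Pv.cm
    g := fun i j κ => by
      apply Pv.to_cm
      rw [io_g (hc i j)]
      exact Pv.mul (hbot) Pv.cm }
  have hall := irr_bot hI (isRel_p1 hd.isRel) (fun j => by
    change p1 (L 0 j 0) = ⊥
    rw [hL0, eq_bot_iff]; intro v hv
    obtain ⟨w, hw⟩ := mem_p1.1 hv
    exact congrArg Prod.fst hw)
  by_cases hκ : κ < S.e i j - 1
  · apply LInv.of_inj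
    intro x y hxy
    have h1 : p1 (L i j (κ+1)) = ⊥ := hall (vR S i j κ hκ)
    have h2 : x - y ∈ p1 (L i j (κ+1)) := by
      refine mem_p1.2 ⟨0, mem_cm.2 ?_⟩
      have : io (DD S i j) (mf M i j) (κ+1) *ᵥ (x - y) = 0 := by
        change (io (DD S i j) (mf M i j) κ * mf M i j κ) *ᵥ (x - y) = 0
        rw [← Matrix.mulVec_mulVec, Matrix.mulVec_sub, hxy, sub_self, Matrix.mulVec_zero]
      simp only [this, Matrix.mulVec_zero]
      exact Submodule.zero_mem _
    rw [h1, Submodule.mem_bot, sub_eq_zero] at h2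
    exact h2
  · exact ⟨0, mat_ext0 (DD_ge S i j κ (by omega)) _ _⟩

end quiG

section quiH

variable {S : Setup}

/-- trace identity -/
theorem trace_id {β : V S → ℕ} {μ : V S → ℂ} {M : Rep S β} (hM : onMu S μ M)
    {W : ∀ a : V S, Submodule ℂ (Fin (β a) → ℂ)} (hW : isSubrep S M W) :
    ∑ a, (Module.finrank ℂ (W a) : ℂ) * μ a = 0 := by
  let F : ∀ (a b : V S) (ρ : Fin (arr S a b)), W a →ₗ[ℂ] W b := fun a b ρ =>
    (Matrix.toLin' (M.f a b ρ)).restrict (p := W a) (q := W b)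
      (fun v hv => by rw [Matrix.toLin'_apply]; exact (hW a b ρ).1 v hv)
  let G : ∀ (a b : V S) (ρ : Fin (arr S a b)), W b →ₗ[ℂ] W a := fun a b ρ =>
    (Matrix.toLin' (M.g a b ρ)).restrict (p := W b) (q := W a)
      (fun v hv => by rw [Matrix.toLin'_apply]; exact (hW a b ρ).2 v hv)
  have h1 : ∀ x : V S, (∑ a, ∑ ρ, (F a x ρ) ∘ₗ (G a x ρ)) - (∑ b, ∑ ρ, (G x b ρ) ∘ₗ (F x b ρ)) =
      μ x • (LinearMap.id : W x →ₗ[ℂ] W x) := by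
    intro x
    ext1 v
    apply Subtype.ext
    have h := congrArg (fun X => X *ᵥ (v : Fin (β x) → ℂ)) (hM x)
    simp only [moment, Matrix.sub_mulVec, Matrix.sum_mulVec, Matrix.smul_mulVec,
      Matrix.one_mulVec] at h
    simp only [LinearMap.sub_apply, LinearMap.sum_apply, LinearMap.comp_apply, LinearMap.smul_apply,
      LinearMap.id_apply, Submodule.coe_sub, Submodule.coe_smul, Submodule.coe_sum]
    rw [← h]
    congr 1
    · refine Finset.sum_congr rfl fun a _ => Finset.sum_congr rfl fun ρ _ => ?_
      simp [F, G, LinearMap.restrict_apply, Matrix.mulVec_mulVec]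
    · refine Finset.sum_congr rfl fun a _ => Finset.sum_congr rfl fun ρ _ => ?_
      simp [F, G, LinearMap.restrict_apply, Matrix.mulVec_mulVec]
  have h2 : ∀ x : V S, (Module.finrank ℂ (W x) : ℂ) * μ x =
      (∑ a, ∑ ρ, LinearMap.trace ℂ _ ((F a x ρ) ∘ₗ (G a x ρ))) -
      (∑ b, ∑ ρ, LinearMap.trace ℂ _ ((F x b ρ) ∘ₗ (G x b ρ))) := by
    intro x
    have h := congrArg (LinearMap.trace ℂ (W x)) (sub_eq_iff_eq_add.1 (h1 x))
    rw [LinearMap.map_add, LinearMap.map_smul, LinearMap.trace_id, smul_eq_mul,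
      ← sub_eq_iff_eq_add] at h
    simp only [map_sum] at h
    rw [mul_comm, ← h]
    congr 1
    refine Finset.sum_congr rfl fun a _ => Finset.sum_congr rfl fun ρ _ => ?_
    exact LinearMap.trace_comp_comm' _ _
  rw [Finset.sum_congr rfl fun x _ => h2 x, Finset.sum_sub_distrib, Finset.sum_comm, sub_self]

/-- the shift polynomials -/
def gpol (S : Setup) (β : V S → ℕ) : Polynomial ℂ :=
  Polynomial.C (∑ a, (β a : ℂ) * lam S a) +
  ∑ i : {i : Fin (S.p+1) // Iirr S i}, Polynomial.C (∑ j, (β (vI S i j) : ℂ)) *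
    (if i.1 = 0 then - ∑ i' : Fin (S.p+1), (if Iirr S i' ∧ i' ≠ 0 then X ^ ((i':ℕ)+1) else 0)
      else X ^ ((i.1:ℕ)+1))

theorem gpol_eval (β : V S → ℕ) (s : ℂ) :
    (gpol S β).eval s = ∑ a, (β a : ℂ) * lamp S (fun i => s ^ ((i:ℕ)+1)) a := by
  have h : ∀ a : V S, lamp S (fun i => s ^ ((i:ℕ)+1)) a = lam S a + (match a with
    | .inl ⟨i, _⟩ => (if i.1 = 0 then - csum S (fun i => s ^ ((i:ℕ)+1)) else s ^ ((i.1:ℕ)+1))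
    | .inr _ => 0) := by
    rintro (⟨i, j⟩ | r)
    · rfl
    · simp [lamp]
  simp only [h, mul_add, Finset.sum_add_distrib, gpol, eval_add, eval_C, eval_finsetSum, eval_mul]
  congr 1
  rw [Fintype.sum_sum_type, Fintype.sum_sigma]
  simp only [mul_zero, Finset.sum_const_zero, add_zero]
  refine Finset.sum_congr rfl fun i _ => ?_
  rw [Finset.sum_mul]
  refine Finset.sum_congr rfl fun j _ => ?_
  congr 1
  split_ifs
  · rw [eval_neg, eval_finsetSum, csum]
    congr 1
    refine Finset.sum_congr rfl fun i' _ => ?_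
    split_ifs <;> simp
  · simp

theorem gpol_coeff (β : V S → ℕ) (i : {i : Fin (S.p+1) // Iirr S i}) (hi : i.1 ≠ 0) :
    (gpol S β).coeff ((i.1:ℕ)+1) = (∑ j, (β (vI S i j) : ℂ)) - ∑ j, (β (v0 S j) : ℂ) := by
  rw [gpol, coeff_add, coeff_C, if_neg (by omega), zero_add, finsetSum_coeff]
  simp only [coeff_C_mul]
  have hne : i ≠ i0 S := fun h => hi (by rw [h]; rfl)
  rw [Finset.sum_eq_add (i0 S) i (fun h => hne h.symm)]
  · rw [if_pos (show (i0 S).1 = 0 from rfl), if_neg hi, coeff_X_pow, if_pos rfl, coeff_neg,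
      finsetSum_coeff, Finset.sum_eq_single i.1]
    · rw [if_pos ⟨i.2, hi⟩, coeff_X_pow, if_pos rfl]
      change (∑ j, (β (v0 S j) : ℂ)) * -1 + _ = _
      ring
    · intro b _ hb
      split_ifs
      · rw [coeff_X_pow, if_neg]
        intro h
        exact hb (Fin.ext (by omega))
      · simp
    · simp
  · rintro b _ ⟨hb, hb'⟩
    rw [if_neg, coeff_X_pow, if_neg, mul_zero]
    · intro h
      exact hb' (Subtype.ext (Fin.ext (by omega)))
    · intro h
      exact hb (Subtype.ext h)
  · simp
  · simp

theorem exists_generic (S : Setup) : ∃ c : Fin (S.p+1) → ℂ, ∀ β : V S → ℕ,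
    (∑ a, (β a : ℂ) * lamp S c a = 0) → balanced S β := by
  have hcount : (⋃ β : V S → ℕ, {s : ℂ | gpol S β ≠ 0 ∧ (gpol S β).IsRoot s}).Countable := by
    refine Set.countable_iUnion fun β => Set.Finite.countable ?_
    by_cases h : gpol S β = 0
    · simp [h]
    · refine (Polynomial.finite_setOfPred_isRoot h).subset fun s hs => hs.2
  obtain ⟨s, hs⟩ : ∃ s : ℂ, s ∉ ⋃ β : V S → ℕ, {s : ℂ | gpol S β ≠ 0 ∧ (gpol S β).IsRoot s} := by
    by_contra hcon
    push Not at hcon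
    exact not_countable_complex (by rw [← Set.eq_univ_of_forall hcon]; exact hcount)
  refine ⟨fun i => s ^ ((i:ℕ)+1), fun β hβ i hi => ?_⟩
  rw [← gpol_eval] at hβ
  have h0 : gpol S β = 0 := by
    by_contra hne
    exact hs (Set.mem_iUnion.2 ⟨β, hne, hβ⟩)
  have := gpol_coeff β i hi
  rw [h0, coeff_zero, eq_comm, sub_eq_zero] at this
  exact_mod_cast this.symm

theorem lamp_lam (c : Fin (S.p+1) → ℂ) (h : ∀ i : Fin (S.p+1), Iirr S i → i = 0) : lamp S c = lam S := by
  funext a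
  have hc : csum S c = 0 := Finset.sum_eq_zero fun i _ => if_neg fun hi => hi.2 (h i hi.1)
  rcases a with ⟨i, j⟩ | r
  · simp [lamp, h i.1 i.2, hc]
  · rfl

/-- total subspace -/
def sU (W : ∀ a : V S, Submodule ℂ (Fin (alN S a) → ℂ)) (i : {i : Fin (S.p+1) // Iirr S i}) :
    Submodule ℂ (Fin S.n → ℂ) := ⨅ j, (W (vI S i j)).comap (Matrix.toLin' (Pr S i.1 j))

theorem mem_sU {W : ∀ a : V S, Submodule ℂ (Fin (alN S a) → ℂ)} {i : {i : Fin (S.p+1) // Iirr S i}} {v} :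
    v ∈ sU W i ↔ ∀ j, Pr S i.1 j *ᵥ v ∈ W (vI S i j) := by
  rw [sU, Submodule.mem_iInf]
  exact Iff.rfl

theorem finrank_sU (W : ∀ a : V S, Submodule ℂ (Fin (alN S a) → ℂ)) (i : {i : Fin (S.p+1) // Iirr S i}) :
    Module.finrank ℂ (sU W i) = ∑ j, Module.finrank ℂ (W (vI S i j)) := by
  rw [← Module.finrank_pi_fintype]
  let e : sU W i →ₗ[ℂ] (∀ j, W (vI S i j)) :=
    LinearMap.pi fun j => (Matrix.toLin' (Pr S i.1 j)).restrict (p := sU W i) (q := W (vI S i j))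
      (fun v hv => mem_sU.1 hv j)
  have he : ∀ v j, ((e v j : W (vI S i j)) : Fin (alN S (vI S i j)) → ℂ) = Pr S i.1 j *ᵥ (v : Fin S.n → ℂ) := by
    intro v j; rfl
  refine LinearEquiv.finrank_eq (LinearEquiv.ofBijective e ⟨?_, ?_⟩)
  · rw [injective_iff_map_eq_zero]
    intro v hv
    apply Subtype.ext
    rw [vec_ext i.1 (v : Fin S.n → ℂ)]
    refine Finset.sum_eq_zero fun j _ => ?_
    have := he v j
    rw [hv] at this
    have h2 : Pr S i.1 j *ᵥ (v : Fin S.n → ℂ) = 0 := this.symm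
    rw [h2, Matrix.mulVec_zero]
  · intro w
    have hPI : ∀ (j : Fin (S.m i.1)) (v : Fin (DD S i.1 j 0) → ℂ), Pr S i.1 j *ᵥ (In S i.1 j *ᵥ v) = v := by
      intro j v
      rw [Matrix.mulVec_mulVec, Pr_In, Matrix.one_mulVec]
    have hPI' : ∀ (j b : Fin (S.m i.1)) (v : Fin (DD S i.1 b 0) → ℂ), j ≠ b →
        Pr S i.1 j *ᵥ (In S i.1 b *ᵥ v) = 0 := by
      intro j b v hb
      rw [Matrix.mulVec_mulVec, Pr_In_ne _ _ _ _ hb, Matrix.zero_mulVec]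
    have hw : ∀ j, Pr S i.1 j *ᵥ (∑ j', In S i.1 j' *ᵥ (w j' : Fin (alN S (vI S i j')) → ℂ)) = (w j : Fin (alN S (vI S i j)) → ℂ) := by
      intro j
      rw [Matrix.mulVec_sum, Finset.sum_eq_single j]
      · exact hPI j _
      · intro b _ hb
        exact hPI' j b _ hb.symm
      · simp
    refine ⟨⟨∑ j', In S i.1 j' *ᵥ (w j' : Fin (alN S (vI S i j')) → ℂ), mem_sU.2 fun j => ?_⟩, ?_⟩
    · exact (congrArg (· ∈ W (vI S i j)) (hw j)).mpr (w j).2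
    · funext j
      exact Subtype.ext (hw j)

theorem UI_dbl (W : ∀ a : V S, Submodule ℂ (Fin (alN S a) → ℂ)) (i : Fin (S.p+1)) (hi : Iirr S i) :
    UI (fun a => dbl (W a)) i hi = dbl (sU W ⟨i, hi⟩) := by
  ext ⟨v, w⟩
  rw [UI, Submodule.mem_iInf, Submodule.mem_prod, mem_sU, mem_sU]
  constructor
  · intro h
    exact ⟨fun j => (mem_cm.1 (h j)).1, fun j => (mem_cm.1 (h j)).2⟩
  · intro h j
    exact mem_cm.2 ⟨h.1 j, h.2 j⟩

/-- irreducibility of the representation -/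
theorem T2irr {M : Rep S (alN S)} {c : Fin (S.p+1) → ℂ}
    (hgen : ∀ β : V S → ℕ, (∑ a, (β a : ℂ) * lamp S c a = 0) → balanced S β)
    (hM : onMu S (lamp S c) M) (hB : BijM M)
    (hL : ∀ i j κ, LInv (mf M i j κ)) (hR : ∀ i j κ, RInv (mg M i j κ))
    (hI : ∀ W0 : Submodule ℂ (Fin S.n → ℂ), (∀ i l, ∀ v ∈ W0, cf (ta M c i) l *ᵥ v ∈ W0) →
      W0 = ⊥ ∨ W0 = ⊤) : irredRep S M := by
  intro W hW
  have hrel : isRel M M (fun a => dbl (W a)) := fun a b ρ =>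
    ⟨Pv_dbl.2 (hW a b ρ).1, Pv_dbl.2 (hW a b ρ).2⟩
  have hbal := hgen _ (trace_id hM hW)
  have hd := relData_of hrel
  set U0 := sU W (i0 S) with hU0
  have hU00 : UW (fun a => dbl (W a)) 0 = dbl U0 := by
    rw [UW_irr _ 0 (i0 S).2]; exact UI_dbl W 0 _
  have hmap : ∀ i, UW (fun a => dbl (W a)) i = dbl (U0.map (Matrix.toLin' (mP M i))) := by
    intro i
    by_cases hi : Iirr S i ∧ i ≠ 0
    · have hP := hd.P i
      rw [hU00, UW_irr _ i hi.1, UI_dbl W i hi.1, Pv_dbl] at hP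
      rw [UW_irr _ i hi.1, UI_dbl W i hi.1]
      congr 1 <;>
      · symm
        apply Submodule.eq_of_le_of_finrank_eq
        · rintro _ ⟨v, hv, rfl⟩
          rw [Matrix.toLin'_apply]; exact hP v hv
        · have h1 := hbal ⟨i, hi.1⟩ hi.2
          rw [finrank_sU, ← h1]
          have h2 : Module.finrank ℂ (U0.map (Matrix.toLin' (mP M i))) = Module.finrank ℂ U0 := by
            refine (LinearEquiv.finrank_eq (Submodule.equivMapOfInjective _ ?_ U0)).symm
            rw [Matrix.toLin'_apply']
            exact Matrix.mulVec_injective_of_isUnit ((Matrix.isUnit_iff_isUnit_det _).2 (hB i))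
          rw [h2, hU0, finrank_sU]
          rfl
    · rw [mP_triv M hi, Matrix.toLin'_one, Submodule.map_id, ← hU00]
      by_cases h0 : i = 0
      · rw [h0]
      · exact hd.reg i (fun h => hi ⟨h, h0⟩)
  have hPi : ∀ i, Pv (mP M i)⁻¹ (mP M i)⁻¹ (UW (fun a => dbl (W a)) i) (UW (fun a => dbl (W a)) 0) := by
    intro i
    rw [hmap i, hU00, Pv_dbl]
    rintro _ ⟨v, hv, rfl⟩
    rw [Matrix.toLin'_apply, Matrix.mulVec_mulVec, Matrix.nonsing_inv_mul _ (hB i), Matrix.one_mulVec]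
    exact hv
  have hta := bwd_ta c hd hPi
  rw [hU00] at hta
  have hWa : ∀ a, p1 (mkW (LW (fun a => dbl (W a))) a) = W a := by
    intro a; rw [mkW_LW, p1_dbl]
  rcases hI U0 (fun i l => Pv_dbl.1 (hta i l)) with h | h
  · left
    have hb : ∀ i, p1 (UW (fun a => dbl (W a)) i) = ⊥ := by
      intro i; rw [hmap, p1_dbl, h, Submodule.map_bot]
    have hLb : ∀ i j κ, p1 (LW (fun a => dbl (W a)) i j κ) = ⊥ := by
      intro i j κ
      induction κ with
      | zero =>
        rw [eq_bot_iff]; intro v hv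
        have := (hd.inn i j).p1 v hv
        rw [hb, Submodule.mem_bot] at this
        have h2 : Pr S i j *ᵥ (In S i j *ᵥ v) = v := by
          rw [Matrix.mulVec_mulVec, Pr_In, Matrix.one_mulVec]
        rw [Submodule.mem_bot, ← h2, this, Matrix.mulVec_zero]
      | succ κ ih =>
        rw [eq_bot_iff]; intro v hv
        have := (hd.f i j κ).p1 v hv
        rw [ih, Submodule.mem_bot] at this
        apply (hL i j κ).inj
        change mf M i j κ *ᵥ v = mf M i j κ *ᵥ 0
        rw [this, Matrix.mulVec_zero]
    intro a
    rw [← hWa a]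
    rcases a with ⟨i, j⟩ | ⟨i, j, κ⟩
    · exact hLb i.1 j 0
    · exact hLb i j (κ+1)
  · right
    have hb : ∀ i, p1 (UW (fun a => dbl (W a)) i) = ⊤ := by
      intro i; rw [hmap, p1_dbl, h, Submodule.map_top, LinearMap.range_eq_top, Matrix.toLin'_apply']
      exact Matrix.mulVec_surjective_iff_isUnit.2 ((Matrix.isUnit_iff_isUnit_det _).2 (hB i))
    have hLb : ∀ i j κ, p1 (LW (fun a => dbl (W a)) i j κ) = ⊤ := by
      intro i j κ
      induction κ with
      | zero =>
        rw [eq_top_iff]; intro v _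
        have := (hd.pr i j).p1 (In S i j *ᵥ v) (by rw [hb]; trivial)
        rwa [Matrix.mulVec_mulVec, Pr_In, Matrix.one_mulVec] at this
      | succ κ ih =>
        rw [eq_top_iff]; intro v _
        obtain ⟨w, hw⟩ := (hR i j κ).surj v
        have := (hd.g i j κ).p1 w (by rw [ih]; trivial)
        have hw' : mg M i j κ *ᵥ w = v := hw
        rwa [hw'] at this
    intro a
    rw [← hWa a]
    rcases a with ⟨i, j⟩ | ⟨i, j, κ⟩
    · exact hLb i.1 j 0
    · exact hLb i j (κ+1)

end quiH

section quiI

variable {S : Setup}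

theorem Pr_In_apply (i i' : Fin (S.p+1)) (X : Mn S) (j : Fin (S.m i)) (j' : Fin (S.m i'))
    (x : Fin (S.nn i j)) (y : Fin (S.nn i' j')) :
    (Pr S i j * X * In S i' j') x y = X (S.emb i ⟨j, x⟩) (S.emb i' ⟨j', y⟩) := by
  change (Pr0 S i j * X * In0 S i' j') x y = _
  simp [Matrix.mul_apply, Pr0, In0]

theorem crossMat_eq (M : Rep S (alN S)) (i : {i : Fin (S.p+1) // Iirr S i}) (hi : i.1 ≠ 0) :
    crossMat S M i = (mP M i.1).submatrix (S.emb i.1) (S.emb 0) := by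
  ext ⟨j', x⟩ ⟨j, y⟩
  have h : 0 < arr S (v0 S j) (vI S i j') := by rw [arr_cross S i hi]; exact Nat.one_pos
  have h1 : crossMat S M i ⟨j', x⟩ ⟨j, y⟩ = fN M (v0 S j) (vI S i j') 0 x y := by
    simp only [crossMat, Matrix.of_apply]
    rw [dif_pos h, fN, dif_pos h]
  rw [h1, ex_P M i hi]
  exact Pr_In_apply _ _ _ _ _ _ _

theorem crossBij_iff (M : Rep S (alN S)) : crossBij S M ↔ BijM M := by
  have key : ∀ i : {i : Fin (S.p+1) // Iirr S i}, i.1 ≠ 0 →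
      (Function.Bijective ((crossMat S M i).mulVec) ↔ IsUnit (mP M i.1).det) := by
    intro i hi
    have h1 : (crossMat S M i).mulVec = (Equiv.arrowCongr (S.emb i.1).symm (Equiv.refl ℂ)) ∘
        (mP M i.1).mulVec ∘ (Equiv.arrowCongr (S.emb 0) (Equiv.refl ℂ)) := by
      funext v
      rw [crossMat_eq M i hi]
      exact Matrix.submatrix_mulVec_equiv _ _ _ _
    have h2 : Function.Bijective ((crossMat S M i).mulVec) ↔ Function.Bijective (mP M i.1).mulVec := by
      rw [h1]
      exact (Equiv.comp_bijective _ _).trans (Equiv.bijective_comp _ _)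
    rw [h2, ← Matrix.isUnit_iff_isUnit_det]
    exact ⟨fun h => Matrix.mulVec_surjective_iff_isUnit.1 h.2, fun h =>
      ⟨Matrix.mulVec_injective_of_isUnit h, Matrix.mulVec_surjective_iff_isUnit.2 h⟩⟩
  constructor
  · intro h i
    by_cases hi : Iirr S i ∧ i ≠ 0
    · exact (key ⟨i, hi.1⟩ hi.2).1 (h ⟨i, hi.1⟩ hi.2)
    · rw [mP_triv M hi, Matrix.det_one]; exact isUnit_one
  · intro h i hi
    exact (key i hi).2 (h i.1)

/-- block data for building a representation -/
structure Bld (S : Setup) where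
  P : Fin (S.p+1) → Mn S
  Q : Fin (S.p+1) → Mn S
  Γ : ∀ i : Fin (S.p+1), Fin (S.m i) → Fin (S.m i) → ℕ → Mn S
  f : ∀ (i : Fin (S.p+1)) (j : Fin (S.m i)) (κ : ℕ),
    Matrix (Fin (DD S i j κ)) (Fin (DD S i j (κ+1))) ℂ
  g : ∀ (i : Fin (S.p+1)) (j : Fin (S.m i)) (κ : ℕ),
    Matrix (Fin (DD S i j (κ+1))) (Fin (DD S i j κ)) ℂ

namespace Bld
variable (D : Bld S)

/-- assembled intra maps -/
def HH (i : Fin (S.p+1)) (t : ℕ) : Mn S :=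
  ∑ a, ∑ b, In S i b * (Pr S i b * D.Γ i a b t * In S i a) * Pr S i a

theorem HH_blk (i : Fin (S.p+1)) (t : ℕ) (a b : Fin (S.m i)) :
    Pr S i b * D.HH i t * In S i a = Pr S i b * D.Γ i a b t * In S i a :=
  blk S i i (fun a b => Pr S i b * D.Γ i a b t * In S i a) a b

/-- forward arrows -/
def ff : ∀ a b : V S, ℕ → Matrix (Fin (alN S b)) (Fin (alN S a)) ℂ
  | .inl ⟨i, j⟩, .inl ⟨i', j'⟩, t =>
      Pr S i'.1 j' * (if i.1 = 0 ∧ i'.1 ≠ 0 then D.P i'.1 else D.HH i'.1 t) * In S i.1 j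
  | .inl _, .inr _, _ => 0
  | .inr ⟨i, j, κ⟩, .inl ⟨i', j'⟩, _ => Pr S i'.1 j' * (In S i j * io (DD S i j) (D.f i j) (κ+1))
  | .inr ⟨i, j, κ⟩, .inr ⟨i', j', κ'⟩, _ =>
      if h : i = i' ∧ (j:ℕ) = (j':ℕ) ∧ (κ:ℕ) = (κ':ℕ)+1 then
        (D.f i j κ).submatrix (Fin.cast (by
          obtain ⟨rfl, h2, h3⟩ := h; obtain rfl := Fin.ext h2; rw [h3]; rfl)) id
      else 0

/-- backward arrows -/
def gg : ∀ a b : V S, ℕ → Matrix (Fin (alN S a)) (Fin (alN S b)) ℂ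
  | .inl ⟨i, j⟩, .inl ⟨i', j'⟩, t =>
      Pr S i.1 j * (if i.1 = 0 ∧ i'.1 ≠ 0 then D.Q i'.1 else D.HH i.1 t) * In S i'.1 j'
  | .inl _, .inr _, _ => 0
  | .inr ⟨i, j, κ⟩, .inl ⟨i', j'⟩, _ => so (DD S i j) (D.g i j) (κ+1) * Pr S i j * In S i'.1 j'
  | .inr ⟨i, j, κ⟩, .inr ⟨i', j', κ'⟩, _ =>
      if h : i = i' ∧ (j:ℕ) = (j':ℕ) ∧ (κ:ℕ) = (κ':ℕ)+1 then
        (D.g i j κ).submatrix id (Fin.cast (by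
          obtain ⟨rfl, h2, h3⟩ := h; obtain rfl := Fin.ext h2; rw [h3]; rfl))
      else 0

/-- the representation -/
def M : Rep S (alN S) where
  f a b ρ := D.ff a b ρ
  g a b ρ := D.gg a b ρ

theorem fN_M (a b : V S) (t : ℕ) (h : t < arr S a b) : fN D.M a b t = D.ff a b t := by
  rw [fN, dif_pos h]; rfl
theorem gN_M (a b : V S) (t : ℕ) (h : t < arr S a b) : gN D.M a b t = D.gg a b t := by
  rw [gN, dif_pos h]; rfl

/-- two-sided Peirce decomposition -/
theorem peirce (i i' : Fin (S.p+1)) (X : Mn S) :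
    ∑ a, ∑ b, In S i' b * (Pr S i' b * X * In S i a) * Pr S i a = X := by
  have : ∀ a, ∑ b, In S i' b * (Pr S i' b * X * In S i a) * Pr S i a = X * (In S i a * Pr S i a) := by
    intro a
    have h2 : ∀ b, In S i' b * (Pr S i' b * X * In S i a) * Pr S i a =
      (In S i' b * Pr S i' b) * (X * (In S i a * Pr S i a)) := by
      intro b; simp only [Matrix.mul_assoc]
    rw [Finset.sum_congr rfl fun b _ => h2 b, ← Finset.sum_mul, sum_In_Pr, Matrix.one_mul]
  rw [Finset.sum_congr rfl fun a _ => this a, ← Finset.mul_sum, sum_In_Pr, Matrix.mul_one]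

theorem mP_M (i : Fin (S.p+1)) (hi : Iirr S i ∧ i ≠ 0) : mP D.M i = D.P i := by
  rw [mP, dif_pos hi]
  have h : ∀ j j', aP D.M i hi.1 j j' = Pr S i j' * D.P i * In S 0 j := by
    intro j j'
    refine (D.fN_M (v0 S j) (vI S ⟨i, hi.1⟩ j') 0 (by
      rw [arr_cross S ⟨i, hi.1⟩ hi.2]; exact Nat.one_pos)).trans ?_
    change Pr S i j' * (if (i0 S).1 = 0 ∧ i ≠ 0 then D.P i else D.HH i 0) * In S 0 j = _
    rw [if_pos ⟨rfl, hi.2⟩]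
  simp only [h]
  exact peirce 0 i (D.P i)

theorem mQ_M (i : Fin (S.p+1)) (hi : Iirr S i ∧ i ≠ 0) : mQ D.M i = D.Q i := by
  rw [mQ, dif_pos hi]
  have h : ∀ j j', aQ D.M i hi.1 j j' = Pr S 0 j * D.Q i * In S i j' := by
    intro j j'
    refine (D.gN_M (v0 S j) (vI S ⟨i, hi.1⟩ j') 0 (by
      rw [arr_cross S ⟨i, hi.1⟩ hi.2]; exact Nat.one_pos)).trans ?_
    change Pr S 0 j * (if (i0 S).1 = 0 ∧ i ≠ 0 then D.Q i else D.HH 0 0) * In S i j' = _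
    rw [if_pos ⟨rfl, hi.2⟩]
  simp only [h]
  exact peirce i 0 (D.Q i)

theorem mG_M (i : Fin (S.p+1)) (hΓ : Val (eP S i) (S.q i) Finset.univ (D.Γ i))
    (j j' : Fin (S.m i)) (t : ℕ) (ht : t < dq (S.q i) j j') : mG D.M i j j' t = D.Γ i j j' t := by
  obtain ⟨h1, h2⟩ := hΓ j (Finset.mem_univ _) j' (Finset.mem_univ _) t ht
  have hne : j ≠ j' := by
    rintro rfl
    rw [dq_self] at ht; omega
  have hi : Iirr S i := by
    by_contra hi
    exact hne (sub_reg hi j j')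
  have hno : ¬ (i = 0 ∧ i ≠ 0) := by tauto
  have h3 : In S i j' * (Pr S i j' * D.Γ i j j' t * In S i j) * Pr S i j = D.Γ i j j' t := by
    rw [show In S i j' * (Pr S i j' * D.Γ i j j' t * In S i j) * Pr S i j =
      (In S i j' * Pr S i j') * D.Γ i j j' t * (In S i j * Pr S i j) by simp only [Matrix.mul_assoc]]
    change eP S i j' * D.Γ i j j' t * eP S i j = _
    rw [h1, h2]
  rw [mG, dif_pos hi]
  by_cases hj : j < j'
  · rw [if_pos hj]
    have : aF D.M i hi j j' t = Pr S i j' * D.Γ i j j' t * In S i j := by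
      refine (D.fN_M (vI S ⟨i, hi⟩ j) (vI S ⟨i, hi⟩ j') t (by
        rw [arr_intra, if_pos hj]; exact ht)).trans ?_
      change Pr S i j' * (if i = 0 ∧ i ≠ 0 then D.P i else D.HH i t) * In S i j = _
      rw [if_neg hno, HH_blk]
    rw [this, h3]
  · rw [if_neg hj]
    have hj' : j' < j := by omega
    have : aG D.M i hi j j' t = Pr S i j' * D.Γ i j j' t * In S i j := by
      refine (D.gN_M (vI S ⟨i, hi⟩ j') (vI S ⟨i, hi⟩ j) t (by
        rw [arr_intra, if_pos hj']; rw [dq_symm] at ht; exact ht)).trans ?_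
      change Pr S i j' * (if i = 0 ∧ i ≠ 0 then D.Q i else D.HH i t) * In S i j = _
      rw [if_neg hno, HH_blk]
    rw [this, h3]

theorem mf_M (i : Fin (S.p+1)) (j : Fin (S.m i)) (κ : ℕ) : mf D.M i j κ = D.f i j κ := by
  by_cases hκ : κ < S.e i j - 1
  swap
  · exact mat_ext0 (DD_ge S i j κ (by omega)) _ _
  cases κ with
  | zero =>
    rw [mf, dif_pos hκ]
    have hio : io (DD S i j) (D.f i j) (0+1) = D.f i j 0 := by
      rw [io, io, Matrix.one_mul]
    split_ifs with hi
    · refine (D.fN_M (vR S i j 0 hκ) (vI S ⟨i, hi⟩ j) 0 (by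
        have := arr_rb S i hi j 0 hκ ⟨⟨i, hi⟩, j⟩
        rw [if_pos ⟨rfl, rfl⟩] at this
        exact lt_of_lt_of_eq Nat.one_pos this.symm)).trans ?_
      change Pr S i j * (In S i j * io (DD S i j) (D.f i j) (0+1)) = _
      rw [hio, ← Matrix.mul_assoc, Pr_In, Matrix.one_mul]
    · have h : ∀ j', aL D.M i j hκ 0 (i0 S).2 j' = Pr S 0 j' * (In S i j * D.f i j 0) := by
        intro j'
        refine (D.fN_M (vR S i j 0 hκ) (v0 S j') 0 (by
          have := arr_rb_reg S i hi j 0 hκ ⟨i0 S, j'⟩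
          rw [if_pos ⟨rfl, rfl⟩] at this
          exact lt_of_lt_of_eq Nat.one_pos this.symm)).trans ?_
        change Pr S 0 j' * (In S i j * io (DD S i j) (D.f i j) (0+1)) = _
        rw [hio]
      simp only [h]
      have h2 : ∑ j', In S 0 j' * (Pr S 0 j' * (In S i j * D.f i j 0)) = In S i j * D.f i j 0 := by
        simp only [← Matrix.mul_assoc (In S 0 _)]
        rw [← Matrix.sum_mul, sum_In_Pr, Matrix.one_mul]
      rw [h2, ← Matrix.mul_assoc, Pr_In, Matrix.one_mul]
  | succ κ =>
    rw [mf, dif_pos hκ]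
    refine (D.fN_M (vR S i j (κ+1) hκ) (vR S i j κ (by omega)) 0 (by
      rw [arr_rr, if_pos ⟨rfl, rfl, rfl⟩]; exact Nat.one_pos)).trans ?_
    refine (dif_pos (show i = i ∧ (j:ℕ) = (j:ℕ) ∧ κ + 1 = κ + 1 from ⟨rfl, rfl, rfl⟩)).trans ?_
    rfl

theorem mg_M (i : Fin (S.p+1)) (j : Fin (S.m i)) (κ : ℕ) : mg D.M i j κ = D.g i j κ := by
  by_cases hκ : κ < S.e i j - 1
  swap
  · exact mat_ext0' (DD_ge S i j κ (by omega)) _ _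
  cases κ with
  | zero =>
    rw [mg, dif_pos hκ]
    have hso : so (DD S i j) (D.g i j) (0+1) = D.g i j 0 := by
      rw [so, so, Matrix.mul_one]
    split_ifs with hi
    · refine (D.gN_M (vR S i j 0 hκ) (vI S ⟨i, hi⟩ j) 0 (by
        have := arr_rb S i hi j 0 hκ ⟨⟨i, hi⟩, j⟩
        rw [if_pos ⟨rfl, rfl⟩] at this
        exact lt_of_lt_of_eq Nat.one_pos this.symm)).trans ?_
      change so (DD S i j) (D.g i j) (0+1) * Pr S i j * In S i j = _
      rw [hso, Matrix.mul_assoc, Pr_In, Matrix.mul_one]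
    · have h : ∀ j', aR D.M i j hκ 0 (i0 S).2 j' = D.g i j 0 * Pr S i j * In S 0 j' := by
        intro j'
        refine (D.gN_M (vR S i j 0 hκ) (v0 S j') 0 (by
          have := arr_rb_reg S i hi j 0 hκ ⟨i0 S, j'⟩
          rw [if_pos ⟨rfl, rfl⟩] at this
          exact lt_of_lt_of_eq Nat.one_pos this.symm)).trans ?_
        change so (DD S i j) (D.g i j) (0+1) * Pr S i j * In S 0 j' = _
        rw [hso]
      simp only [h]
      have h2 : ∑ j', D.g i j 0 * Pr S i j * In S 0 j' * Pr S 0 j' = D.g i j 0 * Pr S i j := by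
        simp only [Matrix.mul_assoc _ (In S 0 _)]
        rw [← Matrix.mul_sum, sum_In_Pr, Matrix.mul_one]
      rw [h2, Matrix.mul_assoc, Pr_In, Matrix.mul_one]
  | succ κ =>
    rw [mg, dif_pos hκ]
    refine (D.gN_M (vR S i j (κ+1) hκ) (vR S i j κ (by omega)) 0 (by
      rw [arr_rr, if_pos ⟨rfl, rfl, rfl⟩]; exact Nat.one_pos)).trans ?_
    refine (dif_pos (show i = i ∧ (j:ℕ) = (j:ℕ) ∧ κ + 1 = κ + 1 from ⟨rfl, rfl, rfl⟩)).trans ?_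
    rfl

end Bld
end quiI

section quiJ
variable {S : Setup}

/-- coefficient matrices -/
def CM (A : PMat S) (l : ℕ) : Mn S := Matrix.of fun a b => (A a b).coeff l

theorem CM_eq (A : PMat S) (l : ℕ) : CM A l = (matPolyEquiv A).coeff l := by
  ext a b; rw [matPolyEquiv_coeff_apply]; rfl

/-- passage to the truncated ring -/
def toT (k : ℕ) (A : PMat S) : TT (Mn S) k := tmk k (matPolyEquiv A)

theorem cf_toT {k : ℕ} (A : PMat S) {l : ℕ} (hl : l < k) : cf (toT k A) l = CM A l := by
  rw [toT, cf_tmk' _ hl, CM_eq]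

theorem CM_ge {k : ℕ} {A : PMat S} (h : degLT S k A) {l : ℕ} (hl : k ≤ l) : CM A l = 0 := by
  ext a b
  exact coeff_eq_zero_of_degree_lt ((h a b).trans_le (by exact_mod_cast hl))

theorem cf_toT' {k : ℕ} {A : PMat S} (h : degLT S k A) (l : ℕ) : cf (toT k A) l = CM A l := by
  by_cases hl : l < k
  · exact cf_toT A hl
  · rw [cf_ge _ (by omega), CM_ge h (by omega)]

/-- back from the truncated ring -/
def ofT {k : ℕ} (p : TT (Mn S) k) : PMat S :=
  Matrix.of fun a b => ∑ l ∈ Finset.range k, monomial l (cf p l a b)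

theorem CM_ofT {k : ℕ} (p : TT (Mn S) k) (l : ℕ) : CM (ofT p) l = cf p l := by
  ext a b
  simp only [CM, ofT, Matrix.of_apply, finsetSum_coeff, coeff_monomial]
  rw [Finset.sum_ite_eq']
  split_ifs with h
  · rfl
  · rw [cf_ge p (by simpa using h)]; rfl

theorem degLT_ofT {k : ℕ} (p : TT (Mn S) k) : degLT S k (ofT p) := by
  intro a b
  rw [degree_lt_iff_coeff_zero]
  intro l hl
  have := congrFun (congrFun (CM_ofT p l) a) b
  rw [cf_ge p hl] at this
  exact this

theorem toT_ofT {k : ℕ} (p : TT (Mn S) k) : toT k (ofT p) = p :=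
  cf_ext fun l hl => by rw [cf_toT _ hl, CM_ofT]

theorem CM_ext {A A' : PMat S} (h : ∀ l, CM A l = CM A' l) : A = A' := by
  ext a b l
  exact congrFun (congrFun (h l) a) b

theorem toT_mul (k : ℕ) (A A' : PMat S) : toT k (A * A') = toT k A * toT k A' := by
  simp [toT]

theorem toT_eq (k : ℕ) (A A' : PMat S) :
    toT k A = toT k A' ↔ ∀ a b, (X ^ k : ℂ[X]) ∣ (A - A') a b := by
  constructor
  · intro h a b
    rw [X_pow_dvd_iff]
    intro d hd
    have h1 : CM A d = CM A' d := by rw [← cf_toT A hd, ← cf_toT A' hd, h]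
    have h2 := congrFun (congrFun h1 a) b
    simp only [CM, Matrix.of_apply] at h2
    simp [h2]
  · intro h
    apply cf_ext
    intro l hl
    rw [cf_toT A hl, cf_toT A' hl]
    ext a b
    have := (X_pow_dvd_iff.1 (h a b)) l hl
    simpa [CM, sub_eq_zero] using this

theorem inOrbit_iff (i : Fin (S.p+1)) (A : PMat S) : inOrbit S i A ↔ degLT S (S.kk i) A ∧
    ∃ g : TT (Mn S) (S.kk i), IsUnit (cf g 0) ∧
      g * toT (S.kk i) (Bmat S i) = toT (S.kk i) A * g := by
  have hk := S.hkk i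
  refine and_congr_right fun _ => ⟨?_, ?_⟩
  · rintro ⟨g, h1, h2⟩
    refine ⟨toT _ g, ?_, ?_⟩
    · rw [cf_toT _ hk]; exact h1
    · rw [← toT_mul, ← toT_mul, toT_eq]; exact h2
  · rintro ⟨g, h1, h2⟩
    refine ⟨ofT g, ?_, ?_⟩
    · rw [← CM_ofT] at h1; exact h1
    · rw [← toT_eq, toT_mul, toT_mul, toT_ofT]; exact h2

/-- residue block -/
def R0 (S : Setup) (i : Fin (S.p+1)) (j : Fin (S.m i)) :
    Matrix (Fin (DD S i j 0)) (Fin (DD S i j 0)) ℂ := S.R i j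

/-- block diagonal residue -/
def RR (S : Setup) (i : Fin (S.p+1)) : Mn S := ∑ j, In S i j * R0 S i j * Pr S i j

theorem emb_ext (i : Fin (S.p+1)) {X Y : Mn S}
    (h : ∀ j j', Pr S i j * X * In S i j' = Pr S i j * Y * In S i j') : X = Y := by
  rw [← Bld.peirce i i X, ← Bld.peirce i i Y]
  simp_rw [h]

theorem Pr_eP_In (i : Fin (S.p+1)) (j j' b : Fin (S.m i)) :
    Pr S i j * eP S i b * In S i j' = if j = b ∧ b = j' then Pr S i j * In S i j' else 0 := by
  by_cases h : j = b
  · subst h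
    rw [Pr_eP]
    by_cases h' : j = j'
    · simp [h']
    · simp [h', Pr_In_ne]
  · simp [h, Pr_eP_ne]

theorem RR_blk (i : Fin (S.p+1)) (j j' : Fin (S.m i)) :
    Pr S i j * RR S i * In S i j' = Pr S i j * (In S i j' * R0 S i j') := by
  rw [RR, Matrix.mul_sum, Matrix.sum_mul, Finset.sum_eq_single j']
  · rw [Matrix.mul_assoc, Matrix.mul_assoc, Pr_In, Matrix.mul_one]
  · intro b _ hb
    rw [Matrix.mul_assoc, Matrix.mul_assoc, Pr_In_ne _ _ _ _ hb, Matrix.mul_zero, Matrix.mul_zero]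
  · simp

theorem Bmat_entry (i : Fin (S.p+1)) (s t : Σ j : Fin (S.m i), Fin (S.nn i j)) (a b : Fin S.n)
    (ha : (S.emb i).symm a = s) (hb : (S.emb i).symm b = t) : Bmat S i a b =
    if h : s.1 = t.1 then
      (if Fin.cast (by rw [h]) s.2 = t.2 then reflect (S.kk i) (S.q i t.1) else 0)
        + C (S.R i t.1 (Fin.cast (by rw [h]) s.2) t.2) * X ^ (S.kk i - 1)
    else 0 := by
  subst ha hb; rfl

theorem CM_Bmat (i : Fin (S.p+1)) (l : ℕ) (hl : l < S.kk i) :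
    CM (Bmat S i) l = (∑ j, (S.q i j).coeff (S.kk i - l) • eP S i j) +
      if l = S.kk i - 1 then RR S i else 0 := by
  apply emb_ext i
  intro j j'
  rw [Matrix.mul_add, Matrix.add_mul, Matrix.mul_sum, Matrix.sum_mul]
  have h1 : ∀ b, Pr S i j * ((S.q i b).coeff (S.kk i - l) • eP S i b) * In S i j' =
      if b = j' then (S.q i b).coeff (S.kk i - l) • (Pr S i j * In S i j') else 0 := by
    intro b
    rw [Matrix.mul_smul, Matrix.smul_mul, Pr_eP_In]
    by_cases hb : b = j'
    · subst hb
      by_cases hj : j = b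
      · simp [hj]
      · simp [hj, Pr_In_ne]
    · simp [hb]
  rw [Finset.sum_congr rfl fun b _ => h1 b, Finset.sum_ite_eq', if_pos (Finset.mem_univ _)]
  have h2 : Pr S i j * (if l = S.kk i - 1 then RR S i else 0) * In S i j' =
     if l = S.kk i - 1 then Pr S i j * In S i j' * R0 S i j' else 0 := by
    split_ifs
    · rw [RR_blk, Matrix.mul_assoc]
    · simp
  rw [h2]
  refine Matrix.ext fun x y => ?_
  refine (Pr_In_apply i i _ j j' x y).trans ?_
  have hB : Bmat S i (S.emb i ⟨j, x⟩) (S.emb i ⟨j', y⟩) = _ :=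
    Bmat_entry i ⟨j, x⟩ ⟨j', y⟩ _ _ (Equiv.symm_apply_apply _ _) (Equiv.symm_apply_apply _ _)
  simp only [CM, Matrix.of_apply]
  rw [hB]
  by_cases hj : j = j'
  · subst hj
    rw [Pr_In, Matrix.one_mul, dif_pos rfl, Matrix.add_apply, coeff_add]
    congr 1
    · rw [Matrix.smul_apply, Matrix.one_apply]
      change (if x = y then reflect (S.kk i) (S.q i j) else 0).coeff l = _
      by_cases hxy : x = y
      · rw [if_pos hxy, if_pos hxy, coeff_reflect, revAt_le (by omega)]; simp
      · rw [if_neg hxy, if_neg hxy]; simp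
    · rw [coeff_C_mul, coeff_X_pow]
      by_cases h : l = S.kk i - 1
      · rw [if_pos h, if_pos h, mul_one]; rfl
      · rw [if_neg h, if_neg h, mul_zero]; rfl
  · rw [dif_neg hj, Pr_In_ne _ _ _ _ hj]
    simp

theorem toT_Bmat (i : Fin (S.p+1)) :
    toT (S.kk i) (Bmat S i) = BB (S.kk i) (eP S i) (S.q i) Finset.univ (RR S i) := by
  apply cf_ext
  intro l hl
  rw [cf_toT _ hl, cf_BB hl, CM_Bmat i l hl]

theorem CM_conj (g g' : Mn S) (A : PMat S) (l : ℕ) :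
    CM (g.map C * A * g'.map C) l = g * CM A l * g' := by
  rw [CM_eq, CM_eq, map_mul, map_mul, matPolyEquiv_map_C, matPolyEquiv_map_C, coeff_mul_C,
    coeff_C_mul]

theorem tupConj_iff (A A' : ∀ _ : Fin (S.p+1), PMat S) : tupConj S A A' ↔
    ∃ h : (Mn S)ˣ, ∀ i l, CM (A' i) l * h.val = h.val * CM (A i) l := by
  refine exists_congr fun g => forall_congr' fun i => ?_
  constructor
  · intro h l
    rw [h, CM_conj, mul_assoc, mul_assoc, Units.inv_mul, mul_one]
  · intro h
    apply CM_ext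
    intro l
    rw [CM_conj, ← h, mul_assoc, Units.mul_inv, mul_one]

end quiJ

section quiK
variable {S : Setup}

theorem dg_In (i : Fin (S.p+1)) (Z : Mn S) :
    dg (eP S i) Finset.univ Z = ∑ j, In S i j * (Pr S i j * Z * In S i j) * Pr S i j := by
  refine Finset.sum_congr rfl fun j _ => ?_
  simp only [eP, Matrix.mul_assoc]

theorem Pr_dg (i : Fin (S.p+1)) (Z : Mn S) (j : Fin (S.m i)) :
    Pr S i j * dg (eP S i) Finset.univ Z * In S i j = Pr S i j * Z * In S i j := by
  have h := (eP_orth S i).mul_dg (J := Finset.univ) Z j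
  rw [if_pos (Finset.mem_univ j)] at h
  calc Pr S i j * dg (eP S i) Finset.univ Z * In S i j
      = Pr S i j * (eP S i j * dg (eP S i) Finset.univ Z) * In S i j := by
        rw [← Matrix.mul_assoc (Pr S i j), Pr_eP]
    _ = Pr S i j * (eP S i j * Z * eP S i j) * In S i j := by rw [h]
    _ = (Pr S i j * eP S i j) * Z * (eP S i j * In S i j) := by simp only [Matrix.mul_assoc]
    _ = _ := by rw [Pr_eP, eP_In]

theorem dg_leg {M : Rep S (alN S)} {c : Fin (S.p+1) → ℂ} (i : Fin (S.p+1))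
    (h : ∀ j, star M c i j) :
    dg (eP S i) Finset.univ (mZ M c i) - mX (S.q i) Finset.univ Finset.univ (mG M i) = leg M i := by
  have h1 := (eP_orth S i).corner_mX (mG_Val M i)
  rw [← h1, ← dg_sub, dg_In, leg]
  refine Finset.sum_congr rfl fun j _ => ?_
  rw [h j]

/-- block diagonal matrices -/
def Dg (i : Fin (S.p+1)) (H : ∀ j : Fin (S.m i), Matrix (Fin (DD S i j 0)) (Fin (DD S i j 0)) ℂ) :
    Mn S := ∑ j, In S i j * H j * Pr S i j

theorem Dg_mul (i : Fin (S.p+1))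
    (H H' : ∀ j : Fin (S.m i), Matrix (Fin (DD S i j 0)) (Fin (DD S i j 0)) ℂ) :
    Dg i H * Dg i H' = Dg i (fun j => H j * H' j) := by
  rw [Dg, Dg, Matrix.sum_mul, Dg]
  refine Finset.sum_congr rfl fun j _ => ?_
  rw [Matrix.mul_sum, Finset.sum_eq_single j]
  · calc In S i j * H j * Pr S i j * (In S i j * H' j * Pr S i j)
        = In S i j * H j * (Pr S i j * In S i j) * H' j * Pr S i j := by simp only [Matrix.mul_assoc]
      _ = _ := by rw [Pr_In, Matrix.mul_one, Matrix.mul_assoc (In S i j)]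
  · intro b _ hb
    calc In S i j * H j * Pr S i j * (In S i b * H' b * Pr S i b)
        = In S i j * H j * (Pr S i j * In S i b) * H' b * Pr S i b := by simp only [Matrix.mul_assoc]
      _ = _ := by rw [Pr_In_ne _ _ _ _ hb.symm]; simp
  · simp

theorem Dg_one (i : Fin (S.p+1)) : Dg (S := S) i (fun _ => 1) = 1 := by
  rw [← sum_In_Pr S i, Dg]
  simp

theorem Dg_eP (i : Fin (S.p+1))
    (H : ∀ j : Fin (S.m i), Matrix (Fin (DD S i j 0)) (Fin (DD S i j 0)) ℂ) (b : Fin (S.m i)) :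
    Dg i H * eP S i b = eP S i b * Dg i H := by
  have h : eP S i b = Dg i (fun j => if j = b then 1 else 0) := by
    rw [Dg, Finset.sum_eq_single b]
    · rw [if_pos rfl, Matrix.mul_one, eP]
    · intro j _ hj; rw [if_neg hj]; simp
    · simp
  rw [h, Dg_mul, Dg_mul]
  congr 1; funext j
  split_ifs <;> simp

theorem tC_BB {i : Fin (S.p+1)} {H R R' : Mn S} (h1 : ∀ b, H * eP S i b = eP S i b * H)
    (h2 : H * R = R' * H) :
    tC _ H * BB (S.kk i) (eP S i) (S.q i) Finset.univ R =
      BB (S.kk i) (eP S i) (S.q i) Finset.univ R' * tC _ H := by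
  apply cf_ext
  intro l hl
  rw [cf_tC_mul, cf_mul_tC, cf_BB hl, cf_BB hl, mul_add, add_mul, Finset.mul_sum, Finset.sum_mul]
  congr 1
  · refine Finset.sum_congr rfl fun j _ => ?_
    rw [mul_smul_comm, smul_mul_assoc, h1]
  · split_ifs
    · exact h2
    · simp

theorem orbit_of {M : Rep S (alN S)} {c : Fin (S.p+1) → ℂ} (hM : onMu S (lamp S c) M) (hB : BijM M)
    (hI : irredRep S M) (i : Fin (S.p+1)) : inOrbit S i (ofT (ta M c i)) := by
  obtain ⟨hs, hc⟩ := (mom_iff M c).1 hM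
  have hH : ∀ j, ∃ H : (Matrix (Fin (DD S i j 0)) (Fin (DD S i j 0)) ℂ)ˣ,
      H.val * bR M i j = R0 S i j * H.val := by
    intro j
    obtain ⟨f, g, h1, h2, h3, h4⟩ := exists_chain (DD S i j) (xiN S i j) (R0 S i j)
      (fun κ => DD_succ S i j κ)
    obtain ⟨H, hH⟩ := chain_sim (hc i j) h1 (legs_L hc hI i j) (legs_R hc hI i j) h3 h4 (S.e i j)
      (DD_ge S i j _ (by omega))
    rw [h2] at hH
    exact ⟨H, hH⟩
  choose H hH using hH
  have e1 : Dg i (fun j => (H j).val) * Dg i (fun j => (H j)⁻¹.val) = 1 := by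
    rw [Dg_mul, ← Dg_one]; congr 1; funext j; exact Units.mul_inv _
  have e2 : Dg i (fun j => (H j)⁻¹.val) * Dg i (fun j => (H j).val) = 1 := by
    rw [Dg_mul, ← Dg_one]; congr 1; funext j; exact Units.inv_mul _
  have e3 : Dg i (fun j => (H j)⁻¹.val) * RR S i = leg M i * Dg i (fun j => (H j)⁻¹.val) := by
    change Dg i (fun j => (H j)⁻¹.val) * Dg i (R0 S i) = Dg i (bR M i) * _
    rw [Dg_mul, Dg_mul]; congr 1; funext j
    calc (H j)⁻¹.val * R0 S i j = (H j)⁻¹.val * (R0 S i j * (H j).val) * (H j)⁻¹.val := by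
          rw [Matrix.mul_assoc, Matrix.mul_assoc, Units.mul_inv, Matrix.mul_one]
      _ = _ := by rw [← hH, ← Matrix.mul_assoc, Units.inv_mul, Matrix.one_mul]
  generalize Dg i (fun j => (H j).val) = K at e1 e2
  have e4 := fun b => Dg_eP i (fun j => (H j)⁻¹.val) b
  generalize Dg i (fun j => (H j)⁻¹.val) = K' at e1 e2 e3 e4
  have e5 := tC_BB e4 e3
  obtain ⟨u, v, -, -, h1, h2, h3, h4⟩ := (FSs S i).b (mG M i) (mZ M c i) (mG_Val M i)
    (by rw [eJ_univ, Matrix.one_mul]) (by rw [eJ_univ, Matrix.mul_one])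
  rw [dg_leg i (hs i)] at h4
  rw [eJ_univ, map_one] at h1 h2
  rw [eJ_univ] at h3
  rw [inOrbit_iff]
  refine ⟨degLT_ofT _, tC _ (mP M i)⁻¹ * u * tC _ K', ?_, ?_⟩
  · rw [cf_mul_tC, cf_tC_mul, h3, mul_one]
    refine IsUnit.mul ?_ ?_
    · exact (Matrix.isUnit_iff_isUnit_det _).2 (Matrix.isUnit_nonsing_inv_det _ (hB i))
    · exact ⟨⟨K', K, e2, e1⟩, rfl⟩
  · rw [toT_Bmat, toT_ofT, ta, FM, h4]
    have e6 : tC (S.kk i) (mP M i) * tC _ (mP M i)⁻¹ = 1 := by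
      rw [← map_mul, Matrix.mul_nonsing_inv _ (hB i), map_one]
    generalize tC (S.kk i) (mP M i)⁻¹ = a at e6 ⊢
    generalize tC (S.kk i) (mP M i) = b at e6 ⊢
    rw [mul_assoc (a * u), e5]
    calc _ = a * (u * BB (S.kk i) (eP S i) (S.q i) Finset.univ (leg M i) * 1 * 1) * tC _ K' := by
          simp only [mul_assoc, mul_one, one_mul]
      _ = a * (u * BB (S.kk i) (eP S i) (S.q i) Finset.univ (leg M i) * (v * (b * a) * u)) * tC _ K' := by
          simp only [e6, mul_one, h2]
      _ = _ := by simp only [mul_assoc]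

theorem mZ_sum {M : Rep S (alN S)} (c : Fin (S.p+1) → ℂ) (hB : BijM M) :
    ∑ i, (mP M i)⁻¹ * mZ M c i * mP M i = 0 := by
  have h : ∀ i, (mP M i)⁻¹ * mZ M c i * mP M i =
      (if i = 0 then (∑ i', mQ M i' * mP M i') - csum S c • 1
        - ∑ i', (if Iirr S i' then 0 else leg M i') else 0) +
      ((if Iirr S i ∧ i ≠ 0 then c i else 0) • 1 - mQ M i * mP M i) +
      (if Iirr S i then 0 else leg M i) := by
    intro i
    by_cases hi : Iirr S i ∧ i ≠ 0
    · rw [if_neg hi.2, if_pos hi, if_pos hi.1, mZ, if_neg hi.2, if_pos hi.1]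
      rw [Matrix.mul_sub, Matrix.sub_mul, ← Matrix.mul_assoc _ (mP M i),
        Matrix.nonsing_inv_mul _ (hB i), Matrix.one_mul]
      simp [Matrix.nonsing_inv_mul _ (hB i)]
    · rw [mP_triv M hi, mQ_triv M hi, if_neg hi, inv_one, Matrix.one_mul, Matrix.mul_one, mZ]
      by_cases h0 : i = 0
      · have h1 : Iirr S i := Or.inr h0
        simp [h0, show Iirr S 0 from Or.inr rfl]
      · have h1 : ¬ Iirr S i := fun h => hi ⟨h, h0⟩
        simp [h0, h1]
  rw [Finset.sum_congr rfl fun i _ => h i, Finset.sum_add_distrib, Finset.sum_add_distrib,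
    Finset.sum_ite_eq', if_pos (Finset.mem_univ _), Finset.sum_sub_distrib, ← Finset.sum_smul]
  rw [csum]
  abel

theorem T1 {M : Rep S (alN S)} {c : Fin (S.p+1) → ℂ} (hM : onMu S (lamp S c) M) (hB : BijM M)
    (hI : irredRep S M) :
    isDSElem S (fun i => ofT (ta M c i)) ∧ irredTuple S (fun i => ofT (ta M c i)) := by
  refine ⟨⟨orbit_of hM hB hI, ?_⟩, ?_⟩
  · rw [← mZ_sum c hB]
    refine Finset.sum_congr rfl fun i _ => ?_
    change CM (ofT (ta M c i)) (S.kk i - 1) = _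
    rw [CM_ofT, cf_ta, FM_res]
  · intro W hW
    refine T1irr hM hB hI W fun i l _ v hv => ?_
    have := hW i l v hv
    rw [← CM_ofT]; exact this

end quiK

section quiL
variable {S : Setup}

theorem RR_dg (i : Fin (S.p+1)) : dg (eP S i) Finset.univ (RR S i) = RR S i := by
  rw [dg_In]
  conv_rhs => rw [RR]
  refine Finset.sum_congr rfl fun j _ => ?_
  rw [RR_blk, ← Matrix.mul_assoc (Pr S i j), Pr_In, Matrix.one_mul]

theorem loc_irr (i : Fin (S.p+1)) {A g : TT (Mn S) (S.kk i)} (h : (Mn S)ˣ) (hg : cf g 0 = h.val)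
    (hA : g * BB (S.kk i) (eP S i) (S.q i) Finset.univ (RR S i) = A * g) :
    ∃ Γ, Val (eP S i) (S.q i) Finset.univ Γ ∧
      tC _ h⁻¹.val * A * tC _ h.val = FS S i Γ (h⁻¹.val * cf A (S.kk i - 1) * h.val) ∧
      RR S i = dg (eP S i) Finset.univ (h⁻¹.val * cf A (S.kk i - 1) * h.val)
        - mX (S.q i) Finset.univ Finset.univ Γ := by
  have hk := S.hkk i
  have a1 : tC (S.kk i) h.val * tC _ h⁻¹.val = 1 := by rw [← map_mul, Units.mul_inv, map_one]
  have h0 : cf (tC (S.kk i) h⁻¹.val * g) 0 = 1 := by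
    rw [cf_tC_mul, hg, Units.inv_mul]
  obtain ⟨v, -, -, hv1, hv2, -⟩ := exists_inv (𝓐 := Mn S) hk (E := 1) (mul_one 1)
    (u := tC (S.kk i) h⁻¹.val * g) (by rw [map_one, one_mul]) (by rw [map_one, mul_one]) h0
  have hN : NNc (eJ (eP S i) Finset.univ) (BB (S.kk i) (eP S i) (S.q i) Finset.univ (RR S i))
      (tC _ h⁻¹.val * A * tC _ h.val) := by
    rw [eJ_univ]
    refine ⟨_, v, ⟨by rw [map_one, one_mul], by rw [map_one, mul_one]⟩,
      ⟨by rw [map_one, one_mul], by rw [map_one, mul_one]⟩, hv1, hv2, h0, ?_⟩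
    rw [map_one] at hv1
    rw [mul_assoc _ g, hA]
    calc tC _ h⁻¹.val * A * tC _ h.val
        = tC _ h⁻¹.val * A * tC _ h.val * (tC _ h⁻¹.val * g * v) := by rw [hv1, mul_one]
      _ = tC _ h⁻¹.val * A * (tC _ h.val * tC _ h⁻¹.val) * g * v := by simp only [mul_assoc]
      _ = _ := by rw [a1, mul_one, mul_assoc _ A]
  obtain ⟨Γ, h1, h2, h3⟩ := (FSs S i).c _ _ (RR_dg i) hN
  rw [cf_mul_tC, cf_tC_mul] at h2 h3
  exact ⟨Γ, h1, h2, h3⟩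

theorem loc_reg (i : Fin (S.p+1)) (hi : ¬ Iirr S i) {A g : TT (Mn S) (S.kk i)} (h h0 : (Mn S)ˣ)
    (hg : cf g 0 = h.val)
    (hA : g * BB (S.kk i) (eP S i) (S.q i) Finset.univ (RR S i) = A * g) (j : Fin (S.m i)) (κ : ℕ) :
    DD S i j (κ+1) = (PP (Pr S i j * (h0⁻¹.val * cf A (S.kk i - 1) * h0.val) * In S i j)
      (xiN S i j) (κ+1)).rank := by
  have hk : S.kk i = 1 := S.hreg i hi
  have h1 : h.val * RR S i = cf A (S.kk i - 1) * h.val := by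
    have := congrArg (fun p => cf p 0) hA
    simp only [cf_mul_zero (S.hkk i), hg, cf_BB (S.hkk i)] at this
    rw [if_pos (by omega)] at this
    have h2 : ∑ j, (S.q i j).coeff (S.kk i - 0) • eP S i j = 0 := by
      refine Finset.sum_eq_zero fun j _ => ?_
      rw [hk, show 1 - 0 = 1 from rfl, S.hq1, zero_smul]
    rw [h2, zero_add] at this
    rw [this, show S.kk i - 1 = 0 by omega]
  have e := eP_reg hi j
  let w : Matrix (Fin (DD S i j 0)) (Fin (DD S i j 0)) ℂ := Pr S i j * (h0⁻¹.val * h.val) * In S i j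
  let w' : Matrix (Fin (DD S i j 0)) (Fin (DD S i j 0)) ℂ := Pr S i j * (h⁻¹.val * h0.val) * In S i j
  have mm : ∀ X Y : Mn S, (Pr S i j * X * In S i j) * (Pr S i j * Y * In S i j) =
      Pr S i j * (X * Y) * In S i j := by
    intro X Y
    calc _ = Pr S i j * X * (In S i j * Pr S i j) * Y * In S i j := by simp only [Matrix.mul_assoc]
      _ = _ := by rw [e, Matrix.mul_one, Matrix.mul_assoc (Pr S i j)]
  have hw : w * w' = 1 := by
    have : h0⁻¹.val * h.val * (h⁻¹.val * h0.val) = 1 := by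
      rw [mul_assoc, ← mul_assoc h.val, Units.mul_inv, one_mul, Units.inv_mul]
    simp only [w, w', mm]
    rw [this, Matrix.mul_one, Pr_In]
  have hR : R0 S i j = Pr S i j * RR S i * In S i j := by
    rw [RR_blk, ← Matrix.mul_assoc, Pr_In, Matrix.one_mul]
  have hc : w * R0 S i j = (Pr S i j * (h0⁻¹.val * cf A (S.kk i - 1) * h0.val) * In S i j) * w := by
    rw [hR]
    simp only [w, mm]
    congr 2
    rw [mul_assoc, h1]
    calc h0⁻¹.val * (cf A (S.kk i - 1) * h.val)
        = h0⁻¹.val * cf A (S.kk i - 1) * 1 * h.val := by simp only [mul_assoc, one_mul]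
      _ = h0⁻¹.val * cf A (S.kk i - 1) * (h0.val * h0⁻¹.val) * h.val := by rw [Units.mul_inv]
      _ = _ := by simp only [mul_assoc]
  have hP := PP_conj _ _ (xiN S i j) (κ+1) w hc
  have hwd : IsUnit w.det := by
    have := congrArg Matrix.det hw
    rw [Matrix.det_mul, Matrix.det_one] at this
    exact IsUnit.of_mul_eq_one _ this
  rw [DD_succ]
  change (PP (R0 S i j) (xiN S i j) (κ+1)).rank = _
  rw [← Matrix.rank_mul_eq_right_of_isUnit_det _ _ hwd, hP, Matrix.rank_mul_eq_left_of_isUnit_det _ _ hwd]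

end quiL

section quiM
variable {S : Setup}

theorem T2loc (i : Fin (S.p+1)) {A g : TT (Mn S) (S.kk i)} (h h0 k : (Mn S)ˣ) (hg : cf g 0 = h.val)
    (hA : g * BB (S.kk i) (eP S i) (S.q i) Finset.univ (RR S i) = A * g)
    (k1 : Iirr S i → k = h) :
    ∃ (Γ : Fin (S.m i) → Fin (S.m i) → ℕ → Mn S)
      (f : ∀ (j : Fin (S.m i)) (κ : ℕ), Matrix (Fin (DD S i j κ)) (Fin (DD S i j (κ + 1))) ℂ)
      (g : ∀ (j : Fin (S.m i)) (κ : ℕ), Matrix (Fin (DD S i j (κ + 1))) (Fin (DD S i j κ)) ℂ),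
      Val (eP S i) (S.q i) Finset.univ Γ ∧
      (Iirr S i → tC _ k⁻¹.val * A * tC _ k.val = FS S i Γ (k⁻¹.val * cf A (S.kk i - 1) * k.val)) ∧
      (∀ j, Chain (DD S i j) (xiN S i j) (f j) (g j)) ∧
      (∀ j κ, LInv (f j κ)) ∧ (∀ j κ, RInv (g j κ)) ∧
      ∀ j, Pr S i j * (k⁻¹.val * cf A (S.kk i - 1) * k.val - mX (S.q i) Finset.univ Finset.univ Γ)
        * In S i j = baseR (DD S i j) (xiN S i j) (f j) (g j) := by
  by_cases hi : Iirr S i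
  · obtain rfl := k1 hi
    obtain ⟨Γ, v1, v2, v3⟩ := loc_irr i k hg hA
    choose f g c1 c2 c3 c4 using fun j => exists_chain (DD S i j) (xiN S i j) (R0 S i j)
      (fun κ => DD_succ S i j κ)
    refine ⟨Γ, f, g, v1, fun _ => v2, c1, c3, c4, fun j => ?_⟩
    rw [c2, Matrix.mul_sub, Matrix.sub_mul, ← Pr_dg, ← Matrix.sub_mul, ← Matrix.mul_sub, ← v3,
      RR_blk, ← Matrix.mul_assoc, Pr_In, Matrix.one_mul]
  · choose f g c1 c2 c3 c4 using fun j => exists_chain (DD S i j) (xiN S i j)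
      (Pr S i j * (k⁻¹.val * cf A (S.kk i - 1) * k.val) * In S i j)
      (fun κ => loc_reg i hi h k hg hA j κ)
    refine ⟨fun _ _ _ => 0, f, g, ?_, fun h => absurd h hi, c1, c3, c4, fun j => ?_⟩
    · intro j _ j' _ t _
      simp
    · rw [c2]
      simp [mX]

theorem T2 {c : Fin (S.p+1) → ℂ}
    (hgen : ∀ (β : V S → ℕ), ∑ a, (β a : ℂ) * lamp S c a = 0 → balanced S β)
    {A : ∀ _ : Fin (S.p+1), PMat S} (hA : isDSElem S A) (hI : irredTuple S A) :
    ∃ M : Rep S (alN S), onMu S (lamp S c) M ∧ irredRep S M ∧ BijM M ∧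
      ∃ h : (Mn S)ˣ, ∀ i l, cf (ta M c i) l = h⁻¹.val * CM (A i) l * h.val := by
  have h1 := fun i => (inOrbit_iff i (A i)).1 (hA.1 i)
  choose hdeg g hu hg using h1
  choose h hh using hu
  have hg' : ∀ i, g i * BB (S.kk i) (eP S i) (S.q i) Finset.univ (RR S i) = toT (S.kk i) (A i) * g i := by
    intro i; rw [← toT_Bmat]; exact hg i
  let h0 := h 0
  let k : Fin (S.p+1) → (Mn S)ˣ := fun i => if Iirr S i then h i else h0
  have k1 : ∀ i, Iirr S i → k i = h i := fun i hi => if_pos hi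
  have k2 : ∀ i, ¬ (Iirr S i ∧ i ≠ 0) → k i = h0 := by
    intro i hi
    by_cases h : Iirr S i
    · rw [k1 i h]
      have : i = 0 := by by_contra h'; exact hi ⟨h, h'⟩
      rw [this]
    · exact if_neg h
  choose Γ f gg v1 v2 c1 c3 c4 c5 using fun i =>
    T2loc i (h i) h0 (k i) (hh i).symm (hg' i) (k1 i)
  let Z : Fin (S.p+1) → Mn S := fun i => (k i)⁻¹.val * cf (toT (S.kk i) (A i)) (S.kk i - 1) * (k i).val
  let D : Bld S := ⟨fun i => (k i)⁻¹.val * h0.val,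
    fun i => (h0⁻¹.val * (k i).val) * (c i • 1 - Z i), Γ, f, gg⟩
  let M := D.M
  have hP : ∀ i, mP M i = (k i)⁻¹.val * h0.val := by
    intro i
    by_cases hi : Iirr S i ∧ i ≠ 0
    · exact D.mP_M i hi
    · rw [mP_triv M hi, k2 i hi, Units.inv_mul]
  have hPi : ∀ i, (mP M i)⁻¹ = h0⁻¹.val * (k i).val := by
    intro i
    apply Matrix.inv_eq_right_inv
    rw [hP, mul_assoc, ← mul_assoc h0.val, Units.mul_inv, one_mul, Units.inv_mul]
  have hB : BijM M := by
    intro i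
    rw [hP]
    have := (((k i)⁻¹ * h0 : (Mn S)ˣ)).isUnit
    rw [Units.val_mul] at this
    exact (Matrix.isUnit_iff_isUnit_det _).1 this
  have hmf : ∀ i j, mf M i j = f i j := fun i j => funext fun κ => D.mf_M i j κ
  have hmg : ∀ i j, mg M i j = gg i j := fun i j => funext fun κ => D.mg_M i j κ
  have hG : ∀ i, ∀ j j', ∀ t < dq (S.q i) j j', mG M i j j' t = Γ i j j' t :=
    fun i => D.mG_M i (v1 i)
  have hX : ∀ i, mX (S.q i) Finset.univ Finset.univ (mG M i) =
      mX (S.q i) Finset.univ Finset.univ (Γ i) := by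
    intro i
    unfold mX
    refine Finset.sum_congr rfl fun j _ => Finset.sum_congr rfl fun j' _ =>
      Finset.sum_congr rfl fun t ht => ?_
    have ht' := Finset.mem_range.1 ht
    rw [hG i j j' t ht', hG i j' j t (by rw [dq_symm]; exact ht')]
  have hbR : ∀ i j, bR M i j = Pr S i j * (Z i - mX (S.q i) Finset.univ Finset.univ (mG M i))
        * In S i j := by
    intro i j
    rw [hX, bR, hmf, hmg]
    exact (c5 i j).symm
  -- the residues
  have hZ1 : ∀ i, i ≠ 0 → mZ M c i = Z i := by
    intro i hi
    by_cases hr : Iirr S i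
    · have hQ : mQ M i = (h0⁻¹.val * (k i).val) * (c i • 1 - Z i) := D.mQ_M i ⟨hr, hi⟩
      rw [mZ, if_neg hi, if_pos hr, hQ, hP, ← mul_assoc, mul_assoc _ h0.val, ← mul_assoc h0.val,
        Units.mul_inv, one_mul, Units.inv_mul, one_mul, sub_sub_cancel]
    · rw [mZ, if_neg hi, if_neg hr, leg]
      rw [Finset.sum_eq_single_of_mem (⟨0, S.hm i⟩ : Fin (S.m i)) (Finset.mem_univ _)
        (fun b _ hb => absurd (sub_reg hr b _) hb)]
      rw [hbR, mX_reg M i hr, sub_zero]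
      have e := eP_reg hr ⟨0, S.hm i⟩
      rw [← Matrix.mul_assoc, ← Matrix.mul_assoc, e, Matrix.one_mul, Matrix.mul_assoc, e, Matrix.mul_one]
  have hcc : ∀ i (X : Mn S), h0⁻¹.val * (k i).val * ((k i)⁻¹.val * X * (k i).val) * ((k i)⁻¹.val * h0.val)
      = h0⁻¹.val * X * h0.val := by
    intro i X
    calc _ = h0⁻¹.val * ((k i).val * (k i)⁻¹.val) * X * ((k i).val * (k i)⁻¹.val) * h0.val := by
          simp only [mul_assoc]
      _ = _ := by rw [Units.mul_inv, mul_one, mul_one]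
  have hs : ∑ i, (mP M i)⁻¹ * Z i * mP M i = 0 := by
    have : ∀ i, (mP M i)⁻¹ * Z i * mP M i = h0⁻¹.val * resMat S i (A i) * h0.val := by
      intro i
      rw [hPi, hP, hcc, cf_toT' (hdeg i)]
      rfl
    simp only [this]
    rw [← Finset.sum_mul, ← Finset.mul_sum, hA.2, mul_zero, zero_mul]
  have hZ : ∀ i, mZ M c i = Z i := by
    intro i
    by_cases hi : i = 0
    · subst hi
      have h2 := mZ_sum c hB
      rw [← hs, ← sub_eq_zero, ← Finset.sum_sub_distrib, Finset.sum_eq_single_of_mem 0 (Finset.mem_univ _)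
        (fun b _ hb => by rw [hZ1 b hb, sub_self])] at h2
      have p1 : mP M 0 = 1 := mP_triv M (by simp)
      rw [p1, inv_one, one_mul, one_mul, mul_one, mul_one] at h2
      exact sub_eq_zero.1 h2
    · exact hZ1 i hi
  have hF : ∀ i, FM M c i = tC _ (k i)⁻¹.val * toT (S.kk i) (A i) * tC _ (k i).val := by
    intro i
    by_cases hi : Iirr S i
    · rw [v2 i hi, FM, hZ]
      exact (FSs S i).loc (fun j _ j' _ t ht => hG i j j' t ht)
    · have hk : S.kk i = 1 := S.hreg i hi
      refine cf_ext fun l hl => ?_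
      have : l = S.kk i - 1 := by omega
      rw [this, FM_res, hZ, cf_mul_tC, cf_tC_mul]
  have hta : ∀ i l, cf (ta M c i) l = h0⁻¹.val * CM (A i) l * h0.val := by
    intro i l
    rw [cf_ta, hF, cf_mul_tC, cf_tC_mul, hPi, hP, hcc, cf_toT' (hdeg i)]
  have hmu : onMu S (lamp S c) M := by
    rw [mom_iff]
    refine ⟨fun i j => ?_, fun i j => ?_⟩
    · rw [star, hZ, hbR]
    · rw [hmf, hmg]; exact c1 i j
  refine ⟨M, hmu, ?_, hB, h0, hta⟩
  refine T2irr hgen hmu hB (fun i j κ => by rw [hmf]; exact c3 i j κ)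
    (fun i j κ => by rw [hmg]; exact c4 i j κ) fun W0 hW => ?_
  have hinj : Function.Injective (Matrix.mulVecLin h0.val) := by
    intro x y hxy
    have := congrArg (fun v => h0⁻¹.val *ᵥ v) hxy
    simpa [Matrix.mulVec_mulVec] using this
  have hsur : Function.Surjective (Matrix.mulVecLin h0.val) := by
    intro y
    refine ⟨h0⁻¹.val *ᵥ y, ?_⟩
    rw [Matrix.mulVecLin_apply, Matrix.mulVec_mulVec, Units.mul_inv, Matrix.one_mulVec]
  have := hI (W0.map (Matrix.mulVecLin h0.val)) (by
    rintro i l _ ⟨v, hv, rfl⟩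
    refine ⟨_, hW i l v hv, ?_⟩
    rw [hta]
    change _ = CM (A i) l *ᵥ (h0.val *ᵥ v)
    rw [Matrix.mulVecLin_apply, Matrix.mulVec_mulVec, Matrix.mulVec_mulVec]
    congr 1
    rw [← mul_assoc, ← mul_assoc, Units.mul_inv, one_mul])
  rcases this with h | h
  · left
    rw [eq_bot_iff]
    intro x hx
    have h3 : (Matrix.mulVecLin h0.val) x ∈ W0.map (Matrix.mulVecLin h0.val) := ⟨x, hx, rfl⟩
    rw [h, Submodule.mem_bot, ← map_zero (Matrix.mulVecLin h0.val)] at h3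
    exact hinj h3
  · right
    rw [eq_top_iff]
    intro x _
    have : (Matrix.mulVecLin h0.val) x ∈ W0.map (Matrix.mulVecLin h0.val) := by rw [h]; trivial
    obtain ⟨y, hy, hxy⟩ := this
    rwa [hinj hxy] at hy

end quiM

section quiN
variable {S : Setup}

theorem repConj_refl {β : V S → ℕ} (M : Rep S β) : repConj S M M :=
  ⟨fun _ => 1, fun a b ρ => by simp, fun a b ρ => by simp⟩

theorem repConj_symm {β : V S → ℕ} {M N : Rep S β} (h : repConj S M N) : repConj S N M := by
  obtain ⟨g, h1, h2⟩ := h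
  refine ⟨fun a => (g a)⁻¹, fun a b ρ => ?_, fun a b ρ => ?_⟩
  · rw [h1, inv_inv, Matrix.mul_assoc, Matrix.mul_assoc, Units.inv_mul, Matrix.mul_one,
      ← Matrix.mul_assoc, Units.inv_mul, Matrix.one_mul]
  · rw [h2, inv_inv, Matrix.mul_assoc, Matrix.mul_assoc, Units.inv_mul, Matrix.mul_one,
      ← Matrix.mul_assoc, Units.inv_mul, Matrix.one_mul]

theorem repConj_trans {β : V S → ℕ} {M N L : Rep S β} (h : repConj S M N) (h' : repConj S N L) :
    repConj S M L := by
  obtain ⟨g, h1, h2⟩ := h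
  obtain ⟨g', h1', h2'⟩ := h'
  refine ⟨fun a => g' a * g a, fun a b ρ => ?_, fun a b ρ => ?_⟩
  · rw [h1', h1, _root_.mul_inv_rev, Units.val_mul, Units.val_mul]
    simp only [Matrix.mul_assoc]
  · rw [h2', h2, _root_.mul_inv_rev, Units.val_mul, Units.val_mul]
    simp only [Matrix.mul_assoc]

theorem Mreg_exact {μ : V S → ℂ} {M N : RepIrrC S μ}
    (h : Quot.mk (fun M N : RepIrrC S μ => repConj S M.1 N.1) M = Quot.mk _ N) :
    repConj S M.1 N.1 := by
  have he : Equivalence (fun M N : RepIrrC S μ => repConj S M.1 N.1) :=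
    ⟨fun M => repConj_refl M.1, fun h => repConj_symm h, fun h h' => repConj_trans h h'⟩
  exact he.eqvGen_iff.1 (Quot.eqvGen_exact h)

/-- relating two coefficient conjugations -/
theorem rel_comb {X X' Y Y' : Mn S} {h h' u : (Mn S)ˣ} (e : Y = h⁻¹.val * X * h.val)
    (e' : Y' = h'⁻¹.val * X' * h'.val) (hu : X' * u.val = u.val * X) :
    Y' * (h'⁻¹ * u * h).val = (h'⁻¹ * u * h).val * Y := by
  rw [e, e']
  simp only [Units.val_mul]
  calc h'⁻¹.val * X' * h'.val * (h'⁻¹.val * u.val * h.val)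
      = h'⁻¹.val * X' * (h'.val * h'⁻¹.val) * u.val * h.val := by simp only [mul_assoc]
    _ = h'⁻¹.val * (X' * u.val) * h.val := by rw [Units.mul_inv, mul_one]; simp only [mul_assoc]
    _ = h'⁻¹.val * u.val * (h.val * h⁻¹.val) * X * h.val := by
        rw [hu, Units.mul_inv, mul_one]; simp only [mul_assoc]
    _ = _ := by simp only [mul_assoc]

theorem rel_comb2 {X X' Y Y' : Mn S} {h h' u : (Mn S)ˣ} (e : Y = h⁻¹.val * X * h.val)
    (e' : Y' = h'⁻¹.val * X' * h'.val) (hu : Y' * u.val = u.val * Y) :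
    X' * (h' * u * h⁻¹).val = (h' * u * h⁻¹).val * X := by
  have i1 : X = (h⁻¹)⁻¹.val * Y * h⁻¹.val := by
    rw [e, inv_inv]
    calc X = (h.val * h⁻¹.val) * X * (h.val * h⁻¹.val) := by rw [Units.mul_inv, one_mul, mul_one]
      _ = _ := by simp only [mul_assoc]
  have i2 : X' = (h'⁻¹)⁻¹.val * Y' * h'⁻¹.val := by
    rw [e', inv_inv]
    calc X' = (h'.val * h'⁻¹.val) * X' * (h'.val * h'⁻¹.val) := by rw [Units.mul_inv, one_mul, mul_one]
      _ = _ := by simp only [mul_assoc]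
  have := rel_comb i1 i2 hu
  rwa [inv_inv] at this

theorem main (S : Setup) :
    ∃ (μ : V S → ℂ) (Φ : Mst S → Mreg S μ),
      Function.Injective Φ ∧
      Set.range Φ = {x : Mreg S μ | ∃ M : RepIrrC S μ,
        Quot.mk (fun M N : RepIrrC S μ => repConj S M.1 N.1) M = x ∧ crossBij S M.1} ∧
      ((∀ i : Fin (S.p+1), Iirr S i → i = 0) → μ = lam S ∧ Function.Bijective Φ) := by
  obtain ⟨c, hgen⟩ := exists_generic S
  choose G g1 g2 g3 h hh using fun A : MstC S => T2 hgen A.2.1 A.2.2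
  let GG : MstC S → RepIrrC S (lamp S c) := fun A => ⟨G A, g1 A, g2 A⟩
  let Φ : Mst S → Mreg S (lamp S c) := Quot.lift (fun A => Quot.mk _ (GG A)) (by
    intro A A' hAA
    apply Quot.sound
    obtain ⟨u, hu⟩ := (tupConj_iff _ _).1 hAA
    exact T3a (g1 A) (g1 A') (g3 A) (g3 A') (g2 A) (g2 A') _
      (fun i l => rel_comb (hh A i l) (hh A' i l) (hu i l)))
  have hinj : Function.Injective Φ := by
    rintro ⟨A⟩ ⟨A'⟩ hAA
    have h1 : repConj S (G A) (G A') := Mreg_exact hAA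
    obtain ⟨u, hu⟩ := T3b c (g3 A) (g3 A') h1
    apply Quot.sound
    exact (tupConj_iff _ _).2 ⟨_, fun i l => rel_comb2 (hh A i l) (hh A' i l) (hu i l)⟩
  have hr : Set.range Φ = {x : Mreg S (lamp S c) | ∃ M : RepIrrC S (lamp S c),
        Quot.mk (fun M N : RepIrrC S (lamp S c) => repConj S M.1 N.1) M = x ∧ crossBij S M.1} := by
    ext x
    constructor
    · rintro ⟨⟨A⟩, rfl⟩
      exact ⟨GG A, rfl, (crossBij_iff _).2 (g3 A)⟩
    · rintro ⟨M, rfl, hc⟩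
      have hB := (crossBij_iff _).1 hc
      let A : MstC S := ⟨fun i => ofT (ta M.1 c i), T1 M.2.1 hB M.2.2⟩
      refine ⟨Quot.mk _ A, ?_⟩
      apply Quot.sound
      refine T3a (g1 A) M.2.1 (g3 A) hB (g2 A) M.2.2 (h A) fun i l => ?_
      rw [hh A i l]
      change _ = (h A).val * ((h A)⁻¹.val * CM (ofT (ta M.1 c i)) l * (h A).val)
      rw [CM_ofT, ← mul_assoc, ← mul_assoc, Units.mul_inv, one_mul]
  refine ⟨lamp S c, Φ, hinj, hr, fun h0 => ⟨lamp_lam c h0, hinj, ?_⟩⟩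
  rw [← Set.range_eq_univ, hr]
  ext x
  refine ⟨fun _ => trivial, fun _ => ?_⟩
  obtain ⟨M, rfl⟩ := Quot.exists_rep x
  exact ⟨M, rfl, fun i hi => absurd (h0 i.1 i.2) hi⟩

end quiN

/-- **Open embedding theorem.** There exist `λ' ∈ ℂ^{Q₀}` and an injection
`Φ : ℳ*_{st}(𝐁) ↪ 𝔐^{reg}_{λ'}(Q,α)` whose image is exactly the set of classes
with all block matrices `(ψ_{ρ^{[0,j]}_{[i,j']}})` invertible (for `i ∈ I_irr∖{0}`);
moreover if `I_irr = {0}` then `λ' = λ` and `Φ` is bijective. -/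
theorem statement1 (S : Setup) :
    ∃ (μ : V S → ℂ) (Φ : Mst S → Mreg S μ),
      Function.Injective Φ ∧
      Set.range Φ = {x : Mreg S μ | ∃ M : RepIrrC S μ,
        Quot.mk (fun M N : RepIrrC S μ => repConj S M.1 N.1) M = x ∧ crossBij S M.1} ∧
      ((∀ i : Fin (S.p+1), Iirr S i → i = 0) → μ = lam S ∧ Function.Bijective Φ) := by
  exact main S

end

end DS
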